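/- Let p > 5/3, q ≥ 2, and let (U₁,U₂) ∈ 𝒫^δ be an admissible pair of type 1 at scale δ. If δ > 1 and εδρ² ≤ 1, then ‖E_{U₁}(f) · E_{U₂}(g)‖_{L^p(ℝ³)} ≤ C_{p,q} (εδρ³)^{2(1 − 1/p − 1/q)} ‖f‖_{L^q} ‖g‖_{L^q} for all f ∈ L^q(U₁), g ∈ L^q(U₂), where the constant C_{p,q} is independent of the given admissible pair and of ε, ρ and δ. -/

import Mathlib

open Set MeasureTheory ENNReal Pointwise

noncomputable section

/-- `h` is a perturbation function of cubic type on `[-1,1]`,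
with constants `C₃ > 0` and `Cl l` for `l ≥ 4`. -/
def CubicType (C₃ : ℝ) (Cl : ℕ → ℝ) (h : ℝ → ℝ) : Prop :=
  ContDiff ℝ (⊤ : ℕ∞) h ∧ h 0 = 0 ∧ deriv h 0 = 0 ∧ deriv (deriv h) 0 = 0 ∧
  (∀ y ∈ Icc (-1 : ℝ) 1,
      C₃ / 4 ≤ |deriv (deriv (deriv h)) y| ∧ |deriv (deriv (deriv h)) y| ≤ C₃) ∧
  (∀ l : ℕ, 4 ≤ l → ∀ y ∈ Icc (-1 : ℝ) 1, |iteratedDeriv l h y| ≤ Cl l)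

/-- The transversality quantity `τ_z(z₁,z₂)` for the phase `φ(x,y) = xy + ε h(y)`. -/
def tau (ε : ℝ) (h : ℝ → ℝ) (z z₁ z₂ : ℝ × ℝ) : ℝ :=
  z₂.1 - z₁.1 + ε * (deriv h z₂.2 - deriv h z₁.2
      - (1 / 2) * deriv (deriv h) z.2 * (z₂.2 - z₁.2))

/-- A (positive) dyadic number. -/
def IsDyadic (x : ℝ) : Prop := ∃ k : ℤ, x = 2 ^ k

/-- The set `U₁^{x₁⁰, y₁⁰, δ}`. -/
def U1set (h : ℝ → ℝ) (ε ρ δ x₁0 y₁0 : ℝ) : Set (ℝ × ℝ) :=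
  {z | 0 ≤ z.2 - y₁0 ∧ z.2 - y₁0 < ρ * min 1 δ ∧
    0 ≤ z.1 - x₁0 + ε * (deriv (deriv h) y₁0 / 2) * (z.2 - y₁0) ∧
    z.1 - x₁0 + ε * (deriv (deriv h) y₁0 / 2) * (z.2 - y₁0) < ε * ρ ^ 2 * δ}

/-- The set `U₂^{t₂⁰, y₁⁰, y₂⁰, δ}`. -/
def U2set (h : ℝ → ℝ) (ε ρ δ t₂0 y₁0 y₂0 : ℝ) : Set (ℝ × ℝ) :=
  {z | 0 ≤ z.2 - y₂0 ∧ z.2 - y₂0 < ρ ∧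
    0 ≤ z.1 - t₂0 + ε * (deriv h z.2 - deriv h y₁0 - deriv (deriv h) y₁0 / 2 * (z.2 - y₁0)) ∧
    z.1 - t₂0 + ε * (deriv h z.2 - deriv h y₁0 - deriv (deriv h) y₁0 / 2 * (z.2 - y₁0))
      < ε * ρ ^ 2 * δ}

/-- The base point abscissa `x₂⁰` determined by `t₂⁰, y₁⁰, y₂⁰`. -/
def x20 (h : ℝ → ℝ) (ε t₂0 y₁0 y₂0 : ℝ) : ℝ :=
  t₂0 - ε * (deriv h y₂0 - deriv h y₁0 - deriv (deriv h) y₁0 / 2 * (y₂0 - y₁0))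

/-- `(U₁^{x₁⁰,y₁⁰,δ}, U₂^{t₂⁰,y₁⁰,y₂⁰,δ})` is an admissible pair of type 1 at scales
`δ, ρ`, contained in `V_{j₁,ρ} × V_{j₂,ρ}` (so `y₂⁰ = j₂ ρ`): grid conditions on the
parameters plus the two admissibility inequalities. -/
def Adm1 (h : ℝ → ℝ) (ε ρ δ C₀ : ℝ) (j₁ j₂ : ℤ) (x₁0 y₁0 t₂0 : ℝ) : Prop :=
  (∃ n : ℤ, x₁0 = -1 + (n : ℝ) * (ε * ρ ^ 2 * δ)) ∧ x₁0 ∈ Ico (-1 : ℝ) 1 ∧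
  (∃ n : ℤ, t₂0 = -1 + (n : ℝ) * (ε * ρ ^ 2 * δ)) ∧ t₂0 ∈ Ico (-1 : ℝ) 1 ∧
  (∃ n : ℤ, y₁0 = (j₁ : ℝ) * ρ + (n : ℝ) * (ρ * min 1 δ)) ∧
  (j₁ : ℝ) * ρ ≤ y₁0 ∧ y₁0 + ρ * min 1 δ ≤ (j₁ : ℝ) * ρ + ρ ∧
  C₀ ^ 2 / 4 * (ε * ρ ^ 2 * δ) ≤ |t₂0 - x₁0| ∧
  |t₂0 - x₁0| < 4 * C₀ ^ 2 * (ε * ρ ^ 2 * δ) ∧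
  C₀ ^ 2 / 512 * (ε * ρ ^ 2 * max 1 δ) ≤
      |tau ε h (x20 h ε t₂0 y₁0 ((j₂ : ℝ) * ρ), (j₂ : ℝ) * ρ) (x₁0, y₁0)
        (x20 h ε t₂0 y₁0 ((j₂ : ℝ) * ρ), (j₂ : ℝ) * ρ)| ∧
  |tau ε h (x20 h ε t₂0 y₁0 ((j₂ : ℝ) * ρ), (j₂ : ℝ) * ρ) (x₁0, y₁0)
        (x20 h ε t₂0 y₁0 ((j₂ : ℝ) * ρ), (j₂ : ℝ) * ρ)|
      < 5 * C₀ ^ 2 * (ε * ρ ^ 2 * max 1 δ)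

/-- The Fourier extension operator associated to the graph of `φ` over `U ⊆ ℝ²`,
with smooth density `η`. -/
def extOp (φ η : ℝ × ℝ → ℝ) (U : Set (ℝ × ℝ)) (f : ℝ × ℝ → ℂ) (ξ : ℝ × ℝ × ℝ) : ℂ :=
  ∫ z in U, f z * (η z : ℂ) *
    Complex.exp (-Complex.I * ((ξ.1 * z.1 + ξ.2.1 * z.2 + ξ.2.2 * φ z : ℝ) : ℂ))

/-- The phase `φ(x,y) = xy + ε h(y)`. -/
def phase (ε : ℝ) (h : ℝ → ℝ) (z : ℝ × ℝ) : ℝ := z.1 * z.2 + ε * h z.2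

namespace BAP

/-! ### The frequency window -/

/-- Smooth bump with `∑ₖ chi (s-k)² = 1`. -/
def chi (s : ℝ) : ℝ :=
  Real.sin (Real.pi / 2 * Real.smoothTransition (s + 1)) *
    Real.cos (Real.pi / 2 * Real.smoothTransition s)

lemma chi_contDiff {n : WithTop ℕ∞} (hn : n ≤ (⊤ : ℕ∞)) : ContDiff ℝ n chi := by
  have h : ContDiff ℝ (⊤ : ℕ∞) chi := by
    unfold chi
    have h1 : ContDiff ℝ (⊤ : ℕ∞) Real.smoothTransition := Real.smoothTransition.contDiff
    have h2 : ContDiff ℝ (⊤ : ℕ∞) (fun s : ℝ => Real.smoothTransition (s + 1)) :=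
      h1.comp (contDiff_id.add contDiff_const)
    exact (Real.contDiff_sin.comp (contDiff_const.mul h2)).mul
      (Real.contDiff_cos.comp (contDiff_const.mul h1))
  exact h.of_le hn

lemma chi_continuous : Continuous chi := (chi_contDiff (n := 0) (by simp)).continuous

lemma chi_eq_zero {s : ℝ} (hs : 1 ≤ |s|) : chi s = 0 := by
  unfold chi
  rcases le_abs.1 hs with h | h
  · rw [Real.smoothTransition.one_of_one_le h]; simp
  · rw [Real.smoothTransition.zero_of_nonpos (by linarith : s + 1 ≤ 0)]; simp

lemma chi_abs_le (s : ℝ) : |chi s| ≤ 1 := by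
  unfold chi
  rw [abs_mul]
  exact mul_le_one₀ (Real.abs_sin_le_one _) (abs_nonneg _) (Real.abs_cos_le_one _)

lemma chi_sq_add {s : ℝ} (h0 : 0 ≤ s) (h1 : s ≤ 1) : chi s ^ 2 + chi (s - 1) ^ 2 = 1 := by
  unfold chi
  rw [Real.smoothTransition.one_of_one_le (by linarith : 1 ≤ s + 1),
    Real.smoothTransition.zero_of_nonpos (by linarith : s - 1 ≤ 0)]
  simp

lemma chi_sum_eq (s : ℝ) (S : Finset ℤ) (h0 : ⌊s⌋ ∈ S) (h1 : ⌊s⌋ + 1 ∈ S) :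
    ∑ k ∈ S, chi (s - k) ^ 2 = 1 := by
  have hsub : ({⌊s⌋, ⌊s⌋ + 1} : Finset ℤ) ⊆ S := by
    intro k hk
    simp only [Finset.mem_insert, Finset.mem_singleton] at hk
    rcases hk with rfl | rfl <;> assumption
  rw [← Finset.sum_subset hsub]
  · rw [Finset.sum_pair (by omega)]
    have := chi_sq_add (s := s - ⌊s⌋) (by linarith [Int.floor_le s])
      (by linarith [Int.lt_floor_add_one s])
    push_cast
    rw [show s - ((⌊s⌋ : ℝ) + 1) = s - ⌊s⌋ - 1 by ring, this]
  · intro k _ hk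
    simp only [Finset.mem_insert, Finset.mem_singleton, not_or] at hk
    rw [chi_eq_zero, zero_pow two_ne_zero]
    rcases lt_or_ge k ⌊s⌋ with h | h
    · have : (k : ℝ) + 1 ≤ ⌊s⌋ := by exact_mod_cast h
      exact le_abs.2 (Or.inl (by linarith [Int.floor_le s]))
    · have h2 : ⌊s⌋ + 2 ≤ k := by omega
      have : (⌊s⌋ : ℝ) + 2 ≤ k := by exact_mod_cast h2
      exact le_abs.2 (Or.inr (by linarith [Int.lt_floor_add_one s]))

lemma chi_sum_le (s : ℝ) (S : Finset ℤ) : ∑ k ∈ S, chi (s - k) ^ 2 ≤ 1 := by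
  rw [← chi_sum_eq s (insert ⌊s⌋ (insert (⌊s⌋ + 1) S)) (by simp) (by simp)]
  apply Finset.sum_le_sum_of_subset_of_nonneg
  · intro k hk; simp [hk]
  · intros; positivity

/-! ### One dimensional Fourier decay -/

lemma fourier_decay (G : ℝ → ℂ) (N : ℕ) (M : ℝ) (hG : ContDiff ℝ N G)
    (hsupp : ∀ u, 1 ≤ |u| → G u = 0) (hM0 : ∀ u, ‖G u‖ ≤ M)
    (hM : ∀ u ∈ Icc (-1 : ℝ) 1, ‖iteratedDeriv N G u‖ ≤ M) (lam : ℝ) :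
    ‖∫ u, G u * Complex.exp (-Complex.I * ((lam * u : ℝ) : ℂ))‖ ≤ 4 * 2 ^ N * M / (1 + |lam|) ^ N := by
  have hM' : 0 ≤ M := (norm_nonneg _).trans (hM0 0)
  have hts : tsupport G ⊆ Icc (-1) 1 := by
    apply closure_minimal _ isClosed_Icc
    intro u hu
    by_contra h
    apply hu
    apply hsupp
    rw [mem_Icc, ← abs_le] at h
    exact le_of_not_ge h
  have hcs : HasCompactSupport G := isCompact_Icc.of_isClosed_subset (isClosed_tsupport G) hts
  have hsuppN : ∀ n : ℕ, Function.support (iteratedDeriv n G) ⊆ Icc (-1) 1 := by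
    intro n
    refine Subset.trans ?_ hts
    refine Subset.trans ?_ (support_iteratedFDeriv_subset (𝕜 := ℝ) n (f := G))
    intro u hu
    simp only [Function.mem_support, ne_eq] at hu ⊢
    intro h; apply hu; rw [iteratedDeriv, h]; simp
  have hIntg : ∀ n : ℕ, (n : ℕ∞) ≤ N → Integrable (iteratedDeriv n G) := by
    intro n hn
    have hc : Continuous (iteratedDeriv n G) := hG.continuous_iteratedDeriv n (by exact_mod_cast hn)
    exact hc.integrable_of_hasCompactSupport
      (HasCompactSupport.intro isCompact_Icc fun x hx => by
        by_contra h; exact hx (hsuppN n h))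
  have hF := Real.fourier_iteratedDeriv (N := N) (n := N) (by exact_mod_cast hG) hIntg le_rfl
  -- integral bounds
  have hb : ∀ (K : ℝ → ℂ), Function.support K ⊆ Icc (-1) 1 → (∀ u ∈ Icc (-1:ℝ) 1, ‖K u‖ ≤ M) →
      ∀ x : ℝ, ‖FourierTransform.fourier K x‖ ≤ 2 * M := by
    intro K hK hKM x
    rw [Real.fourier_real_eq, ← setIntegral_eq_integral_of_forall_compl_eq_zero (s := Icc (-1) 1)]
    · refine (norm_setIntegral_le_of_norm_le_const (C := M) (by simp) ?_).trans ?_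
      · intro u hu
        rw [Circle.norm_smul]; exact hKM u hu
      · simp [Measure.real]; linarith
    · intro u hu
      have : K u = 0 := by by_contra h; exact hu (hK h)
      simp [this]
  have e1 : ∫ u, G u * Complex.exp (-Complex.I * ((lam * u : ℝ) : ℂ))
      = FourierTransform.fourier G (lam / (2 * Real.pi)) := by
    rw [Real.fourier_real_eq_integral_exp_smul]
    congr 1; ext u
    rw [smul_eq_mul, mul_comm]
    congr 2
    have : (-2 * Real.pi * u * (lam / (2 * Real.pi)) : ℝ) = - (lam * u) := by
      field_simp
    rw [this]; push_cast; ring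
  have h1 := hb G (subset_tsupport G |>.trans hts) (fun u _ => hM0 u) (lam / (2 * Real.pi))
  have h2 := hb _ (hsuppN N) hM (lam / (2 * Real.pi))
  rw [hF] at h2
  simp only [norm_smul, norm_pow] at h2
  have e2 : ‖(2 * (Real.pi : ℂ) * Complex.I * ((lam / (2 * Real.pi) : ℝ) : ℂ))‖ = |lam| := by
    have : (2 * (Real.pi : ℂ) * Complex.I * ((lam / (2 * Real.pi) : ℝ) : ℂ)) = lam * Complex.I := by
      have : (Real.pi : ℂ) ≠ 0 := by exact_mod_cast Real.pi_ne_zero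
      push_cast; field_simp
    rw [this]; simp
  rw [e2] at h2
  rw [e1, le_div_iff₀ (by positivity)]
  set a := ‖FourierTransform.fourier G (lam / (2 * Real.pi))‖
  have h3 : (1 + |lam|) ^ N ≤ 2 ^ N * (1 + |lam| ^ N) := by
    rcases le_total |lam| 1 with h | h
    · calc (1 + |lam|) ^ N ≤ 2 ^ N := by gcongr; linarith
        _ ≤ _ := by nlinarith [pow_nonneg (abs_nonneg lam) N, pow_pos (two_pos : (0:ℝ) < 2) N]
    · calc (1 + |lam|) ^ N ≤ (2 * |lam|) ^ N := by gcongr; linarith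
        _ = 2 ^ N * |lam| ^ N := by rw [mul_pow]
        _ ≤ _ := by nlinarith [pow_nonneg (abs_nonneg lam) N, pow_pos (two_pos : (0:ℝ) < 2) N]
  calc a * (1 + |lam|) ^ N ≤ a * (2 ^ N * (1 + |lam| ^ N)) := by gcongr
    _ = 2 ^ N * (a + |lam| ^ N * a) := by ring
    _ ≤ 2 ^ N * (2 * M + 2 * M) := by gcongr
    _ = _ := by ring

/-! ### The band limited window -/

open FourierTransform in
lemma exists_window : ∃ th : ℝ → ℝ, Continuous th ∧ (∀ s, 0 ≤ th s) ∧ (∀ s, |s| ≤ 1 → 1 ≤ th s) ∧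
    (∀ M : ℕ, ∃ C : ℝ, 0 < C ∧ ∀ s, th s ≤ C / (1 + |s|) ^ M) ∧
    (∀ lam : ℝ, 1 ≤ |lam| → ∫ s, (th s : ℂ) * Complex.exp (-Complex.I * ((lam * s : ℝ) : ℂ)) = 0) := by
  let b0 : ContDiffBump (0 : ℝ) := ⟨1/40, 1/20, by norm_num, by norm_num⟩
  have hb0 : ContDiff ℝ (⊤ : ℕ∞) (fun x => (b0 x : ℂ)) := Complex.ofRealCLM.contDiff.comp b0.contDiff
  have hbc : HasCompactSupport (fun x => (b0 x : ℂ)) := b0.hasCompactSupport.comp_left (g := fun x : ℝ => (x : ℂ)) (by simp)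
  let b : SchwartzMap ℝ ℂ := hbc.toSchwartzMap hb0
  have hbv : ∀ x, b x = (b0 x : ℂ) := fun x => rfl
  let H := SchwartzMap.convolution (ContinuousLinearMap.mul ℂ ℂ) b b
  let F : SchwartzMap ℝ ℂ := 𝓕 b
  have hbi : Integrable (fun x => b0 x) := b0.continuous.integrable_of_hasCompactSupport b0.hasCompactSupport
  have hsm : ∀ x, 1/20 ≤ |x| → b0 x = 0 := fun x hx => b0.zero_of_le_dist (by rw [Real.dist_eq, sub_zero]; exact hx)
  -- the transform is real
  have hF : ∀ s, F s = ((∫ x, b0 x * Real.cos (2 * Real.pi * x * s) : ℝ) : ℂ) := by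
    intro s
    have e1 : F s = ∫ x, (b0 x : ℂ) * Complex.exp (-Complex.I * ((2 * Real.pi * x * s : ℝ) : ℂ)) := by
      change (𝓕 b : SchwartzMap ℝ ℂ) s = _
      rw [SchwartzMap.fourier_coe, Real.fourier_real_eq_integral_exp_smul]
      congr 1; ext x
      rw [smul_eq_mul, mul_comm, hbv]; congr 2; push_cast; ring
    have e2 : F s = ∫ x, (b0 x : ℂ) * Complex.exp (Complex.I * ((2 * Real.pi * x * s : ℝ) : ℂ)) := by
      rw [e1, ← integral_neg_eq_self]
      congr 1; ext x
      rw [b0.neg]; congr 2; push_cast; ring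
    have hi : ∀ c : ℂ, c = Complex.I ∨ c = -Complex.I → Integrable (fun x : ℝ => (b0 x : ℂ) * Complex.exp (c * ((2 * Real.pi * x * s : ℝ) : ℂ))) := by
      intro c hc
      apply hbi.ofReal.mul_bdd (c := 1)
      · apply Continuous.aestronglyMeasurable; fun_prop
      · refine Filter.Eventually.of_forall fun x => ?_
        rw [Complex.norm_exp]
        rcases hc with rfl | rfl <;> simp
    have e3 : F s = (1/2) * (F s + F s) := by ring
    rw [e3]; nth_rewrite 1 [e1]; rw [e2, ← integral_add (hi _ (Or.inr rfl)) (hi _ (Or.inl rfl)), ← integral_complex_ofReal, ← integral_const_mul]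
    congr 1; ext x
    push_cast
    rw [Complex.cos]
    rw [show Complex.I * (2 * (Real.pi : ℂ) * x * s) = (2 * (Real.pi : ℂ) * x * s) * Complex.I by ring, show -Complex.I * (2 * (Real.pi : ℂ) * x * s) = -(2 * (Real.pi : ℂ) * x * s) * Complex.I by ring]
    ring
  have hIpos : 0 < ∫ x, b0 x := b0.integral_pos
  set I0 := ∫ x, b0 x with hI0
  have hlow : ∀ s, |s| ≤ 1 → I0 / 2 ≤ ∫ x, b0 x * Real.cos (2 * Real.pi * x * s) := by
    intro s hs
    have : I0 / 2 = ∫ x, b0 x * (1/2) := by rw [integral_mul_const]; ring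
    rw [this]
    apply integral_mono (hbi.mul_const _)
    · apply hbi.mul_bdd (c := 1)
      · apply Continuous.aestronglyMeasurable; fun_prop
      · exact Filter.Eventually.of_forall fun x => by simpa using Real.abs_cos_le_one _
    · intro x
      simp only
      rcases le_or_gt (1/20) |x| with h | h
      · rw [hsm x h]; simp
      · gcongr
        · exact b0.nonneg
        · have h2 : |2 * Real.pi * x * s| ≤ 1 := by
            rw [abs_mul, abs_mul, abs_of_pos Real.two_pi_pos]
            have := Real.pi_lt_four
            have h3 : |x| * |s| ≤ 1/20 := by nlinarith [abs_nonneg x, abs_nonneg s]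
            nlinarith [abs_nonneg x, abs_nonneg s, mul_nonneg (abs_nonneg x) (abs_nonneg s)]
          have := Real.one_sub_sq_div_two_le_cos (x := 2 * Real.pi * x * s)
          have h4 : (2 * Real.pi * x * s)^2 ≤ 1 := by rw [← sq_abs]; nlinarith [abs_nonneg (2 * Real.pi * x * s)]
          linarith
  set A : ℝ → ℝ := fun s => ∫ x, b0 x * Real.cos (2 * Real.pi * x * s) with hA
  have hAF : ∀ s, A s = (F s).re := fun s => by rw [hF]; simp [hA]
  have hAc : Continuous A := by
    have : A = fun s => (F s).re := funext hAF
    rw [this]; exact Complex.continuous_re.comp F.continuous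
  let K := 4 / I0 ^ 2
  have hK : 0 < K := by positivity
  refine ⟨fun s => K * A s ^ 2, by fun_prop, fun s => by positivity, ?_, ?_, ?_⟩
  · intro s hs
    have := hlow s hs
    have h2 : (I0/2)^2 ≤ A s ^ 2 := by gcongr
    calc (1:ℝ) = K * (I0/2)^2 := by simp only [K]; field_simp; norm_num
      _ ≤ _ := mul_le_mul_of_nonneg_left h2 hK.le
  · intro M
    obtain ⟨D0, hD0p, hD0⟩ := F.decay 0 0
    obtain ⟨D, hDp, hD⟩ := F.decay M 0
    simp only [norm_iteratedFDeriv_zero, pow_zero, one_mul] at hD hD0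
    refine ⟨K * D0 * (2^M * (D0 + D)), by positivity, fun s => ?_⟩
    have hn : ∀ s, |A s| ≤ ‖F s‖ := fun s => by rw [hAF]; exact Complex.abs_re_le_norm _
    rw [le_div_iff₀ (by positivity)]
    have h3 : (1 + |s|) ^ M ≤ 2 ^ M * (1 + |s| ^ M) := by
      rcases le_total |s| 1 with h | h
      · calc (1 + |s|) ^ M ≤ 2 ^ M := by gcongr; linarith
          _ ≤ _ := by nlinarith [pow_nonneg (abs_nonneg s) M, pow_pos (two_pos : (0:ℝ) < 2) M]
      · calc (1 + |s|) ^ M ≤ (2 * |s|) ^ M := by gcongr; linarith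
          _ = 2 ^ M * |s| ^ M := by rw [mul_pow]
          _ ≤ _ := by nlinarith [pow_nonneg (abs_nonneg s) M, pow_pos (two_pos : (0:ℝ) < 2) M]
    have h4 := hD s
    rw [Real.norm_eq_abs] at h4
    calc K * A s ^ 2 * (1 + |s|) ^ M ≤ K * (‖F s‖ * ‖F s‖) * (2 ^ M * (1 + |s| ^ M)) := by
          rw [← sq_abs (A s), sq]; gcongr <;> exact hn s
      _ = K * ‖F s‖ * (2 ^ M * (‖F s‖ + |s|^M * ‖F s‖)) := by ring
      _ ≤ _ := by gcongr <;> exact hD0 s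
  · intro lam hlam
    have hFH : ∀ s, (𝓕 H : SchwartzMap ℝ ℂ) s = F s * F s := by
      intro s
      simp only [H]
      rw [SchwartzMap.fourier_convolution]; simp [F]
    have e1 : ∀ s, ((K * A s ^ 2 : ℝ) : ℂ) = K * (𝓕 H : SchwartzMap ℝ ℂ) s := by
      intro s; rw [hFH, hF]; push_cast; ring
    have hH0 : H (-(lam / (2*Real.pi))) = 0 := by
      simp only [H]
      rw [SchwartzMap.convolution_apply, convolution_def]
      apply integral_eq_zero_of_ae
      refine Filter.Eventually.of_forall fun t => ?_
      simp only [ContinuousLinearMap.mul_apply', Pi.zero_apply, mul_eq_zero, hbv, Complex.ofReal_eq_zero]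
      by_contra hcon
      rw [not_or] at hcon
      have h1 : |t| < 1/20 := lt_of_not_ge fun h => hcon.1 (hsm _ h)
      have h2 : |-(lam / (2*Real.pi)) - t| < 1/20 := lt_of_not_ge fun h => hcon.2 (hsm _ h)
      have h3 : |lam / (2*Real.pi)| < 1/10 := by
        rw [abs_lt] at h1 h2 ⊢
        constructor <;> linarith [h1.1, h1.2, h2.1, h2.2]
      rw [abs_div, abs_of_pos Real.two_pi_pos, div_lt_iff₀ Real.two_pi_pos] at h3
      linarith [Real.pi_lt_four]
    have e2 : 𝓕 (𝓕 H : SchwartzMap ℝ ℂ) (lam / (2 * Real.pi)) = H (-(lam / (2*Real.pi))) := by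
      have h1 : (𝓕⁻ (𝓕 H : SchwartzMap ℝ ℂ) : SchwartzMap ℝ ℂ) (-(lam / (2*Real.pi))) = H (-(lam / (2*Real.pi))) := by
        rw [fourierInv_fourier_eq]
      rw [← h1, SchwartzMap.fourierInv_coe, Real.fourierInv_eq_fourier_neg, neg_neg, SchwartzMap.fourier_coe (𝓕 H)]
    simp_rw [e1]
    have e3 : ∫ s, (K : ℂ) * (𝓕 H : SchwartzMap ℝ ℂ) s * Complex.exp (-Complex.I * ((lam * s : ℝ) : ℂ)) = K * 𝓕 (𝓕 H : SchwartzMap ℝ ℂ) (lam / (2 * Real.pi)) := by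
      rw [SchwartzMap.fourier_coe (𝓕 H), Real.fourier_real_eq_integral_exp_smul, ← integral_const_mul]
      congr 1; ext x
      rw [smul_eq_mul, mul_comm (Complex.exp _), mul_assoc]
      congr 3
      have : (-2 * Real.pi * x * (lam / (2 * Real.pi)) : ℝ) = - (lam * x) := by
        field_simp
      rw [this]; push_cast; ring
    rw [e3, e2, hH0, mul_zero]
end BAP

namespace BAP

/-! ### Wave packets -/

/-- Unimodular exponential `e^{-i x}`. -/
def ee (x : ℝ) : ℂ := Complex.exp (-Complex.I * (x : ℂ))

lemma ee_norm (x : ℝ) : ‖ee x‖ = 1 := by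
  unfold ee; rw [Complex.norm_exp]; simp

lemma ee_add (x y : ℝ) : ee (x + y) = ee x * ee y := by
  unfold ee; rw [← Complex.exp_add]; congr 1; push_cast; ring

@[fun_prop]
lemma ee_continuous : Continuous ee := by unfold ee; fun_prop

lemma ee_contDiff {n : WithTop ℕ∞} : ContDiff ℝ n ee := by
  unfold ee
  exact Complex.contDiff_exp.comp (contDiff_const.mul Complex.ofRealCLM.contDiff)

lemma ee_zero : ee 0 = 1 := by simp [ee]

lemma ee_neg (x : ℝ) : ee (-x) = (starRingEnd ℂ) (ee x) := by
  unfold ee; rw [← Complex.exp_conj]; congr 1; simp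

lemma ee_hasDerivAt (x : ℝ) : HasDerivAt ee (-Complex.I * ee x) x := by
  unfold ee
  have h1 : HasDerivAt (fun x : ℝ => -Complex.I * (x : ℂ)) (-Complex.I * 1) x :=
    (Complex.ofRealCLM.hasDerivAt (x := x)).const_mul _
  have := h1.cexp
  convert this using 1
  ring

lemma ee_iteratedDeriv (n : ℕ) : iteratedDeriv n ee = fun x => (-Complex.I) ^ n * ee x := by
  induction n with
  | zero => simp
  | succ n ih =>
    rw [iteratedDeriv_succ, ih]
    ext x
    rw [((ee_hasDerivAt x).const_mul _).deriv]; ring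

lemma ee_iteratedFDeriv_norm (n : ℕ) (x : ℝ) : ‖iteratedFDeriv ℝ n ee x‖ = 1 := by
  rw [norm_iteratedFDeriv_eq_norm_iteratedDeriv, ee_iteratedDeriv]
  simp [ee_norm]

/-- The phase `xy + ψ(y)`. -/
def ph (ψ : ℝ → ℝ) (z : ℝ × ℝ) : ℝ := z.1 * z.2 + ψ z.2

/-- Extension operator for the phase `xy + ψ(y)`. -/
def EE (ψ : ℝ → ℝ) (f : ℝ × ℝ → ℂ) (ξ : ℝ × ℝ × ℝ) : ℂ :=
  ∫ z, f z * ee (ξ.1 * z.1 + ξ.2.1 * z.2 + ξ.2.2 * ph ψ z)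

/-- Regularity of the perturbation. -/
def Reg (ψ : ℝ → ℝ) (B : ℝ) : Prop :=
  ContDiff ℝ 8 ψ ∧ ∀ k : ℕ, 1 ≤ k → k ≤ 8 → ∀ y, |y| ≤ B → |iteratedDeriv k ψ y| ≤ B

/-- Packet indices: position and frequency. -/
abbrev Idx := (ℤ × ℤ) × (ℤ × ℤ)

/-- centre of the packet in the base -/
def om (r : ℝ) (T : Idx) : ℝ × ℝ := (T.1.1 / r, T.1.2 / r)

/-- the packet -/
def pk (r : ℝ) (T : Idx) (z : ℝ × ℝ) : ℂ :=
  ((r / 2 * (chi (r * z.1 - T.1.1) * chi (r * z.2 - T.1.2)) : ℝ) : ℂ) *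
    ee (-(Real.pi * r * (T.2.1 * z.1 + T.2.2 * z.2)))

/-- gradient of the phase -/
def gr (ψ : ℝ → ℝ) (w : ℝ × ℝ) : ℝ × ℝ := (w.2, w.1 + deriv ψ w.2)

/-- rescaled distance vector to the core line of the packet -/
def sv (ψ : ℝ → ℝ) (r : ℝ) (T : Idx) (ξ : ℝ × ℝ × ℝ) : ℝ × ℝ :=
  ((ξ.1 + ξ.2.2 * (gr ψ (om r T)).1 - Real.pi * r * T.2.1) / r,
   (ξ.2.1 + ξ.2.2 * (gr ψ (om r T)).2 - Real.pi * r * T.2.2) / r)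

/-- packet weight -/
def wt (ψ : ℝ → ℝ) (r : ℝ) (T : Idx) (ξ : ℝ × ℝ × ℝ) : ℝ := ((1 + ‖sv ψ r T ξ‖) ^ 8)⁻¹

lemma pk_continuous (r : ℝ) (T : Idx) : Continuous (pk r T) := by
  unfold pk
  have := chi_continuous
  fun_prop

lemma chi_fd_bound : ∃ K : ℝ, 1 ≤ K ∧ ∀ n : ℕ, n ≤ 8 → ∀ u ∈ Icc (-1 : ℝ) 1,
    ‖iteratedFDeriv ℝ n (fun u => (chi u : ℂ)) u‖ ≤ K := by
  have hc : ContDiff ℝ 8 (fun u => (chi u : ℂ)) :=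
    Complex.ofRealCLM.contDiff.comp (chi_contDiff (WithTop.coe_le_coe.2 (le_top : (8 : ℕ∞) ≤ ⊤)))
  have h : ∀ n : ℕ, ∃ K : ℝ, n ≤ 8 → ∀ u ∈ Icc (-1 : ℝ) 1,
      ‖iteratedFDeriv ℝ n (fun u => (chi u : ℂ)) u‖ ≤ K := by
    intro n
    by_cases hn : n ≤ 8
    · have hcont := hc.continuous_iteratedFDeriv (m := n) (by exact_mod_cast hn)
      obtain ⟨K, hK⟩ := isCompact_Icc.exists_bound_of_continuousOn (s := Icc (-1 : ℝ) 1)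
        hcont.continuousOn
      exact ⟨K, fun _ => hK⟩
    · exact ⟨0, fun h => absurd h hn⟩
  choose K hK using h
  refine ⟨1 + ∑ n ∈ Finset.range 9, |K n|, by
    have : 0 ≤ ∑ n ∈ Finset.range 9, |K n| := Finset.sum_nonneg fun _ _ => abs_nonneg _
    linarith, fun n hn u hu => ?_⟩
  refine (hK n hn u hu).trans ?_
  have := Finset.single_le_sum (f := fun n => |K n|) (fun i _ => abs_nonneg _)
    (Finset.mem_range.2 (by omega : n < 9))
  have := le_abs_self (K n)
  linarith

/-- the second order Taylor remainder, rescaled -/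
def tay (ψ : ℝ → ℝ) (b w c : ℝ) (u : ℝ) : ℝ := c * (ψ (w + b * u) - ψ w - deriv ψ w * b * u)

lemma tay_contDiff {ψ : ℝ → ℝ} (hψ : ContDiff ℝ 8 ψ) (b w c : ℝ) : ContDiff ℝ 8 (tay ψ b w c) := by
  unfold tay
  have h1 : ContDiff ℝ 8 (fun u : ℝ => ψ (w + b * u)) := hψ.comp (by fun_prop)
  exact contDiff_const.mul ((h1.sub contDiff_const).sub (by fun_prop))

lemma tay_deriv {ψ : ℝ → ℝ} (hψ : ContDiff ℝ 8 ψ) (b w c : ℝ) :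
    deriv (tay ψ b w c) = fun u => c * b * (-deriv ψ w + deriv ψ (b * u + w)) := by
  ext u
  have hd : HasDerivAt ψ (deriv ψ (w + b * u)) (w + b * u) :=
    (hψ.differentiable (by norm_num) _).hasDerivAt
  have h1 : HasDerivAt (fun u => w + b * u) (b * 1) u := ((hasDerivAt_id u).const_mul b).const_add w
  have h2 : HasDerivAt (fun u => ψ (w + b * u)) (deriv ψ (w + b * u) * (b * 1)) u := hd.comp u h1
  have h3 : HasDerivAt (fun u => deriv ψ w * b * u) (deriv ψ w * b * 1) u := (hasDerivAt_id u).const_mul _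
  have := (((h2.sub_const (ψ w)).sub h3).const_mul c).deriv
  unfold tay
  refine Eq.trans ?_ (this.trans ?_)
  · rfl
  · rw [add_comm (b * u)]; ring

lemma tay_iter {ψ : ℝ → ℝ} (hψ : ContDiff ℝ 8 ψ) (b w c : ℝ) (i : ℕ) (hi : 1 ≤ i) (hi8 : i ≤ 7) (u : ℝ) :
    iteratedDeriv (i + 1) (tay ψ b w c) u = c * b * (b ^ i * iteratedDeriv (i + 1) ψ (b * u + w)) := by
  have hd : ContDiff ℝ 7 (deriv ψ) :=
    (contDiff_succ_iff_deriv.1 (by exact_mod_cast hψ : ContDiff ℝ (7 + 1) ψ)).2.2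
  have hdi : ContDiff ℝ i (deriv ψ) := hd.of_le (by exact_mod_cast hi8)
  rw [iteratedDeriv_succ', tay_deriv hψ, iteratedDeriv_const_mul_field, iteratedDeriv_const_add (by omega)]
  rw [iteratedDeriv_succ']
  have e1 := iteratedDeriv_comp_const_mul (n := i) (f := fun x => deriv ψ (x + w)) (hdi.comp (by fun_prop)) b
  rw [show (fun z => deriv ψ (b * z + w)) = (fun x => (fun x => deriv ψ (x + w)) (b * x)) from rfl, e1]
  simp only [iteratedDeriv_comp_add_const]

lemma tay_bound {ψ : ℝ → ℝ} {B : ℝ} (hB : 1 ≤ B) (hψ : Reg ψ B) {r : ℝ} (hr : 1 ≤ r) {w : ℝ}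
    (hw : |w| + 1 ≤ B) (c : ℝ) (i : ℕ) (hi : 1 ≤ i) (hi8 : i ≤ 8) {u : ℝ} (hu : u ∈ Icc (-1 : ℝ) 1) :
    |iteratedDeriv i (tay ψ r⁻¹ w c) u| ≤ (B * (1 + |c| / r ^ 2)) ^ i := by
  have hr0 : 0 < r := by linarith
  have hpt : ∀ v ∈ Icc (-1 : ℝ) 1, |r⁻¹ * v + w| ≤ B := by
    intro v hv
    have h1 : |r⁻¹ * v| ≤ 1 := by
      rw [abs_mul, abs_of_pos (inv_pos.2 hr0)]
      exact mul_le_one₀ (inv_le_one_of_one_le₀ hr) (abs_nonneg _) (abs_le.2 hv)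
    linarith [abs_add_le (r⁻¹ * v) w]
  have hD1 : 1 ≤ B * (1 + |c| / r ^ 2) := by
    have : 0 ≤ |c| / r ^ 2 := by positivity
    nlinarith
  have key : |iteratedDeriv i (tay ψ r⁻¹ w c) u| ≤ B * (1 + |c| / r ^ 2) := by
    obtain ⟨j, rfl⟩ : ∃ j, i = j + 1 := ⟨i - 1, by omega⟩
    rcases Nat.eq_zero_or_pos j with rfl | hj
    · simp only [zero_add, iteratedDeriv_one, tay_deriv hψ.1]
      have hlip : |deriv ψ (r⁻¹ * u + w) - deriv ψ w| ≤ B * |r⁻¹ * u + w - w| := by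
        have hd : ContDiff ℝ 7 (deriv ψ) :=
          (contDiff_succ_iff_deriv.1 (by exact_mod_cast hψ.1 : ContDiff ℝ (7 + 1) ψ)).2.2
        have := (convex_Icc (-B) B).norm_image_sub_le_of_norm_deriv_le (𝕜 := ℝ) (f := deriv ψ) (C := B)
          (x := w) (y := r⁻¹ * u + w) (fun x _ => hd.differentiable (by norm_num) x)
          (fun x hx => by
            have := hψ.2 2 (by norm_num) (by norm_num) x (abs_le.2 hx)
            rw [iteratedDeriv_succ, iteratedDeriv_one] at this
            exact this)
          (abs_le.1 (by linarith)) (abs_le.1 (hpt u hu))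
        simpa [Real.norm_eq_abs] using this
      rw [abs_mul, abs_mul, abs_of_pos (inv_pos.2 hr0)]
      have e : -deriv ψ w + deriv ψ (r⁻¹ * u + w) = deriv ψ (r⁻¹ * u + w) - deriv ψ w := by ring
      rw [e]
      have h4 : |r⁻¹ * u + w - w| ≤ r⁻¹ := by
        rw [add_sub_cancel_right, abs_mul, abs_of_pos (inv_pos.2 hr0)]
        exact mul_le_of_le_one_right (inv_pos.2 hr0).le (abs_le.2 hu)
      calc |c| * r⁻¹ * |deriv ψ (r⁻¹ * u + w) - deriv ψ w| ≤ |c| * r⁻¹ * (B * r⁻¹) := by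
            gcongr; exact hlip.trans (by gcongr)
        _ = B * (|c| / r ^ 2) := by field_simp
        _ ≤ _ := by gcongr; linarith
    · rw [tay_iter hψ.1 _ _ _ _ hj (by omega), abs_mul, abs_mul, abs_mul, abs_pow, abs_of_pos (inv_pos.2 hr0)]
      have h5 := hψ.2 (j + 1) (by omega) hi8 _ (hpt u hu)
      have h6 : r⁻¹ ^ j ≤ r⁻¹ := by
        calc r⁻¹ ^ j ≤ r⁻¹ ^ 1 := pow_le_pow_of_le_one (inv_pos.2 hr0).le (inv_le_one_of_one_le₀ hr) hj
          _ = _ := pow_one _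
      calc |c| * r⁻¹ * (r⁻¹ ^ j * |iteratedDeriv (j + 1) ψ (r⁻¹ * u + w)|) ≤ |c| * r⁻¹ * (r⁻¹ * B) := by
            gcongr
        _ = B * (|c| / r ^ 2) := by field_simp
        _ ≤ _ := by gcongr; linarith
  calc _ ≤ B * (1 + |c| / r ^ 2) := key
    _ = (B * (1 + |c| / r ^ 2)) ^ 1 := (pow_one _).symm
    _ ≤ _ := pow_le_pow_right₀ hD1 hi

lemma chirp_bound (B : ℝ) (hB : 1 ≤ B) : ∃ K : ℝ, 1 ≤ K ∧ ∀ ψ, Reg ψ B → ∀ r : ℝ, 1 ≤ r →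
    ∀ w : ℝ, |w| + 1 ≤ B → ∀ c lam : ℝ,
    ‖∫ u, ((chi u : ℂ) * ee (tay ψ r⁻¹ w c u)) * ee (lam * u)‖
      ≤ K * (1 + |c| / r ^ 2) ^ 8 / (1 + |lam|) ^ 8 := by
  obtain ⟨K1, hK1, hchi⟩ := chi_fd_bound
  refine ⟨4 * 2 ^ 8 * (256 * K1 * (Nat.factorial 8 * B ^ 8)), ?_, ?_⟩
  · have : (1:ℝ) ≤ B ^ 8 := one_le_pow₀ hB
    have h8 : (1:ℝ) ≤ Nat.factorial 8 := by exact_mod_cast Nat.one_le_iff_ne_zero.2 (Nat.factorial_ne_zero 8)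
    have := one_le_mul_of_one_le_of_one_le h8 this
    nlinarith [one_le_mul_of_one_le_of_one_le hK1 this]
  intro ψ hψ r hr w hw c lam
  set D := B * (1 + |c| / r ^ 2) with hD
  have hD1 : 1 ≤ D := by
    have : 0 ≤ |c| / r ^ 2 := by positivity
    nlinarith
  have hchid : ContDiff ℝ 8 (fun u => (chi u : ℂ)) :=
    Complex.ofRealCLM.contDiff.comp (chi_contDiff (WithTop.coe_le_coe.2 (le_top : (8 : ℕ∞) ≤ ⊤)))
  have htay := tay_contDiff hψ.1 r⁻¹ w c
  have hexp : ContDiff ℝ 8 (ee ∘ tay ψ r⁻¹ w c) := ee_contDiff.comp htay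
  have hfd : ∀ n : ℕ, n ≤ 8 → ∀ u ∈ Icc (-1 : ℝ) 1, ‖iteratedFDeriv ℝ n (ee ∘ tay ψ r⁻¹ w c) u‖ ≤ Nat.factorial 8 * D ^ 8 := by
    intro n hn u hu
    have := norm_iteratedFDeriv_comp_le (𝕜 := ℝ) (N := 8) (n := n) ee_contDiff htay (by exact_mod_cast hn) u
      (C := 1) (D := D) (fun i _ => (ee_iteratedFDeriv_norm i _).le) (fun i h1 h2 => by
        rw [norm_iteratedFDeriv_eq_norm_iteratedDeriv, Real.norm_eq_abs]
        exact tay_bound hB hψ hr hw c i h1 (h2.trans hn) hu)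
    refine this.trans ?_
    rw [mul_one]
    gcongr
  have main := fourier_decay (fun u => (chi u : ℂ) * ee (tay ψ r⁻¹ w c u)) 8 (256 * K1 * (Nat.factorial 8 * D ^ 8))
    (by exact_mod_cast hchid.mul hexp) (fun u hu => by simp [chi_eq_zero hu]) (fun u => by
      rw [norm_mul, ee_norm, mul_one, Complex.norm_real, Real.norm_eq_abs]
      refine (chi_abs_le u).trans ?_
      have : (1:ℝ) ≤ D ^ 8 := one_le_pow₀ hD1
      have h8 : (1:ℝ) ≤ Nat.factorial 8 := by exact_mod_cast Nat.one_le_iff_ne_zero.2 (Nat.factorial_ne_zero 8)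
      have := one_le_mul_of_one_le_of_one_le h8 this
      nlinarith [one_le_mul_of_one_le_of_one_le hK1 this]) (fun u hu => by
      rw [← norm_iteratedFDeriv_eq_norm_iteratedDeriv]
      refine (norm_iteratedFDeriv_mul_le (𝕜 := ℝ) hchid hexp u (n := 8) (by norm_num)).trans ?_
      have : ∀ i ∈ Finset.range (8 + 1), ((8 : ℕ).choose i : ℝ) * ‖iteratedFDeriv ℝ i (fun u => (chi u : ℂ)) u‖ * ‖iteratedFDeriv ℝ (8 - i) (ee ∘ tay ψ r⁻¹ w c) u‖
          ≤ ((8 : ℕ).choose i : ℝ) * (K1 * (Nat.factorial 8 * D ^ 8)) := by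
        intro i hi
        rw [Finset.mem_range] at hi
        rw [mul_assoc]
        gcongr
        · exact hchi i (by omega) u hu
        · exact hfd _ (by omega) u hu
      refine (Finset.sum_le_sum this).trans ?_
      rw [← Finset.sum_mul]
      have hs : ∑ i ∈ Finset.range (8 + 1), ((8 : ℕ).choose i : ℝ) = 256 := by
        exact_mod_cast Nat.sum_range_choose 8
      rw [hs]; apply le_of_eq; ring) lam
  refine main.trans (le_of_eq ?_)
  rw [hD, mul_pow]; ring

lemma peetre (s t : ℝ) (n : ℕ) : ((1 + |s + t|) ^ n)⁻¹ ≤ (1 + |t|) ^ n / (1 + |s|) ^ n := by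
  rw [inv_eq_one_div, div_le_div_iff₀ (by positivity) (by positivity), one_mul, ← mul_pow]
  gcongr
  have := abs_sub (s + t) t
  rw [add_sub_cancel_right] at this
  nlinarith [abs_nonneg t, abs_nonneg (s + t), abs_nonneg s]

/-- The normalized two dimensional oscillatory integral. -/
lemma packet_osc (B : ℝ) (hB : 1 ≤ B) : ∃ K : ℝ, 1 ≤ K ∧ ∀ ψ, Reg ψ B → ∀ r : ℝ, 1 ≤ r →
    ∀ w : ℝ, |w| + 1 ≤ B → ∀ c s1 s2 : ℝ,
    ‖∫ u : ℝ × ℝ, ((chi u.1 : ℂ) * (chi u.2 : ℂ)) *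
        ee (s1 * u.1 + s2 * u.2 + c / r ^ 2 * (u.1 * u.2) + tay ψ r⁻¹ w c u.2)‖
      ≤ K * (1 + |c| / r ^ 2) ^ 16 / (1 + max |s1| |s2|) ^ 8 := by
  obtain ⟨K, hK, hch⟩ := chirp_bound B hB
  obtain ⟨K0, hK0, hch0⟩ := chirp_bound 1 le_rfl
  refine ⟨2 * K + 2 * K0, by linarith, ?_⟩
  intro ψ hψ r hr w hw c s1 s2
  set t := c / r ^ 2 with ht
  have htabs : |c| / r ^ 2 = |t| := by rw [ht, abs_div, abs_of_pos (by positivity : 0 < r ^ 2)]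
  rw [htabs]
  set F : ℝ × ℝ → ℂ := fun u => ((chi u.1 : ℂ) * (chi u.2 : ℂ)) *
        ee (s1 * u.1 + s2 * u.2 + t * (u.1 * u.2) + tay ψ r⁻¹ w c u.2) with hF
  have hcc := chi_continuous
  have htc : Continuous (tay ψ r⁻¹ w c) := (tay_contDiff hψ.1 _ _ _).continuous
  have hFc : Continuous F := by rw [hF]; fun_prop
  have hFi : Integrable F := by
    apply hFc.integrable_of_hasCompactSupport
    apply HasCompactSupport.intro (isCompact_Icc (a := ((-1, -1) : ℝ × ℝ)) (b := (1, 1)))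
    intro u hu
    have : 1 ≤ |u.1| ∨ 1 ≤ |u.2| := by
      by_contra h
      push Not at h
      apply hu
      rw [abs_lt, abs_lt] at h
      exact ⟨⟨h.1.1.le, h.2.1.le⟩, ⟨h.1.2.le, h.2.2.le⟩⟩
    rcases this with h | h <;> simp [hF, chi_eq_zero h]
  have hzero : Reg (fun _ => (0:ℝ)) 1 := by
    refine ⟨contDiff_const, fun k h1 h2 y _ => ?_⟩
    rw [iteratedDeriv_const]; simp [show k ≠ 0 by omega]
  -- decay in s1
  have hb1 : ‖∫ u, F u‖ ≤ 2 * (K0 * ((1 + |t|) ^ 16 / (1 + |s1|) ^ 8)) := by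
    rw [Measure.volume_eq_prod, integral_prod_symm _ (by rw [← Measure.volume_eq_prod]; exact hFi)]
    rw [← setIntegral_eq_integral_of_forall_compl_eq_zero (s := Icc (-1 : ℝ) 1)]
    · refine (norm_setIntegral_le_of_norm_le_const (C := K0 * ((1 + |t|) ^ 16 / (1 + |s1|) ^ 8)) (by simp) ?_).trans ?_
      · intro u2 hu2
        have e : ∫ u1, F (u1, u2) = ((chi u2 : ℂ) * ee (s2 * u2 + tay ψ r⁻¹ w c u2)) *
            ∫ u, ((chi u : ℂ) * ee (tay (fun _ => 0) 1⁻¹ 0 0 u)) * ee ((s1 + t * u2) * u) := by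
          rw [← integral_const_mul]
          congr 1; ext u
          simp only [hF, tay, zero_mul, ee_zero, mul_one]
          rw [show s1 * u + s2 * u2 + t * (u * u2) + c * (ψ (w + r⁻¹ * u2) - ψ w - deriv ψ w * r⁻¹ * u2)
            = (s2 * u2 + c * (ψ (w + r⁻¹ * u2) - ψ w - deriv ψ w * r⁻¹ * u2)) + (s1 + t * u2) * u by ring, ee_add]
          ring
        rw [e, norm_mul, norm_mul, ee_norm, mul_one, Complex.norm_real, Real.norm_eq_abs]
        have h1 := hch0 _ hzero 1 le_rfl 0 (by simp) 0 (s1 + t * u2)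
        simp only [abs_zero, zero_div, add_zero, one_pow, mul_one] at h1
        calc _ ≤ 1 * (K0 / (1 + |s1 + t * u2|) ^ 8) := by
              gcongr; exact chi_abs_le _
          _ ≤ K0 * ((1 + |t * u2|) ^ 8 / (1 + |s1|) ^ 8) := by
              rw [one_mul, div_eq_mul_inv]; gcongr; exact peetre _ _ _
          _ ≤ _ := by
              gcongr ?_ * (?_ / _)
              have : |t * u2| ≤ |t| := by
                rw [abs_mul]; exact mul_le_of_le_one_right (abs_nonneg _) (abs_le.2 hu2)
              calc (1 + |t * u2|) ^ 8 ≤ (1 + |t|) ^ 8 := by gcongr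
                _ ≤ _ := pow_le_pow_right₀ (by linarith [abs_nonneg t]) (by norm_num)
      · simp [Measure.real]; linarith
    · intro u2 hu2
      have : chi u2 = 0 := chi_eq_zero (by
        by_contra h; push Not at h; rw [abs_lt] at h; exact hu2 ⟨h.1.le, h.2.le⟩)
      simp [hF, this]
  have hb2 : ‖∫ u, F u‖ ≤ 2 * (K * ((1 + |t|) ^ 16 / (1 + |s2|) ^ 8)) := by
    rw [Measure.volume_eq_prod, integral_prod _ (by rw [← Measure.volume_eq_prod]; exact hFi)]
    rw [← setIntegral_eq_integral_of_forall_compl_eq_zero (s := Icc (-1 : ℝ) 1)]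
    · refine (norm_setIntegral_le_of_norm_le_const (C := K * ((1 + |t|) ^ 16 / (1 + |s2|) ^ 8)) (by simp) ?_).trans ?_
      · intro u1 hu1
        have e : ∫ u2, F (u1, u2) = ((chi u1 : ℂ) * ee (s1 * u1)) *
            ∫ u, ((chi u : ℂ) * ee (tay ψ r⁻¹ w c u)) * ee ((s2 + t * u1) * u) := by
          rw [← integral_const_mul]
          congr 1; ext u
          simp only [hF]
          rw [show s1 * u1 + s2 * u + t * (u1 * u) + tay ψ r⁻¹ w c u
            = s1 * u1 + (tay ψ r⁻¹ w c u + (s2 + t * u1) * u) by ring, ee_add, ee_add]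
          ring
        rw [e, norm_mul, norm_mul, ee_norm, mul_one, Complex.norm_real, Real.norm_eq_abs]
        have h1 := hch ψ hψ r hr w hw c (s2 + t * u1)
        rw [htabs] at h1
        calc _ ≤ 1 * (K * (1 + |t|) ^ 8 / (1 + |s2 + t * u1|) ^ 8) := by
              gcongr; exact chi_abs_le _
          _ ≤ K * (1 + |t|) ^ 8 * ((1 + |t * u1|) ^ 8 / (1 + |s2|) ^ 8) := by
              rw [one_mul, div_eq_mul_inv]; gcongr; exact peetre _ _ _
          _ ≤ K * (1 + |t|) ^ 8 * ((1 + |t|) ^ 8 / (1 + |s2|) ^ 8) := by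
              have : |t * u1| ≤ |t| := by
                rw [abs_mul]; exact mul_le_of_le_one_right (abs_nonneg _) (abs_le.2 hu1)
              gcongr
          _ = _ := by ring
      · simp [Measure.real]; linarith
    · intro u1 hu1
      have : chi u1 = 0 := chi_eq_zero (by
        by_contra h; push Not at h; rw [abs_lt] at h; exact hu1 ⟨h.1.le, h.2.le⟩)
      simp [hF, this]
  have hpos1 : 0 ≤ K * ((1 + |t|) ^ 16 / (1 + |s2|) ^ 8) := by positivity
  have hpos2 : 0 ≤ K0 * ((1 + |t|) ^ 16 / (1 + |s1|) ^ 8) := by positivity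
  rcases le_total |s1| |s2| with h | h
  · rw [max_eq_right h]
    refine hb2.trans ?_
    rw [mul_div_assoc]
    have : 0 ≤ K0 * ((1 + |t|) ^ 16 / (1 + |s2|) ^ 8) := by positivity
    linarith
  · rw [max_eq_left h]
    refine hb1.trans ?_
    rw [mul_div_assoc]
    have : 0 ≤ K * ((1 + |t|) ^ 16 / (1 + |s1|) ^ 8) := by positivity
    linarith

lemma pk_decay (B : ℝ) (hB : 1 ≤ B) : ∃ K : ℝ, 1 ≤ K ∧ ∀ ψ, Reg ψ B → ∀ r : ℝ, 1 ≤ r →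
    ∀ T : Idx, |(om r T).2| + 1 ≤ B → ∀ ξ : ℝ × ℝ × ℝ,
    ‖EE ψ (pk r T) ξ‖ ≤ K * r⁻¹ * (1 + |ξ.2.2| / r ^ 2) ^ 16 * wt ψ r T ξ := by
  obtain ⟨K, hK, hosc⟩ := packet_osc B hB
  refine ⟨K, hK, ?_⟩
  intro ψ hψ r hr T hT ξ
  have hr0 : 0 < r := by linarith
  have h1 := hosc ψ hψ r hr (om r T).2 hT ξ.2.2 (sv ψ r T ξ).1 (sv ψ r T ξ).2
  set I := ∫ u : ℝ × ℝ, ((chi u.1 : ℂ) * (chi u.2 : ℂ)) *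
        ee ((sv ψ r T ξ).1 * u.1 + (sv ψ r T ξ).2 * u.2 + ξ.2.2 / r ^ 2 * (u.1 * u.2) + tay ψ r⁻¹ (om r T).2 ξ.2.2 u.2) with hI
  have e : EE ψ (pk r T) ξ = ((1 / (2 * r) : ℝ) : ℂ) * (ee (ξ.1 * (om r T).1 + ξ.2.1 * (om r T).2 + ξ.2.2 * ph ψ (om r T) - Real.pi * r * (T.2.1 * (om r T).1 + T.2.2 * (om r T).2)) * I) := by
    unfold EE
    rw [← integral_add_right_eq_self _ (om r T)]
    have h2 := Measure.integral_comp_smul (volume : Measure (ℝ × ℝ)) (fun z => pk r T (z + om r T) * ee (ξ.1 * (z + om r T).1 + ξ.2.1 * (z + om r T).2 + ξ.2.2 * ph ψ (z + om r T))) r⁻¹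
    have h3 : |(r⁻¹ ^ Module.finrank ℝ (ℝ × ℝ))⁻¹| = r ^ 2 := by
      simp [Module.finrank_prod]
    rw [h3] at h2
    have h4 : ∀ x y : ℂ, x = (r^2 : ℝ) • y → y = ((1 / (2 * r) : ℝ) : ℂ) * ((2 / r : ℝ) * x) := by
      intro x y h
      rw [h, Complex.real_smul]; push_cast
      have : (r : ℂ) ≠ 0 := by exact_mod_cast hr0.ne'
      field_simp
    rw [h4 _ _ h2, hI]
    congr 1
    rw [← integral_const_mul, ← integral_const_mul]
    congr 1; ext u
    have hw1 : r * (r⁻¹ * u.1 + (om r T).1) - T.1.1 = u.1 := by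
      simp only [om]; field_simp; ring
    have hw2 : r * (r⁻¹ * u.2 + (om r T).2) - T.1.2 = u.2 := by
      simp only [om]; field_simp; ring
    simp only [pk, Prod.fst_add, Prod.snd_add, Prod.smul_fst, Prod.smul_snd, smul_eq_mul, hw1, hw2]
    have hs1 : (sv ψ r T ξ).1 = (ξ.1 + ξ.2.2 * (om r T).2 - Real.pi * r * T.2.1) / r := rfl
    have hs2 : (sv ψ r T ξ).2 = (ξ.2.1 + ξ.2.2 * ((om r T).1 + deriv ψ (om r T).2) - Real.pi * r * T.2.2) / r := rfl
    rw [hs1, hs2]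
    have harg : ∀ a b c d : ℝ, a + b = c + d → ee a * ee b = ee c * ee d := by
      intro a b c d h; rw [← ee_add, ← ee_add, h]
    have hfin := harg (-(Real.pi * r * (T.2.1 * (r⁻¹ * u.1 + (om r T).1) + T.2.2 * (r⁻¹ * u.2 + (om r T).2))))
      (ξ.1 * (r⁻¹ * u.1 + (om r T).1) + ξ.2.1 * (r⁻¹ * u.2 + (om r T).2) + ξ.2.2 * ph ψ (r⁻¹ • u + om r T))
      (ξ.1 * (om r T).1 + ξ.2.1 * (om r T).2 + ξ.2.2 * ph ψ (om r T) - Real.pi * r * (T.2.1 * (om r T).1 + T.2.2 * (om r T).2))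
      ((ξ.1 + ξ.2.2 * (om r T).2 - Real.pi * r * T.2.1) / r * u.1 + (ξ.2.1 + ξ.2.2 * ((om r T).1 + deriv ψ (om r T).2) - Real.pi * r * T.2.2) / r * u.2 + ξ.2.2 / r ^ 2 * (u.1 * u.2) + tay ψ r⁻¹ (om r T).2 ξ.2.2 u.2)
      (by
        simp only [ph, tay, Prod.fst_add, Prod.snd_add, Prod.smul_fst, Prod.smul_snd, smul_eq_mul]
        rw [add_comm (r⁻¹ * u.2)]
        field_simp
        ring)
    have hrc : (r : ℂ) ≠ 0 := by exact_mod_cast hr0.ne'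
    calc _ = (((2 / r : ℝ) : ℂ) * ((r / 2 * (chi u.1 * chi u.2) : ℝ) : ℂ)) * (ee (-(Real.pi * r * (T.2.1 * (r⁻¹ * u.1 + (om r T).1) + T.2.2 * (r⁻¹ * u.2 + (om r T).2)))) * ee
      (ξ.1 * (r⁻¹ * u.1 + (om r T).1) + ξ.2.1 * (r⁻¹ * u.2 + (om r T).2) + ξ.2.2 * ph ψ (r⁻¹ • u + om r T))) := by ring
      _ = _ := by
        rw [hfin]; push_cast; field_simp
  rw [e, norm_mul, norm_mul, ee_norm, one_mul, Complex.norm_real, Real.norm_eq_abs, abs_of_pos (by positivity)]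
  have hn : ‖sv ψ r T ξ‖ = max |(sv ψ r T ξ).1| |(sv ψ r T ξ).2| := rfl
  unfold wt
  rw [hn]
  calc 1 / (2 * r) * ‖I‖ ≤ r⁻¹ * (K * (1 + |ξ.2.2| / r ^ 2) ^ 16 / (1 + max |(sv ψ r T ξ).1| |(sv ψ r T ξ).2|) ^ 8) := by
        gcongr
        rw [one_div, mul_inv]
        have : 0 < r⁻¹ := by positivity
        linarith
    _ = _ := by ring

end BAP

namespace BAP

/-! ### Lattice sums -/

lemma lat1 : ∃ K : ℝ, 1 ≤ K ∧ ∀ (S : Finset ℤ) (x : ℝ), ∑ m ∈ S, ((1 + |x - m|) ^ 2)⁻¹ ≤ K := by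
  have hs : Summable (fun n : ℤ => ((1 + |(n : ℝ)|) ^ 2)⁻¹) := by
    have h1 : Summable (fun n : ℤ => 1 / ((n : ℝ) ^ 2)) := by
      have := Real.summable_one_div_int_pow (p := 2)
      exact this.2 (by norm_num)
    have h2 : Summable (fun n : ℤ => if n = 0 then (1:ℝ) else 0) := by
      apply summable_of_ne_finset_zero (s := {0})
      intro b hb; simp at hb; simp [hb]
    refine Summable.of_nonneg_of_le (fun n => by positivity) (fun n => ?_) (h1.add h2)
    by_cases hn : n = 0
    · simp [hn]
    · simp only [hn, if_false, add_zero, one_div]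
      have : (0:ℝ) < |(n : ℝ)| := by positivity
      rw [← sq_abs (n : ℝ)]
      gcongr
      linarith
  refine ⟨1 + 4 * ∑' n : ℤ, ((1 + |(n : ℝ)|) ^ 2)⁻¹, ?_, ?_⟩
  · have : 0 ≤ ∑' n : ℤ, ((1 + |(n : ℝ)|) ^ 2)⁻¹ := tsum_nonneg (fun n => by positivity)
    linarith
  intro S x
  have h1 : ∀ m ∈ S, ((1 + |x - m|) ^ 2)⁻¹ ≤ 4 * ((1 + |((⌊x⌋ - m : ℤ) : ℝ)|) ^ 2)⁻¹ := by
    intro m _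
    rw [← div_eq_mul_inv, inv_eq_one_div, div_le_div_iff₀ (by positivity) (by positivity)]
    have : |((⌊x⌋ - m : ℤ) : ℝ)| ≤ |x - m| + 1 := by
      push_cast
      have h2 := abs_sub (x - m) (x - ⌊x⌋)
      have h3 : |x - ⌊x⌋| ≤ 1 := by
        rw [abs_le]; constructor <;> linarith [Int.floor_le x, Int.lt_floor_add_one x]
      rw [show x - m - (x - ⌊x⌋) = ⌊x⌋ - m by ring] at h2
      linarith
    nlinarith [abs_nonneg (x - m), abs_nonneg ((⌊x⌋ - m : ℤ) : ℝ)]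
  refine (Finset.sum_le_sum h1).trans ?_
  rw [← Finset.mul_sum]
  have h4 : ∑ m ∈ S, ((1 + |((⌊x⌋ - m : ℤ) : ℝ)|) ^ 2)⁻¹ = ∑ n ∈ S.image (fun m => ⌊x⌋ - m), ((1 + |(n : ℝ)|) ^ 2)⁻¹ := by
    rw [Finset.sum_image]
    intro a _ b _ h
    simp only at h; omega
  rw [h4]
  have := hs.sum_le_tsum (S.image (fun m => ⌊x⌋ - m)) (fun n _ => by positivity)
  linarith

/-- Two dimensional lattice sums, with spacing `c ≥ 1`. -/
lemma lat2 : ∃ K : ℝ, 1 ≤ K ∧ ∀ (S : Finset (ℤ × ℤ)) (x y c : ℝ), 1 ≤ c →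
    ∑ m ∈ S, ((1 + ‖((x - c * m.1, y - c * m.2) : ℝ × ℝ)‖) ^ 4)⁻¹ ≤ K := by
  obtain ⟨K, hK, hl⟩ := lat1
  refine ⟨K * K, one_le_mul_of_one_le_of_one_le hK hK, ?_⟩
  intro S x y c hc
  have hc0 : 0 < c := by linarith
  have hshr : ∀ (t : ℝ) (m : ℤ), |t / c - m| ≤ |t - c * m| := by
    intro t m
    have : t / c - m = (t - c * m) / c := by field_simp
    rw [this, abs_div, abs_of_pos hc0]
    exact div_le_self (abs_nonneg _) hc
  have h1 : ∀ m ∈ S, ((1 + ‖((x - c * m.1, y - c * m.2) : ℝ × ℝ)‖) ^ 4)⁻¹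
      ≤ ((1 + |x / c - m.1|) ^ 2)⁻¹ * ((1 + |y / c - m.2|) ^ 2)⁻¹ := by
    intro m _
    rw [← mul_inv]
    have hx : |x / c - m.1| ≤ ‖((x - c * m.1, y - c * m.2) : ℝ × ℝ)‖ := (hshr x m.1).trans (norm_fst_le ((x - c * m.1, y - c * m.2) : ℝ × ℝ))
    have hy : |y / c - m.2| ≤ ‖((x - c * m.1, y - c * m.2) : ℝ × ℝ)‖ := (hshr y m.2).trans (norm_snd_le ((x - c * m.1, y - c * m.2) : ℝ × ℝ))
    gcongr
    calc _ ≤ (1 + ‖((x - c * m.1, y - c * m.2) : ℝ × ℝ)‖) ^ 2 * (1 + ‖((x - c * m.1, y - c * m.2) : ℝ × ℝ)‖) ^ 2 := by gcongr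
      _ = _ := by ring
  refine (Finset.sum_le_sum h1).trans ?_
  have hsub : S ⊆ (S.image Prod.fst) ×ˢ (S.image Prod.snd) := Finset.subset_product
  refine (Finset.sum_le_sum_of_subset_of_nonneg hsub (fun m _ _ => by positivity)).trans ?_
  rw [Finset.sum_product]
  dsimp only
  rw [← Finset.sum_mul_sum]
  exact mul_le_mul (hl _ _) (hl _ _) (Finset.sum_nonneg fun _ _ => by positivity) (by linarith)

/-! ### Weights -/

lemma wt_pos (ψ : ℝ → ℝ) (r : ℝ) (T : Idx) (ξ : ℝ × ℝ × ℝ) : 0 < wt ψ r T ξ := by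
  unfold wt; positivity

lemma wt_le_one (ψ : ℝ → ℝ) (r : ℝ) (T : Idx) (ξ : ℝ × ℝ × ℝ) : wt ψ r T ξ ≤ 1 := by
  unfold wt
  apply inv_le_one_of_one_le₀
  apply one_le_pow₀
  linarith [norm_nonneg (sv ψ r T ξ)]

/-- The bounded region for packet centres. -/
def Good (B r : ℝ) (T : Idx) : Prop := |(om r T).1| + 1 ≤ B ∧ |(om r T).2| + 1 ≤ B

lemma gr_bound {ψ : ℝ → ℝ} {B : ℝ} (hψ : Reg ψ B) {w : ℝ × ℝ} (h1 : |w.1| ≤ B)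
    (h2 : |w.2| ≤ B) : ‖gr ψ w‖ ≤ 2 * B := by
  have h3 := hψ.2 1 le_rfl (by norm_num) w.2 h2
  rw [iteratedDeriv_one] at h3
  have hB : 0 ≤ B := (abs_nonneg _).trans h1
  rw [Prod.norm_def]
  apply max_le
  · simp only [gr, Real.norm_eq_abs]; linarith
  · simp only [gr, Real.norm_eq_abs]; linarith [abs_add_le w.1 (deriv ψ w.2)]

/-- Projection of a space-time vector along the direction of a packet. -/
def pr (ψ : ℝ → ℝ) (w : ℝ × ℝ) (x : ℝ × ℝ × ℝ) : ℝ × ℝ :=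
  (x.1 + x.2.2 * (gr ψ w).1, x.2.1 + x.2.2 * (gr ψ w).2)

lemma pr_norm_le {ψ : ℝ → ℝ} {B : ℝ} (hψ : Reg ψ B) {w : ℝ × ℝ} (h1 : |w.1| ≤ B)
    (h2 : |w.2| ≤ B) (x : ℝ × ℝ × ℝ) : ‖pr ψ w x‖ ≤ (1 + 2 * B) * ‖x‖ := by
  have hg := gr_bound hψ h1 h2
  have hx1 : |x.1| ≤ ‖x‖ := norm_fst_le x
  have hx2 : |x.2.1| ≤ ‖x‖ := (norm_fst_le x.2).trans (norm_snd_le x)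
  have hx3 : |x.2.2| ≤ ‖x‖ := (norm_snd_le x.2).trans (norm_snd_le x)
  have hg1 : |(gr ψ w).1| ≤ 2 * B := (norm_fst_le (gr ψ w)).trans hg
  have hg2 : |(gr ψ w).2| ≤ 2 * B := (norm_snd_le (gr ψ w)).trans hg
  rw [Prod.norm_def]
  apply max_le
  · simp only [pr, Real.norm_eq_abs]
    refine (abs_add_le _ _).trans ?_
    rw [abs_mul]
    nlinarith [abs_nonneg x.2.2, abs_nonneg (gr ψ w).1, norm_nonneg x, mul_le_mul hx3 hg1 (abs_nonneg _) (norm_nonneg x)]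
  · simp only [pr, Real.norm_eq_abs]
    refine (abs_add_le _ _).trans ?_
    rw [abs_mul]
    nlinarith [abs_nonneg x.2.2, abs_nonneg (gr ψ w).2, norm_nonneg x, mul_le_mul hx3 hg2 (abs_nonneg _) (norm_nonneg x)]

lemma sv_sub (ψ : ℝ → ℝ) (r : ℝ) (T : Idx) (ξ p : ℝ × ℝ × ℝ) :
    sv ψ r T ξ - sv ψ r T p = r⁻¹ • pr ψ (om r T) (ξ - p) := by
  ext
  · simp only [sv, pr, Prod.fst_sub, Prod.snd_sub, Prod.smul_fst, smul_eq_mul]; ring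
  · simp only [sv, pr, Prod.fst_sub, Prod.snd_sub, Prod.smul_snd, smul_eq_mul]; ring

lemma sv_sub_norm {r : ℝ} (hr : 0 < r) (ψ : ℝ → ℝ) (T : Idx) (ξ p : ℝ × ℝ × ℝ) :
    ‖sv ψ r T ξ - sv ψ r T p‖ = ‖pr ψ (om r T) (ξ - p)‖ / r := by
  rw [sv_sub, norm_smul, Real.norm_eq_abs, abs_of_pos (inv_pos.2 hr)]; ring

lemma wt_shift {ψ : ℝ → ℝ} {B : ℝ} (hB : 1 ≤ B) (hψ : Reg ψ B) {r : ℝ} (hr : 0 < r) {T : Idx} (hT : Good B r T)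
    (ξ p : ℝ × ℝ × ℝ) :
    wt ψ r T ξ ≤ (1 + 2 * B) ^ 8 * (1 + ‖ξ - p‖ / r) ^ 8 * wt ψ r T p := by
  unfold wt
  rw [← div_eq_mul_inv, inv_eq_one_div, div_le_div_iff₀ (by positivity) (by positivity), one_mul, ← mul_pow, ← mul_pow]
  gcongr
  have h1 : ‖sv ψ r T p‖ ≤ ‖sv ψ r T ξ‖ + ‖sv ψ r T ξ - sv ψ r T p‖ := by
    have := norm_sub_norm_le (sv ψ r T p) (sv ψ r T ξ)
    rw [norm_sub_rev (sv ψ r T p)] at this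
    linarith
  have h2 := pr_norm_le hψ (w := om r T) (by linarith [hT.1]) (by linarith [hT.2]) (ξ - p)
  rw [sv_sub_norm hr] at h1
  have h3 : ‖pr ψ (om r T) (ξ - p)‖ / r ≤ (1 + 2 * B) * (‖ξ - p‖ / r) := by
    rw [← mul_div_assoc]; gcongr
  have h4 : 0 ≤ ‖ξ - p‖ / r := by positivity
  nlinarith [norm_nonneg (sv ψ r T ξ), mul_nonneg (norm_nonneg (sv ψ r T ξ)) h4, mul_nonneg (mul_nonneg (norm_nonneg (sv ψ r T ξ)) h4) (by linarith : (0:ℝ) ≤ B), mul_nonneg (norm_nonneg (sv ψ r T ξ)) (by linarith : (0:ℝ) ≤ B)]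

/-! ### Windows -/

/-- The chosen window profile. -/
def th : ℝ → ℝ := Classical.choose exists_window

lemma th_continuous : Continuous th := (Classical.choose_spec exists_window).1
lemma th_nonneg (s : ℝ) : 0 ≤ th s := (Classical.choose_spec exists_window).2.1 s
lemma th_one {s : ℝ} (hs : |s| ≤ 1) : 1 ≤ th s := (Classical.choose_spec exists_window).2.2.1 s hs
lemma th_decay (M : ℕ) : ∃ C : ℝ, 0 < C ∧ ∀ s, th s ≤ C / (1 + |s|) ^ M :=
  (Classical.choose_spec exists_window).2.2.2.1 M
lemma th_fourier {lam : ℝ} (h : 1 ≤ |lam|) : ∫ s, (th s : ℂ) * ee (lam * s) = 0 :=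
  (Classical.choose_spec exists_window).2.2.2.2 lam h

/-- Window at scale `r` around `p`. -/
def win (r : ℝ) (p ξ : ℝ × ℝ × ℝ) : ℝ :=
  th ((ξ.1 - p.1) / r) * (th ((ξ.2.1 - p.2.1) / r) * th ((ξ.2.2 - p.2.2) / r))

/-- Integrable majorant. -/
def maj (r : ℝ) (p ξ : ℝ × ℝ × ℝ) : ℝ :=
  (1 + ((ξ.1 - p.1) / r) ^ 2)⁻¹ * ((1 + ((ξ.2.1 - p.2.1) / r) ^ 2)⁻¹ * (1 + ((ξ.2.2 - p.2.2) / r) ^ 2)⁻¹)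

lemma win_nonneg (r : ℝ) (p ξ : ℝ × ℝ × ℝ) : 0 ≤ win r p ξ :=
  mul_nonneg (th_nonneg _) (mul_nonneg (th_nonneg _) (th_nonneg _))

lemma win_continuous (r : ℝ) (p : ℝ × ℝ × ℝ) : Continuous (win r p) := by
  unfold win
  have := th_continuous
  fun_prop

lemma q_integrable {r : ℝ} (hr : 0 < r) (a : ℝ) : Integrable (fun s : ℝ => (1 + ((s - a) / r) ^ 2)⁻¹) := by
  have h1 := (integrable_inv_one_add_sq).comp_div hr.ne'
  exact h1.comp_sub_right a

lemma q_integral {r : ℝ} (hr : 0 < r) (a : ℝ) : ∫ s : ℝ, (1 + ((s - a) / r) ^ 2)⁻¹ = Real.pi * r := by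
  rw [integral_sub_right_eq_self (fun s => (1 + (s / r) ^ 2)⁻¹) a, Measure.integral_comp_div (fun s => (1 + s ^ 2)⁻¹) r,
    integral_univ_inv_one_add_sq, abs_of_pos hr, smul_eq_mul, mul_comm]

lemma maj_integrable {r : ℝ} (hr : 0 < r) (p : ℝ × ℝ × ℝ) : Integrable (maj r p) := by
  unfold maj
  exact (q_integrable hr p.1).mul_prod ((q_integrable hr p.2.1).mul_prod (q_integrable hr p.2.2))

lemma maj_integral {r : ℝ} (hr : 0 < r) (p : ℝ × ℝ × ℝ) : ∫ ξ, maj r p ξ = Real.pi ^ 3 * r ^ 3 := by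
  unfold maj
  rw [Measure.volume_eq_prod, integral_prod_mul (fun s : ℝ => (1 + ((s - p.1) / r) ^ 2)⁻¹)
    (fun z : ℝ × ℝ => (1 + ((z.1 - p.2.1) / r) ^ 2)⁻¹ * (1 + ((z.2 - p.2.2) / r) ^ 2)⁻¹),
    Measure.volume_eq_prod, integral_prod_mul (fun s : ℝ => (1 + ((s - p.2.1) / r) ^ 2)⁻¹)
    (fun s : ℝ => (1 + ((s - p.2.2) / r) ^ 2)⁻¹), q_integral hr, q_integral hr, q_integral hr]
  ring

lemma rearr6 (a b c x y z : ℝ) : a * (b * c) * (x * (y * z)) = (a * x) * ((b * y) * (c * z)) := by ring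

lemma win_maj : ∃ C : ℝ, 1 ≤ C ∧ ∀ r : ℝ, 0 < r → ∀ p ξ : ℝ × ℝ × ℝ,
    win r p ξ * (1 + ‖ξ - p‖ / r) ^ 96 ≤ C * maj r p ξ := by
  obtain ⟨C, hC, hd⟩ := th_decay 98
  refine ⟨(C + 1) ^ 3, one_le_pow₀ (by linarith), ?_⟩
  intro r hr p ξ
  have h1 : ∀ s, th s * (1 + |s|) ^ 96 ≤ (C + 1) * (1 + s ^ 2)⁻¹ := by
    intro s
    have h2 := hd s
    calc th s * (1 + |s|) ^ 96 ≤ C / (1 + |s|) ^ 98 * (1 + |s|) ^ 96 := by gcongr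
      _ = C * ((1 + |s|) ^ 2)⁻¹ := by field_simp
      _ ≤ _ := by
        gcongr
        · linarith
        · rw [← sq_abs s]; nlinarith [abs_nonneg s]
  set a := (ξ.1 - p.1) / r
  set b := (ξ.2.1 - p.2.1) / r
  set c := (ξ.2.2 - p.2.2) / r
  have hn : ‖ξ - p‖ / r = max |a| (max |b| |c|) := by
    have : ‖ξ - p‖ = max |ξ.1 - p.1| (max |ξ.2.1 - p.2.1| |ξ.2.2 - p.2.2|) := rfl
    rw [this, ← max_div_div_right hr.le, ← max_div_div_right hr.le]
    simp only [a, b, c, abs_div, abs_of_pos hr]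
  have h3 : (1 + ‖ξ - p‖ / r) ≤ (1 + |a|) * ((1 + |b|) * (1 + |c|)) := by
    rw [hn]
    have ha := abs_nonneg a
    have hb := abs_nonneg b
    have hc := abs_nonneg c
    have e : (1 + |a|) * ((1 + |b|) * (1 + |c|)) = 1 + |a| + |b| + |c| + |a| * |b| + |b| * |c| + |a| * |c| + |a| * |b| * |c| := by ring
    have := mul_nonneg ha hb
    have := mul_nonneg hb hc
    have := mul_nonneg ha hc
    have := mul_nonneg (mul_nonneg ha hb) hc
    rw [e]
    have : max |a| (max |b| |c|) ≤ |a| + |b| + |c| := max_le (by linarith) (max_le (by linarith) (by linarith))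
    linarith
  have hq : ∀ s, 0 ≤ th s * (1 + |s|) ^ 96 := fun s => mul_nonneg (th_nonneg s) (by positivity)
  calc win r p ξ * (1 + ‖ξ - p‖ / r) ^ 96 ≤ win r p ξ * ((1 + |a|) * ((1 + |b|) * (1 + |c|))) ^ 96 := by
        gcongr
        exact win_nonneg _ _ _
    _ = (th a * (1 + |a|) ^ 96) * ((th b * (1 + |b|) ^ 96) * (th c * (1 + |c|) ^ 96)) := by
        simp only [win]; rw [mul_pow, mul_pow]; simp only [a, b, c]; exact rearr6 _ _ _ _ _ _
    _ ≤ ((C + 1) * (1 + a ^ 2)⁻¹) * (((C + 1) * (1 + b ^ 2)⁻¹) * ((C + 1) * (1 + c ^ 2)⁻¹)) := by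
        apply mul_le_mul (h1 a) _ (mul_nonneg (hq b) (hq c)) (by positivity)
        exact mul_le_mul (h1 b) (h1 c) (hq c) (by positivity)
    _ = _ := by simp only [maj]; ring

lemma win_integrable {r : ℝ} (hr : 0 < r) (p : ℝ × ℝ × ℝ) : Integrable (win r p) := by
  obtain ⟨C, hC, h⟩ := win_maj
  refine ((maj_integrable hr p).const_mul C).mono' (win_continuous r p).aestronglyMeasurable
    (Filter.Eventually.of_forall fun ξ => ?_)
  rw [Real.norm_eq_abs, abs_of_nonneg (win_nonneg _ _ _)]
  refine le_trans ?_ (h r hr p ξ)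
  apply le_mul_of_one_le_right (win_nonneg _ _ _)
  apply one_le_pow₀
  have : 0 ≤ ‖ξ - p‖ / r := by positivity
  linarith

/-- dot product -/
def dt (ξ v : ℝ × ℝ × ℝ) : ℝ := ξ.1 * v.1 + ξ.2.1 * v.2.1 + ξ.2.2 * v.2.2

lemma th_fourier_scaled {r : ℝ} (hr : 0 < r) (a lam : ℝ) (h : 1 / r ≤ |lam|) :
    ∫ s, (th ((s - a) / r) : ℂ) * ee (s * lam) = 0 := by
  rw [← integral_add_right_eq_self _ a]
  simp only [add_sub_cancel_right]
  have h1 := Measure.integral_comp_div (fun s : ℝ => (th s : ℂ) * ee (lam * r * s)) r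
  rw [th_fourier (by rw [abs_mul, abs_of_pos hr]; rwa [div_le_iff₀ hr] at h), smul_zero] at h1
  have : ∀ s : ℝ, (th (s / r) : ℂ) * ee ((s + a) * lam) = ((th (s / r) : ℂ) * ee (lam * r * (s / r))) * ee (a * lam) := by
    intro s
    rw [show (s + a) * lam = lam * r * (s / r) + a * lam by field_simp, ee_add]; ring
  simp_rw [this]
  rw [integral_mul_const, h1, zero_mul]

lemma win_fourier {r : ℝ} (hr : 0 < r) (p v : ℝ × ℝ × ℝ) (h : 1 / r ≤ ‖v‖) :
    ∫ ξ, (win r p ξ : ℂ) * ee (dt ξ v) = 0 := by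
  have e : ∀ ξ : ℝ × ℝ × ℝ, (win r p ξ : ℂ) * ee (dt ξ v) = ((th ((ξ.1 - p.1) / r) : ℂ) * ee (ξ.1 * v.1)) *
      (((th ((ξ.2.1 - p.2.1) / r) : ℂ) * ee (ξ.2.1 * v.2.1)) * ((th ((ξ.2.2 - p.2.2) / r) : ℂ) * ee (ξ.2.2 * v.2.2))) := by
    intro ξ
    simp only [win, dt, ee_add]; push_cast; ring
  simp_rw [e]
  rw [Measure.volume_eq_prod, integral_prod_mul (fun s : ℝ => (th ((s - p.1) / r) : ℂ) * ee (s * v.1))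
    (fun z : ℝ × ℝ => ((th ((z.1 - p.2.1) / r) : ℂ) * ee (z.1 * v.2.1)) * ((th ((z.2 - p.2.2) / r) : ℂ) * ee (z.2 * v.2.2))),
    Measure.volume_eq_prod, integral_prod_mul (fun s : ℝ => (th ((s - p.2.1) / r) : ℂ) * ee (s * v.2.1))
    (fun s : ℝ => (th ((s - p.2.2) / r) : ℂ) * ee (s * v.2.2))]
  have hn : ‖v‖ = max |v.1| (max |v.2.1| |v.2.2|) := rfl
  rw [hn, le_max_iff, le_max_iff] at h
  rcases h with h | h | h
  · rw [th_fourier_scaled hr _ _ h]; simp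
  · rw [th_fourier_scaled hr _ _ h]; simp
  · rw [th_fourier_scaled hr _ _ h]; simp

end BAP

namespace BAP

/-! ### Orthogonality -/

/-- The graph map. -/
def Gm (ψ : ℝ → ℝ) (z : ℝ × ℝ) : ℝ × ℝ × ℝ := (z.1, z.2, ph ψ z)

lemma EE_eq (ψ : ℝ → ℝ) (f : ℝ × ℝ → ℂ) (ξ : ℝ × ℝ × ℝ) :
    EE ψ f ξ = ∫ z, f z * ee (dt ξ (Gm ψ z)) := rfl

lemma dt_neg (ξ v : ℝ × ℝ × ℝ) : dt ξ (-v) = - dt ξ v := by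
  simp only [dt, Prod.fst_neg, Prod.snd_neg]; ring

lemma dt_add (ξ v w : ℝ × ℝ × ℝ) : dt ξ (v + w) = dt ξ v + dt ξ w := by
  simp only [dt, Prod.fst_add, Prod.snd_add]; ring

lemma EE_conj (ψ : ℝ → ℝ) (f : ℝ × ℝ → ℂ) (ξ : ℝ × ℝ × ℝ) :
    (starRingEnd ℂ) (EE ψ f ξ) = ∫ z, (starRingEnd ℂ) (f z) * ee (dt ξ (-Gm ψ z)) := by
  rw [EE_eq, ← integral_conj]
  congr 1; ext z
  rw [map_mul, dt_neg, ee_neg]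

@[fun_prop]
lemma dt_continuous : Continuous (fun q : (ℝ × ℝ × ℝ) × (ℝ × ℝ × ℝ) => dt q.1 q.2) := by
  unfold dt; fun_prop

lemma Gm_continuous {ψ : ℝ → ℝ} (hψ : Continuous ψ) : Continuous (Gm ψ) := by
  unfold Gm ph; fun_prop

lemma AE_continuous {G : ℝ × ℝ → ℝ × ℝ × ℝ} (hG : Continuous G) {f : ℝ × ℝ → ℂ} (hf : Integrable f) :
    Continuous (fun ξ => ∫ z, f z * ee (dt ξ (G z))) := by
  apply continuous_of_dominated (bound := fun z => ‖f z‖)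
  · intro ξ
    apply hf.aestronglyMeasurable.mul
    apply Continuous.aestronglyMeasurable
    exact ee_continuous.comp (dt_continuous.comp (continuous_const.prodMk hG))
  · intro ξ
    exact Filter.Eventually.of_forall fun z => by rw [norm_mul, ee_norm, mul_one]
  · exact hf.norm
  · refine Filter.Eventually.of_forall fun z => ?_
    apply continuous_const.mul
    exact ee_continuous.comp (dt_continuous.comp (continuous_id.prodMk continuous_const))

lemma AE_bound (G : ℝ × ℝ → ℝ × ℝ × ℝ) (f : ℝ × ℝ → ℂ) (ξ : ℝ × ℝ × ℝ) :
    ‖∫ z, f z * ee (dt ξ (G z))‖ ≤ ∫ z, ‖f z‖ := by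
  refine (norm_integral_le_integral_norm _).trans (le_of_eq ?_)
  congr 1; ext z; rw [norm_mul, ee_norm, mul_one]

lemma EE_continuous {ψ : ℝ → ℝ} (hψ : Continuous ψ) {f : ℝ × ℝ → ℂ} (hf : Integrable f) :
    Continuous (EE ψ f) := AE_continuous (Gm_continuous hψ) hf

lemma EE_bound (ψ : ℝ → ℝ) (f : ℝ × ℝ → ℂ) (ξ : ℝ × ℝ × ℝ) : ‖EE ψ f ξ‖ ≤ ∫ z, ‖f z‖ :=
  AE_bound (Gm ψ) f ξ

lemma swap_vanish {G : ℝ × ℝ → ℝ × ℝ × ℝ} (hG : Continuous G) {f : ℝ × ℝ → ℂ} (hf : Integrable f)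
    {K : ℝ × ℝ × ℝ → ℂ} (hK : Integrable K)
    (h : ∀ z, f z ≠ 0 → ∫ ξ, K ξ * ee (dt ξ (G z)) = 0) :
    ∫ ξ, K ξ * ∫ z, f z * ee (dt ξ (G z)) = 0 := by
  have e1 : ∀ ξ, K ξ * ∫ z, f z * ee (dt ξ (G z)) = ∫ z, K ξ * (f z * ee (dt ξ (G z))) :=
    fun ξ => (integral_const_mul _ _).symm
  simp_rw [e1]
  rw [integral_integral_swap]
  · apply integral_eq_zero_of_ae
    refine Filter.Eventually.of_forall fun z => ?_
    simp only [Pi.zero_apply]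
    by_cases hz : f z = 0
    · simp [hz]
    · have : ∀ ξ, K ξ * (f z * ee (dt ξ (G z))) = f z * (K ξ * ee (dt ξ (G z))) := fun ξ => by ring
      simp_rw [this]
      rw [integral_const_mul, h z hz, mul_zero]
  · have h1 : Integrable (fun q : (ℝ × ℝ × ℝ) × (ℝ × ℝ) => K q.1 * f q.2) (volume.prod volume) := hK.mul_prod hf
    have h2 : Integrable (fun q : (ℝ × ℝ × ℝ) × (ℝ × ℝ) => (K q.1 * f q.2) * ee (dt q.1 (G q.2))) (volume.prod volume) := by
      apply h1.mul_bdd (c := 1)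
      · apply Continuous.aestronglyMeasurable
        exact ee_continuous.comp (dt_continuous.comp (continuous_fst.prodMk (hG.comp continuous_snd)))
      · exact Filter.Eventually.of_forall fun q => (ee_norm _).le
    refine h2.congr (Filter.Eventually.of_forall fun q => ?_)
    simp only [Function.uncurry]; ring

lemma integrable_mul_ee {K : ℝ × ℝ × ℝ → ℂ} (hK : Integrable K) (v : ℝ × ℝ × ℝ) :
    Integrable (fun ξ => K ξ * ee (dt ξ v)) := by
  apply hK.mul_bdd (c := 1)
  · apply Continuous.aestronglyMeasurable
    exact ee_continuous.comp (dt_continuous.comp (continuous_id.prodMk continuous_const))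
  · exact Filter.Eventually.of_forall fun q => (ee_norm _).le

lemma integrable_mul_AE {K : ℝ × ℝ × ℝ → ℂ} (hK : Integrable K) {G : ℝ × ℝ → ℝ × ℝ × ℝ} (hG : Continuous G)
    {f : ℝ × ℝ → ℂ} (hf : Integrable f) :
    Integrable (fun ξ => K ξ * ∫ z, f z * ee (dt ξ (G z))) := by
  apply hK.mul_bdd (c := ∫ z, ‖f z‖)
  · exact (AE_continuous hG hf).aestronglyMeasurable
  · exact Filter.Eventually.of_forall fun q => AE_bound _ _ _

/-- Two factor version, general. -/
lemma swap_vanish2 {G G' : ℝ × ℝ → ℝ × ℝ × ℝ} (hG : Continuous G) (hG' : Continuous G') {f f' : ℝ × ℝ → ℂ}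
    (hf : Integrable f) (hf' : Integrable f')
    {K : ℝ × ℝ × ℝ → ℂ} (hK : Integrable K)
    (h : ∀ z z', f z ≠ 0 → f' z' ≠ 0 → ∫ ξ, K ξ * ee (dt ξ (G z + G' z')) = 0) :
    ∫ ξ, K ξ * (∫ z, f z * ee (dt ξ (G z))) * (∫ z, f' z * ee (dt ξ (G' z))) = 0 := by
  apply swap_vanish hG' hf' (integrable_mul_AE hK hG hf)
  intro z' hz'
  have : ∀ ξ, K ξ * (∫ z, f z * ee (dt ξ (G z))) * ee (dt ξ (G' z')) = (K ξ * ee (dt ξ (G' z'))) * (∫ z, f z * ee (dt ξ (G z))) := fun ξ => by ring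
  simp_rw [this]
  apply swap_vanish hG hf (integrable_mul_ee hK _)
  intro z hz
  rw [← h z z' hz hz']
  congr 1; ext ξ; rw [dt_add, ee_add]; ring

lemma swap_vanish4 {G1 G2 G3 G4 : ℝ × ℝ → ℝ × ℝ × ℝ} (h1 : Continuous G1) (h2 : Continuous G2)
    (h3 : Continuous G3) (h4 : Continuous G4) {f1 f2 f3 f4 : ℝ × ℝ → ℂ}
    (i1 : Integrable f1) (i2 : Integrable f2) (i3 : Integrable f3) (i4 : Integrable f4)
    {K : ℝ × ℝ × ℝ → ℂ} (hK : Integrable K)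
    (h : ∀ z1 z2 z3 z4, f1 z1 ≠ 0 → f2 z2 ≠ 0 → f3 z3 ≠ 0 → f4 z4 ≠ 0 →
      ∫ ξ, K ξ * ee (dt ξ (G1 z1 + G2 z2 + G3 z3 + G4 z4)) = 0) :
    ∫ ξ, K ξ * (∫ z, f1 z * ee (dt ξ (G1 z))) * (∫ z, f2 z * ee (dt ξ (G2 z))) *
      (∫ z, f3 z * ee (dt ξ (G3 z))) * (∫ z, f4 z * ee (dt ξ (G4 z))) = 0 := by
  apply swap_vanish2 h3 h4 i3 i4 (integrable_mul_AE (integrable_mul_AE hK h1 i1) h2 i2)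
  intro z3 z4 hz3 hz4
  have : ∀ ξ, K ξ * (∫ z, f1 z * ee (dt ξ (G1 z))) * (∫ z, f2 z * ee (dt ξ (G2 z))) * ee (dt ξ (G3 z3 + G4 z4))
    = (K ξ * ee (dt ξ (G3 z3 + G4 z4))) * (∫ z, f1 z * ee (dt ξ (G1 z))) * (∫ z, f2 z * ee (dt ξ (G2 z))) := fun ξ => by ring
  simp_rw [this]
  apply swap_vanish2 h1 h2 i1 i2 (integrable_mul_ee hK _)
  intro z1 z2 hz1 hz2
  rw [← h z1 z2 z3 z4 hz1 hz2 hz3 hz4]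
  congr 1; ext ξ; rw [add_assoc, dt_add ξ (G1 z1 + G2 z2), ee_add]; ring

lemma pair_vanish {ψ : ℝ → ℝ} (hψ : Continuous ψ) {r : ℝ} (hr : 0 < r) (p : ℝ × ℝ × ℝ) {f f' : ℝ × ℝ → ℂ}
    (hf : Integrable f) (hf' : Integrable f')
    (h : ∀ z z', f z ≠ 0 → f' z' ≠ 0 → 1 / r ≤ ‖Gm ψ z - Gm ψ z'‖) :
    ∫ ξ, (win r p ξ : ℂ) * EE ψ f ξ * (starRingEnd ℂ) (EE ψ f' ξ) = 0 := by
  simp_rw [EE_conj, EE_eq]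
  apply swap_vanish2 (Gm_continuous hψ) (G' := fun z => -Gm ψ z) (Gm_continuous hψ).neg hf
    (f' := fun z => (starRingEnd ℂ) (f' z)) _ (win_integrable hr p).ofReal
  · intro z z' hz hz'
    rw [← sub_eq_add_neg]
    exact win_fourier hr p _ (h z z' hz (by simpa using hz'))
  · exact (LinearIsometryEquiv.integrable_comp_iff (Complex.conjLIE)).2 hf'

lemma integrable_conj' {f : ℝ × ℝ → ℂ} (hf : Integrable f) : Integrable (fun z => (starRingEnd ℂ) (f z)) :=
  (LinearIsometryEquiv.integrable_comp_iff (Complex.conjLIE)).2 hf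

lemma quad_vanish {ψ : ℝ → ℝ} (hψ : Continuous ψ) {r : ℝ} (hr : 0 < r) (p : ℝ × ℝ × ℝ) {f f' g g' : ℝ × ℝ → ℂ}
    (hf : Integrable f) (hf' : Integrable f') (hg : Integrable g) (hg' : Integrable g')
    (h : ∀ z z' w w', f z ≠ 0 → f' z' ≠ 0 → g w ≠ 0 → g' w' ≠ 0 → 1 / r ≤ ‖Gm ψ z + Gm ψ w - Gm ψ z' - Gm ψ w'‖) :
    ∫ ξ, (win r p ξ : ℂ) * EE ψ f ξ * (starRingEnd ℂ) (EE ψ f' ξ) * EE ψ g ξ * (starRingEnd ℂ) (EE ψ g' ξ) = 0 := by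
  simp_rw [EE_conj, EE_eq]
  apply swap_vanish4 (Gm_continuous hψ) (G2 := fun z => -Gm ψ z) (Gm_continuous hψ).neg (Gm_continuous hψ) (G4 := fun z => -Gm ψ z) (Gm_continuous hψ).neg hf
    (f2 := fun z => (starRingEnd ℂ) (f' z)) (integrable_conj' hf') hg (f4 := fun z => (starRingEnd ℂ) (g' z)) (integrable_conj' hg') (win_integrable hr p).ofReal
  intro z z' w w' hz hz' hw hw'
  rw [show Gm ψ z + -Gm ψ z' + Gm ψ w + -Gm ψ w' = Gm ψ z + Gm ψ w - Gm ψ z' - Gm ψ w' by abel]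
  exact win_fourier hr p _ (h z z' w w' hz (by simpa using hz') hw (by simpa using hw'))

section
end

/-! ### Supports of packets -/

lemma pk_supp {r : ℝ} (hr : 0 < r) {T : Idx} {z : ℝ × ℝ} (h : pk r T z ≠ 0) : ‖z - om r T‖ < 1 / r := by
  have h1 : |r * z.1 - T.1.1| < 1 := by
    by_contra hc; push Not at hc; exact h (by simp [pk, chi_eq_zero hc])
  have h2 : |r * z.2 - T.1.2| < 1 := by
    by_contra hc; push Not at hc; exact h (by simp [pk, chi_eq_zero hc])
  rw [Prod.norm_def]
  have key : ∀ (x : ℝ) (k : ℤ), |r * x - k| < 1 → |x - k / r| < 1 / r := by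
    intro x k hk
    rw [show x - k / r = (r * x - k) / r by field_simp, abs_div, abs_of_pos hr]
    gcongr
  exact max_lt (key _ _ h1) (key _ _ h2)

lemma pk_integrable {r : ℝ} (hr : 0 < r) (T : Idx) : Integrable (pk r T) := by
  apply (pk_continuous r T).integrable_of_hasCompactSupport
  apply HasCompactSupport.intro (isCompact_closedBall (om r T) (1 / r))
  intro z hz
  by_contra h
  exact hz (by rw [mem_closedBall_iff_norm]; exact (pk_supp hr h).le)

lemma ph_lip {ψ : ℝ → ℝ} {B : ℝ} (hB : 1 ≤ B) (hψ : Reg ψ B) {z w : ℝ × ℝ} (hz1 : |z.1| ≤ B) (hz2 : |z.2| ≤ B)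
    (hw1 : |w.1| ≤ B) (hw2 : |w.2| ≤ B) : |ph ψ z - ph ψ w| ≤ 3 * B * ‖z - w‖ := by
  have hlip : |ψ z.2 - ψ w.2| ≤ B * |z.2 - w.2| := by
    have := (convex_Icc (-B) B).norm_image_sub_le_of_norm_deriv_le (𝕜 := ℝ) (f := ψ) (C := B)
      (x := w.2) (y := z.2) (fun x _ => hψ.1.differentiable (by norm_num) x)
      (fun x hx => by
        have := hψ.2 1 (by norm_num) (by norm_num) x (abs_le.2 hx)
        rwa [iteratedDeriv_one] at this)
      (abs_le.1 hw2) (abs_le.1 hz2)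
    simpa [Real.norm_eq_abs] using this
  have h1 : |z.1 - w.1| ≤ ‖z - w‖ := norm_fst_le (z - w)
  have h2 : |z.2 - w.2| ≤ ‖z - w‖ := norm_snd_le (z - w)
  have e : ph ψ z - ph ψ w = (z.1 - w.1) * z.2 + w.1 * (z.2 - w.2) + (ψ z.2 - ψ w.2) := by
    simp only [ph]; ring
  rw [e]
  refine (abs_add_le _ _).trans ?_
  have h3 := abs_add_le ((z.1 - w.1) * z.2) (w.1 * (z.2 - w.2))
  rw [abs_mul, abs_mul] at h3
  have h4 : |z.1 - w.1| * |z.2| ≤ ‖z - w‖ * B := mul_le_mul h1 hz2 (abs_nonneg _) (norm_nonneg _)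
  have h5 : |w.1| * |z.2 - w.2| ≤ B * ‖z - w‖ := mul_le_mul hw1 h2 (abs_nonneg _) (by linarith)
  have h6 : B * |z.2 - w.2| ≤ B * ‖z - w‖ := by gcongr
  linarith

/-- Compatible quadruples. -/
def Cmp (ψ : ℝ → ℝ) (B r : ℝ) (T1 T1' T2 T2' : Idx) : Prop :=
  ‖om r T1 + om r T2 - om r T1' - om r T2'‖ ≤ 13 * B / r ∧
  |ph ψ (om r T1) + ph ψ (om r T2) - ph ψ (om r T1') - ph ψ (om r T2')| ≤ 13 * B / r

lemma pk_near {ψ : ℝ → ℝ} {B : ℝ} (hB : 1 ≤ B) (hψ : Reg ψ B) {r : ℝ} (hr : 1 ≤ r) {T : Idx} (hT : Good B r T)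
    {z : ℝ × ℝ} (h : pk r T z ≠ 0) : ‖z - om r T‖ ≤ 1 / r ∧ |ph ψ z - ph ψ (om r T)| ≤ 3 * B / r := by
  have h1 := (pk_supp (by linarith) h).le
  have hr1 : 1 / r ≤ 1 := by rw [div_le_one (by linarith)]; exact hr
  refine ⟨h1, ?_⟩
  have hz1 : |z.1 - (om r T).1| ≤ ‖z - om r T‖ := norm_fst_le (z - om r T)
  have hz2 : |z.2 - (om r T).2| ≤ ‖z - om r T‖ := norm_snd_le (z - om r T)
  have := ph_lip hB hψ (z := z) (w := om r T) (by
      have := abs_add_le (z.1 - (om r T).1) (om r T).1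
      rw [sub_add_cancel] at this; linarith [hT.1])
    (by
      have := abs_add_le (z.2 - (om r T).2) (om r T).2
      rw [sub_add_cancel] at this; linarith [hT.2])
    (by linarith [hT.1]) (by linarith [hT.2])
  refine this.trans ?_
  calc 3 * B * ‖z - om r T‖ ≤ 3 * B * (1 / r) := by gcongr
    _ = _ := by ring

lemma quad_zero {ψ : ℝ → ℝ} {B : ℝ} (hB : 1 ≤ B) (hψ : Reg ψ B) {r : ℝ} (hr : 1 ≤ r) (p : ℝ × ℝ × ℝ)
    {T1 T1' T2 T2' : Idx} (g1 : Good B r T1) (g1' : Good B r T1') (g2 : Good B r T2) (g2' : Good B r T2')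
    (h : ¬ Cmp ψ B r T1 T1' T2 T2') :
    ∫ ξ, (win r p ξ : ℂ) * EE ψ (pk r T1) ξ * (starRingEnd ℂ) (EE ψ (pk r T1') ξ) *
      EE ψ (pk r T2) ξ * (starRingEnd ℂ) (EE ψ (pk r T2') ξ) = 0 := by
  have hr0 : 0 < r := by linarith
  apply quad_vanish hψ.1.continuous hr0 p (pk_integrable hr0 _) (pk_integrable hr0 _) (pk_integrable hr0 _) (pk_integrable hr0 _)
  intro z z' w w' hz hz' hw hw'
  by_contra hcon
  push Not at hcon
  apply h
  obtain ⟨a1, b1⟩ := pk_near hB hψ hr g1 hz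
  obtain ⟨a1', b1'⟩ := pk_near hB hψ hr g1' hz'
  obtain ⟨a2, b2⟩ := pk_near hB hψ hr g2 hw
  obtain ⟨a2', b2'⟩ := pk_near hB hψ hr g2' hw'
  have hBr : 1 / r ≤ B / r := by gcongr
  set v := Gm ψ z + Gm ψ w - Gm ψ z' - Gm ψ w' with hv
  have hv3 : |ph ψ z + ph ψ w - ph ψ z' - ph ψ w'| ≤ ‖v‖ := (norm_snd_le v.2).trans (norm_snd_le v)
  have hv12 : ‖z + w - z' - w'‖ ≤ ‖v‖ := by
    rw [Prod.norm_def]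
    exact max_le (norm_fst_le v) ((norm_fst_le v.2).trans (norm_snd_le v))
  constructor
  · have e : om r T1 + om r T2 - om r T1' - om r T2' = (z + w - z' - w') - (z - om r T1) - (w - om r T2) + (z' - om r T1') + (w' - om r T2') := by abel
    rw [e]
    have := norm_add_le ((z + w - z' - w') - (z - om r T1) - (w - om r T2) + (z' - om r T1')) (w' - om r T2')
    have := norm_add_le ((z + w - z' - w') - (z - om r T1) - (w - om r T2)) (z' - om r T1')
    have := norm_sub_le ((z + w - z' - w') - (z - om r T1)) (w - om r T2)
    have := norm_sub_le (z + w - z' - w') (z - om r T1)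
    have h13 : 13 * B / r = 13 * (B / r) := by ring
    rw [h13]
    have h0 : 0 < 1 / r := by positivity
    linarith
  · have h13 : 13 * B / r = 13 * (B / r) := by ring
    have h3 : 3 * B / r = 3 * (B / r) := by ring
    rw [h3] at b1 b1' b2 b2'
    rw [h13]
    rw [abs_le] at *
    constructor <;> linarith [b1.1, b1.2, b1'.1, b1'.2, b2.1, b2.2, b2'.1, b2'.2, hv3.1, hv3.2]

lemma pair_zero {ψ : ℝ → ℝ} {B : ℝ} (hψ : Reg ψ B) {r : ℝ} (hr : 1 ≤ r) (p : ℝ × ℝ × ℝ)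
    {T T' : Idx} (h : ¬ ‖om r T - om r T'‖ ≤ 3 / r) :
    ∫ ξ, (win r p ξ : ℂ) * EE ψ (pk r T) ξ * (starRingEnd ℂ) (EE ψ (pk r T') ξ) = 0 := by
  have hr0 : 0 < r := by linarith
  apply pair_vanish hψ.1.continuous hr0 p (pk_integrable hr0 _) (pk_integrable hr0 _)
  intro z z' hz hz'
  by_contra hcon
  push Not at hcon
  apply h
  have a1 := (pk_supp hr0 hz).le
  have a1' := (pk_supp hr0 hz').le
  set v := Gm ψ z - Gm ψ z' with hv
  have hv12 : ‖z - z'‖ ≤ ‖v‖ := by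
    rw [Prod.norm_def]
    exact max_le (norm_fst_le v) ((norm_fst_le v.2).trans (norm_snd_le v))
  have e : om r T - om r T' = (z - z') - (z - om r T) + (z' - om r T') := by abel
  rw [e]
  have := norm_add_le ((z - z') - (z - om r T)) (z' - om r T')
  have := norm_sub_le (z - z') (z - om r T)
  have h13 : 3 / r = 3 * (1 / r) := by ring
  rw [h13]
  linarith

/-! ### Size of the window integrals -/

lemma pk_win_bound (B : ℝ) (hB : 1 ≤ B) : ∃ K : ℝ, 1 ≤ K ∧ ∀ ψ, Reg ψ B → ∀ r : ℝ, 1 ≤ r →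
    ∀ T : Idx, Good B r T → ∀ p ξ : ℝ × ℝ × ℝ, |p.2.2| ≤ 4 * r ^ 2 →
    ‖EE ψ (pk r T) ξ‖ ≤ K * r⁻¹ * (1 + ‖ξ - p‖ / r) ^ 24 * wt ψ r T p := by
  obtain ⟨K, hK, hd⟩ := pk_decay B hB
  refine ⟨K * 5 ^ 16 * (1 + 2 * B) ^ 8, ?_, ?_⟩
  · have : (1:ℝ) ≤ (1 + 2 * B) ^ 8 := one_le_pow₀ (by linarith)
    have h2 : (1:ℝ) ≤ K * 5 ^ 16 := by nlinarith
    exact one_le_mul_of_one_le_of_one_le h2 this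
  intro ψ hψ r hr T hT p ξ hp
  have hr0 : 0 < r := by linarith
  refine (hd ψ hψ r hr T hT.2 ξ).trans ?_
  have h1 := wt_shift hB hψ hr0 hT ξ p
  have h2 : 1 + |ξ.2.2| / r ^ 2 ≤ 5 * (1 + ‖ξ - p‖ / r) := by
    have h3 : |ξ.2.2 - p.2.2| ≤ ‖ξ - p‖ := (norm_snd_le (ξ - p).2).trans (norm_snd_le (ξ - p))
    have h4 : |ξ.2.2| ≤ 4 * r ^ 2 + ‖ξ - p‖ := by
      have := abs_add_le (ξ.2.2 - p.2.2) p.2.2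
      rw [sub_add_cancel] at this; linarith
    have h5 : |ξ.2.2| / r ^ 2 ≤ 4 + ‖ξ - p‖ / r := by
      rw [div_le_iff₀ (by positivity)]
      have : (4 + ‖ξ - p‖ / r) * r ^ 2 = 4 * r ^ 2 + ‖ξ - p‖ * r := by field_simp
      rw [this]
      nlinarith [norm_nonneg (ξ - p)]
    have : 0 ≤ ‖ξ - p‖ / r := by positivity
    linarith
  calc K * r⁻¹ * (1 + |ξ.2.2| / r ^ 2) ^ 16 * wt ψ r T ξ ≤ K * r⁻¹ * (5 * (1 + ‖ξ - p‖ / r)) ^ 16 *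
      ((1 + 2 * B) ^ 8 * (1 + ‖ξ - p‖ / r) ^ 8 * wt ψ r T p) := by
        gcongr
        exact (wt_pos _ _ _ _).le
    _ = _ := by
        rw [mul_pow, show (24 : ℕ) = 16 + 8 from rfl, pow_add]; ring

lemma quad_bound (B : ℝ) (hB : 1 ≤ B) : ∃ K : ℝ, 1 ≤ K ∧ ∀ ψ, Reg ψ B → ∀ r : ℝ, 1 ≤ r →
    ∀ T1 T1' T2 T2' : Idx, Good B r T1 → Good B r T1' → Good B r T2 → Good B r T2' →
    ∀ p : ℝ × ℝ × ℝ, |p.2.2| ≤ 4 * r ^ 2 →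
    ‖∫ ξ, (win r p ξ : ℂ) * EE ψ (pk r T1) ξ * (starRingEnd ℂ) (EE ψ (pk r T1') ξ) *
      EE ψ (pk r T2) ξ * (starRingEnd ℂ) (EE ψ (pk r T2') ξ)‖ ≤
      K * r⁻¹ * (wt ψ r T1 p * wt ψ r T1' p * (wt ψ r T2 p * wt ψ r T2' p)) := by
  obtain ⟨K, hK, hb⟩ := pk_win_bound B hB
  obtain ⟨C, hC, hm⟩ := win_maj
  refine ⟨K ^ 4 * C * Real.pi ^ 3, ?_, ?_⟩
  · have h1 : (1:ℝ) ≤ K ^ 4 := one_le_pow₀ hK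
    have h2 : (1:ℝ) ≤ Real.pi ^ 3 := one_le_pow₀ (by linarith [Real.pi_gt_three])
    exact one_le_mul_of_one_le_of_one_le (one_le_mul_of_one_le_of_one_le h1 hC) h2
  intro ψ hψ r hr T1 T1' T2 T2' g1 g1' g2 g2' p hp
  have hr0 : 0 < r := by linarith
  set W := wt ψ r T1 p * wt ψ r T1' p * (wt ψ r T2 p * wt ψ r T2' p) with hW
  have hW0 : 0 ≤ W := by
    have := (wt_pos ψ r T1 p).le; have := (wt_pos ψ r T1' p).le
    have := (wt_pos ψ r T2 p).le; have := (wt_pos ψ r T2' p).le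
    positivity
  refine (norm_integral_le_of_norm_le (((maj_integrable hr0 p).const_mul (K ^ 4 * r⁻¹ ^ 4 * W * C)))
    (Filter.Eventually.of_forall fun ξ => ?_)).trans ?_
  · rw [norm_mul, norm_mul, norm_mul, norm_mul, RCLike.norm_conj, RCLike.norm_conj, Complex.norm_real, Real.norm_eq_abs, abs_of_nonneg (win_nonneg _ _ _)]
    have hx1 := hb ψ hψ r hr T1 g1 p ξ hp
    have hx1' := hb ψ hψ r hr T1' g1' p ξ hp
    have hx2 := hb ψ hψ r hr T2 g2 p ξ hp
    have hx2' := hb ψ hψ r hr T2' g2' p ξ hp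
    have hq := hm r hr0 p ξ
    set Q := (1 + ‖ξ - p‖ / r) with hQ
    have hQ0 : 0 ≤ Q := by positivity
    have hwn := win_nonneg r p ξ
    have := (wt_pos ψ r T1 p).le; have := (wt_pos ψ r T1' p).le
    have := (wt_pos ψ r T2 p).le; have := (wt_pos ψ r T2' p).le
    calc _ ≤ win r p ξ * (K * r⁻¹ * Q ^ 24 * wt ψ r T1 p) * (K * r⁻¹ * Q ^ 24 * wt ψ r T1' p) *
          (K * r⁻¹ * Q ^ 24 * wt ψ r T2 p) * (K * r⁻¹ * Q ^ 24 * wt ψ r T2' p) := by gcongr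
      _ = K ^ 4 * r⁻¹ ^ 4 * W * (win r p ξ * (Q ^ 24) ^ 4) := by rw [hW]; generalize Q ^ 24 = Q'; ring
      _ = K ^ 4 * r⁻¹ ^ 4 * W * (win r p ξ * Q ^ 96) := by rw [← pow_mul]
      _ ≤ K ^ 4 * r⁻¹ ^ 4 * W * (C * maj r p ξ) := by gcongr
      _ = _ := by ring
  · rw [integral_const_mul, maj_integral hr0]
    apply le_of_eq
    field_simp

lemma pair_bound (B : ℝ) (hB : 1 ≤ B) : ∃ K : ℝ, 1 ≤ K ∧ ∀ ψ, Reg ψ B → ∀ r : ℝ, 1 ≤ r →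
    ∀ T T' : Idx, Good B r T → Good B r T' →
    ∀ p : ℝ × ℝ × ℝ, |p.2.2| ≤ 4 * r ^ 2 →
    ‖∫ ξ, (win r p ξ : ℂ) * EE ψ (pk r T) ξ * (starRingEnd ℂ) (EE ψ (pk r T') ξ)‖ ≤
      K * r * (wt ψ r T p * wt ψ r T' p) := by
  obtain ⟨K, hK, hb⟩ := pk_win_bound B hB
  obtain ⟨C, hC, hm⟩ := win_maj
  refine ⟨K ^ 2 * C * Real.pi ^ 3, ?_, ?_⟩
  · have h1 : (1:ℝ) ≤ K ^ 2 := one_le_pow₀ hK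
    have h2 : (1:ℝ) ≤ Real.pi ^ 3 := one_le_pow₀ (by linarith [Real.pi_gt_three])
    exact one_le_mul_of_one_le_of_one_le (one_le_mul_of_one_le_of_one_le h1 hC) h2
  intro ψ hψ r hr T T' g1 g1' p hp
  have hr0 : 0 < r := by linarith
  set W := wt ψ r T p * wt ψ r T' p with hW
  have hW0 : 0 ≤ W := by
    have := (wt_pos ψ r T p).le; have := (wt_pos ψ r T' p).le
    positivity
  refine (norm_integral_le_of_norm_le (((maj_integrable hr0 p).const_mul (K ^ 2 * r⁻¹ ^ 2 * W * C)))
    (Filter.Eventually.of_forall fun ξ => ?_)).trans ?_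
  · rw [norm_mul, norm_mul, RCLike.norm_conj, Complex.norm_real, Real.norm_eq_abs, abs_of_nonneg (win_nonneg _ _ _)]
    have hx1 := hb ψ hψ r hr T g1 p ξ hp
    have hx1' := hb ψ hψ r hr T' g1' p ξ hp
    have hq := hm r hr0 p ξ
    set Q := (1 + ‖ξ - p‖ / r) with hQ
    have hQ1 : 1 ≤ Q := by
      have : 0 ≤ ‖ξ - p‖ / r := by positivity
      rw [hQ]; linarith
    have hwn := win_nonneg r p ξ
    have := (wt_pos ψ r T p).le; have := (wt_pos ψ r T' p).le
    calc _ ≤ win r p ξ * (K * r⁻¹ * Q ^ 24 * wt ψ r T p) * (K * r⁻¹ * Q ^ 24 * wt ψ r T' p) := by gcongr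
      _ = K ^ 2 * r⁻¹ ^ 2 * W * (win r p ξ * (Q ^ 24) ^ 2) := by rw [hW]; generalize Q ^ 24 = Q'; ring
      _ = K ^ 2 * r⁻¹ ^ 2 * W * (win r p ξ * Q ^ 48) := by rw [← pow_mul]
      _ ≤ K ^ 2 * r⁻¹ ^ 2 * W * (win r p ξ * Q ^ 96) := by
        gcongr
        norm_num
      _ ≤ K ^ 2 * r⁻¹ ^ 2 * W * (C * maj r p ξ) := by gcongr
      _ = _ := by ring
  · rw [integral_const_mul, maj_integral hr0]
    apply le_of_eq
    field_simp

end BAP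

namespace BAP

/-! ### Expanded windowed integrals -/

/-- extension of a finite packet sum -/
def sy (ψ : ℝ → ℝ) (r : ℝ) (F : Finset Idx) (b : Idx → ℂ) (ξ : ℝ × ℝ × ℝ) : ℂ :=
  ∑ T ∈ F, b T * EE ψ (pk r T) ξ

lemma sy_continuous {ψ : ℝ → ℝ} (hψ : Continuous ψ) {r : ℝ} (hr : 0 < r) (F : Finset Idx) (b : Idx → ℂ) :
    Continuous (sy ψ r F b) := by
  unfold sy
  have := fun T => EE_continuous hψ (pk_integrable hr T)
  fun_prop

lemma sy_eq {ψ : ℝ → ℝ} (hψ : Continuous ψ) {r : ℝ} (hr : 0 < r) (F : Finset Idx) (b : Idx → ℂ) (ξ : ℝ × ℝ × ℝ) :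
    sy ψ r F b ξ = EE ψ (fun z => ∑ T ∈ F, b T * pk r T z) ξ := by
  unfold sy EE
  simp_rw [Finset.sum_mul]
  rw [integral_finsetSum]
  · simp_rw [mul_assoc, integral_const_mul]
  · intro T _
    simp_rw [mul_assoc]
    apply Integrable.const_mul
    refine (pk_integrable hr T).mul_bdd (c := 1) ?_ ?_
    · apply Continuous.aestronglyMeasurable
      unfold ph
      fun_prop
    · exact Filter.Eventually.of_forall fun z => (ee_norm _).le

lemma win_int4 {r : ℝ} (hr : 0 < r) (p : ℝ × ℝ × ℝ) {a b c d : ℝ × ℝ × ℝ → ℂ} {Ka Kb Kc Kd : ℝ}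
    (ha : Continuous a) (hb : Continuous b) (hc : Continuous c) (hd : Continuous d)
    (ka : ∀ ξ, ‖a ξ‖ ≤ Ka) (kb : ∀ ξ, ‖b ξ‖ ≤ Kb) (kc : ∀ ξ, ‖c ξ‖ ≤ Kc) (kd : ∀ ξ, ‖d ξ‖ ≤ Kd) :
    Integrable (fun ξ => (win r p ξ : ℂ) * a ξ * (starRingEnd ℂ) (b ξ) * c ξ * (starRingEnd ℂ) (d ξ)) := by
  have hcj : Continuous (fun z : ℂ => (starRingEnd ℂ) z) := Complex.continuous_conj
  refine Integrable.mul_bdd (c := Kd) (Integrable.mul_bdd (c := Kc) (Integrable.mul_bdd (c := Kb) (Integrable.mul_bdd (c := Ka) (win_integrable hr p).ofReal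
    ha.aestronglyMeasurable (Filter.Eventually.of_forall ka)) (hcj.comp hb).aestronglyMeasurable (Filter.Eventually.of_forall fun ξ => ?_))
      hc.aestronglyMeasurable (Filter.Eventually.of_forall kc)) (hcj.comp hd).aestronglyMeasurable (Filter.Eventually.of_forall fun ξ => ?_)
  · rw [RCLike.norm_conj]; exact kb ξ
  · rw [RCLike.norm_conj]; exact kd ξ

open Classical in
lemma win_quad_sum (B : ℝ) (hB : 1 ≤ B) : ∃ K : ℝ, 1 ≤ K ∧ ∀ ψ, Reg ψ B → ∀ r : ℝ, 1 ≤ r →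
    ∀ (F G : Finset Idx), (∀ T ∈ F, Good B r T) → (∀ T ∈ G, Good B r T) → ∀ b d : Idx → ℂ,
    ∀ p : ℝ × ℝ × ℝ, |p.2.2| ≤ 4 * r ^ 2 →
    ∫ ξ, win r p ξ * (‖sy ψ r F b ξ‖ ^ 2 * ‖sy ψ r G d ξ‖ ^ 2) ≤
      K * r⁻¹ * ∑ q ∈ (F ×ˢ F) ×ˢ (G ×ˢ G), if Cmp ψ B r q.1.1 q.1.2 q.2.1 q.2.2 then
        ‖b q.1.1‖ * ‖b q.1.2‖ * (‖d q.2.1‖ * ‖d q.2.2‖) *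
        (wt ψ r q.1.1 p * wt ψ r q.1.2 p * (wt ψ r q.2.1 p * wt ψ r q.2.2 p)) else 0 := by
  obtain ⟨K, hK, hq⟩ := quad_bound B hB
  refine ⟨K, hK, ?_⟩
  intro ψ hψ r hr F G hF hG b d p hp
  have hr0 : 0 < r := by linarith
  have e1 : ((∫ ξ, win r p ξ * (‖sy ψ r F b ξ‖ ^ 2 * ‖sy ψ r G d ξ‖ ^ 2) : ℝ) : ℂ) =
      ∑ q ∈ (F ×ˢ F) ×ˢ (G ×ˢ G), (b q.1.1 * (starRingEnd ℂ) (b q.1.2) * (d q.2.1 * (starRingEnd ℂ) (d q.2.2))) *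
        ∫ ξ, (win r p ξ : ℂ) * EE ψ (pk r q.1.1) ξ * (starRingEnd ℂ) (EE ψ (pk r q.1.2) ξ) *
      EE ψ (pk r q.2.1) ξ * (starRingEnd ℂ) (EE ψ (pk r q.2.2) ξ) := by
    rw [← integral_complex_ofReal]
    simp_rw [← integral_const_mul]
    rw [← integral_finsetSum]
    · congr 1; ext ξ
      simp only [Complex.ofReal_mul, Complex.ofReal_pow]
      have hn : ∀ z : ℂ, ((‖z‖ : ℝ) : ℂ) ^ 2 = z * (starRingEnd ℂ) z := fun z => (Complex.mul_conj' z).symm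
      rw [hn, hn]
      unfold sy
      rw [map_sum, map_sum, Finset.sum_mul_sum, Finset.sum_mul_sum, ← Finset.sum_product', ← Finset.sum_product',
        Finset.sum_mul_sum, ← Finset.sum_product', Finset.mul_sum]
      apply Finset.sum_congr rfl
      intro q _
      simp only [map_mul]
      ring
    · intro q _
      apply Integrable.const_mul
      have hc := fun T => EE_continuous hψ.1.continuous (pk_integrable hr0 T)
      exact win_int4 hr0 p (hc _) (hc _) (hc _) (hc _) (EE_bound ψ _) (EE_bound ψ _) (EE_bound ψ _) (EE_bound ψ _)
  have e2 : ∫ ξ, win r p ξ * (‖sy ψ r F b ξ‖ ^ 2 * ‖sy ψ r G d ξ‖ ^ 2) ≤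
     ‖((∫ ξ, win r p ξ * (‖sy ψ r F b ξ‖ ^ 2 * ‖sy ψ r G d ξ‖ ^ 2) : ℝ) : ℂ)‖ := by
    rw [Complex.norm_real]; exact le_abs_self _
  refine e2.trans ?_
  rw [e1, Finset.mul_sum]
  refine norm_sum_le_of_le _ fun q hqm => ?_
  simp only [Finset.mem_product] at hqm
  obtain ⟨⟨m1, m2⟩, m3, m4⟩ := hqm
  split_ifs with hc
  · rw [norm_mul, norm_mul, norm_mul, norm_mul, RCLike.norm_conj, RCLike.norm_conj]
    have := hq ψ hψ r hr q.1.1 q.1.2 q.2.1 q.2.2 (hF _ m1) (hF _ m2) (hG _ m3) (hG _ m4) p hp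
    calc _ ≤ ‖b q.1.1‖ * ‖b q.1.2‖ * (‖d q.2.1‖ * ‖d q.2.2‖) * _ := mul_le_mul_of_nonneg_left this (by positivity)
      _ = _ := by ring
  · rw [quad_zero hB hψ hr p (hF _ m1) (hF _ m2) (hG _ m3) (hG _ m4) hc]
    simp

open Classical in
lemma win_pair_sum (B : ℝ) (hB : 1 ≤ B) : ∃ K : ℝ, 1 ≤ K ∧ ∀ ψ, Reg ψ B → ∀ r : ℝ, 1 ≤ r →
    ∀ (F : Finset Idx), (∀ T ∈ F, Good B r T) → ∀ b : Idx → ℂ,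
    ∀ p : ℝ × ℝ × ℝ, |p.2.2| ≤ 4 * r ^ 2 →
    ∫ ξ, win r p ξ * ‖sy ψ r F b ξ‖ ^ 2 ≤
      K * r * ∑ q ∈ F ×ˢ F, if ‖om r q.1 - om r q.2‖ ≤ 3 / r then
        ‖b q.1‖ * ‖b q.2‖ * (wt ψ r q.1 p * wt ψ r q.2 p) else 0 := by
  obtain ⟨K, hK, hq⟩ := pair_bound B hB
  refine ⟨K, hK, ?_⟩
  intro ψ hψ r hr F hF b p hp
  have hr0 : 0 < r := by linarith
  have e1 : ((∫ ξ, win r p ξ * ‖sy ψ r F b ξ‖ ^ 2 : ℝ) : ℂ) =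
      ∑ q ∈ F ×ˢ F, (b q.1 * (starRingEnd ℂ) (b q.2)) *
        ∫ ξ, (win r p ξ : ℂ) * EE ψ (pk r q.1) ξ * (starRingEnd ℂ) (EE ψ (pk r q.2) ξ) := by
    rw [← integral_complex_ofReal]
    simp_rw [← integral_const_mul]
    rw [← integral_finsetSum]
    · congr 1; ext ξ
      simp only [Complex.ofReal_mul, Complex.ofReal_pow]
      have hn' : ∀ z : ℂ, ((‖z‖ : ℝ) : ℂ) ^ 2 = z * (starRingEnd ℂ) z := fun z => (Complex.mul_conj' z).symm
      rw [hn']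
      unfold sy
      rw [map_sum, Finset.sum_mul_sum, ← Finset.sum_product', Finset.mul_sum]
      apply Finset.sum_congr rfl
      intro q _
      simp only [map_mul]
      ring
    · intro q _
      apply Integrable.const_mul
      have hc := fun T => EE_continuous hψ.1.continuous (pk_integrable hr0 T)
      have := win_int4 hr0 p (hc q.1) (hc q.2) (c := fun _ => 1) (d := fun _ => 1) continuous_const continuous_const
        (EE_bound ψ _) (EE_bound ψ _) (fun _ => le_rfl) (fun _ => le_rfl)
      simpa using this
  have e2 : ∫ ξ, win r p ξ * ‖sy ψ r F b ξ‖ ^ 2 ≤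
     ‖((∫ ξ, win r p ξ * ‖sy ψ r F b ξ‖ ^ 2 : ℝ) : ℂ)‖ := by
    rw [Complex.norm_real]; exact le_abs_self _
  refine e2.trans ?_
  rw [e1, Finset.mul_sum]
  refine norm_sum_le_of_le _ fun q hqm => ?_
  simp only [Finset.mem_product] at hqm
  obtain ⟨m1, m2⟩ := hqm
  split_ifs with hc
  · rw [norm_mul, norm_mul, RCLike.norm_conj]
    have := hq ψ hψ r hr q.1 q.2 (hF _ m1) (hF _ m2) p hp
    calc _ ≤ ‖b q.1‖ * ‖b q.2‖ * _ := mul_le_mul_of_nonneg_left this (by positivity)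
      _ = _ := by ring
  · rw [pair_zero hψ hr p hc]
    simp

end BAP

namespace BAP

/-! ### Counting lemmas -/

lemma cnt1 (S : Finset ℤ) (x A : ℝ) (hA : 0 ≤ A) (h : ∀ k ∈ S, |(k : ℝ) - x| ≤ A) : (S.card : ℝ) ≤ 2 * A + 1 := by
  rcases S.eq_empty_or_nonempty with rfl | ⟨k0, hk0⟩
  · simp; linarith
  have hs : S ⊆ Finset.Icc ⌈x - A⌉ ⌊x + A⌋ := by
    intro k hk
    have := abs_le.1 (h k hk)
    rw [Finset.mem_Icc, Int.ceil_le, Int.le_floor]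
    constructor <;> linarith
  have h1 := Finset.mem_Icc.1 (hs hk0)
  have h2 := Finset.card_le_card hs
  rw [Int.card_Icc] at h2
  have h3 : (S.card : ℤ) ≤ ⌊x + A⌋ + 1 - ⌈x - A⌉ := by omega
  have h4 : (S.card : ℝ) ≤ (⌊x + A⌋ : ℝ) + 1 - ⌈x - A⌉ := by exact_mod_cast h3
  linarith [Int.floor_le (x + A), Int.le_ceil (x - A)]

lemma card_prod_le {α β : Type*} [DecidableEq α] [DecidableEq β] (S : Finset (α × β)) :
    (S.card : ℝ) ≤ (S.image Prod.fst).card * (S.image Prod.snd).card := by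
  have : S ⊆ (S.image Prod.fst) ×ˢ (S.image Prod.snd) := by
    intro x hx
    rw [Finset.mem_product]
    exact ⟨Finset.mem_image_of_mem _ hx, Finset.mem_image_of_mem _ hx⟩
  have := Finset.card_le_card this
  rw [Finset.card_product] at this
  exact_mod_cast this

/-- base grid point -/
def kp (r : ℝ) (k : ℤ × ℤ) : ℝ × ℝ := (k.1 / r, k.2 / r)

lemma om_eq (r : ℝ) (T : Idx) : om r T = kp r T.1 := rfl

/-- space grid point -/
def gp (r : ℝ) (n : ℤ × ℤ × ℤ) : ℝ × ℝ × ℝ := (r * n.1, r * n.2.1, r * n.2.2)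

lemma scal_div {r : ℝ} (hr : 0 < r) {k x A : ℝ} (h : |k / r - x| ≤ A / r) : |k - r * x| ≤ A := by
  rw [show k / r - x = (k - r * x) / r by field_simp, abs_div, abs_of_pos hr, div_le_div_iff_of_pos_right hr] at h
  exact h

lemma scal_mul {r : ℝ} (hr : 0 < r) {k x A : ℝ} (h : |r * k - x| ≤ A * r) : |k - x / r| ≤ A := by
  rw [show r * k - x = (k - x / r) * r by field_simp, abs_mul, abs_of_pos hr] at h
  exact le_of_mul_le_mul_right h hr

lemma cnt2 {r : ℝ} (hr : 0 < r) (S : Finset (ℤ × ℤ)) (w : ℝ × ℝ) {A : ℝ} (hA : 0 ≤ A)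
    (h : ∀ k ∈ S, ‖kp r k - w‖ ≤ A / r) : (S.card : ℝ) ≤ (2 * A + 1) ^ 2 := by
  classical
  refine (card_prod_le S).trans ?_
  have h1 := cnt1 (S.image Prod.fst) (r * w.1) A hA (by
    intro k hk
    obtain ⟨x, hx, rfl⟩ := Finset.mem_image.1 hk
    exact scal_div hr ((norm_fst_le _).trans (h x hx)))
  have h2 := cnt1 (S.image Prod.snd) (r * w.2) A hA (by
    intro k hk
    obtain ⟨x, hx, rfl⟩ := Finset.mem_image.1 hk
    exact scal_div hr ((norm_snd_le _).trans (h x hx)))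
  rw [sq]
  gcongr

lemma cnt3 {r : ℝ} (hr : 0 < r) (S : Finset (ℤ × ℤ × ℤ)) (w : ℝ × ℝ × ℝ) {A : ℝ} (hA : 0 ≤ A)
    (h : ∀ k ∈ S, ‖gp r k - w‖ ≤ A * r) : (S.card : ℝ) ≤ (2 * A + 1) ^ 3 := by
  classical
  refine (card_prod_le S).trans ?_
  have h1 := cnt1 (S.image Prod.fst) (w.1 / r) A hA (by
    intro k hk
    obtain ⟨x, hx, rfl⟩ := Finset.mem_image.1 hk
    exact scal_mul hr ((norm_fst_le _).trans (h x hx)))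
  have h2 := cnt1 ((S.image Prod.snd).image Prod.fst) (w.2.1 / r) A hA (by
    intro k hk
    obtain ⟨x, hx, rfl⟩ := Finset.mem_image.1 hk
    obtain ⟨x', hx', rfl⟩ := Finset.mem_image.1 hx
    exact scal_mul hr ((norm_fst_le _).trans ((norm_snd_le _).trans (h x' hx'))))
  have h3 := cnt1 ((S.image Prod.snd).image Prod.snd) (w.2.2 / r) A hA (by
    intro k hk
    obtain ⟨x, hx, rfl⟩ := Finset.mem_image.1 hk
    obtain ⟨x', hx', rfl⟩ := Finset.mem_image.1 hx
    exact scal_mul hr ((norm_snd_le _).trans ((norm_snd_le _).trans (h x' hx'))))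
  have h4 := card_prod_le (S.image Prod.snd)
  calc ((S.image Prod.fst).card : ℝ) * (S.image Prod.snd).card ≤ (2 * A + 1) * ((2 * A + 1) * (2 * A + 1)) := by
        refine mul_le_mul h1 (h4.trans (by gcongr)) (by positivity) (by positivity)
    _ = _ := by ring

lemma sv_form {r : ℝ} (hr : 0 < r) (ψ : ℝ → ℝ) (k m : ℤ × ℤ) (ξ : ℝ × ℝ × ℝ) :
    sv ψ r (k, m) ξ = ((pr ψ (kp r k) ξ).1 / r - Real.pi * m.1, (pr ψ (kp r k) ξ).2 / r - Real.pi * m.2) := by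
  unfold sv pr
  simp only [om_eq]
  ext <;> · simp only; field_simp

/-- sum over frequencies of the weights of packets based at `k` -/
lemma sumv : ∃ K : ℝ, 1 ≤ K ∧ ∀ (ψ : ℝ → ℝ) (r : ℝ), 0 < r → ∀ (S : Finset (ℤ × ℤ)) (k : ℤ × ℤ) (ξ : ℝ × ℝ × ℝ),
    ∑ m ∈ S, wt ψ r (k, m) ξ ≤ K := by
  obtain ⟨K, hK, hl⟩ := lat2
  refine ⟨K, hK, ?_⟩
  intro ψ r hr S k ξ
  refine le_trans (Finset.sum_le_sum fun m _ => ?_) (hl S ((pr ψ (kp r k) ξ).1 / r) ((pr ψ (kp r k) ξ).2 / r) Real.pi (by linarith [Real.pi_gt_three]))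
  unfold wt
  rw [sv_form hr]
  gcongr
  · linarith [norm_nonneg ((((pr ψ (kp r k) ξ).1 / r - Real.pi * m.1, (pr ψ (kp r k) ξ).2 / r - Real.pi * m.2)) : ℝ × ℝ)]
  · norm_num

lemma sum_fib {F : Finset Idx} {f : Idx → ℝ} (hf : ∀ T, 0 ≤ f T) (S : Finset (ℤ × ℤ)) (hS : ∀ T ∈ F, T.1 ∈ S) :
    ∑ T ∈ F, f T ≤ ∑ k ∈ S, ∑ m ∈ F.image Prod.snd, f (k, m) := by
  rw [← Finset.sum_product' S (F.image Prod.snd) (fun k m => f (k, m))]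
  refine Finset.sum_le_sum_of_subset_of_nonneg (f := f) ?_ (fun T _ _ => hf T)
  intro T hT
  rw [Finset.mem_product]
  exact ⟨hS T hT, Finset.mem_image_of_mem _ hT⟩

lemma sumv_near : ∃ K : ℝ, 1 ≤ K ∧ ∀ (ψ : ℝ → ℝ) (r : ℝ), 0 < r → ∀ (F : Finset Idx) (w : ℝ × ℝ) (A : ℝ), 0 ≤ A →
    (∀ T ∈ F, ‖om r T - w‖ ≤ A / r) → ∀ (ξ : ℝ × ℝ × ℝ),
    ∑ T ∈ F, wt ψ r T ξ ≤ K * (2 * A + 1) ^ 2 := by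
  obtain ⟨K, hK, hv⟩ := sumv
  refine ⟨K, hK, ?_⟩
  intro ψ r hr F w A hA hF ξ
  have h1 := sum_fib (F := F) (f := fun T => wt ψ r T ξ) (fun T => (wt_pos _ _ _ _).le) (F.image Prod.fst)
    (fun T hT => Finset.mem_image_of_mem _ hT)
  refine h1.trans ((Finset.sum_le_card_nsmul _ _ K fun k _ => hv ψ r hr _ k ξ).trans ?_)
  rw [nsmul_eq_mul, mul_comm]
  gcongr
  apply cnt2 hr _ w hA
  intro k hk
  obtain ⟨x, hx, rfl⟩ := Finset.mem_image.1 hk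
  exact hF x hx

/-- dyadic summation -/
lemma dyad_sum {ι : Type*} (S : Finset ι) (M : ι → ℝ) (D : ℝ) (hM : ∀ i ∈ S, 0 ≤ M i)
    (h : ∀ k : ℝ, 1 ≤ k → ∀ S' ⊆ S, (∀ i ∈ S', M i ≤ k) → (S'.card : ℝ) ≤ D * k ^ 5) :
    ∑ i ∈ S, ((1 + M i) ^ 8)⁻¹ ≤ 512 * D := by
  classical
  have hD : 0 ≤ D := by
    have := h 1 le_rfl ∅ (by simp) (by simp)
    simpa using this
  obtain ⟨N, hN⟩ : ∃ N : ℕ, ∀ i ∈ S, M i ≤ 2 ^ N := by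
    have h1 : ∃ A : ℝ, ∀ i ∈ S, M i ≤ A := ⟨∑ i ∈ S, M i, fun i hi => Finset.single_le_sum hM hi⟩
    obtain ⟨A, hA⟩ := h1
    obtain ⟨N, hN⟩ := pow_unbounded_of_one_lt A (one_lt_two)
    exact ⟨N, fun i hi => (hA i hi).trans hN.le⟩
  have key : ∀ i ∈ S, ((1 + M i) ^ 8)⁻¹ ≤ ∑ j ∈ Finset.range (N + 1), if M i ≤ 2 ^ j then 256 * (((2 : ℝ) ^ j) ^ 8)⁻¹ else 0 := by
    intro i hi
    have hex : ∃ j : ℕ, M i ≤ 2 ^ j := ⟨N, hN i hi⟩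
    set j := Nat.find hex with hj
    have hj1 : M i ≤ 2 ^ j := Nat.find_spec hex
    have hj2 : j ∈ Finset.range (N + 1) := by
      rw [Finset.mem_range]
      exact Nat.lt_succ_of_le (Nat.find_min' hex (hN i hi))
    refine le_trans ?_ (Finset.single_le_sum (f := fun j => if M i ≤ 2 ^ j then 256 * (((2 : ℝ) ^ j) ^ 8)⁻¹ else 0)
      (fun j _ => by split_ifs <;> positivity) hj2)
    simp only [hj1, if_true]
    have h3 : (2 : ℝ) ^ j ≤ 2 * (1 + M i) := by
      rcases Nat.eq_zero_or_pos j with h0 | h0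
      · rw [h0]; linarith [hM i hi]
      · have := Nat.find_min hex (m := j - 1) (by omega)
        push Not at this
        have e : (2 : ℝ) ^ j = 2 * 2 ^ (j - 1) := by rw [← pow_succ']; congr 1; omega
        rw [e]; linarith
    have := hM i hi
    rw [← div_eq_mul_inv, inv_eq_one_div, div_le_div_iff₀ (by positivity) (by positivity), one_mul]
    calc ((2 : ℝ) ^ j) ^ 8 ≤ (2 * (1 + M i)) ^ 8 := by gcongr
      _ = _ := by ring
  refine (Finset.sum_le_sum key).trans ?_
  rw [Finset.sum_comm]
  have h2 : ∀ j ∈ Finset.range (N + 1), (∑ i ∈ S, if M i ≤ 2 ^ j then 256 * (((2 : ℝ) ^ j) ^ 8)⁻¹ else 0) ≤ 256 * D * (1 / 2) ^ j := by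
    intro j _
    rw [← Finset.sum_filter, Finset.sum_const, nsmul_eq_mul]
    have h1 := h (2 ^ j) (one_le_pow₀ one_le_two) (S.filter fun i => M i ≤ 2 ^ j) (Finset.filter_subset _ _)
      (fun i hi => (Finset.mem_filter.1 hi).2)
    calc _ ≤ (D * (2 ^ j) ^ 5) * (256 * (((2 : ℝ) ^ j) ^ 8)⁻¹) := by gcongr
      _ = 256 * D * ((1 / 2) ^ j) ^ 3 := by
        rw [one_div, inv_pow]
        field_simp
      _ ≤ 256 * D * (1 / 2) ^ j := by
        gcongr
        have : ((1 : ℝ) / 2) ^ j ≤ 1 := pow_le_one₀ (by norm_num) (by norm_num)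
        exact pow_le_of_le_one (by positivity) this (by norm_num)
  refine (Finset.sum_le_sum h2).trans ?_
  rw [← Finset.mul_sum]
  have := (summable_geometric_two).sum_le_tsum (Finset.range (N + 1)) (fun i _ => by positivity)
  rw [tsum_geometric_two] at this
  nlinarith

end BAP

namespace BAP

/-! ### Kakeya-type counting -/

/-- difference of normals -/
def uu (ψ : ℝ → ℝ) (w2 w : ℝ × ℝ) : ℝ × ℝ := gr ψ w2 - gr ψ w

/-- wedge product in the plane -/
def wedge (a b : ℝ × ℝ) : ℝ := a.1 * b.2 - a.2 * b.1

/-- quantitative transversality -/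
structure Trans (ψ : ℝ → ℝ) (B : ℝ) (W1 W2 : Set (ℝ × ℝ)) : Prop where
  sep : ∀ w ∈ W1, ∀ w2 ∈ W2, 1 ≤ |w2.2 - w.2|
  bd1 : ∀ w ∈ W1, |w.1| + 1 ≤ B ∧ |w.2| + 1 ≤ B
  bd2 : ∀ w ∈ W2, |w.1| + 1 ≤ B ∧ |w.2| + 1 ≤ B
  tr : ∀ w1 ∈ W1, ∀ w' ∈ W1, ∀ wb ∈ W1, ∀ w2 ∈ W2, ∀ w2' ∈ W2, ∀ a ∈ W2, ∀ b ∈ W2, ∀ κ : ℝ, 0 ≤ κ →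
    ‖w1 + a - w' - w2'‖ ≤ κ → |ph ψ w1 + ph ψ a - ph ψ w' - ph ψ w2'| ≤ κ →
    ‖w1 + b - wb - w2'‖ ≤ κ → |ph ψ w1 + ph ψ b - ph ψ wb - ph ψ w2'| ≤ κ →
    |wedge (uu ψ w2 w') (uu ψ w2 wb)| ≤ κ → ‖w' - wb‖ ≤ B * κ

/-- the compatibility condition between base points -/
def Cmp0 (ψ : ℝ → ℝ) (B r : ℝ) (W2 : Set (ℝ × ℝ)) (w1 w2' w' : ℝ × ℝ) : Prop :=
  ∃ a ∈ W2, ‖w1 + a - w' - w2'‖ ≤ 13 * B / r ∧ |ph ψ w1 + ph ψ a - ph ψ w' - ph ψ w2'| ≤ 13 * B / r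

lemma kak_count (B : ℝ) (hB : 1 ≤ B) : ∃ K : ℝ, 1 ≤ K ∧ ∀ ψ, Reg ψ B → ∀ r : ℝ, 1 ≤ r →
    ∀ W1 W2, Trans ψ B W1 W2 → ∀ c : ℝ, 0 < c → c ≤ 1 → ∀ w1 ∈ W1, ∀ w2 ∈ W2, ∀ w2' ∈ W2,
    ∀ (e : ℝ × ℝ) (p : ℝ × ℝ × ℝ) (κ : ℝ), 1 ≤ κ → ∀ S : Finset ((ℤ × ℤ) × (ℤ × ℤ × ℤ)),
    (∀ s ∈ S, kp r s.1 ∈ W1 ∧ Cmp0 ψ B r W2 w1 w2' (kp r s.1) ∧ ‖pr ψ (kp r s.1) (p - gp r s.2)‖ ≤ κ * r ∧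
      ‖pr ψ w2 (gp r s.2) - e‖ ≤ κ * r ∧ c * r ^ 2 ≤ |p.2.2 - (gp r s.2).2.2|) →
    (S.card : ℝ) ≤ K * (c ^ 2)⁻¹ * κ ^ 5 := by
  classical
  refine ⟨65 ^ 2 * 21 ^ 3 * B ^ 7, ?_, ?_⟩
  · have : (1:ℝ) ≤ B ^ 7 := one_le_pow₀ hB
    nlinarith
  intro ψ hψ r hr W1 W2 hT c hc hc1 w1 hw1 w2 hw2 w2' hw2' e p κ hκ S hS
  have hr0 : 0 < r := by linarith
  have hκr : 0 < κ * r := by positivity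
  -- basic vector identity
  have hb2 := hT.bd2 w2 hw2
  have hg2 := gr_bound hψ (w := w2) (by linarith [hb2.1]) (by linarith [hb2.2])
  have hg : ∀ s ∈ S, ‖gr ψ (kp r s.1)‖ ≤ 2 * B := fun s hs => by
    have := hT.bd1 _ (hS s hs).1
    exact gr_bound hψ (by linarith [this.1]) (by linarith [this.2])
  set E := pr ψ w2 p - e with hE
  set x3 : ((ℤ × ℤ) × (ℤ × ℤ × ℤ)) → ℝ := fun s => p.2.2 - (gp r s.2).2.2 with hx3
  have hvec : ∀ s ∈ S, |x3 s * (uu ψ w2 (kp r s.1)).1 - E.1| ≤ 2 * (κ * r) ∧ |x3 s * (uu ψ w2 (kp r s.1)).2 - E.2| ≤ 2 * (κ * r) := by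
    intro s hs
    obtain ⟨-, -, h3, h4, -⟩ := hS s hs
    have a1 := (norm_fst_le _).trans h3
    have a2 := (norm_snd_le _).trans h3
    have b1 := (norm_fst_le _).trans h4
    have b2 := (norm_snd_le _).trans h4
    rw [Real.norm_eq_abs, abs_le] at a1 a2 b1 b2
    simp only [pr, uu, hE, hx3, Prod.fst_sub, Prod.snd_sub] at a1 a2 b1 b2 ⊢
    constructor <;> rw [abs_le] <;> constructor <;> linarith [a1.1, a1.2, a2.1, a2.2, b1.1, b1.2, b2.1, b2.2]
  have hx3pos : ∀ s ∈ S, 0 < |x3 s| := fun s hs => lt_of_lt_of_le (by positivity) (hS s hs).2.2.2.2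
  -- base points are close
  have hbase : ∀ s ∈ S, ∀ s' ∈ S, ‖kp r s.1 - kp r s'.1‖ ≤ (32 * B ^ 2 * κ / c) / r := by
    intro s hs s' hs'
    have hv := hvec s hs
    have hv' := hvec s' hs'
    set u := uu ψ w2 (kp r s.1) with hu
    set u' := uu ψ w2 (kp r s'.1) with hu'
    have hun : ‖u‖ ≤ 4 * B := (norm_sub_le _ _).trans (by linarith [hg s hs])
    have hu1 : |u.1| ≤ 4 * B := (norm_fst_le _).trans hun
    have hu2 : |u.2| ≤ 4 * B := (norm_snd_le _).trans hun
    have hd1 : |x3 s' * u'.1 - x3 s * u.1| ≤ 4 * (κ * r) := by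
      rw [abs_le] at *; constructor <;> linarith [hv.1.1, hv.1.2, hv'.1.1, hv'.1.2]
    have hd2 : |x3 s' * u'.2 - x3 s * u.2| ≤ 4 * (κ * r) := by
      have q1 := abs_le.1 hv.2
      have q2 := abs_le.1 hv'.2
      rw [abs_le]; constructor <;> linarith [q1.1, q1.2, q2.1, q2.2]
    have hw : x3 s' * wedge u u' = u.1 * (x3 s' * u'.2 - x3 s * u.2) - u.2 * (x3 s' * u'.1 - x3 s * u.1) := by
      unfold wedge; ring
    have hw2 : |x3 s'| * |wedge u u'| ≤ 32 * B * (κ * r) := by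
      rw [← abs_mul, hw]
      refine (abs_sub _ _).trans ?_
      rw [abs_mul, abs_mul]
      calc _ ≤ (4 * B) * (4 * (κ * r)) + (4 * B) * (4 * (κ * r)) := by gcongr
        _ = _ := by ring
    have hw3 : |wedge u u'| ≤ 32 * B * κ / (c * r) := by
      rw [le_div_iff₀ (by positivity)]
      have h1 := (hS s' hs').2.2.2.2
      have h2 : c * r ^ 2 * |wedge u u'| ≤ 32 * B * (κ * r) :=
        (mul_le_mul_of_nonneg_right h1 (abs_nonneg _)).trans hw2
      have h3 : r * (|wedge u u'| * (c * r)) ≤ r * (32 * B * κ) := by nlinarith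
      exact le_of_mul_le_mul_left h3 hr0
    have hle : 13 * B / r ≤ 32 * B * κ / (c * r) := by
      rw [div_le_div_iff₀ hr0 (by positivity)]
      have : c * 1 ≤ 1 * κ := by nlinarith
      have hBr : 0 < B * r := by positivity
      nlinarith
    obtain ⟨hs1, ⟨a, ha, ha1, ha2⟩, -⟩ := hS s hs
    obtain ⟨hs1', ⟨a', ha', ha1', ha2'⟩, -⟩ := hS s' hs'
    have := hT.tr w1 hw1 _ hs1 _ hs1' w2 ‹_› w2' hw2' a ha a' ha' (32 * B * κ / (c * r)) (by positivity)
      (ha1.trans hle) (ha2.trans hle) (ha1'.trans hle) (ha2'.trans hle) hw3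
    refine this.trans (le_of_eq ?_)
    field_simp
  rcases S.eq_empty_or_nonempty with rfl | ⟨s0, hs0⟩
  · simp; positivity
  have hcard1 : ((S.image Prod.fst).card : ℝ) ≤ (65 * B ^ 2 * κ / c) ^ 2 := by
    refine (cnt2 hr0 (S.image Prod.fst) (kp r s0.1) (A := 32 * B ^ 2 * κ / c) (by positivity) ?_).trans ?_
    · intro k hk
      obtain ⟨s, hs, rfl⟩ := Finset.mem_image.1 hk
      exact hbase s hs s0 hs0
    · gcongr
      have : 1 ≤ B ^ 2 * κ / c := by
        rw [le_div_iff₀ hc]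
        have : 1 ≤ B ^ 2 := one_le_pow₀ hB
        nlinarith
      have e1 : 32 * B ^ 2 * κ / c = 32 * (B ^ 2 * κ / c) := by ring
      have e2 : 65 * B ^ 2 * κ / c = 65 * (B ^ 2 * κ / c) := by ring
      rw [e1, e2]; linarith
  have hfib : ∀ k ∈ S.image Prod.fst, ((S.filter fun s => s.1 = k).card : ℝ) ≤ (21 * B * κ) ^ 3 := by
    intro k hk
    obtain ⟨t, ht, rfl⟩ := Finset.mem_image.1 hk
    have hinj : ((S.filter fun s => s.1 = t.1).image Prod.snd).card = (S.filter fun s => s.1 = t.1).card := by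
      apply Finset.card_image_of_injOn
      intro x hx y hy hxy
      have h1 := (Finset.mem_filter.1 hx).2
      have h2 := (Finset.mem_filter.1 hy).2
      exact Prod.ext (h1.trans h2.symm) hxy
    rw [← hinj]
    refine (cnt3 hr0 _ (gp r t.2) (A := 10 * B * κ) (by positivity) ?_).trans ?_
    · intro n hn
      obtain ⟨s, hs, rfl⟩ := Finset.mem_image.1 hn
      obtain ⟨hs, hst⟩ := Finset.mem_filter.1 hs
      have hv := (hvec s hs).1
      have hv' := (hvec t ht).1
      rw [hst] at hv
      obtain ⟨ht1, -, ht3, -⟩ := hS t ht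
      obtain ⟨-, -, hs3, -⟩ := hS s hs
      rw [hst] at hs3
      have hsep := hT.sep _ ht1 w2 hw2
      have hu1 : (uu ψ w2 (kp r t.1)).1 = w2.2 - (kp r t.1).2 := by simp [uu, gr]
      rw [hu1] at hv hv'
      have hx : |x3 s - x3 t| ≤ 4 * (κ * r) := by
        have h1 : |x3 s - x3 t| * |w2.2 - (kp r t.1).2| ≤ 4 * (κ * r) := by
          rw [← abs_mul, sub_mul]
          rw [abs_le] at *; constructor <;> linarith [hv.1, hv.2, hv'.1, hv'.2]
        nlinarith [abs_nonneg (x3 s - x3 t)]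
      have hgt := hg t ht
      have hg1 : |(gr ψ (kp r t.1)).1| ≤ 2 * B := (norm_fst_le _).trans hgt
      have hg2 : |(gr ψ (kp r t.1)).2| ≤ 2 * B := (norm_snd_le _).trans hgt
      have a1 := (norm_fst_le _).trans hs3
      have a2 := (norm_snd_le _).trans hs3
      have b1 := (norm_fst_le _).trans ht3
      have b2 := (norm_snd_le _).trans ht3
      have m1 : |(x3 s - x3 t) * (gr ψ (kp r t.1)).1| ≤ 4 * (κ * r) * (2 * B) := by
        rw [abs_mul]; gcongr
      have m2 : |(x3 s - x3 t) * (gr ψ (kp r t.1)).2| ≤ 4 * (κ * r) * (2 * B) := by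
        rw [abs_mul]; gcongr
      have hBκ : κ * r ≤ B * (κ * r) := by nlinarith
      rw [Real.norm_eq_abs, abs_le] at a1 a2 b1 b2
      rw [abs_le] at m1 m2 hx
      simp only [pr, hx3, Prod.fst_sub, Prod.snd_sub] at a1 a2 b1 b2 m1 m2 hx
      have e10 : 10 * B * κ * r = 10 * (B * (κ * r)) := by ring
      rw [Prod.norm_def, Prod.norm_def, e10]
      simp only [Prod.fst_sub, Prod.snd_sub, Real.norm_eq_abs]
      refine max_le ?_ (max_le ?_ ?_) <;> rw [abs_le] <;> constructor <;>
        linarith [a1.1, a1.2, a2.1, a2.2, b1.1, b1.2, b2.1, b2.2, m1.1, m1.2, m2.1, m2.2, hx.1, hx.2]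
    · gcongr
      have : 1 ≤ B * κ := by nlinarith
      linarith
  have hsum : (S.card : ℝ) = ∑ k ∈ S.image Prod.fst, ((S.filter fun s => s.1 = k).card : ℝ) := by
    exact_mod_cast Finset.card_eq_sum_card_image Prod.fst S
  rw [hsum]
  refine (Finset.sum_le_card_nsmul _ _ _ hfib).trans ?_
  rw [nsmul_eq_mul]
  calc _ ≤ (65 * B ^ 2 * κ / c) ^ 2 * (21 * B * κ) ^ 3 := by gcongr
    _ = _ := by field_simp

end BAP

namespace BAP

/-! ### Kakeya sums and the table estimate -/

lemma two_wt {a b d : ℝ} (ha : 0 ≤ a) (hb : 0 ≤ b) (hd : 0 ≤ d) (h : d ≤ a + b) :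
    ((1 + a) ^ 8)⁻¹ * ((1 + b) ^ 8)⁻¹ ≤ 256 * ((1 + d) ^ 8)⁻¹ * (((1 + a) ^ 8)⁻¹ + ((1 + b) ^ 8)⁻¹) := by
  have key : ∀ x : ℝ, 0 ≤ x → d ≤ 2 * x → ((1 + x) ^ 8)⁻¹ ≤ 256 * ((1 + d) ^ 8)⁻¹ := by
    intro x hx hdx
    rw [← div_eq_mul_inv, inv_eq_one_div, div_le_div_iff₀ (by positivity) (by positivity), one_mul]
    calc (1 + d) ^ 8 ≤ (2 * (1 + x)) ^ 8 := by gcongr; linarith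
      _ = _ := by ring
  have pa : 0 < ((1 + a) ^ 8)⁻¹ := by positivity
  have pb : 0 < ((1 + b) ^ 8)⁻¹ := by positivity
  have pd : 0 < 256 * ((1 + d) ^ 8)⁻¹ := by positivity
  rcases le_total a b with hab | hab
  · have := key b hb (by linarith)
    nlinarith
  · have := key a ha (by linarith)
    nlinarith

lemma vsum2 : ∃ K : ℝ, 1 ≤ K ∧ ∀ (ψ : ℝ → ℝ) (r : ℝ), 0 < r → ∀ (S : Finset (ℤ × ℤ)) (k : ℤ × ℤ) (p p' : ℝ × ℝ × ℝ),
    ∑ m ∈ S, wt ψ r (k, m) p * wt ψ r (k, m) p' ≤ K * ((1 + ‖pr ψ (kp r k) (p - p')‖ / r) ^ 8)⁻¹ := by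
  obtain ⟨K, hK, hv⟩ := sumv
  refine ⟨512 * K, by linarith, ?_⟩
  intro ψ r hr S k p p'
  have h1 : ∀ m ∈ S, wt ψ r (k, m) p * wt ψ r (k, m) p' ≤ 256 * ((1 + ‖pr ψ (kp r k) (p - p')‖ / r) ^ 8)⁻¹ * (wt ψ r (k, m) p + wt ψ r (k, m) p') := by
    intro m _
    apply two_wt (norm_nonneg _) (norm_nonneg _) (by positivity)
    have := sv_sub_norm hr ψ (k, m) p p'
    rw [om_eq] at this
    rw [← this]
    exact norm_sub_le _ _
  refine (Finset.sum_le_sum h1).trans ?_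
  rw [← Finset.mul_sum, Finset.sum_add_distrib]
  have := hv ψ r hr S k p
  have := hv ψ r hr S k p'
  have : 0 < ((1 + ‖pr ψ (kp r k) (p - p')‖ / r) ^ 8)⁻¹ := by positivity
  nlinarith

lemma kak_sum (B : ℝ) (hB : 1 ≤ B) : ∃ K : ℝ, 1 ≤ K ∧ ∀ ψ, Reg ψ B → ∀ r : ℝ, 1 ≤ r →
    ∀ W1 W2, Trans ψ B W1 W2 → ∀ c : ℝ, 0 < c → c ≤ 1 → ∀ w1 ∈ W1, ∀ w2' ∈ W2,
    ∀ (p : ℝ × ℝ × ℝ) (P : Finset (ℤ × ℤ × ℤ)), (∀ n ∈ P, c * r ^ 2 ≤ |p.2.2 - (gp r n).2.2|) →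
    ∀ T2 : Idx, om r T2 ∈ W2 → ∀ F : Finset Idx, (∀ T ∈ F, om r T ∈ W1 ∧ Cmp0 ψ B r W2 w1 w2' (om r T)) →
    ∑ n ∈ P, ∑ T ∈ F, wt ψ r T p * wt ψ r T (gp r n) * wt ψ r T2 (gp r n) ≤ K * (c ^ 2)⁻¹ := by
  classical
  obtain ⟨K1, hK1, hc⟩ := kak_count B hB
  obtain ⟨K2, hK2, hv⟩ := vsum2
  refine ⟨K2 * (512 * K1), by nlinarith, ?_⟩
  intro ψ hψ r hr W1 W2 hT c hc0 hc1 w1 hw1 w2' hw2' p P hP T2 hT2 F hF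
  have hr0 : 0 < r := by linarith
  set M : (ℤ × ℤ) × (ℤ × ℤ × ℤ) → ℝ := fun s => max (‖pr ψ (kp r s.1) (p - gp r s.2)‖ / r) ‖sv ψ r T2 (gp r s.2)‖ with hM
  have h1 : ∀ n ∈ P, ∑ T ∈ F, wt ψ r T p * wt ψ r T (gp r n) * wt ψ r T2 (gp r n) ≤
      ∑ k ∈ F.image Prod.fst, K2 * ((1 + M (k, n)) ^ 8)⁻¹ := by
    intro n _
    rw [← Finset.sum_mul]
    have h2 := sum_fib (F := F) (f := fun T => wt ψ r T p * wt ψ r T (gp r n)) (fun T => mul_nonneg (wt_pos _ _ _ _).le (wt_pos _ _ _ _).le)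
      (F.image Prod.fst) (fun T hT => Finset.mem_image_of_mem _ hT)
    refine (mul_le_mul_of_nonneg_right h2 (wt_pos _ _ _ _).le).trans ?_
    rw [Finset.sum_mul]
    refine Finset.sum_le_sum fun k _ => ?_
    refine (mul_le_mul_of_nonneg_right (hv ψ r hr0 _ k p (gp r n)) (wt_pos _ _ _ _).le).trans ?_
    rw [mul_assoc]
    refine mul_le_mul_of_nonneg_left ?_ (by linarith)
    have a0 : 0 ≤ ‖pr ψ (kp r k) (p - gp r n)‖ / r := by positivity
    have b0 : 0 ≤ ‖sv ψ r T2 (gp r n)‖ := norm_nonneg _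
    unfold wt
    simp only [hM]
    rcases max_cases (‖pr ψ (kp r k) (p - gp r n)‖ / r) ‖sv ψ r T2 (gp r n)‖ with h | h
    · rw [h.1]
      refine mul_le_of_le_one_right (by positivity) (inv_le_one_of_one_le₀ (one_le_pow₀ (by linarith)))
    · rw [h.1]
      refine mul_le_of_le_one_left (by positivity) (inv_le_one_of_one_le₀ (one_le_pow₀ (by linarith)))
  refine (Finset.sum_le_sum h1).trans ?_
  rw [Finset.sum_comm, ← Finset.sum_product' (F.image Prod.fst) P (fun k n => K2 * ((1 + M (k, n)) ^ 8)⁻¹)]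
  simp only [Prod.mk.eta]
  rw [← Finset.mul_sum]
  have h3 := dyad_sum ((F.image Prod.fst) ×ˢ P) M (K1 * (c ^ 2)⁻¹) (fun s _ => le_trans (norm_nonneg _) (le_max_right _ _)) ?_
  · calc _ ≤ K2 * (512 * (K1 * (c ^ 2)⁻¹)) := by gcongr
      _ = _ := by ring
  intro κ hκ S' hS' hk
  apply hc ψ hψ r hr W1 W2 hT c hc0 hc1 w1 hw1 (om r T2) hT2 w2' hw2' (Real.pi * r * T2.2.1, Real.pi * r * T2.2.2) p κ hκ
  intro s hs
  have h4 := Finset.mem_product.1 (hS' hs)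
  obtain ⟨T, hTF, hT1⟩ := Finset.mem_image.1 h4.1
  have h5 := hk s hs
  have h6 := (le_max_left _ _).trans h5
  have h7 := (le_max_right _ _).trans h5
  refine ⟨?_, ?_, ?_, ?_, hP _ h4.2⟩
  · rw [← hT1]; exact (hF T hTF).1
  · rw [← hT1]; exact (hF T hTF).2
  · rwa [div_le_iff₀ hr0] at h6
  · have h8 : pr ψ (om r T2) (gp r s.2) - (Real.pi * r * T2.2.1, Real.pi * r * T2.2.2) = r • sv ψ r T2 (gp r s.2) := by
      unfold sv pr
      ext
      · simp only [Prod.fst_sub, Prod.smul_fst, smul_eq_mul]; field_simp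
      · simp only [Prod.snd_sub, Prod.smul_snd, smul_eq_mul]; field_simp
    rw [h8, norm_smul, Real.norm_eq_abs, abs_of_pos hr0, mul_comm]
    gcongr

lemma sum_rot {α β γ : Type*} (A : Finset α) (B : Finset β) (C : Finset γ) (f : α → β → γ → ℝ) :
    ∑ a ∈ A, ∑ b ∈ B, ∑ c ∈ C, f a b c = ∑ c ∈ C, ∑ b ∈ B, ∑ a ∈ A, f a b c := by
  rw [Finset.sum_comm]
  rw [Finset.sum_congr rfl fun b _ => Finset.sum_comm]
  rw [Finset.sum_comm]

/-- local mass of the second family -/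
def Sg (ψ : ℝ → ℝ) (r : ℝ) (G : Finset Idx) (D : Idx → ℝ) (n : ℤ × ℤ × ℤ) : ℝ :=
  ∑ T ∈ G, D T ^ 2 * wt ψ r T (gp r n)

/-- mass of the second family met by a packet in the region `Q` -/
def mm (ψ : ℝ → ℝ) (r : ℝ) (G : Finset Idx) (D : Idx → ℝ) (Q : Finset (ℤ × ℤ × ℤ)) (T : Idx) : ℝ :=
  ∑ n ∈ Q, wt ψ r T (gp r n) * Sg ψ r G D n

lemma Sg_nonneg (ψ : ℝ → ℝ) (r : ℝ) (G : Finset Idx) (D : Idx → ℝ) (n : ℤ × ℤ × ℤ) : 0 ≤ Sg ψ r G D n :=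
  Finset.sum_nonneg fun T _ => mul_nonneg (sq_nonneg _) (wt_pos _ _ _ _).le

lemma mm_nonneg (ψ : ℝ → ℝ) (r : ℝ) (G : Finset Idx) (D : Idx → ℝ) (Q : Finset (ℤ × ℤ × ℤ)) (T : Idx) : 0 ≤ mm ψ r G D Q T :=
  Finset.sum_nonneg fun n _ => mul_nonneg (wt_pos _ _ _ _).le (Sg_nonneg _ _ _ _ _)

lemma mm_mono (ψ : ℝ → ℝ) (r : ℝ) (G : Finset Idx) (D : Idx → ℝ) {Q Q' : Finset (ℤ × ℤ × ℤ)} (h : Q ⊆ Q') (T : Idx) :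
    mm ψ r G D Q T ≤ mm ψ r G D Q' T :=
  Finset.sum_le_sum_of_subset_of_nonneg h fun n _ _ => mul_nonneg (wt_pos _ _ _ _).le (Sg_nonneg _ _ _ _ _)

/-- the table coefficient -/
def ac (ψ : ℝ → ℝ) (r : ℝ) (G : Finset Idx) (D : Idx → ℝ) (Q P : Finset (ℤ × ℤ × ℤ)) (T : Idx) : ℝ :=
  mm ψ r G D Q T / mm ψ r G D P T

lemma kak_mm (B : ℝ) (hB : 1 ≤ B) : ∃ K : ℝ, 1 ≤ K ∧ ∀ ψ, Reg ψ B → ∀ r : ℝ, 1 ≤ r →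
    ∀ W1 W2, Trans ψ B W1 W2 → ∀ c : ℝ, 0 < c → c ≤ 1 → ∀ w1 ∈ W1, ∀ w2' ∈ W2,
    ∀ (p : ℝ × ℝ × ℝ) (P : Finset (ℤ × ℤ × ℤ)), (∀ n ∈ P, c * r ^ 2 ≤ |p.2.2 - (gp r n).2.2|) →
    ∀ (G : Finset Idx) (D : Idx → ℝ), (∀ T ∈ G, om r T ∈ W2) →
    ∀ F : Finset Idx, (∀ T ∈ F, om r T ∈ W1 ∧ Cmp0 ψ B r W2 w1 w2' (om r T)) →
    ∑ T ∈ F, mm ψ r G D P T * wt ψ r T p ≤ K * (c ^ 2)⁻¹ * ∑ T ∈ G, D T ^ 2 := by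
  obtain ⟨K, hK, h⟩ := kak_sum B hB
  refine ⟨K, hK, ?_⟩
  intro ψ hψ r hr W1 W2 hT c hc0 hc1 w1 hw1 w2' hw2' p P hP G D hG F hF
  calc ∑ T ∈ F, mm ψ r G D P T * wt ψ r T p = ∑ T ∈ F, ∑ n ∈ P, ∑ T2 ∈ G, D T2 ^ 2 * (wt ψ r T p * wt ψ r T (gp r n) * wt ψ r T2 (gp r n)) := by
        refine Finset.sum_congr rfl fun T _ => ?_
        unfold mm Sg
        rw [Finset.sum_mul]
        refine Finset.sum_congr rfl fun n _ => ?_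
        rw [Finset.mul_sum, Finset.sum_mul]
        refine Finset.sum_congr rfl fun T2 _ => ?_
        ring
    _ = ∑ T2 ∈ G, D T2 ^ 2 * ∑ n ∈ P, ∑ T ∈ F, wt ψ r T p * wt ψ r T (gp r n) * wt ψ r T2 (gp r n) := by
        rw [sum_rot]
        simp_rw [Finset.mul_sum]
    _ ≤ ∑ T2 ∈ G, D T2 ^ 2 * (K * (c ^ 2)⁻¹) := by
        refine Finset.sum_le_sum fun T2 hT2 => mul_le_mul_of_nonneg_left ?_ (sq_nonneg _)
        exact h ψ hψ r hr W1 W2 hT c hc0 hc1 w1 hw1 w2' hw2' p P hP T2 (hG T2 hT2) F hF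
    _ = _ := by rw [← Finset.sum_mul, mul_comm]

lemma Cmp_symm {ψ : ℝ → ℝ} {B r : ℝ} {T1 T1' T2 T2' : Idx} (h : Cmp ψ B r T1 T1' T2 T2') : Cmp ψ B r T1' T1 T2' T2 := by
  unfold Cmp at *
  constructor
  · refine le_trans (le_of_eq ?_) h.1
    rw [← norm_neg]; congr 1; abel
  · refine le_trans (le_of_eq ?_) h.2
    rw [← abs_neg]; congr 1; ring

lemma Cmp_swap {ψ : ℝ → ℝ} {B r : ℝ} {T1 T1' T2 T2' : Idx} (h : Cmp ψ B r T1 T1' T2 T2') : Cmp ψ B r T2 T2' T1 T1' := by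
  unfold Cmp at *
  constructor
  · refine le_trans (le_of_eq ?_) h.1
    congr 1; abel
  · refine le_trans (le_of_eq ?_) h.2
    congr 1; ring

open Classical in
/-- The table estimate. -/
lemma table (B : ℝ) (hB : 1 ≤ B) : ∃ K : ℝ, 1 ≤ K ∧ ∀ ψ, Reg ψ B → ∀ r : ℝ, 1 ≤ r →
    ∀ W1 W2, Trans ψ B W1 W2 → ∀ c : ℝ, 0 < c → c ≤ 1 →
    ∀ (F G : Finset Idx) (C D : Idx → ℝ), (∀ T ∈ F, om r T ∈ W1) → (∀ T ∈ G, om r T ∈ W2) →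
    ∀ (Q P' P : Finset (ℤ × ℤ × ℤ)), Q ⊆ P → P' ⊆ P →
    (∀ p ∈ P', ∀ n ∈ Q, c * r ^ 2 ≤ |(gp r p).2.2 - (gp r n).2.2|) →
    ∑ p ∈ P', ∑ q ∈ (F ×ˢ F) ×ˢ (G ×ˢ G), (if Cmp ψ B r q.1.1 q.1.2 q.2.1 q.2.2 then
      (ac ψ r G D Q P q.1.1 * C q.1.1) * (ac ψ r G D Q P q.1.2 * C q.1.2) * (D q.2.1 * D q.2.2) *
      (wt ψ r q.1.1 (gp r p) * wt ψ r q.1.2 (gp r p) * (wt ψ r q.2.1 (gp r p) * wt ψ r q.2.2 (gp r p))) else 0) ≤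
    K * (c ^ 2)⁻¹ * ((∑ T ∈ F, C T ^ 2) * ∑ T ∈ G, D T ^ 2) := by
  obtain ⟨K, hK, hk⟩ := kak_mm B hB
  obtain ⟨K1, hK1, hn⟩ := sumv_near
  have hA0 : (0:ℝ) ≤ 13 * B := by linarith
  have hA : (1:ℝ) ≤ (2 * (13 * B) + 1) ^ 2 := one_le_pow₀ (by linarith)
  refine ⟨K1 * (2 * (13 * B) + 1) ^ 2 * K, ?_, ?_⟩
  · exact one_le_mul_of_one_le_of_one_le (one_le_mul_of_one_le_of_one_le hK1 hA) hK
  set L := K1 * (2 * (13 * B) + 1) ^ 2 with hL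
  have hL0 : 0 ≤ L := by rw [hL]; positivity
  intro ψ hψ r hr W1 W2 hT c hc0 hc1 F G C D hF hG Q P' P hQ hP' hsep
  have hr0 : 0 < r := by linarith
  set μ := mm ψ r G D Q with hμ
  set m := mm ψ r G D P with hm
  have hμ0 : ∀ T, 0 ≤ μ T := mm_nonneg _ _ _ _ _
  set D2 := ∑ T ∈ G, D T ^ 2 with hD2
  have hD20 : 0 ≤ D2 := Finset.sum_nonneg fun _ _ => sq_nonneg _
  -- per point estimate
  have hpt : ∀ p ∈ P', ∑ q ∈ (F ×ˢ F) ×ˢ (G ×ˢ G), (if Cmp ψ B r q.1.1 q.1.2 q.2.1 q.2.2 then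
      (ac ψ r G D Q P q.1.1 * C q.1.1) * (ac ψ r G D Q P q.1.2 * C q.1.2) * (D q.2.1 * D q.2.2) *
      (wt ψ r q.1.1 (gp r p) * wt ψ r q.1.2 (gp r p) * (wt ψ r q.2.1 (gp r p) * wt ψ r q.2.2 (gp r p))) else 0) ≤
      ∑ T ∈ F, (C T / m T) ^ 2 * μ T * (wt ψ r T (gp r p) * Sg ψ r G D p) * (L * (K * (c ^ 2)⁻¹ * D2)) := by
    intro p hp
    set W : Idx → ℝ := fun T => wt ψ r T (gp r p) with hW
    have hW0 : ∀ T, 0 ≤ W T := fun T => (wt_pos _ _ _ _).le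
    set Y : (Idx × Idx) × (Idx × Idx) → ℝ := fun q => if Cmp ψ B r q.1.1 q.1.2 q.2.1 q.2.2 then
      μ q.1.1 * μ q.1.2 * (W q.1.1 * W q.1.2 * (W q.2.1 * W q.2.2)) * ((C q.1.1 / m q.1.1) * D q.2.2) ^ 2 else 0 with hY
    have s1 : ∀ q ∈ (F ×ˢ F) ×ˢ (G ×ˢ G), (if Cmp ψ B r q.1.1 q.1.2 q.2.1 q.2.2 then
      (ac ψ r G D Q P q.1.1 * C q.1.1) * (ac ψ r G D Q P q.1.2 * C q.1.2) * (D q.2.1 * D q.2.2) *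
      (W q.1.1 * W q.1.2 * (W q.2.1 * W q.2.2)) else 0) ≤ 1 / 2 * Y q + 1 / 2 * Y (q.1.swap, q.2.swap) := by
      intro q _
      simp only [hY, Prod.fst_swap, Prod.snd_swap]
      by_cases hc : Cmp ψ B r q.1.1 q.1.2 q.2.1 q.2.2
      · rw [if_pos hc, if_pos hc, if_pos (Cmp_symm hc)]
        unfold ac
        set A := C q.1.1 / m q.1.1 with hA
        set A' := C q.1.2 / m q.1.2 with hA'
        have e1 : μ q.1.1 / m q.1.1 * C q.1.1 = μ q.1.1 * A := by rw [hA]; ring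
        have e2 : μ q.1.2 / m q.1.2 * C q.1.2 = μ q.1.2 * A' := by rw [hA']; ring
        rw [e1, e2]
        set Z := μ q.1.1 * μ q.1.2 * (W q.1.1 * W q.1.2 * (W q.2.1 * W q.2.2)) with hZ
        have hZ0 : 0 ≤ Z := by
          have := hμ0 q.1.1; have := hμ0 q.1.2; have := hW0 q.1.1; have := hW0 q.1.2; have := hW0 q.2.1; have := hW0 q.2.2
          positivity
        have e3 : μ q.1.1 * A * (μ q.1.2 * A') * (D q.2.1 * D q.2.2) * (W q.1.1 * W q.1.2 * (W q.2.1 * W q.2.2)) = Z * ((A * D q.2.2) * (A' * D q.2.1)) := by rw [hZ]; ring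
        have e4 : μ q.1.2 * μ q.1.1 * (W q.1.2 * W q.1.1 * (W q.2.2 * W q.2.1)) = Z := by rw [hZ]; ring
        rw [e3, e4]
        nlinarith [mul_nonneg hZ0 (sq_nonneg (A * D q.2.2 - A' * D q.2.1))]
      · have hc' : ¬ Cmp ψ B r q.1.2 q.1.1 q.2.2 q.2.1 := fun h => hc (Cmp_symm h)
        rw [if_neg hc, if_neg hc, if_neg hc']; simp
    refine (Finset.sum_le_sum s1).trans ?_
    have s2 : ∑ q ∈ (F ×ˢ F) ×ˢ (G ×ˢ G), Y (q.1.swap, q.2.swap) = ∑ q ∈ (F ×ˢ F) ×ˢ (G ×ˢ G), Y q := by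
      refine Finset.sum_nbij' (fun q => (q.1.swap, q.2.swap)) (fun q => (q.1.swap, q.2.swap)) ?_ ?_ ?_ ?_ ?_
      · intro q hq; simp only [Finset.mem_product, Prod.fst_swap, Prod.snd_swap] at hq ⊢; tauto
      · intro q hq; simp only [Finset.mem_product, Prod.fst_swap, Prod.snd_swap] at hq ⊢; tauto
      · intro q _; simp
      · intro q _; simp
      · intro q _; rfl
    rw [Finset.sum_add_distrib, ← Finset.mul_sum, ← Finset.mul_sum, s2]
    rw [← add_mul, show (1:ℝ) / 2 + 1 / 2 = 1 by norm_num, one_mul]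
    rw [Finset.sum_product, Finset.sum_product]
    refine Finset.sum_le_sum fun T1 hT1 => ?_
    have s3 : ∀ T1' ∈ F, ∑ x ∈ G ×ˢ G, Y ((T1, T1'), x) ≤ ∑ T2' ∈ G, (C T1 / m T1) ^ 2 * μ T1 * W T1 * (D T2' ^ 2 * W T2') *
        (L * (if Cmp0 ψ B r W2 (om r T1) (om r T2') (om r T1') then μ T1' * W T1' else 0)) := by
      intro T1' hT1'
      rw [Finset.sum_product, Finset.sum_comm]
      refine Finset.sum_le_sum fun T2' hT2' => ?_
      have s4 : ∀ T2 ∈ G, Y ((T1, T1'), T2, T2') = (C T1 / m T1) ^ 2 * μ T1 * W T1 * (D T2' ^ 2 * W T2') * (μ T1' * W T1') *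
          (if Cmp ψ B r T1 T1' T2 T2' then W T2 else 0) := by
        intro T2 _
        simp only [hY]
        split_ifs
        · ring
        · ring
      rw [Finset.sum_congr rfl s4, ← Finset.mul_sum, mul_assoc]
      have n1 : 0 ≤ (C T1 / m T1) ^ 2 * μ T1 * W T1 * (D T2' ^ 2 * W T2') := by
        have := hμ0 T1; have := hW0 T1; have := hW0 T2'
        positivity
      refine mul_le_mul_of_nonneg_left ?_ n1
      have n2 : 0 ≤ μ T1' * W T1' := mul_nonneg (hμ0 _) (hW0 _)
      split_ifs with hc
      · rw [mul_comm]
        refine mul_le_mul_of_nonneg_right ?_ n2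
        rw [← Finset.sum_filter]
        refine hn ψ r hr0 (G.filter fun T2 => Cmp ψ B r T1 T1' T2 T2') (om r T1' + om r T2' - om r T1) (13 * B) hA0 ?_ (gp r p)
        intro T2 hT2
        have := (Finset.mem_filter.1 hT2).2.1
        convert this using 2
        abel
      · have : ∑ T2 ∈ G, (if Cmp ψ B r T1 T1' T2 T2' then W T2 else 0) = 0 := by
          refine Finset.sum_eq_zero fun T2 hT2 => if_neg fun h => hc ⟨om r T2, hG T2 hT2, h.1, h.2⟩
        rw [this]; simp
    refine (Finset.sum_le_sum s3).trans ?_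
    rw [Finset.sum_comm]
    have s5 : ∀ T2' ∈ G, ∑ T1' ∈ F, (C T1 / m T1) ^ 2 * μ T1 * W T1 * (D T2' ^ 2 * W T2') *
        (L * (if Cmp0 ψ B r W2 (om r T1) (om r T2') (om r T1') then μ T1' * W T1' else 0)) ≤
        (C T1 / m T1) ^ 2 * μ T1 * W T1 * (D T2' ^ 2 * W T2') * (L * (K * (c ^ 2)⁻¹ * D2)) := by
      intro T2' hT2'
      rw [← Finset.mul_sum, ← Finset.mul_sum]
      have n1 : 0 ≤ (C T1 / m T1) ^ 2 * μ T1 * W T1 * (D T2' ^ 2 * W T2') := by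
        have := hμ0 T1; have := hW0 T1; have := hW0 T2'
        positivity
      refine mul_le_mul_of_nonneg_left (mul_le_mul_of_nonneg_left ?_ hL0) n1
      rw [← Finset.sum_filter]
      refine hk ψ hψ r hr W1 W2 hT c hc0 hc1 (om r T1) (hF _ hT1) (om r T2') (hG _ hT2') (gp r p) Q (hsep p hp) G D hG _ ?_
      intro T hT
      exact ⟨hF _ (Finset.mem_filter.1 hT).1, (Finset.mem_filter.1 hT).2⟩
    refine (Finset.sum_le_sum s5).trans (le_of_eq ?_)
    rw [← Finset.sum_mul, ← Finset.mul_sum]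
    unfold Sg
    ring
  refine (Finset.sum_le_sum hpt).trans ?_
  rw [Finset.sum_comm]
  have hfin : ∀ T ∈ F, ∑ p ∈ P', (C T / m T) ^ 2 * μ T * (wt ψ r T (gp r p) * Sg ψ r G D p) * (L * (K * (c ^ 2)⁻¹ * D2)) ≤
      C T ^ 2 * (L * (K * (c ^ 2)⁻¹ * D2)) := by
    intro T _
    rw [← Finset.sum_mul, ← Finset.mul_sum]
    have n1 : 0 ≤ L * (K * (c ^ 2)⁻¹ * D2) := by positivity
    refine mul_le_mul_of_nonneg_right ?_ n1
    have h1 : ∑ p ∈ P', wt ψ r T (gp r p) * Sg ψ r G D p ≤ m T := mm_mono ψ r G D hP' T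
    have h2 : μ T ≤ m T := mm_mono ψ r G D hQ T
    have h3 : 0 ≤ m T := (hμ0 T).trans h2
    calc (C T / m T) ^ 2 * μ T * ∑ p ∈ P', wt ψ r T (gp r p) * Sg ψ r G D p ≤ (C T / m T) ^ 2 * m T * m T := by
          have h4 := hμ0 T
          have h5 : 0 ≤ ∑ p ∈ P', wt ψ r T (gp r p) * Sg ψ r G D p := mm_nonneg ψ r G D P' T
          gcongr
      _ ≤ C T ^ 2 := by
          rcases h3.eq_or_lt with h0 | h0
          · rw [← h0]; simp; positivity
          · apply le_of_eq; field_simp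
  refine (Finset.sum_le_sum hfin).trans (le_of_eq ?_)
  rw [← Finset.sum_mul]
  ring

end BAP

namespace BAP

/-! ### covering by grid windows -/

lemma win_one {r : ℝ} (hr : 0 < r) {p ξ : ℝ × ℝ × ℝ} (h : ‖ξ - p‖ ≤ r) : 1 ≤ win r p ξ := by
  have h1 : |ξ.1 - p.1| ≤ r := (norm_fst_le (ξ - p)).trans h
  have h2 : |ξ.2.1 - p.2.1| ≤ r := (norm_fst_le (ξ - p).2).trans ((norm_snd_le (ξ - p)).trans h)
  have h3 : |ξ.2.2 - p.2.2| ≤ r := (norm_snd_le (ξ - p).2).trans ((norm_snd_le (ξ - p)).trans h)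
  have key : ∀ t : ℝ, |t| ≤ r → 1 ≤ th (t / r) := by
    intro t ht
    apply th_one
    rw [abs_div, abs_of_pos hr, div_le_one hr]; exact ht
  unfold win
  exact one_le_mul_of_one_le_of_one_le (key _ h1) (one_le_mul_of_one_le_of_one_le (key _ h2) (key _ h3))

lemma cover {r : ℝ} (hr : 0 < r) {S : Set (ℝ × ℝ × ℝ)} (hSm : MeasurableSet S) (P : Finset (ℤ × ℤ × ℤ))
    (hS : ∀ ξ ∈ S, ∃ n ∈ P, ‖ξ - gp r n‖ ≤ r) (h : ℝ × ℝ × ℝ → ℝ) (h0 : ∀ ξ, 0 ≤ h ξ)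
    (hi : ∀ n ∈ P, Integrable (fun ξ => win r (gp r n) ξ * h ξ)) :
    ∫ ξ in S, h ξ ≤ ∑ n ∈ P, ∫ ξ, win r (gp r n) ξ * h ξ := by
  rw [← integral_finsetSum _ hi, ← integral_indicator hSm]
  refine integral_mono_of_nonneg (Filter.Eventually.of_forall fun ξ => ?_) (integrable_finsetSum _ hi)
    (Filter.Eventually.of_forall fun ξ => ?_)
  · exact Set.indicator_nonneg (fun x _ => h0 x) ξ
  · show S.indicator h ξ ≤ ∑ n ∈ P, win r (gp r n) ξ * h ξ
    have hn : ∀ n ∈ P, 0 ≤ win r (gp r n) ξ * h ξ := fun n _ => mul_nonneg (win_nonneg _ _ _) (h0 ξ)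
    by_cases hξ : ξ ∈ S
    · rw [Set.indicator_of_mem hξ]
      obtain ⟨n, hnP, hn1⟩ := hS ξ hξ
      refine le_trans ?_ (Finset.single_le_sum hn hnP)
      exact le_mul_of_one_le_left (h0 ξ) (win_one hr hn1)
    · rw [Set.indicator_of_notMem hξ]
      exact Finset.sum_nonneg hn

lemma sy_bdd (ψ : ℝ → ℝ) (r : ℝ) (F : Finset Idx) (b : Idx → ℂ) : ∃ K : ℝ, 0 ≤ K ∧ ∀ ξ, ‖sy ψ r F b ξ‖ ≤ K := by
  refine ⟨∑ T ∈ F, ‖b T‖ * ∫ z, ‖pk r T z‖, ?_, fun ξ => ?_⟩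
  · exact Finset.sum_nonneg fun T _ => mul_nonneg (norm_nonneg _) (integral_nonneg fun z => norm_nonneg _)
  · unfold sy
    refine (norm_sum_le _ _).trans (Finset.sum_le_sum fun T _ => ?_)
    rw [norm_mul]
    exact mul_le_mul_of_nonneg_left (EE_bound _ _ _) (norm_nonneg _)

lemma win_int_bdd {r : ℝ} (hr : 0 < r) (p : ℝ × ℝ × ℝ) {h : ℝ × ℝ × ℝ → ℝ} (hc : Continuous h) {K : ℝ}
    (hK : ∀ ξ, |h ξ| ≤ K) : Integrable (fun ξ => win r p ξ * h ξ) :=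
  Integrable.mul_bdd (c := K) (win_integrable hr p) hc.aestronglyMeasurable (Filter.Eventually.of_forall hK)

/-- the sum of a weight over grid points at a fixed height -/
lemma sumg : ∃ K : ℝ, 1 ≤ K ∧ ∀ (ψ : ℝ → ℝ) (r : ℝ), 0 < r → ∀ (T : Idx) (P : Finset (ℤ × ℤ × ℤ)) (N : Finset ℤ),
    (∀ n ∈ P, n.2.2 ∈ N) → ∑ n ∈ P, wt ψ r T (gp r n) ≤ K * N.card := by
  obtain ⟨K, hK, hl⟩ := lat2
  refine ⟨K, hK, ?_⟩
  intro ψ r hr T P N hN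
  classical
  rw [← Finset.sum_fiberwise_of_maps_to hN]
  rw [mul_comm, ← nsmul_eq_mul]
  refine Finset.sum_le_card_nsmul _ _ _ fun k _ => ?_
  have e1 : ∑ n ∈ P with n.2.2 = k, wt ψ r T (gp r n) =
      ∑ m ∈ (P.filter (fun n => n.2.2 = k)).image (fun n => (n.1, n.2.1)), wt ψ r T (gp r (m.1, m.2, k)) := by
    rw [Finset.sum_image]
    · refine Finset.sum_congr rfl fun n hn => ?_
      have := (Finset.mem_filter.1 hn).2
      rw [← this]
    · intro n hn n' hn' e
      have h1 := (Finset.mem_filter.1 hn).2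
      have h2 := (Finset.mem_filter.1 hn').2
      simp only [Prod.mk.injEq] at e
      ext
      · exact e.1
      · exact e.2
      · rw [h1, h2]
  rw [e1]
  set u := (r * k * (gr ψ (om r T)).1 - Real.pi * r * T.2.1) / r with hu
  set v := (r * k * (gr ψ (om r T)).2 - Real.pi * r * T.2.2) / r with hv
  refine le_trans (Finset.sum_le_sum fun m _ => ?_) (hl _ (-u) (-v) 1 le_rfl)
  unfold wt
  have e2 : sv ψ r T (gp r (m.1, m.2, k)) = -((-u - 1 * m.1, -v - 1 * m.2) : ℝ × ℝ) := by
    unfold sv gp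
    rw [hu, hv]
    ext <;> · simp only [Prod.neg_mk]; field_simp; ring
  rw [e2, norm_neg]
  gcongr
  · linarith [norm_nonneg ((-u - 1 * m.1, -v - 1 * m.2) : ℝ × ℝ)]
  · norm_num

/-- L2 bound on finite unions of grid cubes in a slab -/
lemma l2_slab (B : ℝ) (hB : 1 ≤ B) : ∃ K : ℝ, 1 ≤ K ∧ ∀ ψ, Reg ψ B → ∀ r : ℝ, 1 ≤ r →
    ∀ (F : Finset Idx), (∀ T ∈ F, Good B r T) → ∀ b : Idx → ℂ,
    ∀ (S : Set (ℝ × ℝ × ℝ)), MeasurableSet S → ∀ (P : Finset (ℤ × ℤ × ℤ)),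
    (∀ ξ ∈ S, ∃ n ∈ P, ‖ξ - gp r n‖ ≤ r) → (∀ n ∈ P, 0 ≤ n.2.2 ∧ (n.2.2 : ℝ) ≤ r) →
    ∫ ξ in S, ‖sy ψ r F b ξ‖ ^ 2 ≤ K * r ^ 2 * ∑ T ∈ F, ‖b T‖ ^ 2 := by
  obtain ⟨K, hK, hp⟩ := win_pair_sum B hB
  obtain ⟨K1, hK1, hn⟩ := sumv_near
  obtain ⟨K2, hK2, hg⟩ := sumg
  refine ⟨K * (K1 * (2 * 3 + 1) ^ 2) * (K2 * 2), ?_, ?_⟩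
  · refine one_le_mul_of_one_le_of_one_le (one_le_mul_of_one_le_of_one_le hK (one_le_mul_of_one_le_of_one_le hK1 (by norm_num))) (by linarith)
  intro ψ hψ r hr F hF b S hSm P hS hP
  have hr0 : 0 < r := by linarith
  obtain ⟨M, hM0, hM⟩ := sy_bdd ψ r F b
  have h1 := cover hr0 hSm P hS (fun ξ => ‖sy ψ r F b ξ‖ ^ 2) (fun ξ => sq_nonneg _) (fun n _ =>
    win_int_bdd hr0 _ (K := M ^ 2) ((sy_continuous hψ.1.continuous hr0 F b).norm.pow 2) (fun ξ => by
      rw [abs_of_nonneg (sq_nonneg _)]; exact pow_le_pow_left₀ (norm_nonneg _) (hM ξ) 2))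
  refine h1.trans ?_
  have hz : ∀ n ∈ P, |(gp r n).2.2| ≤ 4 * r ^ 2 := by
    intro n hn
    obtain ⟨a, c⟩ := hP n hn
    have a' : (0:ℝ) ≤ n.2.2 := by exact_mod_cast a
    show |r * (n.2.2 : ℝ)| ≤ _
    rw [abs_of_nonneg (by positivity)]
    nlinarith
  have h2 : ∀ n ∈ P, ∫ ξ, win r (gp r n) ξ * ‖sy ψ r F b ξ‖ ^ 2 ≤
      K * r * ∑ T ∈ F, ‖b T‖ ^ 2 * wt ψ r T (gp r n) * (K1 * (2 * 3 + 1) ^ 2) := by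
    intro n hnP
    refine (hp ψ hψ r hr F hF b (gp r n) (hz n hnP)).trans ?_
    refine mul_le_mul_of_nonneg_left ?_ (by positivity)
    set w : Idx → ℝ := fun T => wt ψ r T (gp r n) with hw
    have hw0 : ∀ T, 0 ≤ w T := fun T => (wt_pos _ _ _ _).le
    classical
    set E : Idx → Idx → Prop := fun T T' => ‖om r T - om r T'‖ ≤ 3 / r with hE
    have h3 : ∑ q ∈ F ×ˢ F, (if E q.1 q.2 then ‖b q.1‖ * ‖b q.2‖ * (w q.1 * w q.2) else 0) ≤
        ∑ q ∈ F ×ˢ F, ((if E q.1 q.2 then ‖b q.1‖ ^ 2 / 2 * (w q.1 * w q.2) else 0) +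
          (if E q.1 q.2 then ‖b q.2‖ ^ 2 / 2 * (w q.1 * w q.2) else 0)) := by
      refine Finset.sum_le_sum fun q _ => ?_
      split_ifs
      · rw [← add_mul]
        refine mul_le_mul_of_nonneg_right ?_ (mul_nonneg (hw0 _) (hw0 _))
        nlinarith [sq_nonneg (‖b q.1‖ - ‖b q.2‖)]
      · simp
    have hnear : ∀ T, ∑ T' ∈ F, (if E T' T then w T' else 0) ≤ K1 * (2 * 3 + 1) ^ 2 := by
      intro T
      rw [← Finset.sum_filter]
      exact hn ψ r hr0 _ (om r T) 3 (by norm_num) (fun T' hT' => (Finset.mem_filter.1 hT').2) _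
    have hsymm : ∀ T T', E T T' ↔ E T' T := by
      intro T T'
      simp only [hE]
      rw [norm_sub_rev]
    have h4 : ∀ T ∈ F, ‖b T‖ ^ 2 / 2 * w T * ∑ T' ∈ F, (if E T' T then w T' else 0) ≤
        ‖b T‖ ^ 2 / 2 * w T * (K1 * (2 * 3 + 1) ^ 2) := fun T _ =>
      mul_le_mul_of_nonneg_left (hnear T) (mul_nonneg (by positivity) (hw0 T))
    have h5 : ∑ q ∈ F ×ˢ F, (if E q.1 q.2 then ‖b q.1‖ ^ 2 / 2 * (w q.1 * w q.2) else 0) ≤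
        ∑ T ∈ F, ‖b T‖ ^ 2 / 2 * w T * (K1 * (2 * 3 + 1) ^ 2) := by
      rw [Finset.sum_product]
      refine Finset.sum_le_sum fun T hT => le_trans (le_of_eq ?_) (h4 T hT)
      rw [Finset.mul_sum]
      refine Finset.sum_congr rfl fun T' _ => ?_
      simp only [hsymm T T']
      split_ifs <;> ring
    have h6 : ∑ q ∈ F ×ˢ F, (if E q.1 q.2 then ‖b q.2‖ ^ 2 / 2 * (w q.1 * w q.2) else 0) ≤
        ∑ T ∈ F, ‖b T‖ ^ 2 / 2 * w T * (K1 * (2 * 3 + 1) ^ 2) := by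
      rw [Finset.sum_product_right]
      refine Finset.sum_le_sum fun T hT => le_trans (le_of_eq ?_) (h4 T hT)
      rw [Finset.mul_sum]
      refine Finset.sum_congr rfl fun T' _ => ?_
      split_ifs <;> ring
    have h7 : ∑ q ∈ F ×ˢ F, (if E q.1 q.2 then ‖b q.1‖ * ‖b q.2‖ * (w q.1 * w q.2) else 0) ≤
        ∑ T ∈ F, ‖b T‖ ^ 2 * w T * (K1 * (2 * 3 + 1) ^ 2) := by
      refine h3.trans ?_
      rw [Finset.sum_add_distrib]
      refine (add_le_add h5 h6).trans (le_of_eq ?_)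
      rw [← Finset.sum_add_distrib]
      exact Finset.sum_congr rfl fun T _ => by ring
    convert h7
  refine (Finset.sum_le_sum h2).trans ?_
  rw [← Finset.mul_sum, Finset.sum_comm]
  have hN : ∀ T, ∑ n ∈ P, wt ψ r T (gp r n) ≤ K2 * 2 * r := by
    intro T
    refine (hg ψ r hr0 T P (Finset.Icc 0 ⌊r⌋) (fun n hn => ?_)).trans ?_
    · rw [Finset.mem_Icc, Int.le_floor]
      exact hP n hn
    · rw [mul_assoc]
      refine mul_le_mul_of_nonneg_left ?_ (by linarith)
      rw [Int.card_Icc]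
      have : (0:ℤ) ≤ ⌊r⌋ := Int.floor_nonneg.2 hr0.le
      have e : (((⌊r⌋ + 1 - 0).toNat : ℕ) : ℝ) = ⌊r⌋ + 1 := by
        have : ((⌊r⌋ + 1 - 0).toNat : ℤ) = ⌊r⌋ + 1 := by omega
        exact_mod_cast this
      rw [e]
      linarith [Int.floor_le r]
  calc K * r * ∑ T ∈ F, ∑ n ∈ P, ‖b T‖ ^ 2 * wt ψ r T (gp r n) * (K1 * (2 * 3 + 1) ^ 2)
      ≤ K * r * ∑ T ∈ F, ‖b T‖ ^ 2 * (K2 * 2 * r) * (K1 * (2 * 3 + 1) ^ 2) := by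
        refine mul_le_mul_of_nonneg_left (Finset.sum_le_sum fun T _ => ?_) (by positivity)
        rw [← Finset.sum_mul, ← Finset.mul_sum]
        have := hN T
        have hK0 : 0 ≤ K1 := by linarith
        gcongr
    _ = _ := by
        rw [← Finset.sum_mul, ← Finset.sum_mul]
        ring

open Classical in
/-- L2 bound for the off-diagonal terms of a table -/
lemma l2_table (B : ℝ) (hB : 1 ≤ B) : ∃ K : ℝ, 1 ≤ K ∧ ∀ ψ, Reg ψ B → ∀ r : ℝ, 1 ≤ r →
    ∀ W1 W2, Trans ψ B W1 W2 → ∀ c : ℝ, 0 < c → c ≤ 1 →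
    ∀ (F G : Finset Idx) (C D D' : Idx → ℂ), (∀ T ∈ F, om r T ∈ W1) → (∀ T ∈ G, om r T ∈ W2) →
    (∀ T ∈ G, ‖D' T‖ ≤ ‖D T‖) →
    ∀ (Q P' P : Finset (ℤ × ℤ × ℤ)), Q ⊆ P → P' ⊆ P → (∀ n ∈ P, 0 ≤ n.2.2 ∧ (n.2.2 : ℝ) ≤ r) →
    (∀ p ∈ P', ∀ n ∈ Q, c * r ^ 2 ≤ |(gp r p).2.2 - (gp r n).2.2|) →
    ∀ (S : Set (ℝ × ℝ × ℝ)), MeasurableSet S → (∀ ξ ∈ S, ∃ n ∈ P', ‖ξ - gp r n‖ ≤ r) →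
    ∫ ξ in S, ‖sy ψ r F (fun T => (ac ψ r G (fun T => ‖D T‖) Q P T : ℂ) * C T) ξ‖ ^ 2 * ‖sy ψ r G D' ξ‖ ^ 2 ≤
    K * r⁻¹ * (c ^ 2)⁻¹ * ((∑ T ∈ F, ‖C T‖ ^ 2) * ∑ T ∈ G, ‖D T‖ ^ 2) := by
  obtain ⟨K, hK, hq⟩ := win_quad_sum B hB
  obtain ⟨K1, hK1, ht⟩ := table B hB
  refine ⟨K * K1, one_le_mul_of_one_le_of_one_le hK hK1, ?_⟩
  intro ψ hψ r hr W1 W2 hT c hc0 hc1 F G C D D' hF hG hD Q P' P hQ hP' hP hsep S hSm hS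
  have hr0 : 0 < r := by linarith
  set A : Idx → ℝ := ac ψ r G (fun T => ‖D T‖) Q P with hA
  have hA0 : ∀ T, 0 ≤ A T := fun T => div_nonneg (mm_nonneg _ _ _ _ _ _) (mm_nonneg _ _ _ _ _ _)
  obtain ⟨M1, hM10, hM1⟩ := sy_bdd ψ r F (fun T => (A T : ℂ) * C T)
  obtain ⟨M2, hM20, hM2⟩ := sy_bdd ψ r G D'
  have hz : ∀ n ∈ P', |(gp r n).2.2| ≤ 4 * r ^ 2 := by
    intro n hn
    obtain ⟨a, c⟩ := hP n (hP' hn)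
    have a' : (0:ℝ) ≤ n.2.2 := by exact_mod_cast a
    show |r * (n.2.2 : ℝ)| ≤ _
    rw [abs_of_nonneg (by positivity)]
    nlinarith
  have h1 := cover hr0 hSm P' hS (fun ξ => ‖sy ψ r F (fun T => (A T : ℂ) * C T) ξ‖ ^ 2 * ‖sy ψ r G D' ξ‖ ^ 2)
    (fun ξ => by positivity) (fun n _ =>
    win_int_bdd hr0 _ (K := M1 ^ 2 * M2 ^ 2) (((sy_continuous hψ.1.continuous hr0 F _).norm.pow 2).mul ((sy_continuous hψ.1.continuous hr0 G _).norm.pow 2)) (fun ξ => by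
      rw [abs_of_nonneg (by positivity)]
      have := hM1 ξ
      have := hM2 ξ
      gcongr))
  refine h1.trans ?_
  have h2 := Finset.sum_le_sum fun n (hn : n ∈ P') => hq ψ hψ r hr F G (fun T h => ⟨(hT.bd1 _ (hF T h)).1, (hT.bd1 _ (hF T h)).2⟩)
    (fun T h => ⟨(hT.bd2 _ (hG T h)).1, (hT.bd2 _ (hG T h)).2⟩) (fun T => (A T : ℂ) * C T) D' (gp r n) (hz n hn)
  refine h2.trans ?_
  rw [← Finset.mul_sum]
  have h3 := ht ψ hψ r hr W1 W2 hT c hc0 hc1 F G (fun T => ‖C T‖) (fun T => ‖D T‖) hF hG Q P' P hQ hP' hsep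
  calc _ ≤ K * r⁻¹ * (K1 * (c ^ 2)⁻¹ * ((∑ T ∈ F, ‖C T‖ ^ 2) * ∑ T ∈ G, ‖D T‖ ^ 2)) := by
        refine mul_le_mul_of_nonneg_left ?_ (by positivity)
        refine le_trans (Finset.sum_le_sum fun p _ => Finset.sum_le_sum fun q hqm => ?_) h3
        simp only [Finset.mem_product] at hqm
        split_ifs with hc
        · have e : ∀ T, ‖(A T : ℂ) * C T‖ = A T * ‖C T‖ := by
            intro T
            rw [norm_mul, Complex.norm_real, Real.norm_of_nonneg (hA0 T)]
          rw [e, e]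
          have a1 := hD _ hqm.2.1
          have a2 := hD _ hqm.2.2
          have a3 := hA0 q.1.1
          have a4 := hA0 q.1.2
          have b1 := (wt_pos ψ r q.1.1 (gp r p)).le
          have b2 := (wt_pos ψ r q.1.2 (gp r p)).le
          have b3 := (wt_pos ψ r q.2.1 (gp r p)).le
          have b4 := (wt_pos ψ r q.2.2 (gp r p)).le
          gcongr
        · exact le_rfl
    _ = _ := by ring

end BAP

namespace BAP

/-! ### Fourier series on packet boxes -/
section torus
attribute [local instance] instMeasureSpaceUnitAddCircle

abbrev T2 := UnitAddTorus (Fin 2)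

/-- the box of index `k` -/
def bx (r : ℝ) (k : ℤ × ℤ) : Set (ℝ × ℝ) :=
  Ioc ((k.1 - 1) / r) ((k.1 + 1) / r) ×ˢ Ioc ((k.2 - 1) / r) ((k.2 + 1) / r)

lemma bx_meas (r : ℝ) (k : ℤ × ℤ) : MeasurableSet (bx r k) := measurableSet_Ioc.prod measurableSet_Ioc

/-- the torus point of `z` -/
def tp (r : ℝ) (z : ℝ × ℝ) : T2 := fun i => ((r / 2 * (![z.1, z.2] i) : ℝ) : UnitAddCircle)

lemma tor {r : ℝ} (hr : 0 < r) (k : ℤ × ℤ) (h : T2 → ℝ≥0∞) :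
    ∫⁻ x : T2, h x = ENNReal.ofReal (r ^ 2 / 4) * ∫⁻ z in bx r k, h (tp r z) := by
  rw [UnitAddTorus.lintegral_preimage h ![(k.1 - 1) / 2, (k.2 - 1) / 2]]
  have hmp := volume_preserving_finTwoArrow ℝ
  have hc : (2 / r : ℝ) ≠ 0 := by positivity
  have hmap := Measure.map_addHaar_smul (volume : Measure (ℝ × ℝ)) hc
  have hme : MeasurableEmbedding (fun x : ℝ × ℝ => (2 / r : ℝ) • x) := (Homeomorph.smulOfNeZero _ hc).measurableEmbedding
  have hfr : Module.finrank ℝ (ℝ × ℝ) = 2 := by simp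
  rw [hfr] at hmap
  have hco : |((2 / r) ^ 2)⁻¹| = r ^ 2 / 4 := by
    rw [abs_of_pos (by positivity)]; field_simp; norm_num
  rw [hco] at hmap
  set g : ℝ × ℝ → ℝ≥0∞ := (bx r k).indicator (fun z => h (tp r z)) with hg
  have e1 : ∫⁻ z, g ((2 / r : ℝ) • z) = ENNReal.ofReal (r ^ 2 / 4) * ∫⁻ z, g z := by
    rw [← hme.lintegral_map g, hmap, lintegral_smul_measure, smul_eq_mul]
  have e2 : ∫⁻ z in bx r k, h (tp r z) = ∫⁻ z, g z := (lintegral_indicator (bx_meas r k) _).symm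
  rw [e2, ← e1, ← hmp.lintegral_comp_emb (MeasurableEquiv.measurableEmbedding _)]
  rw [← lintegral_indicator]
  · refine lintegral_congr fun x => ?_
    have e3 : (MeasurableEquiv.finTwoArrow x : ℝ × ℝ) = (x 0, x 1) := rfl
    rw [e3]
    have e4 : ((2 / r : ℝ) • ((x 0, x 1) : ℝ × ℝ)) = (2 / r * x 0, 2 / r * x 1) := rfl
    rw [e4, hg]
    have e5 : x ∈ {x : Fin 2 → ℝ | ∀ i, x i ∈ Ioc ((![((k.1:ℝ) - 1) / 2, ((k.2:ℝ) - 1) / 2]) i) ((![((k.1:ℝ) - 1) / 2, ((k.2:ℝ) - 1) / 2]) i + 1)} ↔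
        ((2 / r * x 0, 2 / r * x 1) : ℝ × ℝ) ∈ bx r k := by
      unfold bx
      simp only [mem_ofPred_eq, Fin.forall_fin_two, Matrix.cons_val_zero, Matrix.cons_val_one, mem_prod, mem_Ioc]
      rw [div_lt_iff₀ hr, le_div_iff₀ hr, div_lt_iff₀ hr, le_div_iff₀ hr]
      have f1 : ∀ t : ℝ, 2 / r * t * r = 2 * t := by intro t; field_simp
      rw [f1, f1]
      constructor
      · rintro ⟨⟨a, b⟩, c, d⟩; refine ⟨⟨?_, ?_⟩, ?_, ?_⟩ <;> linarith
      · rintro ⟨⟨a, b⟩, c, d⟩; refine ⟨⟨?_, ?_⟩, ?_, ?_⟩ <;> linarith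
    by_cases hx : ((2 / r * x 0, 2 / r * x 1) : ℝ × ℝ) ∈ bx r k
    · rw [Set.indicator_of_mem hx, Set.indicator_of_mem (e5.2 hx)]
      congr 1
      funext i
      unfold tp
      congr 1
      fin_cases i
      · simp; field_simp
      · simp; field_simp
    · rw [Set.indicator_of_notMem hx, Set.indicator_of_notMem (fun h' => hx (e5.1 h'))]
  · have : {x : Fin 2 → ℝ | ∀ i, x i ∈ Ioc ((![((k.1:ℝ) - 1) / 2, ((k.2:ℝ) - 1) / 2]) i) ((![((k.1:ℝ) - 1) / 2, ((k.2:ℝ) - 1) / 2]) i + 1)} =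
      Set.pi univ (fun i => Ioc ((![((k.1:ℝ) - 1) / 2, ((k.2:ℝ) - 1) / 2]) i) ((![((k.1:ℝ) - 1) / 2, ((k.2:ℝ) - 1) / 2]) i + 1)) := by
        ext x; simp
    rw [this]
    exact MeasurableSet.univ_pi fun i => measurableSet_Ioc

/-- the exponentials -/
def ex (r : ℝ) (m : ℤ × ℤ) (z : ℝ × ℝ) : ℂ := ee (-(Real.pi * r * (m.1 * z.1 + m.2 * z.2)))

lemma ex_fourier (r : ℝ) (m : ℤ × ℤ) (z : ℝ × ℝ) : UnitAddTorus.mFourier ![m.1, m.2] (tp r z) = ex r m z := by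
  unfold ex ee tp UnitAddTorus.mFourier
  simp only [ContinuousMap.coe_mk, Fin.prod_univ_two, Matrix.cons_val_zero, Matrix.cons_val_one, fourier_coe_apply]
  rw [← Complex.exp_add]
  congr 1
  push_cast
  ring

lemma box_synth {r : ℝ} (hr : 0 < r) (k : ℤ × ℤ) (S : Finset (ℤ × ℤ)) (b : ℤ × ℤ → ℂ) :
    ∫⁻ z in bx r k, ‖((r / 2 : ℝ) : ℂ) * ∑ m ∈ S, b m * ex r m z‖ₑ ^ 2 = ENNReal.ofReal (∑ m ∈ S, ‖b m‖ ^ 2) := by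
  have horth := UnitAddTorus.orthonormal_mFourier (d := Fin 2)
  set ι : ℤ × ℤ → (Fin 2 → ℤ) := fun m => ![m.1, m.2] with hι
  have hinj : Function.Injective ι := by
    intro m m' h
    have h0 := congrFun h 0
    have h1 := congrFun h 1
    simp [hι] at h0 h1
    ext <;> assumption
  have ho2 := horth.comp ι hinj
  set v : Lp ℂ 2 (volume : Measure T2) := ∑ m ∈ S, b m • UnitAddTorus.mFourierLp 2 (ι m) with hv
  have hn : ‖v‖ ^ 2 = ∑ m ∈ S, ‖b m‖ ^ 2 := by
    have h1 := ho2.inner_sum b b S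
    have h2 : (inner ℂ v v : ℂ) = ∑ m ∈ S, (starRingEnd ℂ) (b m) * b m := by rw [hv]; exact h1
    rw [inner_self_eq_norm_sq_to_K] at h2
    have h3 : ((‖v‖ ^ 2 : ℝ) : ℂ) = ((∑ m ∈ S, ‖b m‖ ^ 2 : ℝ) : ℂ) := by
      push_cast
      refine Eq.trans ?_ (h2.trans (Finset.sum_congr rfl fun m _ => ?_))
      · rfl
      · rw [Complex.conj_mul']
    exact_mod_cast h3
  have hae : (v : T2 → ℂ) =ᵐ[volume] fun x => ∑ m ∈ S, b m * UnitAddTorus.mFourier (ι m) x := by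
    have h1 := Lp.coeFn_finsetSum S (fun m => b m • UnitAddTorus.mFourierLp (d := Fin 2) 2 (ι m))
    have h2 : ∀ᵐ x ∂(volume : Measure T2), ∀ m ∈ S, (b m • UnitAddTorus.mFourierLp (d := Fin 2) 2 (ι m) : Lp ℂ 2 (volume : Measure T2)) x = b m * UnitAddTorus.mFourier (ι m) x := by
      rw [Filter.eventually_all_finset]
      intro m _
      filter_upwards [Lp.coeFn_smul (b m) (UnitAddTorus.mFourierLp (d := Fin 2) 2 (ι m)), UnitAddTorus.coeFn_mFourierLp (d := Fin 2) 2 (ι m)] with x hx1 hx2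
      rw [hx1, Pi.smul_apply, hx2, smul_eq_mul]
    filter_upwards [h1, h2] with x hx1 hx2
    rw [hv, hx1]
    simp only [Finset.sum_apply]
    exact Finset.sum_congr rfl fun m hm => hx2 m hm
  have h5 : ∫⁻ x : T2, ‖∑ m ∈ S, b m * UnitAddTorus.mFourier (ι m) x‖ₑ ^ 2 = ENNReal.ofReal (‖v‖ ^ 2) := by
    have h6 : ∫⁻ x : T2, ‖∑ m ∈ S, b m * UnitAddTorus.mFourier (ι m) x‖ₑ ^ 2 = ∫⁻ x : T2, ‖v x‖ₑ ^ 2 := by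
      refine lintegral_congr_ae ?_
      filter_upwards [hae] with x hx
      rw [hx]
    rw [h6]
    have h7 := eLpNorm_nnreal_pow_eq_lintegral (μ := (volume : Measure T2)) (f := v) (p := 2) (by norm_num)
    have h8 : eLpNorm v 2 volume = ENNReal.ofReal ‖v‖ := by
      rw [Lp.norm_def, ENNReal.ofReal_toReal (Lp.eLpNorm_ne_top v)]
    norm_num at h7
    rw [← h7, h8, ENNReal.ofReal_pow (norm_nonneg _)]
  rw [tor hr k] at h5
  rw [← hn, ← h5, ← lintegral_const_mul']
  · refine lintegral_congr fun z => ?_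
    rw [enorm_mul, mul_pow]
    congr 1
    · rw [← ofReal_norm, Complex.norm_real, Real.norm_of_nonneg (by positivity), ← ENNReal.ofReal_pow (by positivity)]
      congr 1; ring
    · congr 2
      exact Finset.sum_congr rfl fun m _ => by rw [hι, ex_fourier]
  · exact ENNReal.ofReal_ne_top

lemma box_approx {r : ℝ} (hr : 0 < r) (k : ℤ × ℤ) (h : ℝ × ℝ → ℂ) (hm : Measurable h)
    (hfin : ∫⁻ z in bx r k, ‖h z‖ₑ ^ 2 ≠ ⊤) {κ : ℝ} (hκ : 0 < κ) :
    ∃ (S : Finset (ℤ × ℤ)) (b : ℤ × ℤ → ℂ), ENNReal.ofReal (∑ m ∈ S, ‖b m‖ ^ 2) ≤ ∫⁻ z in bx r k, ‖h z‖ₑ ^ 2 ∧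
      ∫⁻ z in bx r k, ‖h z - ((r / 2 : ℝ) : ℂ) * ∑ m ∈ S, b m * ex r m z‖ₑ ^ 2 ≤ ENNReal.ofReal κ := by
  set a : Fin 2 → ℝ := ![((k.1:ℝ) - 1) / 2, ((k.2:ℝ) - 1) / 2] with ha
  set inv : T2 → ℝ × ℝ := fun x => (2 / r * (UnitAddTorus.measurableEquivPiIoc a x).1 0, 2 / r * (UnitAddTorus.measurableEquivPiIoc a x).1 1) with hinv
  have hinvm : Measurable inv := by
    have h1 : Measurable fun x => (UnitAddTorus.measurableEquivPiIoc a x).1 := measurable_subtype_coe.comp (UnitAddTorus.measurableEquivPiIoc a).measurable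
    have h2 : ∀ i, Measurable fun x => (UnitAddTorus.measurableEquivPiIoc a x).1 i := fun i => (measurable_pi_apply i).comp h1
    exact ((h2 0).const_mul _).prodMk ((h2 1).const_mul _)
  have hpt : ∀ z ∈ bx r k, inv (tp r z) = z := by
    intro z hz
    obtain ⟨⟨z1, z2⟩, z3, z4⟩ := hz
    rw [div_lt_iff₀ hr] at z1 z3
    rw [le_div_iff₀ hr] at z2 z4
    have h0 : (r / 2 * z.1) ∈ Ioc (a 0) (a 0 + 1) := by
      simp only [ha, Matrix.cons_val_zero]
      constructor <;> linarith
    have h1 : (r / 2 * z.2) ∈ Ioc (a 1) (a 1 + 1) := by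
      simp only [ha, Matrix.cons_val_one, Matrix.cons_val_zero]
      constructor <;> linarith
    have e0 := AddCircle.equivIoc_coe_eq (p := (1:ℝ)) h0
    have e1 := AddCircle.equivIoc_coe_eq (p := (1:ℝ)) h1
    have g0 : (UnitAddTorus.measurableEquivPiIoc a (tp r z)).1 0 = r / 2 * z.1 := congrArg Subtype.val e0
    have g1 : (UnitAddTorus.measurableEquivPiIoc a (tp r z)).1 1 = r / 2 * z.2 := congrArg Subtype.val e1
    simp only [hinv, g0, g1]
    ext <;> · simp only; field_simp
  set c2 : ℂ := ((r / 2 : ℝ) : ℂ) with hc2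
  have hc20 : c2 ≠ 0 := by rw [hc2]; exact_mod_cast (by positivity : r / 2 ≠ 0)
  have hc2e : ‖c2‖ₑ ^ 2 = ENNReal.ofReal (r ^ 2 / 4) := by
    rw [← ofReal_norm, hc2, Complex.norm_real, Real.norm_of_nonneg (by positivity), ← ENNReal.ofReal_pow (by positivity)]
    congr 1; ring
  set H : T2 → ℂ := fun x => c2⁻¹ * h (inv x) with hH
  have hHm : Measurable H := (hm.comp hinvm).const_mul _
  have hkey : ∀ (g : T2 → ℂ), ∫⁻ x : T2, ‖H x - g x‖ₑ ^ 2 = ∫⁻ z in bx r k, ‖h z - c2 * g (tp r z)‖ₑ ^ 2 := by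
    intro g
    rw [tor hr k, ← lintegral_const_mul' _ _ ENNReal.ofReal_ne_top]
    refine setLIntegral_congr_fun (bx_meas r k) fun z hz => ?_
    rw [← hc2e, ← mul_pow, ← enorm_mul]
    congr 2
    simp only [hH]
    rw [hpt z hz]
    field_simp
  have hH2 : ∫⁻ x : T2, ‖H x‖ₑ ^ 2 = ∫⁻ z in bx r k, ‖h z‖ₑ ^ 2 := by
    have := hkey (fun _ => 0)
    simpa using this
  have hpow : ∀ g : T2 → ℂ, eLpNorm g 2 volume ^ 2 = ∫⁻ x : T2, ‖g x‖ₑ ^ 2 := by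
    intro g
    have h7 := eLpNorm_nnreal_pow_eq_lintegral (μ := (volume : Measure T2)) (f := g) (p := 2) (by norm_num)
    norm_num at h7
    exact h7
  have hmem : MemLp H 2 (volume : Measure T2) := by
    refine ⟨hHm.aestronglyMeasurable, ?_⟩
    have := hpow H
    rw [hH2] at this
    by_contra hcon
    rw [not_lt, top_le_iff] at hcon
    rw [hcon] at this
    simp at this
    exact hfin this.symm
  set v : Lp ℂ 2 (volume : Measure T2) := hmem.toLp H with hv
  have hs := UnitAddTorus.hasSum_mFourier_series_L2 v
  have horth := UnitAddTorus.orthonormal_mFourier (d := Fin 2)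
  obtain ⟨S0, hS0⟩ := (Metric.tendsto_atTop.1 hs (Real.sqrt κ) (Real.sqrt_pos.2 hκ))
  have hS1 := hS0 S0 le_rfl
  classical
  set cf := fun n => UnitAddTorus.mFourierCoeff v n with hcf
  set ι : ℤ × ℤ → (Fin 2 → ℤ) := fun m => ![m.1, m.2] with hι
  set S : Finset (ℤ × ℤ) := S0.image (fun n => (n 0, n 1)) with hS
  have hre : ∀ {M : Type} [AddCommMonoid M] (f : (Fin 2 → ℤ) → M), ∑ m ∈ S, f (ι m) = ∑ n ∈ S0, f n := by
    intro M _ f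
    rw [hS, Finset.sum_image]
    · refine Finset.sum_congr rfl fun n _ => ?_
      congr 1
      funext i; fin_cases i <;> simp [hι]
    · intro n _ n' _ e
      simp only [Prod.mk.injEq] at e
      funext i; fin_cases i
      · exact e.1
      · exact e.2
  refine ⟨S, fun m => cf (ι m), ?_, ?_⟩
  · rw [hre (fun n => ‖cf n‖ ^ 2)]
    have hb := horth.sum_inner_products_le v (s := S0)
    have e : ∀ n, inner ℂ (UnitAddTorus.mFourierLp 2 n) v = cf n := by
      intro n
      rw [hcf]
      simp only
      rw [← UnitAddTorus.mFourierBasis_repr, HilbertBasis.repr_apply_apply, UnitAddTorus.coe_mFourierBasis]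
    simp only [e] at hb
    rw [← hH2, ← hpow H]
    have h8 : eLpNorm H 2 volume = ENNReal.ofReal ‖v‖ := by
      rw [hv, Lp.norm_toLp, ENNReal.ofReal_toReal hmem.2.ne]
    rw [h8, ← ENNReal.ofReal_pow (norm_nonneg _)]
    exact ENNReal.ofReal_le_ofReal hb
  · have h9 := hkey (fun x => ∑ n ∈ S0, cf n * UnitAddTorus.mFourier n x)
    have e1 : ∫⁻ z in bx r k, ‖h z - c2 * ∑ m ∈ S, cf (ι m) * ex r m z‖ₑ ^ 2 =
        ∫⁻ z in bx r k, ‖h z - c2 * ∑ n ∈ S0, cf n * UnitAddTorus.mFourier n (tp r z)‖ₑ ^ 2 := by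
      refine lintegral_congr fun z => ?_
      rw [← hre (fun n => cf n * UnitAddTorus.mFourier n (tp r z))]
      simp only [hι, ex_fourier]
    rw [e1, ← h9, ← hpow]
    have hae : (v - ∑ n ∈ S0, cf n • UnitAddTorus.mFourierLp 2 n : Lp ℂ 2 (volume : Measure T2)) =ᵐ[volume] fun x => H x - ∑ n ∈ S0, cf n * UnitAddTorus.mFourier n x := by
      have h1 := Lp.coeFn_finsetSum S0 (fun n => cf n • UnitAddTorus.mFourierLp (d := Fin 2) 2 n)
      have h2 : ∀ᵐ x ∂(volume : Measure T2), ∀ m ∈ S0, (cf m • UnitAddTorus.mFourierLp (d := Fin 2) 2 m : Lp ℂ 2 (volume : Measure T2)) x = cf m * UnitAddTorus.mFourier m x := by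
        rw [Filter.eventually_all_finset]
        intro m _
        filter_upwards [Lp.coeFn_smul (cf m) (UnitAddTorus.mFourierLp (d := Fin 2) 2 m), UnitAddTorus.coeFn_mFourierLp (d := Fin 2) 2 m] with x hx1 hx2
        rw [hx1, Pi.smul_apply, hx2, smul_eq_mul]
      filter_upwards [h1, h2, Lp.coeFn_sub v (∑ n ∈ S0, cf n • UnitAddTorus.mFourierLp 2 n), hmem.coeFn_toLp] with x hx1 hx2 hx3 hx4
      rw [hx3, Pi.sub_apply, hx1, hv, hx4]
      simp only [Finset.sum_apply]
      congr 1
      exact Finset.sum_congr rfl fun m hm => hx2 m hm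
    rw [← eLpNorm_congr_ae hae]
    have h8 : eLpNorm (v - ∑ n ∈ S0, cf n • UnitAddTorus.mFourierLp 2 n : Lp ℂ 2 (volume : Measure T2)) 2 volume =
        ENNReal.ofReal ‖v - ∑ n ∈ S0, cf n • UnitAddTorus.mFourierLp 2 n‖ := by
      rw [Lp.norm_def, ENNReal.ofReal_toReal (Lp.eLpNorm_ne_top _)]
    rw [h8, ← ENNReal.ofReal_pow (norm_nonneg _)]
    apply ENNReal.ofReal_le_ofReal
    rw [dist_comm, dist_eq_norm] at hS1
    calc ‖v - ∑ n ∈ S0, cf n • UnitAddTorus.mFourierLp 2 n‖ ^ 2 ≤ (Real.sqrt κ) ^ 2 := by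
          exact pow_le_pow_left₀ (norm_nonneg _) hS1.le 2
      _ = κ := Real.sq_sqrt hκ.le

end torus

end BAP

namespace BAP

/-- planar cutoffs -/
def ck (r : ℝ) (k : ℤ × ℤ) (z : ℝ × ℝ) : ℝ := chi (r * z.1 - k.1) * chi (r * z.2 - k.2)

lemma ck_continuous (r : ℝ) (k : ℤ × ℤ) : Continuous (ck r k) := by
  unfold ck
  have := chi_continuous
  fun_prop

lemma ex_continuous (r : ℝ) (m : ℤ × ℤ) : Continuous (ex r m) := by
  unfold ex
  have := ee_continuous
  fun_prop

lemma pk_eq (r : ℝ) (T : Idx) (z : ℝ × ℝ) : pk r T z = (ck r T.1 z : ℂ) * (((r / 2 : ℝ) : ℂ) * ex r T.2 z) := by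
  unfold pk ck ex
  push_cast
  ring

lemma ck_near {r : ℝ} (hr : 0 < r) {k : ℤ × ℤ} {z : ℝ × ℝ} (h : ck r k z ≠ 0) : ‖z - kp r k‖ < 1 / r := by
  unfold ck at h
  have h1 : |r * z.1 - k.1| < 1 := by
    by_contra hc; push Not at hc; exact h (by rw [chi_eq_zero hc, zero_mul])
  have h2 : |r * z.2 - k.2| < 1 := by
    by_contra hc; push Not at hc; exact h (by rw [chi_eq_zero hc, mul_zero])
  have key : ∀ (t : ℝ) (m : ℤ), |r * t - m| < 1 → |t - m / r| < 1 / r := by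
    intro t m ht
    have : t - m / r = (r * t - m) / r := by field_simp
    rw [this, abs_div, abs_of_pos hr]
    exact div_lt_div_of_pos_right ht hr
  rw [Prod.norm_def, max_lt_iff]
  exact ⟨key _ _ h1, key _ _ h2⟩

lemma ck_bx {r : ℝ} (hr : 0 < r) {k : ℤ × ℤ} {z : ℝ × ℝ} (h : ck r k z ≠ 0) : z ∈ bx r k := by
  have h1 := ck_near hr h
  rw [Prod.norm_def, max_lt_iff] at h1
  have a1 := abs_lt.1 h1.1
  have a2 := abs_lt.1 h1.2
  simp only [Prod.fst_sub, Prod.snd_sub, kp] at a1 a2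
  unfold bx
  rw [mem_prod, mem_Ioc, mem_Ioc]
  simp only [sub_div, add_div]
  refine ⟨⟨?_, ?_⟩, ?_, ?_⟩ <;> linarith

lemma ck_sum_prod (r : ℝ) (S1 S2 : Finset ℤ) (z : ℝ × ℝ) :
    ∑ k ∈ S1 ×ˢ S2, ck r k z ^ 2 = (∑ k ∈ S1, chi (r * z.1 - k) ^ 2) * ∑ k ∈ S2, chi (r * z.2 - k) ^ 2 := by
  rw [Finset.sum_mul_sum, Finset.sum_product]
  refine Finset.sum_congr rfl fun a _ => Finset.sum_congr rfl fun b _ => ?_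
  unfold ck; ring

lemma ck_sum_le (r : ℝ) (S : Finset (ℤ × ℤ)) (z : ℝ × ℝ) : ∑ k ∈ S, ck r k z ^ 2 ≤ 1 := by
  classical
  have h1 : S ⊆ S.image Prod.fst ×ˢ S.image Prod.snd := by
    intro k hk
    rw [Finset.mem_product]
    exact ⟨Finset.mem_image_of_mem _ hk, Finset.mem_image_of_mem _ hk⟩
  refine (Finset.sum_le_sum_of_subset_of_nonneg h1 fun k _ _ => sq_nonneg _).trans ?_
  rw [ck_sum_prod]
  exact mul_le_one₀ (chi_sum_le _ _) (Finset.sum_nonneg fun k _ => sq_nonneg _) (chi_sum_le _ _)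

lemma glue {r : ℝ} (hr : 0 < r) (S : Finset (ℤ × ℤ)) (G : ℤ × ℤ → ℝ × ℝ → ℂ) (hG : ∀ k ∈ S, Measurable (G k)) :
    ∫⁻ z, ‖∑ k ∈ S, (ck r k z : ℂ) * G k z‖ₑ ^ 2 ≤ ∑ k ∈ S, ∫⁻ z in bx r k, ‖G k z‖ₑ ^ 2 := by
  have h1 : ∀ k ∈ S, ∫⁻ z in bx r k, ‖G k z‖ₑ ^ 2 = ∫⁻ z, (bx r k).indicator (fun z => ‖G k z‖ₑ ^ 2) z := fun k _ =>
    (lintegral_indicator (bx_meas r k) _).symm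
  rw [Finset.sum_congr rfl h1, ← lintegral_finsetSum']
  · refine lintegral_mono fun z => ?_
    set x : ℤ × ℤ → ℝ := (fun k => (bx r k).indicator (fun z => ‖G k z‖) z) with hx
    have hx0 : ∀ k, 0 ≤ x k := fun k => Set.indicator_nonneg (fun _ _ => norm_nonneg _) z
    have h2 : ‖∑ k ∈ S, (ck r k z : ℂ) * G k z‖ ≤ ∑ k ∈ S, |ck r k z| * x k := by
      refine (norm_sum_le _ _).trans (Finset.sum_le_sum fun k _ => ?_)
      rw [norm_mul, Complex.norm_real, Real.norm_eq_abs]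
      by_cases h0 : ck r k z = 0
      · rw [h0]; simp
      · rw [hx]; simp only
        rw [Set.indicator_of_mem (ck_bx hr h0)]
    have h3 : (∑ k ∈ S, |ck r k z| * x k) ^ 2 ≤ ∑ k ∈ S, x k ^ 2 := by
      refine (Finset.sum_mul_sq_le_sq_mul_sq S (fun k => |ck r k z|) x).trans ?_
      refine mul_le_of_le_one_left (Finset.sum_nonneg fun k _ => sq_nonneg _) ?_
      simp only [sq_abs]
      exact ck_sum_le r S z
    have h4 : ‖∑ k ∈ S, (ck r k z : ℂ) * G k z‖ ^ 2 ≤ ∑ k ∈ S, x k ^ 2 :=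
      (pow_le_pow_left₀ (norm_nonneg _) h2 2).trans h3
    have h5 := ENNReal.ofReal_le_ofReal h4
    rw [ENNReal.ofReal_pow (norm_nonneg _), ofReal_norm, ENNReal.ofReal_sum_of_nonneg (fun k _ => sq_nonneg _)] at h5
    refine h5.trans (Finset.sum_le_sum fun k _ => le_of_eq ?_)
    rw [hx]
    simp only
    by_cases hz : z ∈ bx r k
    · rw [Set.indicator_of_mem hz, Set.indicator_of_mem hz, ENNReal.ofReal_pow (norm_nonneg _), ofReal_norm]
    · rw [Set.indicator_of_notMem hz, Set.indicator_of_notMem hz]; simp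
  · intro k hk
    exact (((hG k hk).enorm.pow_const 2).indicator (bx_meas r k)).aemeasurable

lemma box_meas (r : ℝ) (S : Finset (ℤ × ℤ)) (b : ℤ × ℤ → ℂ) : Measurable (fun z => ((r / 2 : ℝ) : ℂ) * ∑ m ∈ S, b m * ex r m z) := by
  apply Continuous.measurable
  have : ∀ m, Continuous (ex r m) := ex_continuous r
  fun_prop

lemma synth {r : ℝ} (hr : 0 < r) (F : Finset Idx) (b : Idx → ℂ) :
    ∫⁻ z, ‖∑ T ∈ F, b T * pk r T z‖ₑ ^ 2 ≤ ENNReal.ofReal (∑ T ∈ F, ‖b T‖ ^ 2) := by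
  classical
  set S := F.image Prod.fst with hS
  set N := F.image Prod.snd with hN
  set d : Idx → ℂ := fun T => if T ∈ F then b T else 0 with hd
  have hsub : F ⊆ S ×ˢ N := by
    intro T hT
    rw [Finset.mem_product]
    exact ⟨Finset.mem_image_of_mem _ hT, Finset.mem_image_of_mem _ hT⟩
  have e1 : ∀ z, ∑ T ∈ F, b T * pk r T z = ∑ k ∈ S, (ck r k z : ℂ) * (((r / 2 : ℝ) : ℂ) * ∑ m ∈ N, d (k, m) * ex r m z) := by
    intro z
    have : ∑ T ∈ F, b T * pk r T z = ∑ T ∈ S ×ˢ N, d T * pk r T z := by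
      rw [← Finset.sum_subset hsub]
      · refine Finset.sum_congr rfl fun T hT => ?_
        simp only [hd, hT, if_true]
      · intro T _ hT
        simp only [hd, hT, if_false, zero_mul]
    rw [this, Finset.sum_product]
    refine Finset.sum_congr rfl fun k _ => ?_
    rw [Finset.mul_sum, Finset.mul_sum]
    refine Finset.sum_congr rfl fun m _ => ?_
    rw [pk_eq]; ring
  simp only [e1]
  refine (glue hr S (fun k z => ((r / 2 : ℝ) : ℂ) * ∑ m ∈ N, d (k, m) * ex r m z) (fun k _ => box_meas r N _)).trans ?_
  simp only [box_synth hr]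
  rw [← ENNReal.ofReal_sum_of_nonneg (fun k _ => Finset.sum_nonneg fun m _ => sq_nonneg _)]
  apply ENNReal.ofReal_le_ofReal
  rw [← Finset.sum_product' S N (fun k m => ‖d (k, m)‖ ^ 2)]
  apply le_of_eq
  have : ∑ T ∈ F, ‖b T‖ ^ 2 = ∑ T ∈ S ×ˢ N, ‖d T‖ ^ 2 := by
    rw [← Finset.sum_subset hsub]
    · refine Finset.sum_congr rfl fun T hT => ?_
      simp only [hd, hT, if_true]
    · intro T _ hT
      simp [hd, hT]
  rw [this]

lemma approx {r : ℝ} (hr : 0 < r) (f : ℝ × ℝ → ℂ) (hm : Measurable f) (hfin : ∫⁻ z, ‖f z‖ₑ ^ 2 ≠ ⊤)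
    (V : Set (ℝ × ℝ)) {L : ℝ} (hV : ∀ z ∈ V, ‖z‖ ≤ L) (hf : ∀ z, z ∉ V → f z = 0) {κ : ℝ} (hκ : 0 < κ) :
    ∃ (F : Finset Idx) (c : Idx → ℂ), (∀ T ∈ F, ∃ z ∈ V, ‖z - om r T‖ < 1 / r) ∧
      ENNReal.ofReal (∑ T ∈ F, ‖c T‖ ^ 2) ≤ ∫⁻ z, ‖f z‖ₑ ^ 2 ∧
      ∫⁻ z, ‖f z - ∑ T ∈ F, c T * pk r T z‖ₑ ^ 2 ≤ ENNReal.ofReal κ := by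
  classical
  set N : Finset ℤ := Finset.Icc (-(⌈r * L⌉ + 2)) (⌈r * L⌉ + 2) with hN
  have hfl : ∀ t : ℝ, |t| ≤ L → ⌊r * t⌋ ∈ N ∧ ⌊r * t⌋ + 1 ∈ N := by
    intro t ht
    have h1 := abs_le.1 ht
    have h2 : r * t ≤ r * L := mul_le_mul_of_nonneg_left h1.2 hr.le
    have h3 : -(r * L) ≤ r * t := by nlinarith [mul_le_mul_of_nonneg_left h1.1 hr.le]
    have h4 := Int.le_ceil (r * L)
    have h5 : ⌊r * t⌋ ≤ ⌈r * L⌉ := by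
      have : (⌊r * t⌋ : ℝ) ≤ ⌈r * L⌉ := (Int.floor_le _).trans (h2.trans h4)
      exact_mod_cast this
    have h6 : -⌈r * L⌉ ≤ ⌊r * t⌋ := by
      rw [Int.le_floor]; push_cast; linarith
    simp only [hN, Finset.mem_Icc]
    omega
  set S : Finset (ℤ × ℤ) := (N ×ˢ N).filter (fun k => ∃ z ∈ V, ‖z - kp r k‖ < 1 / r) with hS
  have hsum : ∀ z ∈ V, ∑ k ∈ S, ck r k z ^ 2 = 1 := by
    intro z hz
    have h1 : ∑ k ∈ S, ck r k z ^ 2 = ∑ k ∈ N ×ˢ N, ck r k z ^ 2 := by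
      refine Finset.sum_subset (Finset.filter_subset _ _) ?_
      intro k hk hkS
      by_contra hne
      apply hkS
      rw [hS, Finset.mem_filter]
      exact ⟨hk, z, hz, ck_near hr (fun h => hne (by rw [h]; norm_num))⟩
    rw [h1, ck_sum_prod]
    have a1 := hfl z.1 ((norm_fst_le z).trans (hV z hz))
    have a2 := hfl z.2 ((norm_snd_le z).trans (hV z hz))
    rw [chi_sum_eq _ _ a1.1 a1.2, chi_sum_eq _ _ a2.1 a2.2, one_mul]
  have hckm : ∀ k, Measurable fun z => (ck r k z : ℂ) * f z := fun k =>
    (Complex.continuous_ofReal.comp (ck_continuous r k)).measurable.mul hm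
  have htot : ∑ k ∈ S, ∫⁻ z in bx r k, ‖(ck r k z : ℂ) * f z‖ₑ ^ 2 ≤ ∫⁻ z, ‖f z‖ₑ ^ 2 := by
    calc ∑ k ∈ S, ∫⁻ z in bx r k, ‖(ck r k z : ℂ) * f z‖ₑ ^ 2 ≤ ∑ k ∈ S, ∫⁻ z, ‖(ck r k z : ℂ) * f z‖ₑ ^ 2 :=
          Finset.sum_le_sum fun k _ => setLIntegral_le_lintegral _ _
      _ = ∫⁻ z, ∑ k ∈ S, ‖(ck r k z : ℂ) * f z‖ₑ ^ 2 := by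
          rw [lintegral_finsetSum]
          intro k _
          exact (hckm k).enorm.pow_const 2
      _ ≤ ∫⁻ z, ‖f z‖ₑ ^ 2 := by
          refine lintegral_mono fun z => ?_
          have : ∑ k ∈ S, ‖(ck r k z : ℂ) * f z‖ ^ 2 ≤ ‖f z‖ ^ 2 := by
            have : ∀ k ∈ S, ‖(ck r k z : ℂ) * f z‖ ^ 2 = ck r k z ^ 2 * ‖f z‖ ^ 2 := by
              intro k _
              rw [norm_mul, Complex.norm_real, mul_pow, Real.norm_eq_abs, sq_abs]
            rw [Finset.sum_congr rfl this, ← Finset.sum_mul]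
            exact mul_le_of_le_one_left (sq_nonneg _) (ck_sum_le r S z)
          have h5 := ENNReal.ofReal_le_ofReal this
          rw [ENNReal.ofReal_pow (norm_nonneg _), ofReal_norm, ENNReal.ofReal_sum_of_nonneg (fun k _ => sq_nonneg _)] at h5
          refine le_trans (Finset.sum_le_sum fun k _ => le_of_eq ?_) h5
          rw [ENNReal.ofReal_pow (norm_nonneg _), ofReal_norm]
  have hκ' : 0 < κ / (S.card + 1) := by positivity
  have hex : ∀ k : ℤ × ℤ, ∃ (S' : Finset (ℤ × ℤ)) (b : ℤ × ℤ → ℂ), k ∈ S →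
      (ENNReal.ofReal (∑ m ∈ S', ‖b m‖ ^ 2) ≤ ∫⁻ z in bx r k, ‖(ck r k z : ℂ) * f z‖ₑ ^ 2 ∧
      ∫⁻ z in bx r k, ‖(ck r k z : ℂ) * f z - ((r / 2 : ℝ) : ℂ) * ∑ m ∈ S', b m * ex r m z‖ₑ ^ 2 ≤ ENNReal.ofReal (κ / (S.card + 1))) := by
    intro k
    by_cases hk : k ∈ S
    · obtain ⟨S', b, h1, h2⟩ := box_approx hr k (fun z => (ck r k z : ℂ) * f z) (hckm k) (ne_top_of_le_ne_top hfin
        ((Finset.single_le_sum (f := fun k => ∫⁻ z in bx r k, ‖(ck r k z : ℂ) * f z‖ₑ ^ 2) (fun _ _ => zero_le) hk).trans htot)) hκ'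
      exact ⟨S', b, fun _ => ⟨h1, h2⟩⟩
    · exact ⟨∅, 0, fun h => absurd h hk⟩
  choose S' b hb using hex
  set M := S.biUnion S' with hM
  set c : Idx → ℂ := fun T => if T.2 ∈ S' T.1 then b T.1 T.2 else 0 with hc
  have hsubM : ∀ k ∈ S, S' k ⊆ M := fun k hk => Finset.subset_biUnion_of_mem S' hk
  refine ⟨S ×ˢ M, c, ?_, ?_, ?_⟩
  · intro T hT
    exact (Finset.mem_filter.1 (Finset.mem_product.1 hT).1).2
  · rw [Finset.sum_product]
    have e : ∀ k ∈ S, ∑ m ∈ M, ‖c (k, m)‖ ^ 2 = ∑ m ∈ S' k, ‖b k m‖ ^ 2 := by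
      intro k hk
      rw [← Finset.sum_subset (hsubM k hk)]
      · exact Finset.sum_congr rfl fun m hm => by simp only [hc, hm, if_true]
      · intro m _ hm; simp [hc, hm]
    rw [Finset.sum_congr rfl e, ENNReal.ofReal_sum_of_nonneg (fun k _ => Finset.sum_nonneg fun m _ => sq_nonneg _)]
    exact (Finset.sum_le_sum fun k hk => (hb k hk).1).trans htot
  · have e : ∀ z, f z - ∑ T ∈ S ×ˢ M, c T * pk r T z =
        ∑ k ∈ S, (ck r k z : ℂ) * ((ck r k z : ℂ) * f z - ((r / 2 : ℝ) : ℂ) * ∑ m ∈ S' k, b k m * ex r m z) := by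
      intro z
      have e1 : f z = ∑ k ∈ S, (ck r k z : ℂ) * ((ck r k z : ℂ) * f z) := by
        by_cases hz : z ∈ V
        · have h1 : ((∑ k ∈ S, ck r k z ^ 2 : ℝ) : ℂ) = 1 := by rw [hsum z hz]; norm_num
          push_cast at h1
          calc f z = (∑ k ∈ S, (ck r k z : ℂ) ^ 2) * f z := by rw [h1, one_mul]
            _ = _ := by
              rw [Finset.sum_mul]
              exact Finset.sum_congr rfl fun k _ => by ring
        · rw [hf z hz]; simp
      have e2 : ∑ T ∈ S ×ˢ M, c T * pk r T z = ∑ k ∈ S, (ck r k z : ℂ) * (((r / 2 : ℝ) : ℂ) * ∑ m ∈ S' k, b k m * ex r m z) := by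
        rw [Finset.sum_product]
        refine Finset.sum_congr rfl fun k hk => ?_
        rw [← Finset.sum_subset (hsubM k hk)]
        · rw [Finset.mul_sum, Finset.mul_sum]
          refine Finset.sum_congr rfl fun m hm => ?_
          rw [pk_eq]
          simp only [hc, hm, if_true]
          ring
        · intro m _ hm; simp [hc, hm]
      rw [e2]
      conv_lhs => rw [e1]
      rw [← Finset.sum_sub_distrib]
      exact Finset.sum_congr rfl fun k _ => by ring
    simp only [e]
    refine (glue hr S (fun k z => (ck r k z : ℂ) * f z - ((r / 2 : ℝ) : ℂ) * ∑ m ∈ S' k, b k m * ex r m z)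
      (fun k _ => (hckm k).sub (box_meas r _ _))).trans ?_
    refine (Finset.sum_le_sum fun k hk => (hb k hk).2).trans ?_
    rw [Finset.sum_const, nsmul_eq_mul, ← ENNReal.ofReal_natCast, ← ENNReal.ofReal_mul (by positivity)]
    apply ENNReal.ofReal_le_ofReal
    rw [mul_div_assoc', div_le_iff₀ (by positivity)]
    nlinarith [hκ]

end BAP

namespace BAP

/-! ### Interpolation and error terms -/

lemma eLp_eq {α : Type*} [MeasurableSpace α] {μ : Measure α} (F : α → ℂ) {p : ℝ} (hp : 0 < p) :
    eLpNorm F (ENNReal.ofReal p) μ = (∫⁻ x, ‖F x‖ₑ ^ p ∂μ) ^ (1 / p) := by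
  rw [eLpNorm_eq_lintegral_rpow_enorm_toReal (by simpa using hp) (by simp), ENNReal.toReal_ofReal hp.le]

lemma interp {α : Type*} [MeasurableSpace α] {μ : Measure α} {F : α → ℂ} (hF : AEMeasurable F μ)
    {p a b : ℝ} (hp : 1 < p) (hp2 : p < 2) (ha : 0 ≤ a) (hb : 0 ≤ b)
    (h1 : ∫⁻ x, ‖F x‖ₑ ∂μ ≤ ENNReal.ofReal a) (h2 : ∫⁻ x, ‖F x‖ₑ ^ 2 ∂μ ≤ ENNReal.ofReal b) :
    eLpNorm F (ENNReal.ofReal p) μ ≤ ENNReal.ofReal (a ^ (2 / p - 1) * b ^ (1 - 1 / p)) := by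
  have hp0 : 0 < p := by linarith
  rw [eLp_eq F hp0]
  have e1 : ∀ x, ‖F x‖ₑ ^ p = ‖F x‖ₑ ^ (2 - p) * (‖F x‖ₑ ^ 2) ^ (p - 1) := by
    intro x
    rw [← ENNReal.rpow_natCast, ← ENNReal.rpow_mul, ← ENNReal.rpow_add_of_nonneg _ _ (by linarith) (by push_cast; linarith)]
    congr 1; push_cast; ring
  have h3 : ∫⁻ x, ‖F x‖ₑ ^ p ∂μ ≤ ENNReal.ofReal a ^ (2 - p) * ENNReal.ofReal b ^ (p - 1) := by
    simp_rw [e1]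
    refine (ENNReal.lintegral_mul_norm_pow_le (hF.enorm) (hF.enorm.pow_const 2) (by linarith) (by linarith) (by ring)).trans ?_
    gcongr
  calc (∫⁻ x, ‖F x‖ₑ ^ p ∂μ) ^ (1 / p) ≤ (ENNReal.ofReal a ^ (2 - p) * ENNReal.ofReal b ^ (p - 1)) ^ (1 / p) := by gcongr
    _ = _ := by
      rw [ENNReal.mul_rpow_of_nonneg _ _ (by positivity), ← ENNReal.rpow_mul, ← ENNReal.rpow_mul,
        ENNReal.ofReal_rpow_of_nonneg ha (by apply mul_nonneg <;> [linarith; positivity]),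
        ENNReal.ofReal_rpow_of_nonneg hb (by apply mul_nonneg <;> [linarith; positivity]), ← ENNReal.ofReal_mul (by positivity)]
      congr 3 <;> field_simp

lemma bdd_int {S : Set (ℝ × ℝ × ℝ)} (hS : volume S ≠ ⊤) {h : ℝ × ℝ × ℝ → ℝ} (hc : Continuous h) {K : ℝ}
    (hK : ∀ x, |h x| ≤ K) : IntegrableOn h S := by
  have : IsFiniteMeasure (volume.restrict S) := ⟨by simpa [lt_top_iff_ne_top] using hS⟩
  exact Integrable.of_bound (C := K) hc.aestronglyMeasurable (Filter.Eventually.of_forall hK)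

/-- norm of a coefficient family -/
def nn (F : Finset Idx) (b : Idx → ℂ) : ℝ := √(∑ T ∈ F, ‖b T‖ ^ 2)

lemma nn_nonneg (F : Finset Idx) (b : Idx → ℂ) : 0 ≤ nn F b := Real.sqrt_nonneg _

lemma nn_sq (F : Finset Idx) (b : Idx → ℂ) : nn F b ^ 2 = ∑ T ∈ F, ‖b T‖ ^ 2 :=
  Real.sq_sqrt (Finset.sum_nonneg fun _ _ => sq_nonneg _)

lemma nn_mono {F : Finset Idx} {b c : Idx → ℂ} (h : ∀ T ∈ F, ‖b T‖ ≤ ‖c T‖) : nn F b ≤ nn F c := by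
  apply Real.sqrt_le_sqrt
  apply Finset.sum_le_sum fun T hT => ?_
  gcongr; exact h T hT

lemma lint_sq {S : Set (ℝ × ℝ × ℝ)} (hS : volume S ≠ ⊤) {Φ : ℝ × ℝ × ℝ → ℂ} (hc : Continuous Φ) {K A : ℝ}
    (hK : ∀ x, ‖Φ x‖ ≤ K) (hA : ∫ x in S, ‖Φ x‖ ^ 2 ≤ A) : ∫⁻ x in S, ‖Φ x‖ₑ ^ 2 ≤ ENNReal.ofReal A := by
  have h := ofReal_integral_eq_lintegral_ofReal (μ := volume.restrict S) (f := fun x => ‖Φ x‖ ^ 2)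
    (bdd_int hS (by fun_prop) (K := K ^ 2) (fun x => by rw [abs_of_nonneg (sq_nonneg _)]; gcongr; exact hK x))
    (Filter.Eventually.of_forall fun x => sq_nonneg _)
  have e : ∀ x, ENNReal.ofReal (‖Φ x‖ ^ 2) = ‖Φ x‖ₑ ^ 2 := fun x => by
    rw [ENNReal.ofReal_pow (norm_nonneg _), ofReal_norm]
  simp_rw [e] at h
  rw [← h]
  exact ENNReal.ofReal_le_ofReal hA

lemma lint_cs {S : Set (ℝ × ℝ × ℝ)} {Φ Ψ : ℝ × ℝ × ℝ → ℂ} (hc : Continuous Φ) (hd : Continuous Ψ) {a b : ℝ}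
    (ha : 0 ≤ a) (hb : 0 ≤ b)
    (h1 : ∫⁻ x in S, ‖Φ x‖ₑ ^ 2 ≤ ENNReal.ofReal (a ^ 2)) (h2 : ∫⁻ x in S, ‖Ψ x‖ₑ ^ 2 ≤ ENNReal.ofReal (b ^ 2)) :
    ∫⁻ x in S, ‖Φ x * Ψ x‖ₑ ≤ ENNReal.ofReal (a * b) := by
  have := ENNReal.lintegral_mul_le_Lp_mul_Lq (volume.restrict S) Real.HolderConjugate.two_two
    (f := fun x => ‖Φ x‖ₑ) (g := fun x => ‖Ψ x‖ₑ) hc.enorm.aemeasurable hd.enorm.aemeasurable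
  simp only [Pi.mul_apply, ENNReal.rpow_two] at this
  simp_rw [enorm_mul]
  refine this.trans ?_
  rw [ENNReal.ofReal_mul ha]
  have key : ∀ (X : ℝ≥0∞) (c : ℝ), 0 ≤ c → X ≤ ENNReal.ofReal (c ^ 2) → X ^ (1 / (2:ℝ)) ≤ ENNReal.ofReal c := by
    intro X c hc hX
    calc X ^ (1 / (2:ℝ)) ≤ (ENNReal.ofReal (c ^ 2)) ^ (1 / (2:ℝ)) := by gcongr
      _ = ENNReal.ofReal c := by
        rw [ENNReal.ofReal_rpow_of_nonneg (by positivity) (by positivity), ← Real.sqrt_eq_rpow, Real.sqrt_sq hc]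
  gcongr
  · exact key _ _ ha h1
  · exact key _ _ hb h2

lemma table_err (B : ℝ) (hB : 1 ≤ B) (p : ℝ) (hp : 1 < p) (hp2 : p < 2) :
    ∃ K : ℝ, 1 ≤ K ∧ ∀ ψ, Reg ψ B → ∀ r : ℝ, 1 ≤ r →
    ∀ W1 W2, Trans ψ B W1 W2 → ∀ c : ℝ, 0 < c → c ≤ 1 →
    ∀ (F G : Finset Idx) (C D D' : Idx → ℂ), (∀ T ∈ F, om r T ∈ W1) → (∀ T ∈ G, om r T ∈ W2) →
    (∀ T ∈ G, ‖D' T‖ ≤ ‖D T‖) →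
    ∀ (Q P' P : Finset (ℤ × ℤ × ℤ)), Q ⊆ P → P' ⊆ P → (∀ n ∈ P, 0 ≤ n.2.2 ∧ (n.2.2 : ℝ) ≤ r) →
    (∀ p ∈ P', ∀ n ∈ Q, c * r ^ 2 ≤ |(gp r p).2.2 - (gp r n).2.2|) →
    ∀ (S : Set (ℝ × ℝ × ℝ)), MeasurableSet S → volume S ≠ ⊤ → (∀ ξ ∈ S, ∃ n ∈ P', ‖ξ - gp r n‖ ≤ r) →
    eLpNorm (fun ξ => sy ψ r F (fun T => (ac ψ r G (fun T => ‖D T‖) Q P T : ℂ) * C T) ξ * sy ψ r G D' ξ)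
      (ENNReal.ofReal p) (volume.restrict S) ≤
    ENNReal.ofReal (K * c⁻¹ * r ^ (-(3 - 5 / p)) * (nn F C * nn G D)) := by
  obtain ⟨K1, hK1, hs⟩ := l2_slab B hB
  obtain ⟨K2, hK2, ht⟩ := l2_table B hB
  refine ⟨K1 * K2, one_le_mul_of_one_le_of_one_le hK1 hK2, ?_⟩
  intro ψ hψ r hr W1 W2 hT c hc0 hc1 F G C D D' hF hG hD Q P' P hQ hP' hP hsep S hSm hSf hS
  have hr0 : 0 < r := by linarith
  have hp0 : 0 < p := by linarith
  set C' : Idx → ℂ := (fun T => (ac ψ r G (fun T => ‖D T‖) Q P T : ℂ) * C T) with hC'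
  have hCC : ∀ T ∈ F, ‖C' T‖ ≤ ‖C T‖ := by
    intro T _
    rw [hC', norm_mul]
    refine mul_le_of_le_one_left (norm_nonneg _) ?_
    rw [Complex.norm_real, Real.norm_eq_abs, ac, abs_of_nonneg (div_nonneg (mm_nonneg _ _ _ _ _ _) (mm_nonneg _ _ _ _ _ _))]
    exact div_le_one_of_le₀ (mm_mono _ _ _ _ hQ _) (mm_nonneg _ _ _ _ _ _)
  have c1 : Continuous (sy ψ r F C') := sy_continuous hψ.1.continuous hr0 F C'
  have c2 : Continuous (sy ψ r G D') := sy_continuous hψ.1.continuous hr0 G D'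
  obtain ⟨M1, hM10, hM1⟩ := sy_bdd ψ r F C'
  obtain ⟨M2, hM20, hM2⟩ := sy_bdd ψ r G D'
  have a0 := nn_nonneg F C
  have b0 := nn_nonneg G D
  have l1 : ∫⁻ x in S, ‖sy ψ r F C' x‖ₑ ^ 2 ≤ ENNReal.ofReal ((√K1 * r * nn F C) ^ 2) := by
    refine lint_sq hSf c1 hM1 ((hs ψ hψ r hr F (fun T hT' => hT.bd1 _ (hF T hT')) C' S hSm P' hS (fun n hn => hP n (hP' hn))).trans ?_)
    rw [← nn_sq, mul_pow, mul_pow, Real.sq_sqrt (by linarith)]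
    have := nn_mono hCC
    have := nn_nonneg F C'
    gcongr
  have l2 : ∫⁻ x in S, ‖sy ψ r G D' x‖ₑ ^ 2 ≤ ENNReal.ofReal ((√K1 * r * nn G D) ^ 2) := by
    refine lint_sq hSf c2 hM2 ((hs ψ hψ r hr G (fun T hT' => hT.bd2 _ (hG T hT')) D' S hSm P' hS (fun n hn => hP n (hP' hn))).trans ?_)
    rw [← nn_sq, mul_pow, mul_pow, Real.sq_sqrt (by linarith)]
    have := nn_mono hD
    have := nn_nonneg G D'
    gcongr
  have l3 := lint_cs c1 c2 (by positivity) (by positivity) l1 l2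
  have l4 : ∫⁻ x in S, ‖sy ψ r F C' x * sy ψ r G D' x‖ₑ ^ 2 ≤ ENNReal.ofReal (K2 * r⁻¹ * (c ^ 2)⁻¹ * (nn F C * nn G D) ^ 2) := by
    refine lint_sq (Φ := fun x => sy ψ r F C' x * sy ψ r G D' x) hSf (c1.mul c2) (K := M1 * M2) (fun x => ?_) ?_
    · rw [norm_mul]; gcongr; exacts [hM1 x, hM2 x]
    · simp_rw [norm_mul, mul_pow]
      rw [nn_sq, nn_sq]
      exact ht ψ hψ r hr W1 W2 hT c hc0 hc1 F G C D D' hF hG hD Q P' P hQ hP' hP hsep S hSm hS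
  refine (interp (c1.mul c2).aemeasurable hp hp2 (by positivity) (by positivity) l3 l4).trans (ENNReal.ofReal_le_ofReal ?_)
  obtain ⟨n, hn⟩ : ∃ n, n = nn F C * nn G D := ⟨_, rfl⟩
  have hn0 : 0 ≤ n := by rw [hn]; positivity
  rw [← hn]
  rw [show √K1 * r * nn F C * (√K1 * r * nn G D) = K1 * r ^ 2 * n by
    rw [hn]; linear_combination (r ^ 2 * nn F C * nn G D) * Real.mul_self_sqrt (show 0 ≤ K1 by linarith)]
  have e1 : 0 ≤ 2 / p - 1 := by rw [sub_nonneg, le_div_iff₀ hp0]; linarith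
  have e2 : 0 ≤ 1 - 1 / p := by rw [sub_nonneg, div_le_iff₀ hp0]; linarith
  have e3 : 1 / p ≤ 1 := by rw [div_le_iff₀ hp0]; linarith
  have e4 : 1 / 2 ≤ 1 / p := by gcongr
  have e5 : 2 / p = 2 * (1 / p) := by ring
  rw [Real.mul_rpow (by positivity) hn0, Real.mul_rpow (x := K1) (by positivity) (by positivity),
    Real.mul_rpow (by positivity) (by positivity), Real.mul_rpow (by positivity) (by positivity), Real.mul_rpow (by positivity) (by positivity)]
  have k1 : K1 ^ (2 / p - 1) ≤ K1 := by
    conv_rhs => rw [← Real.rpow_one K1]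
    exact Real.rpow_le_rpow_of_exponent_le hK1 (by linarith)
  have k2 : K2 ^ (1 - 1 / p) ≤ K2 := by
    conv_rhs => rw [← Real.rpow_one K2]
    exact Real.rpow_le_rpow_of_exponent_le hK2 (by linarith)
  have k3 : ((c ^ 2)⁻¹) ^ (1 - 1 / p) ≤ c⁻¹ := by
    rw [← inv_pow, ← Real.rpow_natCast, ← Real.rpow_mul (by positivity)]
    conv_rhs => rw [← Real.rpow_one c⁻¹]
    exact Real.rpow_le_rpow_of_exponent_le ((one_le_inv₀ hc0).2 hc1) (by push_cast; linarith)
  have k4 : n ^ (2 / p - 1) * (n ^ 2) ^ (1 - 1 / p) = n := by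
    rw [← Real.rpow_natCast, ← Real.rpow_mul hn0, ← Real.rpow_add_of_nonneg hn0 e1 (by push_cast; linarith)]
    conv_rhs => rw [← Real.rpow_one n]
    congr 1; push_cast; ring
  have k5 : (r ^ 2) ^ (2 / p - 1) * (r⁻¹) ^ (1 - 1 / p) = r ^ (-(3 - 5 / p)) := by
    rw [← Real.rpow_natCast, ← Real.rpow_mul hr0.le, ← Real.rpow_neg_one, ← Real.rpow_mul hr0.le, ← Real.rpow_add hr0]
    congr 1; push_cast; ring
  calc K1 ^ (2 / p - 1) * (r ^ 2) ^ (2 / p - 1) * n ^ (2 / p - 1) * (K2 ^ (1 - 1 / p) * r⁻¹ ^ (1 - 1 / p) * (c ^ 2)⁻¹ ^ (1 - 1 / p) * (n ^ 2) ^ (1 - 1 / p))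
      = K1 ^ (2 / p - 1) * K2 ^ (1 - 1 / p) * ((c ^ 2)⁻¹ ^ (1 - 1 / p)) * ((r ^ 2) ^ (2 / p - 1) * r⁻¹ ^ (1 - 1 / p)) * (n ^ (2 / p - 1) * (n ^ 2) ^ (1 - 1 / p)) := by ring
    _ ≤ K1 * K2 * c⁻¹ * r ^ (-(3 - 5 / p)) * n := by rw [k4, k5]; gcongr

end BAP

namespace BAP

/-! ### Localized bilinear bounds -/

/-- thickening of a set -/
def thk (V : Set (ℝ × ℝ)) (μ : ℝ) : Set (ℝ × ℝ) := {z | ∃ w ∈ V, ‖z - w‖ ≤ μ}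

/-- space-time boxes -/
def box (M a b : ℝ) : Set (ℝ × ℝ × ℝ) := Icc (-M) M ×ˢ (Icc (-M) M ×ˢ Icc a b)

/-- admissible input functions -/
def Ok (V : Set (ℝ × ℝ)) (f : ℝ × ℝ → ℂ) : Prop :=
  Measurable f ∧ ∫⁻ z, ‖f z‖ₑ ^ 2 ≠ ⊤ ∧ ∀ z, z ∉ V → f z = 0

/-- the `L²` norm -/
def N2 (f : ℝ × ℝ → ℂ) : ℝ := √((∫⁻ z, ‖f z‖ₑ ^ 2).toReal)

/-- local bilinear estimate with constant `A` -/
def Bd (ψ : ℝ → ℝ) (V1 V2 : Set (ℝ × ℝ)) (p R μ A : ℝ) : Prop :=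
  ∀ (M : ℝ) (f g : ℝ × ℝ → ℂ), Ok (thk V1 μ) f → Ok (thk V2 μ) g →
    eLpNorm (fun ξ => EE ψ f ξ * EE ψ g ξ) (ENNReal.ofReal p) (volume.restrict (box M 0 R)) ≤
      ENNReal.ofReal (A * (N2 f * N2 g))

lemma N2_nonneg (f : ℝ × ℝ → ℂ) : 0 ≤ N2 f := Real.sqrt_nonneg _

lemma slab_meas (M a b : ℝ) : MeasurableSet (box M a b) :=
  measurableSet_Icc.prod (measurableSet_Icc.prod measurableSet_Icc)

lemma box_fin (M a b : ℝ) : volume (box M a b) ≠ ⊤ :=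
  (isCompact_Icc.prod (isCompact_Icc.prod isCompact_Icc)).measure_ne_top

lemma thk_mono {V : Set (ℝ × ℝ)} {μ ν : ℝ} (h : μ ≤ ν) : thk V μ ⊆ thk V ν := by
  rintro z ⟨w, hw, hz⟩; exact ⟨w, hw, hz.trans h⟩

lemma Bd_shift {ψ : ℝ → ℝ} (hψ : Continuous ψ) {V1 V2 : Set (ℝ × ℝ)} {p R μ A : ℝ} (h : Bd ψ V1 V2 p R μ A)
    (M t : ℝ) {f g : ℝ × ℝ → ℂ} (hf : Ok (thk V1 μ) f) (hg : Ok (thk V2 μ) g) :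
    eLpNorm (fun ξ => EE ψ f ξ * EE ψ g ξ) (ENNReal.ofReal p) (volume.restrict (box M t (t + R))) ≤
      ENNReal.ofReal (A * (N2 f * N2 g)) := by
  set T : (ℝ × ℝ → ℂ) → (ℝ × ℝ → ℂ) := fun f z => f z * ee (t * ph ψ z) with hT
  have hph : Continuous (ph ψ) := by unfold ph; fun_prop
  have en : ∀ f z, ‖T f z‖ₑ = ‖f z‖ₑ := fun f z => by
    simp only [hT]
    rw [enorm_mul]
    have : ‖ee (t * ph ψ z)‖ₑ = 1 := by
      rw [← ofReal_norm, ee_norm]; simp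
    rw [this, mul_one]
  have hok : ∀ V f, Ok V f → Ok V (T f) := by
    intro V f hf
    refine ⟨?_, ?_, ?_⟩
    · exact hf.1.mul (ee_continuous.comp (by fun_prop : Continuous fun z => t * ph ψ z)).measurable
    · simp_rw [en]; exact hf.2.1
    · intro z hz; simp only [hT]; rw [hf.2.2 z hz, zero_mul]
  have hN : ∀ f, N2 (T f) = N2 f := fun f => by unfold N2; simp_rw [en]
  have hE : ∀ f ξ, EE ψ (T f) ξ = EE ψ f (ξ + (0, 0, t)) := by
    intro f ξ
    unfold EE
    refine integral_congr_ae (Filter.Eventually.of_forall fun z => ?_)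
    simp only [hT, Prod.fst_add, Prod.snd_add, add_zero]
    rw [mul_assoc, ← ee_add]; congr 2; ring
  have key := h M (T f) (T g) (hok _ f hf) (hok _ g hg)
  rw [hN, hN] at key
  simp_rw [hE] at key
  have mp : MeasurePreserving (fun ξ : ℝ × ℝ × ℝ => ξ + (0, 0, t)) volume volume :=
    by
      have h := (MeasurePreserving.id (volume : Measure ℝ)).prod ((MeasurePreserving.id (volume : Measure ℝ)).prod (measurePreserving_add_right (volume : Measure ℝ) t))
      have e : (fun ξ : ℝ × ℝ × ℝ => ξ + (0, 0, t)) = Prod.map id (Prod.map id fun x => x + t) := by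
        funext ξ
        simp [Prod.map, Prod.ext_iff]
      rw [e]; exact h
  have hpre : (fun ξ : ℝ × ℝ × ℝ => ξ + (0, 0, t)) ⁻¹' box M t (t + R) = box M 0 R := by
    ext ⟨a, b, c⟩
    simp only [box, mem_preimage, mem_prod, mem_Icc, Prod.fst_add, Prod.snd_add, add_zero]
    constructor <;> rintro ⟨h1, h2, h3, h4⟩ <;> refine ⟨h1, h2, ?_, ?_⟩ <;> linarith
  have mp2 := mp.restrict_preimage_emb (MeasurableEquiv.addRight ((0, 0, t) : ℝ × ℝ × ℝ)).measurableEmbedding (box M t (t + R))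
  have e := eLpNorm_comp_measurePreserving (p := ENNReal.ofReal p) (g := fun ξ => EE ψ f ξ * EE ψ g ξ) ?_ mp2
  · rw [← e, hpre]; exact key
  · have hi : ∀ {V} {f : ℝ × ℝ → ℂ}, Ok V f → Continuous (EE ψ f) ∨ EE ψ f = 0 := by
      intro V f hf
      by_cases hI : Integrable f
      · exact Or.inl (EE_continuous hψ hI)
      · right
        funext ξ
        refine integral_undef fun hc => hI ?_
        refine hc.mono hf.1.aestronglyMeasurable (Filter.Eventually.of_forall fun z => ?_)
        rw [norm_mul, ee_norm, mul_one]
    refine AEStronglyMeasurable.mul ?_ ?_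
    · rcases hi hf with h | h
      · exact h.aestronglyMeasurable
      · rw [h]; exact aestronglyMeasurable_const
    · rcases hi hg with h | h
      · exact h.aestronglyMeasurable
      · rw [h]; exact aestronglyMeasurable_const

/-! ### One tile -/

lemma sy_sum (ψ : ℝ → ℝ) (r : ℝ) (F : Finset Idx) (I : Finset ℤ) (a : ℤ → Idx → ℂ) (b : Idx → ℂ)
    (h : ∀ T ∈ F, ∑ q ∈ I, a q T = b T) (ξ : ℝ × ℝ × ℝ) :
    sy ψ r F b ξ = ∑ q ∈ I, sy ψ r F (a q) ξ := by
  unfold sy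
  rw [Finset.sum_comm]
  refine Finset.sum_congr rfl fun T hT => ?_
  rw [← h T hT, Finset.sum_mul]

lemma ac_sum {ψ : ℝ → ℝ} {r : ℝ} {G : Finset Idx} {D : Idx → ℝ} {P : Finset (ℤ × ℤ × ℤ)} (tl : ℤ × ℤ × ℤ → ℤ)
    {I : Finset ℤ} (hI : ∀ n ∈ P, tl n ∈ I) (T : Idx) (h : mm ψ r G D P T ≠ 0) :
    ∑ q ∈ I, ac ψ r G D (P.filter fun n => tl n = q) P T = 1 := by
  unfold ac
  rw [← Finset.sum_div, div_eq_one_iff_eq h]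
  unfold mm
  exact Finset.sum_fiberwise_of_maps_to hI _

lemma mm_ne {ψ : ℝ → ℝ} {r : ℝ} {G : Finset Idx} {D : Idx → ℂ} {P : Finset (ℤ × ℤ × ℤ)} (hP : P.Nonempty)
    (h : nn G D ≠ 0) (T : Idx) : mm ψ r G (fun T => ‖D T‖) P T ≠ 0 := by
  obtain ⟨n, hn⟩ := hP
  have h1 : ∃ S ∈ G, ‖D S‖ ^ 2 ≠ 0 := by
    by_contra hc
    push Not at hc
    exact h (by rw [nn, Finset.sum_eq_zero hc, Real.sqrt_zero])
  obtain ⟨S, hS, hD⟩ := h1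
  have h2 : 0 < Sg ψ r G (fun T => ‖D T‖) n := by
    refine Finset.sum_pos' (fun T _ => mul_nonneg (sq_nonneg _) (wt_pos _ _ _ _).le) ⟨S, hS, ?_⟩
    exact mul_pos (lt_of_le_of_ne (sq_nonneg _) (Ne.symm hD)) (wt_pos _ _ _ _)
  refine ne_of_gt (Finset.sum_pos' (fun T _ => mul_nonneg (wt_pos _ _ _ _).le (Sg_nonneg _ _ _ _ _)) ⟨n, hn, ?_⟩)
  exact mul_pos (wt_pos _ _ _ _) h2

lemma ac_nonneg (ψ : ℝ → ℝ) (r : ℝ) (G : Finset Idx) (D : Idx → ℝ) (Q P : Finset (ℤ × ℤ × ℤ)) (T : Idx) :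
    0 ≤ ac ψ r G D Q P T := div_nonneg (mm_nonneg _ _ _ _ _ _) (mm_nonneg _ _ _ _ _ _)

lemma ac_le (ψ : ℝ → ℝ) (r : ℝ) (G : Finset Idx) (D : Idx → ℝ) {Q P : Finset (ℤ × ℤ × ℤ)} (h : Q ⊆ P) (T : Idx) :
    ac ψ r G D Q P T ≤ 1 := div_le_one_of_le₀ (mm_mono _ _ _ _ h _) (mm_nonneg _ _ _ _ _ _)

lemma tile_alg {p : ℝ} (hp : 1 < p) {S : Set (ℝ × ℝ × ℝ)} (I : Finset ℤ) {q0 : ℤ} (hq0 : q0 ∈ I) {u v : ℤ → ℝ × ℝ × ℝ → ℂ}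
    {Φ Ψ : ℝ × ℝ × ℝ → ℂ} (hu : ∀ q, Continuous (u q)) (hv : ∀ q, Continuous (v q)) (hΨ : Continuous Ψ)
    (h1 : ∀ ξ, Φ ξ = ∑ q ∈ I, u q ξ) (h2 : ∀ ξ, Ψ ξ = ∑ q ∈ I, v q ξ) {E : ℝ} (hE : 0 ≤ E)
    (E1 : ∀ q ≠ q0, eLpNorm (fun ξ => u q ξ * Ψ ξ) (ENNReal.ofReal p) (volume.restrict S) ≤ ENNReal.ofReal E)
    (E2 : ∀ q ≠ q0, eLpNorm (fun ξ => v q ξ * u q0 ξ) (ENNReal.ofReal p) (volume.restrict S) ≤ ENNReal.ofReal E) :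
    eLpNorm (fun ξ => Φ ξ * Ψ ξ) (ENNReal.ofReal p) (volume.restrict S) ≤
      eLpNorm (fun ξ => u q0 ξ * v q0 ξ) (ENNReal.ofReal p) (volume.restrict S) + ENNReal.ofReal (2 * I.card * E) := by
  have hfun : (fun ξ => Φ ξ * Ψ ξ) = (fun ξ => u q0 ξ * v q0 ξ) +
      ((∑ q ∈ I.erase q0, fun ξ => u q ξ * Ψ ξ) + ∑ q ∈ I.erase q0, fun ξ => v q ξ * u q0 ξ) := by
    funext ξ
    simp only [Pi.add_apply, Finset.sum_apply]
    rw [← Finset.sum_mul, ← Finset.sum_mul]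
    have h1 := h1 ξ
    have h2 := h2 ξ
    rw [← Finset.add_sum_erase _ _ hq0] at h1 h2
    linear_combination (Ψ ξ) * h1 + u q0 ξ * h2
  have hp1 : (1:ℝ≥0∞) ≤ ENNReal.ofReal p := by rw [← ENNReal.ofReal_one]; exact ENNReal.ofReal_le_ofReal hp.le
  have m1 : ∀ q, AEStronglyMeasurable (fun ξ => u q ξ * Ψ ξ) (volume.restrict S) := fun q => ((hu q).mul hΨ).aestronglyMeasurable
  have m2 : ∀ q, AEStronglyMeasurable (fun ξ => v q ξ * u q0 ξ) (volume.restrict S) := fun q => ((hv q).mul (hu q0)).aestronglyMeasurable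
  have n1 : AEStronglyMeasurable (∑ q ∈ I.erase q0, fun ξ => u q ξ * Ψ ξ) (volume.restrict S) :=
    Finset.aestronglyMeasurable_sum _ fun q _ => m1 q
  have n2 : AEStronglyMeasurable (∑ q ∈ I.erase q0, fun ξ => v q ξ * u q0 ξ) (volume.restrict S) :=
    Finset.aestronglyMeasurable_sum _ fun q _ => m2 q
  rw [hfun]
  refine (eLpNorm_add_le ((hu _).mul (hv _)).aestronglyMeasurable (n1.add n2) hp1).trans ?_
  refine add_le_add le_rfl ?_
  refine (eLpNorm_add_le n1 n2 hp1).trans ?_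
  have s1 : ∀ (w : ℤ → ℝ × ℝ × ℝ → ℂ), (∀ q, AEStronglyMeasurable (w q) (volume.restrict S)) →
      (∀ q ≠ q0, eLpNorm (w q) (ENNReal.ofReal p) (volume.restrict S) ≤ ENNReal.ofReal E) →
      eLpNorm (∑ q ∈ I.erase q0, w q) (ENNReal.ofReal p) (volume.restrict S) ≤ I.card * ENNReal.ofReal E := by
    intro w hw hE
    refine (eLpNorm_sum_le (fun q _ => hw q) hp1).trans ?_
    refine (Finset.sum_le_card_nsmul _ _ (ENNReal.ofReal E) fun q hq => hE q (Finset.ne_of_mem_erase hq)).trans ?_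
    rw [nsmul_eq_mul]
    gcongr
    exact Finset.erase_subset _ _
  refine (add_le_add (s1 _ m1 E1) (s1 _ m2 E2)).trans ?_
  rw [ENNReal.ofReal_mul (by positivity), ENNReal.ofReal_mul (by positivity), ENNReal.ofReal_natCast, ENNReal.ofReal_ofNat, ← two_mul, mul_assoc]

lemma tile (B : ℝ) (hB : 1 ≤ B) (p : ℝ) (hp : 1 < p) (hp2 : p < 2) :
    ∃ K : ℝ, 1 ≤ K ∧ ∀ ψ, Reg ψ B → ∀ r : ℝ, 1 ≤ r →
    ∀ W1 W2, Trans ψ B W1 W2 → Trans ψ B W2 W1 → ∀ c : ℝ, 0 < c → c ≤ 1 →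
    ∀ (F G : Finset Idx) (b d : Idx → ℂ), (∀ T ∈ F, om r T ∈ W1) → (∀ T ∈ G, om r T ∈ W2) →
    nn F b ≠ 0 → nn G d ≠ 0 →
    ∀ (P : Finset (ℤ × ℤ × ℤ)), P.Nonempty → (∀ n ∈ P, 0 ≤ n.2.2 ∧ (n.2.2 : ℝ) ≤ r) →
    ∀ (tl : ℤ × ℤ × ℤ → ℤ) (I : Finset ℤ), (∀ n ∈ P, tl n ∈ I) → ∀ q0 ∈ I,
    ∀ (S : Set (ℝ × ℝ × ℝ)), MeasurableSet S → volume S ≠ ⊤ →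
    (∀ ξ ∈ S, ∃ n ∈ P, ‖ξ - gp r n‖ ≤ r) →
    (∀ ξ ∈ S, ∀ n ∈ P, ‖ξ - gp r n‖ ≤ r → ∀ m ∈ P, tl m ≠ q0 → c * r ^ 2 ≤ |(gp r n).2.2 - (gp r m).2.2|) →
    eLpNorm (fun ξ => sy ψ r F b ξ * sy ψ r G d ξ) (ENNReal.ofReal p) (volume.restrict S) ≤
    eLpNorm (fun ξ => sy ψ r F (fun T => (ac ψ r G (fun T => ‖d T‖) (P.filter fun n => tl n = q0) P T : ℂ) * b T) ξ *
       sy ψ r G (fun T => (ac ψ r F (fun T => ‖b T‖) (P.filter fun n => tl n = q0) P T : ℂ) * d T) ξ)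
       (ENNReal.ofReal p) (volume.restrict S) +
    ENNReal.ofReal (2 * I.card * (K * c⁻¹ * r ^ (-(3 - 5 / p)) * (nn F b * nn G d))) := by
  classical
  obtain ⟨K, hK, ht⟩ := table_err B hB p hp hp2
  refine ⟨K, hK, ?_⟩
  intro ψ hψ r hr W1 W2 hT hT' c hc0 hc1 F G b d hF hG hb hd P hPne hP tl I hI q0 hq0 S hSm hSf hS hsep
  have hr0 : 0 < r := by linarith
  have hcψ := hψ.1.continuous
  set a : ℤ → Idx → ℂ := fun q T => (ac ψ r G (fun T => ‖d T‖) (P.filter fun n => tl n = q) P T : ℂ) * b T with ha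
  set e : ℤ → Idx → ℂ := fun q T => (ac ψ r F (fun T => ‖b T‖) (P.filter fun n => tl n = q) P T : ℂ) * d T with he
  set P' := P.filter fun n => ∃ ξ ∈ S, ‖ξ - gp r n‖ ≤ r with hP'
  have hcov : ∀ ξ ∈ S, ∃ n ∈ P', ‖ξ - gp r n‖ ≤ r := by
    intro ξ hξ
    obtain ⟨n, hn, hh⟩ := hS ξ hξ
    exact ⟨n, Finset.mem_filter.2 ⟨hn, ξ, hξ, hh⟩, hh⟩
  have hsep' : ∀ q ≠ q0, ∀ n ∈ P', ∀ m ∈ P.filter (fun n => tl n = q), c * r ^ 2 ≤ |(gp r n).2.2 - (gp r m).2.2| := by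
    intro q hq n hn m hm
    obtain ⟨hn, ξ, hξ, hh⟩ := Finset.mem_filter.1 hn
    obtain ⟨hm, hm'⟩ := Finset.mem_filter.1 hm
    exact hsep ξ hξ n hn hh m hm (by rw [hm']; exact hq)
  have hsb : ∀ q, P.filter (fun n => tl n = q) ⊆ P := fun q => Finset.filter_subset _ _
  have suma : ∀ T ∈ F, ∑ q ∈ I, a q T = b T := by
    intro T _
    simp only [ha]
    rw [← Finset.sum_mul, ← Complex.ofReal_sum, ac_sum tl hI T (mm_ne hPne hd T)]; simp
  have sume : ∀ T ∈ G, ∑ q ∈ I, e q T = d T := by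
    intro T _
    simp only [he]
    rw [← Finset.sum_mul, ← Complex.ofReal_sum, ac_sum tl hI T (mm_ne hPne hb T)]; simp
  have a0 := nn_nonneg F b
  have b0 := nn_nonneg G d
  have E1 : ∀ q ≠ q0, eLpNorm (fun ξ => sy ψ r F (a q) ξ * sy ψ r G d ξ) (ENNReal.ofReal p) (volume.restrict S) ≤ ENNReal.ofReal (K * c⁻¹ * r ^ (-(3 - 5 / p)) * (nn F b * nn G d)) := by
    intro q hq
    exact ht ψ hψ r hr W1 W2 hT c hc0 hc1 F G b d d hF hG (fun _ _ => le_rfl) _ P' P (hsb q) (Finset.filter_subset _ _) hP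
      (hsep' q hq) S hSm hSf hcov
  have E2 : ∀ q ≠ q0, eLpNorm (fun ξ => sy ψ r G (e q) ξ * sy ψ r F (a q0) ξ) (ENNReal.ofReal p) (volume.restrict S) ≤ ENNReal.ofReal (K * c⁻¹ * r ^ (-(3 - 5 / p)) * (nn F b * nn G d)) := by
    intro q hq
    have := ht ψ hψ r hr W2 W1 hT' c hc0 hc1 G F d b (a q0) hG hF ?_ _ P' P (hsb q) (Finset.filter_subset _ _) hP
      (hsep' q hq) S hSm hSf hcov
    · rw [mul_comm (nn G d)] at this; exact this
    · intro T _
      simp only [ha]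
      rw [norm_mul, Complex.norm_real, Real.norm_eq_abs, abs_of_nonneg (ac_nonneg _ _ _ _ _ _ _)]
      exact mul_le_of_le_one_left (norm_nonneg _) (ac_le _ _ _ _ (hsb q0) _)
  exact tile_alg hp I hq0 (fun q => sy_continuous hcψ hr0 F (a q)) (fun q => sy_continuous hcψ hr0 G (e q))
    (sy_continuous hcψ hr0 G d) (sy_sum ψ r F I a b suma) (sy_sum ψ r G I e d sume) (by positivity) E1 E2

end BAP

namespace BAP

/-- times close to the tile boundaries -/
def bad (L : ℝ) (J j : ℕ) : Set (ℝ × ℝ × ℝ) := {ξ | ∃ k : ℤ, |ξ.2.2 - j * L / J - k * L| < L / (2 * J)}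

lemma bad_meas (L : ℝ) (J j : ℕ) : MeasurableSet (bad L J j) := by
  have : bad L J j = ⋃ k : ℤ, {ξ : ℝ × ℝ × ℝ | |ξ.2.2 - j * L / J - k * L| < L / (2 * J)} := by
    ext ξ; simp [bad]
  rw [this]
  exact (isOpen_iUnion fun k => isOpen_lt (by fun_prop) continuous_const).measurableSet

lemma bad_disj {L : ℝ} (hL : 0 < L) {J : ℕ} (hJ : 2 ≤ J) {i j : ℕ} (hi : i < J) (hj : j < J) (hij : i ≠ j) :
    Disjoint (bad L J i) (bad L J j) := by
  rw [Set.disjoint_left]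
  rintro ξ ⟨k, hk⟩ ⟨l, hl⟩
  have hJ0 : (0:ℝ) < J := by exact_mod_cast (by lia : 0 < J)
  have h1 : |((i:ℝ) - j + (k - l) * J) * (L / J)| < L / J := by
    have e : ((i:ℝ) - j + (k - l) * J) * (L / J) = (ξ.2.2 - j * L / J - l * L) - (ξ.2.2 - i * L / J - k * L) := by
      field_simp; ring
    rw [e]
    calc _ ≤ |ξ.2.2 - j * L / J - l * L| + |ξ.2.2 - i * L / J - k * L| := abs_sub _ _
      _ < L / (2 * J) + L / (2 * J) := add_lt_add hl hk
      _ = L / J := by field_simp; norm_num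
  rw [abs_mul, abs_of_pos (by positivity : 0 < L / J)] at h1
  have h2 : |((i:ℝ) - j + (k - l) * J)| < 1 := by
    by_contra hc
    push Not at hc
    nlinarith [(by positivity : 0 < L / J)]
  have h3 : |((i:ℤ) - j + (k - l) * J)| < 1 := by exact_mod_cast h2
  rw [Int.abs_lt_one_iff] at h3
  have h4 : (J:ℤ) ∣ (i - j) := ⟨l - k, by linarith⟩
  have h5 : |(i:ℤ) - j| < J := by rw [abs_lt]; constructor <;> lia
  have h6 := Int.eq_zero_of_abs_lt_dvd h4 h5
  lia

lemma pigeon {H : ℝ × ℝ × ℝ → ℂ} (hc : Continuous H) {K : ℝ} (hK : ∀ x, ‖H x‖ ≤ K) {p : ℝ} (hp : 1 < p)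
    {S : Set (ℝ × ℝ × ℝ)} (hSf : volume S ≠ ⊤) {L : ℝ} (hL : 0 < L) {J : ℕ} (hJ : 2 ≤ J) :
    ∃ j < J, eLpNorm H (ENNReal.ofReal p) (volume.restrict S) ≤
      ENNReal.ofReal (J / (J - 1)) * eLpNorm H (ENNReal.ofReal p) (volume.restrict (S \ bad L J j)) := by
  have hp0 : 0 < p := by linarith
  set X := ∫⁻ x in S, ‖H x‖ₑ ^ p with hX
  have hXf : X ≠ ⊤ := by
    have : X ≤ ∫⁻ x in S, ENNReal.ofReal K ^ p := by
      refine lintegral_mono fun x => ?_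
      gcongr
      rw [← ofReal_norm]; exact ENNReal.ofReal_le_ofReal (hK x)
    refine ne_top_of_le_ne_top ?_ this
    rw [setLIntegral_const]
    exact ENNReal.mul_ne_top (ENNReal.rpow_ne_top_of_nonneg hp0.le (by simp)) hSf
  have hm : Measurable fun x => ‖H x‖ₑ ^ p := (hc.enorm.measurable).pow_const p
  have hsum : ∑ j ∈ Finset.range J, ∫⁻ x in S ∩ bad L J j, ‖H x‖ₑ ^ p ≤ X := by
    have : ∀ j, ∫⁻ x in S ∩ bad L J j, ‖H x‖ₑ ^ p = ∫⁻ x in bad L J j, ‖H x‖ₑ ^ p ∂(volume.restrict S) := by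
      intro j
      rw [Measure.restrict_restrict (bad_meas L J j), Set.inter_comm]
    simp_rw [this]
    rw [← lintegral_biUnion_finset]
    · exact setLIntegral_le_lintegral _ _
    · intro i hi j hj hij
      exact bad_disj hL hJ (by simpa using hi) (by simpa using hj) hij
    · exact fun j _ => bad_meas L J j
  obtain ⟨j, hj, hjX⟩ : ∃ j < J, J * ∫⁻ x in S ∩ bad L J j, ‖H x‖ₑ ^ p ≤ X := by
    by_contra hcon
    push Not at hcon
    have hJ0 : (J:ℝ≥0∞) ≠ 0 := by simp; lia
    have h1 : ∀ j ∈ Finset.range J, X / J < ∫⁻ x in S ∩ bad L J j, ‖H x‖ₑ ^ p := by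
      intro j hj
      have := hcon j (by simpa using hj)
      rw [ENNReal.div_lt_iff (Or.inl hJ0) (Or.inl (by simp)), mul_comm]
      exact this
    have h2 := ENNReal.sum_lt_sum_of_nonempty (s := Finset.range J) (by simp; lia) h1
    rw [Finset.sum_const, Finset.card_range, nsmul_eq_mul, ENNReal.mul_div_cancel hJ0 (by simp)] at h2
    exact absurd hsum (not_le.2 h2)
  refine ⟨j, hj, ?_⟩
  rw [eLp_eq H hp0, eLp_eq H hp0, ← hX]
  set Y := ∫⁻ x in S \ bad L J j, ‖H x‖ₑ ^ p with hY
  have hsplit : X = (∫⁻ x in S ∩ bad L J j, ‖H x‖ₑ ^ p) + Y := by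
    rw [hX, hY]; exact (lintegral_inter_add_sdiff (fun x => ‖H x‖ₑ ^ p) S (bad_meas L J j)).symm
  have hYf : Y ≠ ⊤ := ne_top_of_le_ne_top hXf (by rw [hsplit]; exact le_add_self)
  have hJr : (2:ℝ) ≤ J := by exact_mod_cast hJ
  have h3 : (1:ℝ) ≤ J / (J - 1) := by rw [le_div_iff₀ (by linarith)]; linarith
  have h4 : X ≤ ENNReal.ofReal (J / (J - 1)) * Y := by
    obtain ⟨Z, hZ⟩ : ∃ Z, Z = ∫⁻ x in S ∩ bad L J j, ‖H x‖ₑ ^ p := ⟨_, rfl⟩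
    rw [← hZ] at hjX hsplit
    clear_value X Y
    clear hsum
    have hZf : Z ≠ ⊤ := ne_top_of_le_ne_top hXf (by rw [hsplit]; exact le_self_add)
    rw [hsplit] at hjX ⊢
    clear hZ
    clear hsplit hY hX
    lift Z to NNReal using hZf
    lift Y to NNReal using hYf
    rw [ENNReal.ofReal, ← ENNReal.coe_mul, ← ENNReal.coe_add, ENNReal.coe_le_coe, ← NNReal.coe_le_coe]
    have h5 : ((J:NNReal):ℝ≥0∞) * Z ≤ Z + Y := hjX
    rw [← ENNReal.coe_mul, ← ENNReal.coe_add, ENNReal.coe_le_coe, ← NNReal.coe_le_coe] at h5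
    push_cast at h5 ⊢
    rw [Real.coe_toNNReal _ (by linarith), div_mul_eq_mul_div, le_div_iff₀ (by linarith)]
    linarith
  calc X ^ (1 / p) ≤ (ENNReal.ofReal (J / (J - 1)) * Y) ^ (1 / p) := by gcongr
    _ = ENNReal.ofReal (J / (J - 1)) ^ (1 / p) * Y ^ (1 / p) := ENNReal.mul_rpow_of_nonneg _ _ (by positivity)
    _ ≤ _ := by
      gcongr
      conv_rhs => rw [← ENNReal.rpow_one (ENNReal.ofReal _)]
      refine ENNReal.rpow_le_rpow_of_exponent_le ?_ ?_
      · rw [← ENNReal.ofReal_one]; exact ENNReal.ofReal_le_ofReal h3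
      · rw [div_le_iff₀ hp0]; linarith

lemma eLp_cover {H : ℝ × ℝ × ℝ → ℂ} (hc : Continuous H) {p : ℝ} (hp : 1 < p) (I : Finset ℤ)
    {S : Set (ℝ × ℝ × ℝ)} {D : ℤ → Set (ℝ × ℝ × ℝ)} (hS : MeasurableSet S) (hD : ∀ q, MeasurableSet (D q)) (h : ∀ ξ ∈ S, ∃ q ∈ I, ξ ∈ D q) :
    eLpNorm H (ENNReal.ofReal p) (volume.restrict S) ≤ ∑ q ∈ I, eLpNorm H (ENNReal.ofReal p) (volume.restrict (D q)) := by
  have hp1 : (1:ℝ≥0∞) ≤ ENNReal.ofReal p := by rw [← ENNReal.ofReal_one]; exact ENNReal.ofReal_le_ofReal hp.le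
  simp_rw [← fun q => eLpNorm_indicator_eq_eLpNorm_restrict (f := H) (p := ENNReal.ofReal p) (μ := volume) (hD q)]
  rw [← eLpNorm_indicator_eq_eLpNorm_restrict hS]
  have e : ∀ q ∈ I, eLpNorm ((D q).indicator H) (ENNReal.ofReal p) volume = eLpNorm (fun ξ => ‖(D q).indicator H ξ‖) (ENNReal.ofReal p) volume :=
    fun q _ => (eLpNorm_norm _).symm
  rw [Finset.sum_congr rfl e]
  refine le_trans ?_ (eLpNorm_sum_le (fun q _ => (hc.aestronglyMeasurable.indicator (hD q)).norm) hp1)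
  refine eLpNorm_mono_real fun ξ => ?_
  simp only [Finset.sum_apply]
  by_cases hξ : ξ ∈ S
  · obtain ⟨q, hq, hξq⟩ := h ξ hξ
    rw [indicator_of_mem hξ]
    refine le_trans ?_ (Finset.single_le_sum (f := fun q => ‖(D q).indicator H ξ‖) (fun q _ => norm_nonneg _) hq)
    simp only [indicator_of_mem hξq, le_refl]
  · rw [indicator_of_notMem hξ, norm_zero]
    exact Finset.sum_nonneg fun q _ => norm_nonneg _

lemma Ok_synth {V : Set (ℝ × ℝ)} {μ r : ℝ} (hr : 0 < r) {F : Finset Idx}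
    (hF : ∀ T ∈ F, ∃ z ∈ thk V μ, ‖z - om r T‖ < 1 / r) (b : Idx → ℂ) :
    Ok (thk V (μ + 2 / r)) (fun z => ∑ T ∈ F, b T * pk r T z) ∧ N2 (fun z => ∑ T ∈ F, b T * pk r T z) ≤ nn F b := by
  have hs := synth hr F b
  refine ⟨⟨?_, ne_top_of_le_ne_top (by simp) hs, ?_⟩, ?_⟩
  · refine Continuous.measurable ?_
    exact continuous_finsetSum _ fun T _ => continuous_const.mul (pk_continuous r T)
  · intro z hz
    refine Finset.sum_eq_zero fun T hT => ?_
    by_contra hne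
    have h1 := pk_supp hr (right_ne_zero_of_mul hne)
    obtain ⟨y, ⟨w, hw, hyw⟩, hy⟩ := hF T hT
    refine hz ⟨w, hw, ?_⟩
    calc ‖z - w‖ = ‖(z - om r T) - (y - om r T) + (y - w)‖ := by congr 1; abel
      _ ≤ ‖z - om r T‖ + ‖y - om r T‖ + ‖y - w‖ := (norm_add_le _ _).trans (by gcongr; exact norm_sub_le _ _)
      _ ≤ 1 / r + 1 / r + μ := by gcongr
      _ = μ + 2 / r := by ring
  · refine Real.sqrt_le_sqrt ?_
    exact ENNReal.toReal_le_of_le_ofReal (Finset.sum_nonneg fun _ _ => sq_nonneg _) hs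

lemma nn_cs {F G : Finset Idx} {I : Finset ℤ} {b d : Idx → ℂ} {a e : ℤ → Idx → ℝ}
    (ha : ∀ q ∈ I, ∀ T ∈ F, 0 ≤ a q T) (he : ∀ q ∈ I, ∀ T ∈ G, 0 ≤ e q T)
    (ha1 : ∀ T ∈ F, ∑ q ∈ I, a q T = 1) (he1 : ∀ T ∈ G, ∑ q ∈ I, e q T = 1) :
    ∑ q ∈ I, nn F (fun T => (a q T : ℂ) * b T) * nn G (fun T => (e q T : ℂ) * d T) ≤ nn F b * nn G d := by
  have key : ∀ (F : Finset Idx) (b : Idx → ℂ) (a : ℤ → Idx → ℝ), (∀ q ∈ I, ∀ T ∈ F, 0 ≤ a q T) → (∀ T ∈ F, ∑ q ∈ I, a q T = 1) →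
      ∑ q ∈ I, nn F (fun T => (a q T : ℂ) * b T) ^ 2 ≤ nn F b ^ 2 := by
    intro F b a ha ha1
    simp_rw [nn_sq]
    rw [Finset.sum_comm]
    refine Finset.sum_le_sum fun T hT => ?_
    calc ∑ q ∈ I, ‖(a q T : ℂ) * b T‖ ^ 2 ≤ ∑ q ∈ I, a q T * ‖b T‖ ^ 2 := by
          refine Finset.sum_le_sum fun q hq => ?_
          have h0 := ha q hq T hT
          have h1 : a q T ≤ 1 := by
            rw [← ha1 T hT]; exact Finset.single_le_sum (f := fun q => a q T) (fun q hq => ha q hq T hT) hq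
          rw [norm_mul, Complex.norm_real, Real.norm_eq_abs, abs_of_nonneg h0, mul_pow]
          gcongr
          nlinarith
      _ = ‖b T‖ ^ 2 := by rw [← Finset.sum_mul, ha1 T hT, one_mul]
  refine (Real.sum_mul_le_sqrt_mul_sqrt _ _ _).trans ?_
  have := nn_nonneg F b
  gcongr
  · exact Real.sqrt_le_iff.2 ⟨nn_nonneg _ _, key F b a ha ha1⟩
  · exact Real.sqrt_le_iff.2 ⟨nn_nonneg _ _, key G d e he he1⟩

end BAP

namespace BAP

/-- grid points covering a slab -/
def Pg (M r : ℝ) : Finset (ℤ × ℤ × ℤ) :=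
  Finset.Icc (-((⌈|M| / r⌉₊ : ℤ) + 1)) ((⌈|M| / r⌉₊ : ℤ) + 1) ×ˢ
    (Finset.Icc (-((⌈|M| / r⌉₊ : ℤ) + 1)) ((⌈|M| / r⌉₊ : ℤ) + 1) ×ˢ Finset.Icc 0 ⌊r⌋)

lemma Pg_time {M r : ℝ} {n : ℤ × ℤ × ℤ} (h : n ∈ Pg M r) : 0 ≤ n.2.2 ∧ (n.2.2 : ℝ) ≤ r := by
  simp only [Pg, Finset.mem_product, Finset.mem_Icc] at h
  exact ⟨h.2.2.1, Int.le_floor.1 h.2.2.2⟩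

lemma Pg_ne {M r : ℝ} (hr : 1 ≤ r) : (Pg M r).Nonempty := by
  refine ⟨(0, 0, 0), ?_⟩
  simp only [Pg, Finset.mem_product, Finset.mem_Icc]
  have : 0 ≤ ⌊r⌋ := Int.floor_nonneg.2 (by linarith)
  refine ⟨⟨?_, ?_⟩, ⟨?_, ?_⟩, le_rfl, this⟩ <;> lia

lemma Pg_cover {M r : ℝ} (hr : 1 ≤ r) {ξ : ℝ × ℝ × ℝ} (h : ξ ∈ box M 0 (r ^ 2)) : ∃ n ∈ Pg M r, ‖ξ - gp r n‖ ≤ r := by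
  have hr0 : 0 < r := by linarith
  obtain ⟨x, y, t⟩ := ξ
  simp only [box, mem_prod, mem_Icc] at h
  obtain ⟨⟨a1, a2⟩, ⟨b1, b2⟩, c1, c2⟩ := h
  have key : ∀ x : ℝ, |x - r * ⌊x / r⌋| ≤ r := by
    intro x
    have h1 := Int.floor_le (x / r)
    have h2 := Int.lt_floor_add_one (x / r)
    rw [le_div_iff₀ hr0] at h1
    rw [div_lt_iff₀ hr0] at h2
    rw [abs_le]; constructor <;> nlinarith
  have key2 : ∀ x : ℝ, -M ≤ x → x ≤ M → -((⌈|M| / r⌉₊ : ℤ) + 1) ≤ ⌊x / r⌋ ∧ ⌊x / r⌋ ≤ (⌈|M| / r⌉₊ : ℤ) + 1 := by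
    intro x h1 h2
    have hM : |x| ≤ |M| := by
      rw [abs_le]; have := le_abs_self M; have := neg_abs_le M; constructor <;> linarith
    have hc := Nat.le_ceil (|M| / r)
    have h3 : |x / r| ≤ ⌈|M| / r⌉₊ := by
      rw [abs_div, abs_of_pos hr0]; exact (by gcongr : |x| / r ≤ |M| / r).trans hc
    obtain ⟨h4, h5⟩ := abs_le.1 h3
    constructor
    · rw [Int.le_floor]; push_cast; linarith
    · have := Int.floor_le (x / r)
      have : (⌊x / r⌋ : ℝ) ≤ ((⌈|M| / r⌉₊ : ℤ) : ℝ) + 1 := by push_cast; linarith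
      exact_mod_cast this
  refine ⟨(⌊x / r⌋, ⌊y / r⌋, ⌊t / r⌋), ?_, ?_⟩
  · simp only [Pg, Finset.mem_product, Finset.mem_Icc]
    refine ⟨key2 x a1 a2, key2 y b1 b2, ?_, ?_⟩
    · exact Int.floor_nonneg.2 (by positivity)
    · apply Int.floor_le_floor
      rw [div_le_iff₀ hr0]; nlinarith
  · simp only [gp, Prod.mk_sub_mk, Prod.norm_mk, Real.norm_eq_abs]
    exact max_le (key _) (max_le (key _) (key _))

/-- good part of a tile -/
def gtile (M R θ L c : ℝ) (q : ℤ) : Set (ℝ × ℝ × ℝ) :=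
  box M 0 R ∩ {ξ | θ + q * L + c ≤ ξ.2.2 ∧ ξ.2.2 ≤ θ + (q + 1) * L - c}

lemma gtile_meas (M R θ L c : ℝ) (q : ℤ) : MeasurableSet (gtile M R θ L c q) := by
  have h : IsClosed {ξ : ℝ × ℝ × ℝ | θ + q * L + c ≤ ξ.2.2 ∧ ξ.2.2 ≤ θ + (q + 1) * L - c} :=
    IsClosed.inter (isClosed_le (f := fun _ => θ + q * L + c) (g := fun ξ : ℝ × ℝ × ℝ => ξ.2.2) continuous_const (by fun_prop))
      (isClosed_le (f := fun ξ : ℝ × ℝ × ℝ => ξ.2.2) (g := fun _ => θ + (q + 1) * L - c) (by fun_prop) continuous_const)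
  exact (slab_meas _ _ _).inter h.measurableSet

set_option maxHeartbeats 800000 in
lemma syn_step (B : ℝ) (hB : 1 ≤ B) (p : ℝ) (hp : 1 < p) (hp2 : p < 2) :
    ∃ K : ℝ, 1 ≤ K ∧ ∀ ψ, Reg ψ B → ∀ V1 V2, Trans ψ B (thk V1 10) (thk V2 10) → Trans ψ B (thk V2 10) (thk V1 10) →
    ∀ r : ℝ, 1 ≤ r → ∀ J : ℕ, 2 ≤ J → 8 * (J : ℝ) ≤ r → ∀ μ : ℝ, μ + 2 / r ≤ 10 → ∀ A : ℝ, 0 ≤ A →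
    Bd ψ V1 V2 p (r ^ 2 / 2) (μ + 2 / r) A →
    ∀ (F G : Finset Idx) (b d : Idx → ℂ), (∀ T ∈ F, ∃ z ∈ thk V1 μ, ‖z - om r T‖ < 1 / r) →
    (∀ T ∈ G, ∃ z ∈ thk V2 μ, ‖z - om r T‖ < 1 / r) → ∀ M : ℝ,
    eLpNorm (fun ξ => sy ψ r F b ξ * sy ψ r G d ξ) (ENNReal.ofReal p) (volume.restrict (box M 0 (r ^ 2))) ≤
    ENNReal.ofReal (J / (J - 1) * (A + K * J * r ^ (-(3 - 5 / p))) * (nn F b * nn G d)) := by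
  obtain ⟨K, hK, ht⟩ := tile B hB p hp hp2
  refine ⟨256 * K, by linarith, ?_⟩
  intro ψ hψ V1 V2 hT hT' r hr J hJ hJr μ hμ A hA hBd F G b d hF hG M
  have hr0 : 0 < r := by linarith
  have hcψ := hψ.1.continuous
  have hJ2 : (2:ℝ) ≤ J := by exact_mod_cast hJ
  have n1 := nn_nonneg F b
  have n2 := nn_nonneg G d
  have om_mem : ∀ {V : Set (ℝ × ℝ)} {T : Idx}, (∃ z ∈ thk V μ, ‖z - om r T‖ < 1 / r) → om r T ∈ thk V 10 := by
    rintro V T ⟨z, ⟨w, hw, hz⟩, hT⟩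
    refine ⟨w, hw, ?_⟩
    calc ‖om r T - w‖ = ‖-(z - om r T) + (z - w)‖ := by congr 1; abel
      _ ≤ ‖z - om r T‖ + ‖z - w‖ := (norm_add_le _ _).trans (by rw [norm_neg])
      _ ≤ 1 / r + μ := by gcongr
      _ ≤ 2 / r + μ := by gcongr; norm_num
      _ ≤ 10 := by linarith
  by_cases hb : nn F b = 0
  · have hz : ∀ T ∈ F, b T = 0 := by
      have h := nn_sq F b
      rw [hb, zero_pow two_ne_zero, eq_comm, Finset.sum_eq_zero_iff_of_nonneg (fun _ _ => sq_nonneg _)] at h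
      exact fun T hT => by simpa using h T hT
    have : (fun ξ => sy ψ r F b ξ * sy ψ r G d ξ) = 0 := by
      funext ξ
      have : sy ψ r F b ξ = 0 := Finset.sum_eq_zero fun T hT => by rw [hz T hT, zero_mul]
      simp [this]
    rw [this, eLpNorm_zero]; exact zero_le
  by_cases hd : nn G d = 0
  · have hz : ∀ T ∈ G, d T = 0 := by
      have h := nn_sq G d
      rw [hd, zero_pow two_ne_zero, eq_comm, Finset.sum_eq_zero_iff_of_nonneg (fun _ _ => sq_nonneg _)] at h
      exact fun T hT => by simpa using h T hT
    have : (fun ξ => sy ψ r F b ξ * sy ψ r G d ξ) = 0 := by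
      funext ξ
      have : sy ψ r G d ξ = 0 := Finset.sum_eq_zero fun T hT => by rw [hz T hT, zero_mul]
      simp [this]
    rw [this, eLpNorm_zero]; exact zero_le
  have hcont : Continuous (fun ξ => sy ψ r F b ξ * sy ψ r G d ξ) := (sy_continuous hcψ hr0 F b).mul (sy_continuous hcψ hr0 G d)
  obtain ⟨M1, hM10, hM1⟩ := sy_bdd ψ r F b
  obtain ⟨M2, hM20, hM2⟩ := sy_bdd ψ r G d
  have hbd : ∀ ξ, ‖sy ψ r F b ξ * sy ψ r G d ξ‖ ≤ M1 * M2 := fun ξ => by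
    rw [norm_mul]; gcongr; exacts [hM1 ξ, hM2 ξ]
  set L := r ^ 2 / 2 with hL
  have hL0 : 0 < L := by positivity
  obtain ⟨j, hj, hpig⟩ := pigeon hcont hbd hp (box_fin M 0 (r ^ 2)) hL0 hJ
  set θ : ℝ := j * L / J with hθ
  set c := L / (2 * J) with hc
  have hjJ : (j:ℝ) + 1 ≤ J := by exact_mod_cast hj
  have hθ0 : 0 ≤ θ := by positivity
  have hθL : θ < L := by rw [hθ, div_lt_iff₀ (by linarith)]; nlinarith
  have hc0 : 0 < c := by positivity
  set I : Finset ℤ := Finset.Icc (-1) 2 with hI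
  have hfl : ∀ t : ℝ, 0 ≤ t → t ≤ r ^ 2 → ⌊(t - θ) / L⌋ ∈ I := by
    intro t h0 h1
    rw [hI, Finset.mem_Icc]
    constructor
    · rw [Int.le_floor, le_div_iff₀ hL0]; push_cast; linarith
    · have : ⌊(t - θ) / L⌋ < 3 := by
        rw [Int.floor_lt, div_lt_iff₀ hL0]; push_cast; linarith
      lia
  have hfl2 : ∀ t : ℝ, θ + ⌊(t - θ) / L⌋ * L ≤ t ∧ t < θ + (⌊(t - θ) / L⌋ + 1) * L := by
    intro t
    have h1 := Int.floor_le ((t - θ) / L)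
    have h2 := Int.lt_floor_add_one ((t - θ) / L)
    rw [le_div_iff₀ hL0] at h1
    rw [div_lt_iff₀ hL0] at h2
    constructor <;> linarith
  have hcov : ∀ ξ ∈ box M 0 (r ^ 2) \ bad L J j, ∃ q ∈ I, ξ ∈ gtile M (r ^ 2) θ L c q := by
    rintro ξ ⟨hξ, hnb⟩
    have hξ' : ξ ∈ box M 0 (r ^ 2) := hξ
    simp only [box, mem_prod, mem_Icc] at hξ
    refine ⟨⌊(ξ.2.2 - θ) / L⌋, hfl _ hξ.2.2.1 hξ.2.2.2, hξ', ?_⟩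
    obtain ⟨h1, h2⟩ := hfl2 ξ.2.2
    simp only [bad, Set.mem_ofPred_eq, not_exists, not_lt] at hnb
    have h3 := hnb ⌊(ξ.2.2 - θ) / L⌋
    have h4 := hnb (⌊(ξ.2.2 - θ) / L⌋ + 1)
    rw [← hθ, ← hc] at h3 h4
    push_cast at h4
    rw [abs_of_nonneg (by linarith)] at h3
    rw [abs_of_nonpos (by linarith)] at h4
    constructor <;> linarith
  set P := Pg M r with hP
  have hPt : ∀ n ∈ P, 0 ≤ n.2.2 ∧ (n.2.2 : ℝ) ≤ r := fun n hn => Pg_time hn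
  set tl : ℤ × ℤ × ℤ → ℤ := fun n => ⌊(r * n.2.2 - θ) / L⌋ with htl
  have htlI : ∀ n ∈ P, tl n ∈ I := by
    intro n hn
    obtain ⟨h1, h2⟩ := hPt n hn
    have h1' : (0:ℝ) ≤ n.2.2 := by exact_mod_cast h1
    exact hfl _ (by positivity) (by nlinarith)
  set c' : ℝ := 1 / (8 * J) with hc'
  have hc'0 : 0 < c' := by positivity
  have hc'1 : c' ≤ 1 := by rw [hc', div_le_one (by linarith)]; linarith
  have hsep0 : c' * r ^ 2 ≤ c - r := by
    have : c = r ^ 2 / (4 * J) := by rw [hc, hL]; field_simp; norm_num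
    have h2 : r ≤ r ^ 2 / (8 * J) := by rw [le_div_iff₀ (by linarith)]; nlinarith
    have h3 : c' * r ^ 2 = r ^ 2 / (8 * J) := by rw [hc']; ring
    have h4 : r ^ 2 / (4 * J) = 2 * (r ^ 2 / (8 * J)) := by field_simp; norm_num
    linarith
  set a : ℤ → Idx → ℝ := fun q T => ac ψ r G (fun T => ‖d T‖) (P.filter fun n => tl n = q) P T with ha
  set e : ℤ → Idx → ℝ := fun q T => ac ψ r F (fun T => ‖b T‖) (P.filter fun n => tl n = q) P T with he
  set E : ℝ := 2 * I.card * (K * c'⁻¹ * r ^ (-(3 - 5 / p)) * (nn F b * nn G d)) with hE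
  have hE0 : 0 ≤ E := by positivity
  have htile : ∀ q ∈ I, eLpNorm (fun ξ => sy ψ r F b ξ * sy ψ r G d ξ) (ENNReal.ofReal p) (volume.restrict (gtile M (r ^ 2) θ L c q)) ≤
      ENNReal.ofReal (A * (nn F (fun T => (a q T : ℂ) * b T) * nn G (fun T => (e q T : ℂ) * d T)) + E) := by
    intro q hq
    have hsub : gtile M (r ^ 2) θ L c q ⊆ box M 0 (r ^ 2) := inter_subset_left
    have h1 := ht ψ hψ r hr _ _ hT hT' c' hc'0 hc'1 F G b d (fun T hT => om_mem (hF T hT)) (fun T hT => om_mem (hG T hT)) hb hd P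
      (Pg_ne hr) hPt tl I htlI q hq (gtile M (r ^ 2) θ L c q) (gtile_meas _ _ _ _ _ _)
      (ne_top_of_le_ne_top (box_fin M 0 (r ^ 2)) (measure_mono hsub)) (fun ξ hξ => Pg_cover hr (hsub hξ)) ?_
    · refine h1.trans ?_
      rw [ENNReal.ofReal_add (mul_nonneg hA (mul_nonneg (nn_nonneg _ _) (nn_nonneg _ _))) hE0]
      refine add_le_add ?_ le_rfl
      have s1 := Ok_synth hr0 hF (fun T => (a q T : ℂ) * b T)
      have s2 := Ok_synth hr0 hG (fun T => (e q T : ℂ) * d T)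
      have h2 := Bd_shift hcψ hBd M (θ + q * L) s1.1 s2.1
      simp_rw [← sy_eq hcψ hr0] at h2
      refine (eLpNorm_mono_measure _ (Measure.restrict_mono ?_ le_rfl)).trans (h2.trans (ENNReal.ofReal_le_ofReal ?_))
      · rintro ξ ⟨hξ, hξ1, hξ2⟩
        simp only [box, mem_prod, mem_Icc] at hξ ⊢
        refine ⟨hξ.1, hξ.2.1, ?_, ?_⟩ <;> linarith
      · gcongr
        · exact N2_nonneg _
        · exact nn_nonneg _ _
        · exact s1.2
        · exact s2.2
    · intro ξ hξ n hn hξn m hm hmq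
      have h2 : |ξ.2.2 - r * n.2.2| ≤ r := (((norm_snd_le _).trans (norm_snd_le _)) : ‖(ξ - gp r n).2.2‖ ≤ _).trans hξn
      obtain ⟨h3, h4⟩ := abs_le.1 h2
      obtain ⟨h5, h6⟩ := hfl2 (r * m.2.2)
      obtain ⟨_, h7, h8⟩ := hξ
      show c' * r ^ 2 ≤ |r * (n.2.2 : ℝ) - r * m.2.2|
      refine hsep0.trans ?_
      rcases lt_or_gt_of_ne hmq with hlt | hgt
      · have : (tl m : ℝ) + 1 ≤ q := by exact_mod_cast hlt
        have h9 : ((tl m : ℝ) + 1) * L ≤ q * L := by gcongr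
        refine le_trans ?_ (le_abs_self _)
        simp only [htl] at h9
        linarith
      · have : (q : ℝ) + 1 ≤ tl m := by exact_mod_cast hgt
        have h9 : ((q : ℝ) + 1) * L ≤ tl m * L := by gcongr
        refine le_trans ?_ (neg_le_abs _)
        simp only [htl] at h9
        linarith
  have hcs := nn_cs (F := F) (G := G) (I := I) (b := b) (d := d) (a := a) (e := e) (fun q _ T _ => ac_nonneg _ _ _ _ _ _ _) (fun q _ T _ => ac_nonneg _ _ _ _ _ _ _)
    (fun T _ => ac_sum tl htlI T (mm_ne (Pg_ne hr) hd T)) (fun T _ => ac_sum tl htlI T (mm_ne (Pg_ne hr) hb T))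
  refine hpig.trans ?_
  have h10 := eLp_cover hcont hp I ((slab_meas M 0 (r ^ 2)).diff (bad_meas L J j)) (fun q => gtile_meas M (r ^ 2) θ L c q) hcov
  have h11 : eLpNorm (fun ξ => sy ψ r F b ξ * sy ψ r G d ξ) (ENNReal.ofReal p) (volume.restrict (box M 0 (r ^ 2) \ bad L J j)) ≤
      ENNReal.ofReal ((A + 256 * K * J * r ^ (-(3 - 5 / p))) * (nn F b * nn G d)) := by
    refine h10.trans ((Finset.sum_le_sum htile).trans ?_)
    rw [← ENNReal.ofReal_sum_of_nonneg]
    · refine ENNReal.ofReal_le_ofReal ?_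
      rw [Finset.sum_add_distrib, ← Finset.mul_sum, Finset.sum_const, nsmul_eq_mul]
      have hcard : (I.card : ℝ) = 4 := by
        have h4 : I.card = 4 := by rw [hI]; rfl
        rw [h4]; norm_num
      rw [hE, hcard, hc']
      have := mul_le_mul_of_nonneg_left hcs hA
      rw [one_div, inv_inv]
      linarith
    · intro q _
      exact add_nonneg (mul_nonneg hA (mul_nonneg (nn_nonneg _ _) (nn_nonneg _ _))) hE0
  rw [mul_assoc, ENNReal.ofReal_mul (div_nonneg (by linarith) (by linarith))]
  gcongr

end BAP

namespace BAP

lemma N2_le {f : ℝ × ℝ → ℂ} {κ : ℝ} (hκ : 0 ≤ κ) (h : ∫⁻ z, ‖f z‖ₑ ^ 2 ≤ ENNReal.ofReal (κ ^ 2)) : N2 f ≤ κ := by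
  unfold N2
  rw [Real.sqrt_le_left hκ]
  exact ENNReal.toReal_le_of_le_ofReal (sq_nonneg _) h

lemma nn_le {F : Finset Idx} {b : Idx → ℂ} {f : ℝ × ℝ → ℂ} (hf : ∫⁻ z, ‖f z‖ₑ ^ 2 ≠ ⊤)
    (h : ENNReal.ofReal (∑ T ∈ F, ‖b T‖ ^ 2) ≤ ∫⁻ z, ‖f z‖ₑ ^ 2) : nn F b ≤ N2 f := by
  unfold nn N2
  apply Real.sqrt_le_sqrt
  rwa [← ENNReal.ofReal_le_iff_le_toReal hf]

lemma Ok_mono {V W : Set (ℝ × ℝ)} (h : V ⊆ W) {f : ℝ × ℝ → ℂ} (hf : Ok V f) : Ok W f :=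
  ⟨hf.1, hf.2.1, fun z hz => hf.2.2 z fun hm => hz (h hm)⟩

/-- Cauchy-Schwarz on a bounded support -/
lemma l1_bound {V : Set (ℝ × ℝ)} {B : ℝ} (hB : 0 ≤ B) (hV : ∀ z ∈ V, ‖z‖ ≤ B) {f : ℝ × ℝ → ℂ} (hf : Ok V f) :
    ∫⁻ z, ‖f z‖ₑ ≤ ENNReal.ofReal (2 * B * N2 f) := by
  set Q : Set (ℝ × ℝ) := Icc (-B) B ×ˢ Icc (-B) B with hQ
  have hQm : MeasurableSet Q := measurableSet_Icc.prod measurableSet_Icc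
  have hQv : volume Q = ENNReal.ofReal ((2 * B) ^ 2) := by
    rw [hQ, Measure.volume_eq_prod, Measure.prod_prod, Real.volume_Icc, ← ENNReal.ofReal_mul (by linarith)]
    congr 1; ring
  have h1 : ∀ z, ‖f z‖ₑ = ‖f z‖ₑ * Q.indicator (fun _ => (1:ℝ≥0∞)) z := by
    intro z
    by_cases hz : z ∈ V
    · have h2 := hV z hz
      rw [Prod.norm_def, max_le_iff, Real.norm_eq_abs, Real.norm_eq_abs, abs_le, abs_le] at h2
      rw [indicator_of_mem (show z ∈ Q from ⟨h2.1, h2.2⟩), mul_one]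
    · simp [hf.2.2 z hz]
  have h3 := ENNReal.lintegral_mul_le_Lp_mul_Lq volume Real.HolderConjugate.two_two
    (f := fun z => ‖f z‖ₑ) (g := Q.indicator (fun _ => (1:ℝ≥0∞))) hf.1.enorm.aemeasurable (measurable_const.indicator hQm).aemeasurable
  simp only [Pi.mul_apply, ENNReal.rpow_two] at h3
  rw [lintegral_congr h1]
  refine h3.trans ?_
  have h4 : ∀ z, Q.indicator (fun _ => (1:ℝ≥0∞)) z ^ 2 = Q.indicator (fun _ => (1:ℝ≥0∞)) z := by
    intro z; by_cases hz : z ∈ Q <;> simp [hz]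
  rw [lintegral_congr h4, lintegral_indicator hQm, setLIntegral_const, one_mul, hQv]
  have h5 : ∫⁻ z, ‖f z‖ₑ ^ 2 = ENNReal.ofReal (N2 f ^ 2) := by
    unfold N2
    rw [Real.sq_sqrt ENNReal.toReal_nonneg, ENNReal.ofReal_toReal hf.2.1]
  rw [h5, ENNReal.ofReal_pow (N2_nonneg _), ENNReal.ofReal_pow (by linarith)]
  have h6 : ∀ x : ℝ≥0∞, (x ^ 2) ^ (1 / (2:ℝ)) = x := fun x => by
    rw [← ENNReal.rpow_two, ← ENNReal.rpow_mul]; norm_num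
  rw [h6, h6, mul_comm, ← ENNReal.ofReal_mul (by linarith)]

lemma Ok_int {V : Set (ℝ × ℝ)} {B : ℝ} (hB : 0 ≤ B) (hV : ∀ z ∈ V, ‖z‖ ≤ B) {f : ℝ × ℝ → ℂ} (hf : Ok V f) : Integrable f :=
  ⟨hf.1.aestronglyMeasurable, (l1_bound hB hV hf).trans_lt ENNReal.ofReal_lt_top⟩

lemma EE_sup {V : Set (ℝ × ℝ)} {B : ℝ} (hB : 0 ≤ B) (hV : ∀ z ∈ V, ‖z‖ ≤ B) {f : ℝ × ℝ → ℂ} (hf : Ok V f) (ψ : ℝ → ℝ)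
    (ξ : ℝ × ℝ × ℝ) : ‖EE ψ f ξ‖ ≤ 2 * B * N2 f := by
  refine (EE_bound ψ f ξ).trans ?_
  rw [integral_norm_eq_lintegral_enorm hf.1.aestronglyMeasurable]
  exact ENNReal.toReal_le_of_le_ofReal (mul_nonneg (by linarith) (N2_nonneg _)) (l1_bound hB hV hf)

lemma EE_sub {ψ : ℝ → ℝ} (hψ : Continuous ψ) {f g : ℝ × ℝ → ℂ} (hf : Integrable f) (hg : Integrable g) (ξ : ℝ × ℝ × ℝ) :
    EE ψ (fun z => f z - g z) ξ = EE ψ f ξ - EE ψ g ξ := by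
  unfold EE
  have hc : Continuous fun z : ℝ × ℝ => ee (ξ.1 * z.1 + ξ.2.1 * z.2 + ξ.2.2 * ph ψ z) := by
    unfold ph
    have := ee_continuous
    fun_prop
  have hi : ∀ f : ℝ × ℝ → ℂ, Integrable f → Integrable fun z => f z * ee (ξ.1 * z.1 + ξ.2.1 * z.2 + ξ.2.2 * ph ψ z) := fun f hf =>
    Integrable.mul_bdd (c := 1) hf hc.aestronglyMeasurable (Filter.Eventually.of_forall fun z => (ee_norm _).le)
  rw [← integral_sub (hi f hf) (hi g hg)]
  congr 1; funext z; ring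

lemma Ok_sub {V : Set (ℝ × ℝ)} {f g : ℝ × ℝ → ℂ} (hf : Ok V f) (hg : Ok V g) (h : ∫⁻ z, ‖f z - g z‖ₑ ^ 2 ≠ ⊤) :
    Ok V (fun z => f z - g z) :=
  ⟨hf.1.sub hg.1, h, fun z hz => by simp [hf.2.2 z hz, hg.2.2 z hz]⟩

/-- transfer from packets to functions -/
lemma transfer {ψ : ℝ → ℝ} (hψ : Continuous ψ) {B p r μ K : ℝ} (hB : 0 ≤ B) (hp : 1 < p) (hr : 0 < r) (hK : 0 ≤ K)
    {V1 V2 : Set (ℝ × ℝ)} (h1 : ∀ z ∈ thk V1 (μ + 2 / r), ‖z‖ ≤ B) (h2 : ∀ z ∈ thk V2 (μ + 2 / r), ‖z‖ ≤ B)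
    {S : Set (ℝ × ℝ × ℝ)} (hS : volume S ≠ ⊤)
    (h : ∀ (F G : Finset Idx) (b d : Idx → ℂ), (∀ T ∈ F, ∃ z ∈ thk V1 μ, ‖z - om r T‖ < 1 / r) →
      (∀ T ∈ G, ∃ z ∈ thk V2 μ, ‖z - om r T‖ < 1 / r) →
      eLpNorm (fun ξ => sy ψ r F b ξ * sy ψ r G d ξ) (ENNReal.ofReal p) (volume.restrict S) ≤ ENNReal.ofReal (K * (nn F b * nn G d)))
    {f g : ℝ × ℝ → ℂ} (hf : Ok (thk V1 μ) f) (hg : Ok (thk V2 μ) g) :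
    eLpNorm (fun ξ => EE ψ f ξ * EE ψ g ξ) (ENNReal.ofReal p) (volume.restrict S) ≤ ENNReal.ofReal (K * (N2 f * N2 g)) := by
  have hp1 : (1:ℝ≥0∞) ≤ ENNReal.ofReal p := by rw [← ENNReal.ofReal_one]; exact ENNReal.ofReal_le_ofReal hp.le
  have hm : ∀ V, thk V μ ⊆ thk V (μ + 2 / r) := fun V => thk_mono (by have : 0 < 2 / r := by positivity
                                                                      linarith)
  have hNf := N2_nonneg f
  have hNg := N2_nonneg g
  have key : ∀ κ : ℝ, 0 < κ → eLpNorm (fun ξ => EE ψ f ξ * EE ψ g ξ) (ENNReal.ofReal p) (volume.restrict S) ≤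
      ENNReal.ofReal (K * (N2 f * N2 g)) + volume S ^ (ENNReal.ofReal p).toReal⁻¹ * ENNReal.ofReal (κ * (4 * B ^ 2 * (N2 f + N2 g))) := by
    intro κ hκ
    obtain ⟨F, b, hF, hFb, hFe⟩ := approx hr f hf.1 hf.2.1 (thk V1 μ) (fun z hz => h1 z (hm _ hz)) hf.2.2 (κ := κ ^ 2) (by positivity)
    obtain ⟨G, d, hG, hGb, hGe⟩ := approx hr g hg.1 hg.2.1 (thk V2 μ) (fun z hz => h2 z (hm _ hz)) hg.2.2 (κ := κ ^ 2) (by positivity)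
    have s1 := Ok_synth hr hF b
    have s2 := Ok_synth hr hG d
    have of := Ok_mono (hm _) hf
    have og := Ok_mono (hm _) hg
    have e1 := Ok_sub of s1.1 (ne_top_of_le_ne_top (by simp) hFe)
    have e2 := Ok_sub og s2.1 (ne_top_of_le_ne_top (by simp) hGe)
    have hb1 := nn_le hf.2.1 hFb
    have hb2 := nn_le hg.2.1 hGb
    set Φ := sy ψ r F b with hΦ
    set Ψ := sy ψ r G d with hΨ
    have hΦe : ∀ ξ, ‖EE ψ f ξ - Φ ξ‖ ≤ 2 * B * κ := fun ξ => by
      rw [hΦ, sy_eq hψ hr, ← EE_sub hψ (Ok_int hB h1 of) (Ok_int hB h1 s1.1)]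
      refine (EE_sup hB h1 e1 ψ ξ).trans ?_
      gcongr
      exact N2_le hκ.le hFe
    have hΨe : ∀ ξ, ‖EE ψ g ξ - Ψ ξ‖ ≤ 2 * B * κ := fun ξ => by
      rw [hΨ, sy_eq hψ hr, ← EE_sub hψ (Ok_int hB h2 og) (Ok_int hB h2 s2.1)]
      refine (EE_sup hB h2 e2 ψ ξ).trans ?_
      gcongr
      exact N2_le hκ.le hGe
    have hΦb : ∀ ξ, ‖Φ ξ‖ ≤ 2 * B * N2 f := fun ξ => by
      rw [hΦ, sy_eq hψ hr]
      refine (EE_sup hB h1 s1.1 ψ ξ).trans ?_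
      gcongr
      exact s1.2.trans hb1
    have hgb : ∀ ξ, ‖EE ψ g ξ‖ ≤ 2 * B * N2 g := EE_sup hB h2 og ψ
    have cΦ : Continuous Φ := sy_continuous hψ hr F b
    have cΨ : Continuous Ψ := sy_continuous hψ hr G d
    have cf : Continuous (EE ψ f) := EE_continuous hψ (Ok_int hB h1 of)
    have cg : Continuous (EE ψ g) := EE_continuous hψ (Ok_int hB h2 og)
    have hfun : (fun ξ => EE ψ f ξ * EE ψ g ξ) = (fun ξ => Φ ξ * Ψ ξ) + fun ξ => EE ψ f ξ * EE ψ g ξ - Φ ξ * Ψ ξ := by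
      funext ξ; simp
    rw [hfun]
    refine (eLpNorm_add_le (cΦ.mul cΨ).aestronglyMeasurable ((cf.mul cg).sub (cΦ.mul cΨ)).aestronglyMeasurable hp1).trans ?_
    refine add_le_add ((h F G b d hF hG).trans (ENNReal.ofReal_le_ofReal ?_)) ?_
    · gcongr
      exact nn_nonneg _ _
    · refine (eLpNorm_le_of_ae_bound (C := κ * (4 * B ^ 2 * (N2 f + N2 g))) (Filter.Eventually.of_forall fun ξ => ?_)).trans_eq ?_
      · have : EE ψ f ξ * EE ψ g ξ - Φ ξ * Ψ ξ = (EE ψ f ξ - Φ ξ) * EE ψ g ξ + Φ ξ * (EE ψ g ξ - Ψ ξ) := by ring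
        show ‖EE ψ f ξ * EE ψ g ξ - Φ ξ * Ψ ξ‖ ≤ _
        rw [this]
        calc _ ≤ ‖EE ψ f ξ - Φ ξ‖ * ‖EE ψ g ξ‖ + ‖Φ ξ‖ * ‖EE ψ g ξ - Ψ ξ‖ := by
              refine (norm_add_le _ _).trans ?_; rw [norm_mul, norm_mul]
          _ ≤ 2 * B * κ * (2 * B * N2 g) + 2 * B * N2 f * (2 * B * κ) := by
              gcongr
              exacts [hΦe ξ, hgb ξ, hΦb ξ, hΨe ξ]
          _ = _ := by ring
      · rw [Measure.restrict_apply_univ]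
  refine ENNReal.le_of_forall_pos_le_add fun ε hε _ => ?_
  set X := volume S ^ (ENNReal.ofReal p).toReal⁻¹ with hX
  have hXf : X ≠ ⊤ := ENNReal.rpow_ne_top_of_nonneg (by positivity) hS
  set Y := X.toReal * (4 * B ^ 2 * (N2 f + N2 g)) with hY
  have hY0 : 0 ≤ Y := by positivity
  refine (key (ε / (Y + 1)) (by positivity)).trans ?_
  gcongr
  rw [← ENNReal.ofReal_toReal hXf, ← ENNReal.ofReal_mul ENNReal.toReal_nonneg]
  refine (ENNReal.ofReal_le_ofReal (q := ε) ?_).trans_eq (by simp)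
  have : X.toReal * (ε / (Y + 1) * (4 * B ^ 2 * (N2 f + N2 g))) = ε * (Y / (Y + 1)) := by rw [hY]; ring
  rw [this]
  have h3 : Y / (Y + 1) ≤ 1 := by rw [div_le_one (by linarith)]; linarith
  have h4 : (0:ℝ) ≤ ε := ε.2
  nlinarith

end BAP

namespace BAP

lemma Trans.nb1 {ψ : ℝ → ℝ} {B : ℝ} {W1 W2 : Set (ℝ × ℝ)} (h : Trans ψ B W1 W2) : ∀ z ∈ W1, ‖z‖ ≤ B := fun z hz => by
  have := h.bd1 z hz
  rw [Prod.norm_def, max_le_iff, Real.norm_eq_abs, Real.norm_eq_abs]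
  constructor <;> linarith

lemma Trans.nb2 {ψ : ℝ → ℝ} {B : ℝ} {W1 W2 : Set (ℝ × ℝ)} (h : Trans ψ B W1 W2) : ∀ z ∈ W2, ‖z‖ ≤ B := fun z hz => by
  have := h.bd2 z hz
  rw [Prod.norm_def, max_le_iff, Real.norm_eq_abs, Real.norm_eq_abs]
  constructor <;> linarith

lemma Bd_mono {ψ : ℝ → ℝ} {V1 V2 : Set (ℝ × ℝ)} {p R μ ν A A' : ℝ} (h : Bd ψ V1 V2 p R μ A) (h1 : ν ≤ μ) (h2 : A ≤ A') :
    Bd ψ V1 V2 p R ν A' := fun M f g hf hg =>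
  (h M f g (Ok_mono (thk_mono h1) hf) (Ok_mono (thk_mono h1) hg)).trans
    (ENNReal.ofReal_le_ofReal (mul_le_mul_of_nonneg_right h2 (mul_nonneg (N2_nonneg _) (N2_nonneg _))))

lemma full_step (B : ℝ) (hB : 1 ≤ B) (p : ℝ) (hp : 1 < p) (hp2 : p < 2) :
    ∃ K : ℝ, 1 ≤ K ∧ ∀ ψ, Reg ψ B → ∀ V1 V2, Trans ψ B (thk V1 10) (thk V2 10) → Trans ψ B (thk V2 10) (thk V1 10) →
    ∀ r : ℝ, 1 ≤ r → ∀ J : ℕ, 2 ≤ J → 8 * (J:ℝ) ≤ r → ∀ μ : ℝ, μ + 2 / r ≤ 10 → ∀ A : ℝ, 0 ≤ A →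
    Bd ψ V1 V2 p (r ^ 2 / 2) (μ + 2 / r) A →
    Bd ψ V1 V2 p (r ^ 2) μ (J / (J - 1) * (A + K * J * r ^ (-(3 - 5 / p)))) := by
  obtain ⟨K, hK, h⟩ := syn_step B hB p hp hp2
  refine ⟨K, hK, ?_⟩
  intro ψ hψ V1 V2 hT hT' r hr J hJ hJr μ hμ A hA hBd M f g hf hg
  have hJ' : (2:ℝ) ≤ J := by exact_mod_cast hJ
  have hr0 : 0 < r := by linarith
  refine transfer hψ.1.continuous (B := B) (by linarith) hp hr0 (mul_nonneg (div_nonneg (by linarith) (by linarith)) (by positivity))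
    (fun z hz => hT.nb1 z (thk_mono hμ hz)) (fun z hz => hT.nb2 z (thk_mono hμ hz)) (box_fin M 0 (r ^ 2)) ?_ hf hg
  intro F G b d hF hG
  exact h ψ hψ V1 V2 hT hT' r hr J hJ hJr μ hμ A hA hBd F G b d hF hG M

lemma base (B : ℝ) (hB : 1 ≤ B) (p : ℝ) (hp : 1 < p) (hp2 : p < 2) (r : ℝ) (hr : 1 ≤ r) :
    ∃ K : ℝ, 1 ≤ K ∧ ∀ ψ, Reg ψ B → ∀ V1 V2, Trans ψ B (thk V1 10) (thk V2 10) →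
    ∀ μ : ℝ, μ + 2 / r ≤ 10 → Bd ψ V1 V2 p (r ^ 2) μ K := by
  obtain ⟨K, hK, h⟩ := l2_slab B hB
  have hr0 : 0 < r := by linarith
  refine ⟨4 * B ^ 2 * K * r ^ 2, ?_, ?_⟩
  · have : (1:ℝ) ≤ B ^ 2 := one_le_pow₀ hB
    have h2 : (1:ℝ) ≤ r ^ 2 := one_le_pow₀ hr
    have : (1:ℝ) ≤ B ^ 2 * K := one_le_mul_of_one_le_of_one_le this hK
    nlinarith
  intro ψ hψ V1 V2 hT μ hμ M f g hf hg
  have hcψ := hψ.1.continuous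
  have n1 : ∀ z ∈ thk V1 (μ + 2 / r), ‖z‖ ≤ B := fun z hz => hT.nb1 z (thk_mono hμ hz)
  have n2 : ∀ z ∈ thk V2 (μ + 2 / r), ‖z‖ ≤ B := fun z hz => hT.nb2 z (thk_mono hμ hz)
  refine transfer hcψ (B := B) (by linarith) hp hr0 (by positivity) n1 n2 (box_fin M 0 (r ^ 2)) ?_ hf hg
  intro F G b d hF hG
  have om_mem : ∀ {V : Set (ℝ × ℝ)} {T : Idx}, (∃ z ∈ thk V μ, ‖z - om r T‖ < 1 / r) → om r T ∈ thk V 10 := by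
    rintro V T ⟨z, ⟨w, hw, hzw⟩, hz⟩
    refine ⟨w, hw, ?_⟩
    calc ‖om r T - w‖ = ‖(z - w) - (z - om r T)‖ := by congr 1; abel
      _ ≤ ‖z - w‖ + ‖z - om r T‖ := norm_sub_le _ _
      _ ≤ μ + 1 / r := by gcongr
      _ ≤ μ + 2 / r := by gcongr; norm_num
      _ ≤ 10 := hμ
  have gF : ∀ T ∈ F, Good B r T := fun T hT' => hT.bd1 _ (om_mem (hF T hT'))
  have gG : ∀ T ∈ G, Good B r T := fun T hT' => hT.bd2 _ (om_mem (hG T hT'))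
  set N := nn F b with hN
  set N' := nn G d with hN'
  have hN0 : 0 ≤ N := nn_nonneg _ _
  have hN0' : 0 ≤ N' := nn_nonneg _ _
  obtain ⟨M1, hM10, hM1⟩ := sy_bdd ψ r F b
  obtain ⟨M2, hM20, hM2⟩ := sy_bdd ψ r G d
  have cΦ := sy_continuous hcψ hr0 F b
  have cΨ := sy_continuous hcψ hr0 G d
  have hcov : ∀ ξ ∈ box M 0 (r ^ 2), ∃ n ∈ Pg M r, ‖ξ - gp r n‖ ≤ r := fun ξ hξ => Pg_cover hr hξ
  have hPt : ∀ n ∈ Pg M r, 0 ≤ n.2.2 ∧ (n.2.2 : ℝ) ≤ r := fun n hn => Pg_time hn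
  have q1 := h ψ hψ r hr F gF b _ (slab_meas M 0 (r ^ 2)) (Pg M r) hcov hPt
  have q2 := h ψ hψ r hr G gG d _ (slab_meas M 0 (r ^ 2)) (Pg M r) hcov hPt
  rw [← nn_sq, ← hN] at q1
  rw [← nn_sq, ← hN'] at q2
  have hsK : 0 ≤ √K := Real.sqrt_nonneg _
  have hsK2 : √K ^ 2 = K := Real.sq_sqrt (by linarith)
  have l1 : ∫⁻ ξ in box M 0 (r ^ 2), ‖sy ψ r F b ξ‖ₑ ^ 2 ≤ ENNReal.ofReal ((√K * r * N) ^ 2) := by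
    have := lint_sq (box_fin M 0 (r ^ 2)) cΦ hM1 q1
    rwa [mul_pow, mul_pow, hsK2]
  have l2 : ∫⁻ ξ in box M 0 (r ^ 2), ‖sy ψ r G d ξ‖ₑ ^ 2 ≤ ENNReal.ofReal ((√K * r * N') ^ 2) := by
    have := lint_sq (box_fin M 0 (r ^ 2)) cΨ hM2 q2
    rwa [mul_pow, mul_pow, hsK2]
  have i1 := lint_cs cΦ cΨ (by positivity) (by positivity) l1 l2
  have e1 : √K * r * N * (√K * r * N') = K * r ^ 2 * (N * N') := by
    calc _ = √K ^ 2 * r ^ 2 * (N * N') := by ring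
      _ = _ := by rw [hsK2]
  rw [e1] at i1
  have s1 := Ok_synth hr0 hF b
  have hΦb : ∀ ξ, ‖sy ψ r F b ξ‖ ≤ 2 * B * N := fun ξ => by
    rw [sy_eq hcψ hr0]
    refine (EE_sup (by linarith) n1 s1.1 ψ ξ).trans ?_
    gcongr
    exact s1.2
  have i2 : ∫⁻ ξ in box M 0 (r ^ 2), ‖sy ψ r F b ξ * sy ψ r G d ξ‖ₑ ^ 2 ≤ ENNReal.ofReal ((2 * B * N) ^ 2 * (K * r ^ 2 * N' ^ 2)) := by
    calc _ ≤ ∫⁻ ξ in box M 0 (r ^ 2), ENNReal.ofReal ((2 * B * N) ^ 2) * ‖sy ψ r G d ξ‖ₑ ^ 2 := by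
          refine lintegral_mono fun ξ => ?_
          simp only
          rw [enorm_mul, mul_pow, ENNReal.ofReal_pow (by positivity)]
          gcongr
          rw [← ofReal_norm]
          exact ENNReal.ofReal_le_ofReal (hΦb ξ)
      _ = ENNReal.ofReal ((2 * B * N) ^ 2) * ∫⁻ ξ in box M 0 (r ^ 2), ‖sy ψ r G d ξ‖ₑ ^ 2 := by
          rw [lintegral_const_mul' _ _ (by simp)]
      _ ≤ _ := by
          rw [ENNReal.ofReal_mul (by positivity)]
          gcongr
          refine l2.trans_eq ?_
          rw [mul_pow, mul_pow, hsK2]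
  refine (interp (cΦ.mul cΨ).aemeasurable hp hp2 (by positivity) (by positivity) i1 i2).trans (ENNReal.ofReal_le_ofReal ?_)
  set a := 4 * B ^ 2 * K * r ^ 2 * (N * N') with ha
  have hB1 : 1 ≤ B ^ 2 := one_le_pow₀ hB
  have hr1 : 1 ≤ r ^ 2 := one_le_pow₀ hr
  have ha0 : 0 ≤ a := by positivity
  have u1 : K * r ^ 2 * (N * N') ≤ a := by
    rw [ha]
    have : 0 ≤ K * r ^ 2 * (N * N') := by positivity
    nlinarith
  have u2 : (2 * B * N) ^ 2 * (K * r ^ 2 * N' ^ 2) ≤ a ^ 2 := by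
    have : a ^ 2 = (2 * B * N) ^ 2 * (K * r ^ 2 * N' ^ 2) * (4 * (B ^ 2 * (K * r ^ 2))) := by rw [ha]; ring
    rw [this]
    refine le_mul_of_one_le_right (by positivity) ?_
    have := one_le_mul_of_one_le_of_one_le hB1 (one_le_mul_of_one_le_of_one_le hK hr1)
    linarith
  have v1 : 0 ≤ 2 / p - 1 := by rw [sub_nonneg, le_div_iff₀ (by linarith)]; linarith
  have v2 : 0 ≤ 1 - 1 / p := by rw [sub_nonneg, div_le_iff₀ (by linarith)]; linarith
  calc _ ≤ a ^ (2 / p - 1) * (a ^ 2) ^ (1 - 1 / p) := by gcongr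
    _ = a := by
      rcases ha0.eq_or_lt with h0 | h0
      · rw [← h0, zero_pow two_ne_zero, Real.zero_rpow (x := 1 - 1 / p), mul_zero]
        have : 1 / p < 1 := by rw [div_lt_iff₀ (by linarith)]; linarith
        linarith
      · rw [← Real.rpow_natCast, ← Real.rpow_mul h0.le, ← Real.rpow_add h0]
        convert Real.rpow_one a using 2
        push_cast; ring

end BAP

namespace BAP

lemma geo_bdd {x : ℝ} (h0 : 0 ≤ x) (h1 : x < 1) : ∃ D : ℝ, 1 ≤ D ∧ (∀ n : ℕ, ((n:ℝ) + 2) ^ 2 * x ^ n ≤ D) ∧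
    ∀ n : ℕ, ∑ i ∈ Finset.range n, ((i:ℝ) + 2) ^ 2 * x ^ i ≤ D := by
  have hs : Summable fun n : ℕ => ((n:ℝ) + 2) ^ 2 * x ^ n := by
    have e : (fun n : ℕ => ((n:ℝ) + 2) ^ 2 * x ^ n) = fun n : ℕ => (n:ℝ) ^ 2 * x ^ n + (4 * ((n:ℝ) ^ 1 * x ^ n) + 4 * ((n:ℝ) ^ 0 * x ^ n)) := by
      funext n; ring
    rw [e]
    have hx : ‖x‖ < 1 := by rwa [Real.norm_eq_abs, abs_of_nonneg h0]
    have := fun k => summable_pow_mul_geometric_of_norm_lt_one k hx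
    exact (this 2).add (((this 1).mul_left 4).add ((this 0).mul_left 4))
  have hn : ∀ n : ℕ, 0 ≤ ((n:ℝ) + 2) ^ 2 * x ^ n := fun n => by positivity
  refine ⟨1 + ∑' n : ℕ, ((n:ℝ) + 2) ^ 2 * x ^ n, ?_, fun n => ?_, fun n => ?_⟩
  · have h : 0 ≤ ∑' n : ℕ, ((n:ℝ) + 2) ^ 2 * x ^ n := tsum_nonneg hn
    linarith
  · have := hs.le_tsum n (fun j _ => hn j); linarith
  · have := hs.sum_le_tsum (Finset.range n) (fun j _ => hn j); linarith

lemma iter (B : ℝ) (hB : 1 ≤ B) (p : ℝ) (hp : 5 / 3 < p) (hp2 : p < 2) :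
    ∃ K : ℝ, 1 ≤ K ∧ ∀ ψ, Reg ψ B → ∀ V1 V2, Trans ψ B (thk V1 10) (thk V2 10) → Trans ψ B (thk V2 10) (thk V1 10) →
    ∃ r0 : ℝ, 1 ≤ r0 ∧ ∀ n : ℕ, Bd ψ V1 V2 p (r0 ^ 2 * 2 ^ n) 0 K := by
  have hp1 : 1 < p := by linarith
  set s := 3 - 5 / p with hs
  have hs0 : 0 < s := by
    rw [hs, sub_pos, div_lt_iff₀ (by linarith)]; linarith
  obtain ⟨K, hK, hstep⟩ := full_step B hB p hp1 hp2
  set x : ℝ := (√2)⁻¹ with hx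
  have h2 : (1:ℝ) < √2 := by rw [Real.lt_sqrt (by norm_num)]; norm_num
  have hx0 : 0 < x := by positivity
  have hx1 : x < 1 := inv_lt_one_of_one_lt₀ h2
  obtain ⟨D, hD, hD1, -⟩ := geo_bdd hx0.le hx1
  obtain ⟨D', hD', -, hD2⟩ := geo_bdd (Real.rpow_nonneg hx0.le s) (Real.rpow_lt_one hx0.le hx1 hs0)
  set r0 : ℝ := 8 * D with hr0
  have hr01 : 1 ≤ r0 := by linarith
  obtain ⟨A0, hA0, hbase⟩ := base B hB p hp1 hp2 r0 hr01
  refine ⟨2 * (A0 + K * D'), by nlinarith, ?_⟩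
  intro ψ hψ V1 V2 hT hT'
  refine ⟨r0, hr01, ?_⟩
  set r : ℕ → ℝ := fun n => r0 * (√2) ^ n with hr
  have hr1 : ∀ n, 1 ≤ r n := fun n => one_le_mul_of_one_le_of_one_le hr01 (one_le_pow₀ h2.le)
  have hr2 : ∀ n, r n ^ 2 = r0 ^ 2 * 2 ^ n := fun n => by
    simp only [hr]
    rw [mul_pow, ← pow_mul, mul_comm n 2, pow_mul, Real.sq_sqrt (by norm_num)]
  have hrs : ∀ n, r (n + 1) = r n * √2 := fun n => by simp only [hr]; ring
  set e : ℕ → ℝ := fun n => K * (((n:ℝ) + 2) ^ 2 * (x ^ s) ^ n) with he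
  have he0 : ∀ n, 0 ≤ e n := fun n => by positivity
  have main : ∀ n : ℕ, Bd ψ V1 V2 p (r n ^ 2) (5 / r n) (2 * (n + 1) / (n + 2) * (A0 + ∑ i ∈ Finset.range n, e i)) := by
    intro n
    induction n with
    | zero =>
      have : Bd ψ V1 V2 p (r0 ^ 2) (5 / r0) A0 := hbase ψ hψ V1 V2 hT _ (by
        have : 1 / r0 ≤ 1 := by rw [div_le_one (by linarith)]; exact hr01
        have e1 : 5 / r0 + 2 / r0 = 7 * (1 / r0) := by ring
        linarith)
      simpa [hr] using this
    | succ n ih =>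
      have hrn := hr1 n
      have hrn1 := hr1 (n + 1)
      have e0 : r (n + 1) ^ 2 / 2 = r n ^ 2 := by rw [hr2, hr2]; ring
      have hsum0 : 0 ≤ ∑ i ∈ Finset.range n, e i := Finset.sum_nonneg fun i _ => he0 i
      have hA : 0 ≤ 2 * ((n:ℝ) + 1) / (n + 2) * (A0 + ∑ i ∈ Finset.range n, e i) := by positivity
      have hμ : 5 / r (n + 1) + 2 / r (n + 1) ≤ 5 / r n := by
        rw [← add_div, div_le_div_iff₀ (by linarith) (by linarith), hrs]
        have : (1.4:ℝ) ≤ √2 := by rw [Real.le_sqrt (by norm_num) (by norm_num)]; norm_num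
        nlinarith
      have h3 := hstep ψ hψ V1 V2 hT hT' (r (n + 1)) hrn1 ((n + 2) ^ 2) (by have := Nat.pow_le_pow_left (show 2 ≤ n + 2 by lia) 2; lia) ?_ (5 / r (n + 1)) ?_ _ hA
        (by rw [e0]; exact Bd_mono ih hμ le_rfl)
      · refine Bd_mono h3 le_rfl ?_
        rw [Finset.sum_range_succ]
        set S := ∑ i ∈ Finset.range n, e i with hS
        have e3 : K * (((n + 2) ^ 2 : ℕ):ℝ) * r (n + 1) ^ (-s) ≤ e n := by
          simp only [he]
          push_cast
          rw [mul_assoc]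
          gcongr
          have : r (n + 1) ^ (-s) ≤ ((√2) ^ n) ^ (-s) := by
            apply Real.rpow_le_rpow_of_nonpos (by positivity) _ (by linarith)
            rw [hrs]
            have h4 : (√2) ^ n ≤ r n := le_mul_of_one_le_left (by positivity) hr01
            nlinarith
          refine this.trans_eq ?_
          rw [hx, Real.inv_rpow (by positivity), Real.rpow_neg (by positivity), inv_pow, ← Real.rpow_natCast, ← Real.rpow_natCast,
            ← Real.rpow_mul (by positivity), ← Real.rpow_mul (by positivity), mul_comm]
        have e4 : (((n + 2) ^ 2 : ℕ):ℝ) / ((((n + 2) ^ 2 : ℕ):ℝ) - 1) = ((n:ℝ) + 2) ^ 2 / (((n:ℝ) + 1) * (n + 3)) := by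
          push_cast; congr 1; ring
        rw [e4]
        have e5 : (1:ℝ) ≤ 2 * ((n:ℝ) + 1) / (n + 2) := by rw [le_div_iff₀ (by positivity)]; linarith [Nat.cast_nonneg (α := ℝ) n]
        have hen := he0 n
        calc _ ≤ ((n:ℝ) + 2) ^ 2 / (((n:ℝ) + 1) * (n + 3)) * (2 * ((n:ℝ) + 1) / (n + 2) * (A0 + S) + 2 * ((n:ℝ) + 1) / (n + 2) * e n) := by
              refine mul_le_mul_of_nonneg_left (add_le_add le_rfl ?_) (by positivity)
              exact e3.trans (le_mul_of_one_le_left hen e5)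
          _ = _ := by
              push_cast; field_simp; ring
      · have h4 := hD1 n
        push_cast
        rw [hrs]
        have h5 : ((n:ℝ) + 2) ^ 2 ≤ D * (√2) ^ n := by
          rw [hx, inv_pow, ← div_eq_mul_inv, div_le_iff₀ (by positivity)] at h4
          exact h4
        have h6 : r n = 8 * (D * (√2) ^ n) := by simp only [hr, hr0]; ring
        nlinarith
      · refine hμ.trans ?_
        rw [div_le_iff₀ (by linarith)]; linarith
  intro n
  rw [← hr2]
  refine Bd_mono (main n) (by have := hr1 n; positivity) ?_
  have hsum : ∑ i ∈ Finset.range n, e i ≤ K * D' := by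
    simp only [he]
    rw [← Finset.mul_sum]
    gcongr
    exact hD2 n
  have hsum0 : 0 ≤ ∑ i ∈ Finset.range n, e i := Finset.sum_nonneg fun i _ => he0 i
  have : 2 * ((n:ℝ) + 1) / (n + 2) ≤ 2 := by rw [div_le_iff₀ (by positivity)]; linarith
  gcongr

/-- global estimate, `p < 2` -/
lemma glob (B : ℝ) (hB : 1 ≤ B) (p : ℝ) (hp : 5 / 3 < p) (hp2 : p < 2) :
    ∃ K : ℝ, 1 ≤ K ∧ ∀ ψ, Reg ψ B → ∀ V1 V2, Trans ψ B (thk V1 10) (thk V2 10) → Trans ψ B (thk V2 10) (thk V1 10) →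
    ∀ f g, Ok V1 f → Ok V2 g →
    eLpNorm (fun ξ => EE ψ f ξ * EE ψ g ξ) (ENNReal.ofReal p) volume ≤ ENNReal.ofReal (K * (N2 f * N2 g)) := by
  obtain ⟨K, hK, h⟩ := iter B hB p hp hp2
  refine ⟨K, hK, ?_⟩
  intro ψ hψ V1 V2 hT hT' f g hf hg
  obtain ⟨r0, hr0, hb⟩ := h ψ hψ V1 V2 hT hT'
  have hp0 : 0 < p := by linarith
  have hsub : ∀ V : Set (ℝ × ℝ), V ⊆ thk V 0 := fun V z hz => ⟨z, hz, by simp⟩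
  have h1 : ∀ m : ℕ, ∫⁻ ξ in box m (-m) m, ‖EE ψ f ξ * EE ψ g ξ‖ₑ ^ p ≤ ENNReal.ofReal (K * (N2 f * N2 g)) ^ p := by
    intro m
    obtain ⟨n, hn⟩ := pow_unbounded_of_one_lt (2 * (m:ℝ)) (one_lt_two (α := ℝ))
    have h2 := Bd_shift hψ.1.continuous (hb n) m (-m) (Ok_mono (hsub V1) hf) (Ok_mono (hsub V2) hg)
    have h3 : box (m:ℝ) (-m) m ⊆ box m (-m) (-m + r0 ^ 2 * 2 ^ n) := by
      have h4 : (1:ℝ) ≤ r0 ^ 2 := one_le_pow₀ hr0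
      have h5 : (2:ℝ) ^ n ≤ r0 ^ 2 * 2 ^ n := le_mul_of_one_le_left (by positivity) h4
      exact prod_mono le_rfl (prod_mono le_rfl (Icc_subset_Icc le_rfl (by linarith)))
    have h6 := (eLpNorm_mono_measure (fun ξ => EE ψ f ξ * EE ψ g ξ) (p := ENNReal.ofReal p) (Measure.restrict_mono h3 (le_refl volume))).trans h2
    rw [eLp_eq _ hp0] at h6
    rwa [one_div, ENNReal.rpow_inv_le_iff hp0] at h6
  rw [eLp_eq _ hp0, one_div, ENNReal.rpow_inv_le_iff hp0]
  have hun : (⋃ m : ℕ, box (m:ℝ) (-m) m) = univ := by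
    refine eq_univ_of_forall fun ξ => mem_iUnion.2 ?_
    obtain ⟨m, hm⟩ := exists_nat_ge ‖ξ‖
    refine ⟨m, ?_⟩
    have a1 := (norm_fst_le ξ).trans hm
    have a2 := ((norm_fst_le ξ.2).trans (norm_snd_le ξ)).trans hm
    have a3 := ((norm_snd_le ξ.2).trans (norm_snd_le ξ)).trans hm
    rw [Real.norm_eq_abs, abs_le] at a1 a2 a3
    exact ⟨a1, a2, a3⟩
  rw [← setLIntegral_univ, ← hun, setLIntegral_iUnion_of_directed]
  · exact iSup_le h1
  · refine Monotone.directed_le fun m n hmn => ?_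
    have : (m:ℝ) ≤ n := by exact_mod_cast hmn
    exact prod_mono (Icc_subset_Icc (by linarith) this) (prod_mono (Icc_subset_Icc (by linarith) this) (Icc_subset_Icc (by linarith) this))

/-- global estimate -/
lemma glob2 (B : ℝ) (hB : 1 ≤ B) (p : ℝ) (hp : 5 / 3 < p) :
    ∃ K : ℝ, 1 ≤ K ∧ ∀ ψ, Reg ψ B → ∀ V1 V2, Trans ψ B (thk V1 10) (thk V2 10) → Trans ψ B (thk V2 10) (thk V1 10) →
    ∀ f g, Ok V1 f → Ok V2 g →
    eLpNorm (fun ξ => EE ψ f ξ * EE ψ g ξ) (ENNReal.ofReal p) volume ≤ ENNReal.ofReal (K * (N2 f * N2 g)) := by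
  by_cases hp2 : p < 2
  · exact glob B hB p hp hp2
  push Not at hp2
  obtain ⟨K, hK, h⟩ := glob B hB (9 / 5) (by norm_num) (by norm_num)
  have hB1 : 1 ≤ B ^ 2 := one_le_pow₀ hB
  refine ⟨4 * B ^ 2 * K, by nlinarith, ?_⟩
  intro ψ hψ V1 V2 hT hT' f g hf hg
  have h1 := h ψ hψ V1 V2 hT hT' f g hf hg
  have hsub : ∀ V : Set (ℝ × ℝ), V ⊆ thk V 10 := fun V z hz => ⟨z, hz, by simp⟩
  have hN := N2_nonneg f
  have hN' := N2_nonneg g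
  have hs : ∀ ξ, ‖EE ψ f ξ * EE ψ g ξ‖ₑ ≤ ENNReal.ofReal (4 * B ^ 2 * K * (N2 f * N2 g)) := fun ξ => by
    rw [← ofReal_norm, norm_mul]
    refine ENNReal.ofReal_le_ofReal ?_
    have a1 := EE_sup (by linarith) (fun z hz => hT.nb1 z (hsub _ hz)) hf ψ ξ
    have a2 := EE_sup (by linarith) (fun z hz => hT.nb2 z (hsub _ hz)) hg ψ ξ
    calc _ ≤ (2 * B * N2 f) * (2 * B * N2 g) := by gcongr
      _ = 4 * B ^ 2 * (N2 f * N2 g) * 1 := by ring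
      _ ≤ 4 * B ^ 2 * (N2 f * N2 g) * K := by gcongr
      _ = _ := by ring
  have hp0 : 0 < p := by linarith
  rw [eLp_eq _ (by norm_num : (0:ℝ) < 9 / 5), one_div, ENNReal.rpow_inv_le_iff (by norm_num)] at h1
  rw [eLp_eq _ hp0, one_div, ENNReal.rpow_inv_le_iff hp0]
  set X := ENNReal.ofReal (4 * B ^ 2 * K * (N2 f * N2 g)) with hX
  have hX2 : ENNReal.ofReal (K * (N2 f * N2 g)) ≤ X := by
    refine ENNReal.ofReal_le_ofReal ?_
    have : 0 ≤ K * (N2 f * N2 g) := by positivity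
    nlinarith
  calc _ ≤ ∫⁻ ξ, X ^ (p - 9 / 5) * ‖EE ψ f ξ * EE ψ g ξ‖ₑ ^ (9 / 5 : ℝ) := by
        refine lintegral_mono fun ξ => ?_
        simp only
        have : ‖EE ψ f ξ * EE ψ g ξ‖ₑ ^ p = ‖EE ψ f ξ * EE ψ g ξ‖ₑ ^ (p - 9 / 5) * ‖EE ψ f ξ * EE ψ g ξ‖ₑ ^ (9 / 5 : ℝ) := by
          rw [← ENNReal.rpow_add_of_nonneg _ _ (by linarith) (by norm_num)]; congr 1; ring
        rw [this]
        gcongr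
        · linarith
        · exact hs ξ
    _ = X ^ (p - 9 / 5) * ∫⁻ ξ, ‖EE ψ f ξ * EE ψ g ξ‖ₑ ^ (9 / 5 : ℝ) := by
        rw [lintegral_const_mul' _ _ (ENNReal.rpow_ne_top_of_nonneg (by linarith) (by simp [hX]))]
    _ ≤ X ^ (p - 9 / 5) * X ^ (9 / 5 : ℝ) := by
        gcongr
        exact h1.trans (by gcongr)
    _ = X ^ p := by rw [← ENNReal.rpow_add_of_nonneg _ _ (by linarith) (by norm_num)]; congr 1; ring

end BAP

namespace BAP

lemma mvt {g : ℝ → ℝ} (hg : Differentiable ℝ g) (a b : ℝ) :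
    ∃ ζ, (∀ e R : ℝ, |a - e| ≤ R → |b - e| ≤ R → |ζ - e| ≤ R) ∧ g a - g b = deriv g ζ * (a - b) := by
  rcases lt_trichotomy a b with h | h | h
  · obtain ⟨ζ, hζ, he⟩ := exists_deriv_eq_slope g h hg.continuous.continuousOn hg.differentiableOn
    refine ⟨ζ, fun e R h1 h2 => ?_, ?_⟩
    · rw [abs_le] at *; constructor <;> linarith [hζ.1, hζ.2]
    · rw [he]; have : b - a ≠ 0 := by linarith
      field_simp; ring
  · exact ⟨a, fun e R h1 _ => h1, by rw [h]; ring⟩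
  · obtain ⟨ζ, hζ, he⟩ := exists_deriv_eq_slope g h hg.continuous.continuousOn hg.differentiableOn
    refine ⟨ζ, fun e R h1 h2 => ?_, ?_⟩
    · rw [abs_le] at *; constructor <;> linarith [hζ.1, hζ.2]
    · rw [he]; have : a - b ≠ 0 := by linarith
      field_simp

lemma abs_mul_le {a b A B : ℝ} (ha : |a| ≤ A) (hb : |b| ≤ B) : |a * b| ≤ A * B := by
  rw [abs_mul]; exact mul_le_mul ha hb (abs_nonneg _) ((abs_nonneg _).trans ha)

lemma bracket {E Td S Λ Λ2 X P Y Z s : ℝ} (hX : |X - Td| ≤ 2 * Λ) (hP : |P - Td| ≤ 2 * Λ) (hY : |Y - E| ≤ 22) (hZ : |Z - E| ≤ 22)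
    (hs : |s - S| ≤ Λ2) (hbig : 4 * Λ * (|E| + 22) + 44 * |Td| + ((|E| + 22) ^ 2 * Λ2 + |S| * (44 * (|E| + 22))) + 1 ≤ |E * (2 * Td - E * S)|) :
    1 ≤ |(X - Y * s) * Z + Y * P| := by
  have hZ' : |Z| ≤ |E| + 22 := by
    have := abs_add_le (Z - E) E; rw [sub_add_cancel] at this; linarith
  have hY' : |Y| ≤ |E| + 22 := by
    have := abs_add_le (Y - E) E; rw [sub_add_cancel] at this; linarith
  have e : E * (2 * Td - E * S) = ((X - Y * s) * Z + Y * P) - ((X - Td) * Z + Td * (Z - E) + (Y * (P - Td) + (Y - E) * Td)) +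
      (Y * Z * (s - S) + S * ((Y - E) * Z + (Z - E) * E)) := by ring
  have a1 := abs_mul_le hX hZ'
  have a2 := abs_mul_le (le_refl |Td|) hZ
  have a3 := abs_mul_le hY' hP
  have a4 := abs_mul_le hY (le_refl |Td|)
  have a5 := abs_mul_le (abs_mul_le hY' hZ') hs
  have a7 : |(Y - E) * Z + (Z - E) * E| ≤ 44 * (|E| + 22) := by
    have b1 := abs_mul_le hY hZ'
    have b2 := abs_mul_le hZ (show |E| ≤ |E| + 22 by linarith)
    exact (abs_add_le _ _).trans (by linarith)
  have a8 := abs_mul_le (le_refl |S|) a7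
  rw [e] at hbig
  have t1 := abs_add_le (((X - Y * s) * Z + Y * P) - ((X - Td) * Z + Td * (Z - E) + (Y * (P - Td) + (Y - E) * Td))) (Y * Z * (s - S) + S * ((Y - E) * Z + (Z - E) * E))
  have t2 := abs_sub ((X - Y * s) * Z + Y * P) ((X - Td) * Z + Td * (Z - E) + (Y * (P - Td) + (Y - E) * Td))
  have t3 := abs_add_le ((X - Td) * Z + Td * (Z - E)) (Y * (P - Td) + (Y - E) * Td)
  have t4 := abs_add_le ((X - Td) * Z) (Td * (Z - E))
  have t5 := abs_add_le (Y * (P - Td)) ((Y - E) * Td)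
  have t6 := abs_add_le (Y * Z * (s - S)) (S * ((Y - E) * Z + (Z - E) * E))
  nlinarith

set_option maxHeartbeats 2000000 in
lemma trans_core {ψ : ℝ → ℝ} (hψ : Differentiable ℝ ψ) (hψ2 : Differentiable ℝ (deriv ψ)) {W1 W2 : Set (ℝ × ℝ)}
    {e1 e2 T1 T2 S Λ Λ2 G B : ℝ} (hΛ : 0 ≤ Λ) (hΛ2 : 0 ≤ Λ2)
    (H1 : ∀ w ∈ W1, |w.2 - e1| ≤ 11 ∧ ∀ ζ, |ζ - e1| ≤ 11 → |w.1 + deriv ψ ζ - T1| ≤ Λ)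
    (H2 : ∀ w ∈ W2, |w.2 - e2| ≤ 11 ∧ ∀ ζ, |ζ - e2| ≤ 11 → |w.1 + deriv ψ ζ - T2| ≤ Λ)
    (H3 : ∀ ζ, |ζ - e1| ≤ 11 → |deriv (deriv ψ) ζ - S| ≤ Λ2)
    (hE : 23 ≤ |e2 - e1|)
    (hbig : 4 * Λ * (|e2 - e1| + 22) + 44 * |T2 - T1| + ((|e2 - e1| + 22) ^ 2 * Λ2 + |S| * (44 * (|e2 - e1| + 22))) + 1 ≤
      |(e2 - e1) * (2 * (T2 - T1) - (e2 - e1) * S)|)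
    (hG : 1 ≤ G) (G1 : |e2| + 11 ≤ G) (G2 : |T2| + Λ ≤ G) (G3 : |e2 - e1| + 22 ≤ G)
    (G4 : |T2 - T1| + 2 * Λ + (|e2 - e1| + 22) * (|S| + Λ2) ≤ G) (hB : G ^ 2 * (3 + 4 * G) + 1 ≤ B)
    (bd1 : ∀ w ∈ W1, |w.1| + 1 ≤ B ∧ |w.2| + 1 ≤ B)
    (bd2 : ∀ w ∈ W2, |w.1| + 1 ≤ B ∧ |w.2| + 1 ≤ B) : Trans ψ B W1 W2 := by
  refine ⟨?_, bd1, bd2, ?_⟩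
  · intro w hw w2 hw2
    have h1 := (H1 w hw).1
    have h2 := (H2 w2 hw2).1
    have h3 := abs_sub_abs_le_abs_sub (e2 - e1) ((w.2 - e1) - (w2.2 - e2))
    have h4 := abs_sub (w.2 - e1) (w2.2 - e2)
    have e : (e2 - e1) - ((w.2 - e1) - (w2.2 - e2)) = w2.2 - w.2 := by ring
    rw [e] at h3
    linarith
  intro w1 hw1 w' hw' w'' hw'' w2 hw2 w2' hw2' a ha b hb κ hκ c1 c2 c3 c4 c5
  obtain ⟨ζ, hζ, hζe⟩ := mvt hψ2 w'.2 w''.2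
  obtain ⟨ζa, hζa, hζae⟩ := mvt hψ a.2 b.2
  obtain ⟨ζw, hζw, hζwe⟩ := mvt hψ w'.2 w''.2
  have hζ1 := hζ e1 11 (H1 _ hw').1 (H1 _ hw'').1
  have hζw1 := hζw e1 11 (H1 _ hw').1 (H1 _ hw'').1
  have hζa1 := hζa e2 11 (H2 _ ha).1 (H2 _ hb).1
  set s := deriv (deriv ψ) ζ with hs
  set X := w2.1 + deriv ψ w2.2 - (w'.1 + deriv ψ w'.2) with hX
  set Y := w2.2 - w'.2 with hY
  set Z := (a.2 + b.2) / 2 - (w'.2 + w''.2) / 2 with hZ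
  set Pa := (a.1 + b.1) / 2 + deriv ψ ζa with hPa
  set P := Pa - ((w'.1 + w''.1) / 2 + deriv ψ ζw) with hP
  set d1 := w'.1 - w''.1 with hd1
  set d2 := w'.2 - w''.2 with hd2
  have aPa : |Pa - T2| ≤ Λ := by
    have h1 := (H2 _ ha).2 ζa hζa1
    have h2 := (H2 _ hb).2 ζa hζa1
    rw [abs_le] at h1 h2 ⊢; constructor <;> linarith
  have aX : |X - (T2 - T1)| ≤ 2 * Λ := by
    have h1 := (H2 _ hw2).2 _ (H2 _ hw2).1
    have h2 := (H1 _ hw').2 _ (H1 _ hw').1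
    rw [abs_le] at h1 h2 ⊢; constructor <;> linarith
  have aP : |P - (T2 - T1)| ≤ 2 * Λ := by
    have h1 := (H1 _ hw').2 ζw hζw1
    have h2 := (H1 _ hw'').2 ζw hζw1
    have h3 := aPa
    rw [abs_le] at h1 h2 h3 ⊢; constructor <;> linarith
  have aY : |Y - (e2 - e1)| ≤ 22 := by
    have h1 := (H2 _ hw2).1
    have h2 := (H1 _ hw').1
    rw [abs_le] at h1 h2 ⊢; constructor <;> linarith
  have aZ : |Z - (e2 - e1)| ≤ 22 := by
    have h1 := (H2 _ ha).1
    have h2 := (H2 _ hb).1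
    have h3 := (H1 _ hw').1
    have h4 := (H1 _ hw'').1
    rw [abs_le] at h1 h2 h3 h4 ⊢; constructor <;> linarith
  have as := H3 ζ hζ1
  have hbr := bracket aX aP aY aZ as hbig
  -- size bounds
  have gZ : |Z| ≤ G := by
    have := abs_add_le (Z - (e2 - e1)) (e2 - e1); rw [sub_add_cancel] at this; linarith
  have gY : |Y| ≤ G := by
    have := abs_add_le (Y - (e2 - e1)) (e2 - e1); rw [sub_add_cancel] at this; linarith
  have gPa : |Pa| ≤ G := by
    have := abs_add_le (Pa - T2) T2; rw [sub_add_cancel] at this; linarith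
  have gya : |(a.2 + b.2) / 2| ≤ G := by
    have h1 := (H2 _ ha).1
    have h2 := (H2 _ hb).1
    have h3 := neg_le_abs e2
    have h4 := le_abs_self e2
    rw [abs_le] at h1 h2 ⊢; constructor <;> linarith
  have gXs : |X - Y * s| ≤ G := by
    have h1 := abs_add_le (X - (T2 - T1)) (T2 - T1); rw [sub_add_cancel] at h1
    have h2 := abs_add_le (s - S) S; rw [sub_add_cancel] at h2
    have hY2 : |Y| ≤ |e2 - e1| + 22 := by
      have := abs_add_le (Y - (e2 - e1)) (e2 - e1); rw [sub_add_cancel] at this; linarith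
    have h3 := abs_mul_le hY2 (show |s| ≤ |S| + Λ2 by linarith)
    have h4 := abs_sub X (Y * s)
    linarith
  have gY1 : 1 ≤ |Y| := by
    have h3 := abs_sub_abs_le_abs_sub (e2 - e1) ((e2 - e1) - Y)
    have e : (e2 - e1) - ((e2 - e1) - Y) = Y := by ring
    rw [e, abs_sub_comm _ Y] at h3
    linarith
  -- the two equations
  have i1 : |Y * d1 - (X - Y * s) * d2| ≤ κ := by
    have : wedge (uu ψ w2 w') (uu ψ w2 w'') = Y * d1 - (X - Y * s) * d2 := by
      have : Y * d1 - (X - Y * s) * d2 = Y * d1 - X * d2 + Y * (s * d2) := by ring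
      rw [this, ← hζe]
      simp only [wedge, uu, gr, Prod.fst_sub, Prod.snd_sub, hX, hY, hd1, hd2]
      ring
    rwa [this] at c5
  have k1 : |a.1 - b.1 - d1| ≤ 2 * κ := by
    have h1 := (norm_fst_le _).trans c1
    have h2 := (norm_fst_le _).trans c3
    simp only [Prod.fst_sub, Prod.fst_add, Real.norm_eq_abs] at h1 h2
    rw [abs_le] at h1 h2 ⊢; constructor <;> linarith
  have k2 : |a.2 - b.2 - d2| ≤ 2 * κ := by
    have h1 := (norm_snd_le _).trans c1
    have h2 := (norm_snd_le _).trans c3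
    simp only [Prod.snd_sub, Prod.snd_add, Real.norm_eq_abs] at h1 h2
    rw [abs_le] at h1 h2 ⊢; constructor <;> linarith
  have k3 : |ph ψ a - ph ψ b - (ph ψ w' - ph ψ w'')| ≤ 2 * κ := by
    rw [abs_le] at c2 c4 ⊢; constructor <;> linarith
  have i2 : |d1 * Z + d2 * P| ≤ (2 + 4 * G) * κ := by
    have e : d1 * Z + d2 * P = (ph ψ a - ph ψ b - (ph ψ w' - ph ψ w'')) - (a.1 - b.1 - d1) * ((a.2 + b.2) / 2) - (a.2 - b.2 - d2) * Pa := by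
      have q1 : ph ψ a - ph ψ b = (a.1 - b.1) * ((a.2 + b.2) / 2) + (a.2 - b.2) * Pa := by
        have : ψ a.2 = ψ b.2 + deriv ψ ζa * (a.2 - b.2) := by linarith
        simp only [ph, hPa]; rw [this]; ring
      have q2 : ph ψ w' - ph ψ w'' = d1 * ((w'.2 + w''.2) / 2) + d2 * ((w'.1 + w''.1) / 2 + deriv ψ ζw) := by
        have : ψ w'.2 = ψ w''.2 + deriv ψ ζw * (w'.2 - w''.2) := by linarith
        simp only [ph, hd1, hd2]; rw [this]; ring
      rw [q1, q2]; simp only [hZ, hP]; ring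
    rw [e]
    have m1 := abs_mul_le k1 gya
    have m2 := abs_mul_le k2 gPa
    have m3 := abs_sub ((ph ψ a - ph ψ b - (ph ψ w' - ph ψ w'')) - (a.1 - b.1 - d1) * ((a.2 + b.2) / 2)) ((a.2 - b.2 - d2) * Pa)
    have m4 := abs_sub (ph ψ a - ph ψ b - (ph ψ w' - ph ψ w'')) ((a.1 - b.1 - d1) * ((a.2 + b.2) / 2))
    linarith
  have hd2b : |d2| ≤ G * (3 + 4 * G) * κ := by
    have e : d2 * ((X - Y * s) * Z + Y * P) = Y * (d1 * Z + d2 * P) - Z * (Y * d1 - (X - Y * s) * d2) := by ring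
    have m1 := abs_mul_le gY i2
    have m2 := abs_mul_le gZ i1
    have m3 := abs_sub (Y * (d1 * Z + d2 * P)) (Z * (Y * d1 - (X - Y * s) * d2))
    rw [← e, abs_mul] at m3
    have m4 : |d2| ≤ |d2| * |(X - Y * s) * Z + Y * P| := le_mul_of_one_le_right (abs_nonneg _) hbr
    linarith
  have hd1b : |d1| ≤ (G ^ 2 * (3 + 4 * G) + 1) * κ := by
    have m1 := abs_mul_le gXs hd2b
    have m2 := abs_add_le (Y * d1 - (X - Y * s) * d2) ((X - Y * s) * d2)
    rw [sub_add_cancel, abs_mul] at m2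
    have m4 : |d1| ≤ |Y| * |d1| := le_mul_of_one_le_left (abs_nonneg _) gY1
    linarith
  have hfin : (G ^ 2 * (3 + 4 * G) + 1) * κ ≤ B * κ := mul_le_mul_of_nonneg_right hB hκ
  rw [Prod.norm_def, max_le_iff, Real.norm_eq_abs, Real.norm_eq_abs]
  refine ⟨hd1b.trans hfin, hd2b.trans (le_trans ?_ hfin)⟩
  refine mul_le_mul_of_nonneg_right ?_ hκ
  nlinarith

end BAP

namespace BAP

/-- normal form of the first set -/
def V1s : Set (ℝ × ℝ) := {z | 0 ≤ z.2 ∧ z.2 < 1 ∧ 0 ≤ z.1 ∧ z.1 < 1}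

/-- normal form of the second set -/
def V2s (ψ : ℝ → ℝ) (D t : ℝ) : Set (ℝ × ℝ) :=
  {z | 0 ≤ z.2 - D ∧ z.2 - D < 1 ∧ 0 ≤ z.1 - t + deriv ψ z.2 ∧ z.1 - t + deriv ψ z.2 < 1}

/-- the constant for transversality in normal form -/
def Gc (N C : ℝ) : ℝ := 100 * N * C ^ 2

structure NF (ψ : ℝ → ℝ) (N C D t : ℝ) : Prop where
  d1 : Differentiable ℝ ψ
  d2 : Differentiable ℝ (deriv ψ)
  z1 : deriv ψ 0 = 0
  z2 : deriv (deriv ψ) 0 = 0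
  lip : ∀ y z, min 0 D - 11 ≤ y → y ≤ max 0 D + 11 → min 0 D - 11 ≤ z → z ≤ max 0 D + 11 →
    |deriv (deriv ψ) y - deriv (deriv ψ) z| ≤ N * |y - z|
  hN : 1 ≤ N
  hC : 1000000 * N ≤ C
  D1 : C / 8 < |D|
  D2 : |D| < C / 2
  t1 : C ^ 2 / 4 ≤ |t|
  t2 : |t| < 4 * C ^ 2
  ta : C ^ 2 / 512 ≤ |t - 1 / 2 * D * deriv (deriv ψ) D|

lemma NF.der {ψ : ℝ → ℝ} {N C D t : ℝ} (h : NF ψ N C D t) {y : ℝ} (h1 : min 0 D - 11 ≤ y) (h2 : y ≤ max 0 D + 11) :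
    |deriv (deriv ψ) y| ≤ N * C := by
  have hm1 : min 0 D ≤ 0 := min_le_left _ _
  have hm2 : 0 ≤ max 0 D := le_max_left _ _
  have hl := h.lip y 0 h1 h2 (by linarith) (by linarith)
  rw [h.z2, sub_zero, sub_zero] at hl
  have hN := h.hN
  have hC := h.hC
  have : |y| ≤ C := by
    have hD := h.D2
    have := le_abs_self D
    have := neg_le_abs D
    have q1 : -|D| ≤ min 0 D := le_min (by linarith [abs_nonneg D]) (by linarith)
    have q2 : max 0 D ≤ |D| := max_le (abs_nonneg D) (by linarith)
    rw [abs_le]; constructor <;> linarith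
  exact hl.trans (mul_le_mul_of_nonneg_left this (by linarith))

lemma NF.der1 {ψ : ℝ → ℝ} {N C D t : ℝ} (h : NF ψ N C D t) {y z : ℝ} (h1 : min 0 D - 11 ≤ y) (h2 : y ≤ max 0 D + 11)
    (h3 : min 0 D - 11 ≤ z) (h4 : z ≤ max 0 D + 11) : |deriv ψ y - deriv ψ z| ≤ N * C * |y - z| := by
  obtain ⟨ζ, hζ, he⟩ := mvt h.d2 y z
  have := hζ ((min 0 D + max 0 D) / 2) ((max 0 D - min 0 D) / 2 + 11) (by rw [abs_le]; constructor <;> linarith)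
    (by rw [abs_le]; constructor <;> linarith)
  rw [abs_le] at this
  rw [he, abs_mul]
  exact mul_le_mul_of_nonneg_right (h.der (by linarith) (by linarith)) (abs_nonneg _)

lemma NF.reg {D e y : ℝ} (he : e = 0 ∨ e = D) (hy : |y - e| ≤ 11) : min 0 D - 11 ≤ y ∧ y ≤ max 0 D + 11 := by
  rw [abs_le] at hy
  rcases he with rfl | rfl
  · have := min_le_left 0 D; have := le_max_left 0 D
    constructor <;> linarith
  · have := min_le_right 0 e; have := le_max_right 0 e
    constructor <;> linarith

lemma NF.H1 {ψ : ℝ → ℝ} {N C D t : ℝ} (h : NF ψ N C D t) : ∀ w ∈ thk V1s 10, |w.2 - 0| ≤ 11 ∧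
    ∀ ζ, |ζ - 0| ≤ 11 → |w.1 + deriv ψ ζ - 0| ≤ 33 * N * C := by
  rintro w ⟨v, ⟨a1, a2, a3, a4⟩, hv⟩
  have n1 := (norm_fst_le _).trans hv
  have n2 := (norm_snd_le _).trans hv
  simp only [Prod.fst_sub, Prod.snd_sub, Real.norm_eq_abs, abs_le] at n1 n2
  have hN := h.hN
  have hC := h.hC
  have hNC : 1000000 ≤ N * C := by nlinarith
  refine ⟨by rw [abs_le]; constructor <;> linarith, fun ζ hζ => ?_⟩
  have r := NF.reg (D := D) (Or.inl rfl) hζ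
  have r0 := NF.reg (D := D) (y := 0) (Or.inl rfl) (by norm_num)
  have := h.der1 r.1 r.2 r0.1 r0.2
  rw [h.z1, sub_zero] at this
  have : N * C * |ζ - 0| ≤ N * C * 11 := mul_le_mul_of_nonneg_left hζ (by linarith)
  have h3 : |deriv ψ ζ| ≤ N * C * 11 := by linarith
  rw [abs_le] at h3 ⊢
  constructor <;> linarith

lemma NF.H2 {ψ : ℝ → ℝ} {N C D t : ℝ} (h : NF ψ N C D t) : ∀ w ∈ thk (V2s ψ D t) 10, |w.2 - D| ≤ 11 ∧
    ∀ ζ, |ζ - D| ≤ 11 → |w.1 + deriv ψ ζ - t| ≤ 33 * N * C := by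
  rintro w ⟨v, ⟨a1, a2, a3, a4⟩, hv⟩
  have n1 := (norm_fst_le _).trans hv
  have n2 := (norm_snd_le _).trans hv
  simp only [Prod.fst_sub, Prod.snd_sub, Real.norm_eq_abs, abs_le] at n1 n2
  have hN := h.hN
  have hC := h.hC
  have hNC : 1000000 ≤ N * C := by nlinarith
  refine ⟨by rw [abs_le]; constructor <;> linarith, fun ζ hζ => ?_⟩
  have r := NF.reg (D := D) (Or.inr rfl) hζ
  have r0 := NF.reg (D := D) (y := v.2) (Or.inr rfl) (by rw [abs_le]; constructor <;> linarith)
  have h2 := h.der1 r.1 r.2 r0.1 r0.2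
  have : |ζ - v.2| ≤ 12 := by rw [abs_le] at hζ ⊢; constructor <;> linarith
  have : N * C * |ζ - v.2| ≤ N * C * 12 := mul_le_mul_of_nonneg_left this (by linarith)
  have h3 : |deriv ψ ζ - deriv ψ v.2| ≤ N * C * 12 := by linarith
  rw [abs_le] at h3 ⊢
  constructor <;> linarith

lemma NF.bd {ψ : ℝ → ℝ} {N C D t B : ℝ} (h : NF ψ N C D t) (hB : Gc N C ≤ B) :
    (∀ w ∈ thk V1s 10, |w.1| + 1 ≤ B ∧ |w.2| + 1 ≤ B) ∧ ∀ w ∈ thk (V2s ψ D t) 10, |w.1| + 1 ≤ B ∧ |w.2| + 1 ≤ B := by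
  have hN := h.hN
  have hC := h.hC
  have hNC : 1000000 ≤ N * C := by nlinarith
  have hC2 : N * C * 1 ≤ N * C * C := mul_le_mul_of_nonneg_left (by linarith) (by linarith)
  have hC3 : 1 * C ^ 2 ≤ N * C ^ 2 := mul_le_mul_of_nonneg_right hN (by positivity)
  have hC4 : 1 * C ≤ N * C := mul_le_mul_of_nonneg_right hN (by linarith)
  have hD := h.D2
  have ht := h.t2
  unfold Gc at hB
  constructor
  · intro w hw
    have h1 := (h.H1 w hw).1
    have h2 := (h.H1 w hw).2 0 (by norm_num)
    rw [h.z1] at h2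
    simp only [add_zero, sub_zero] at h1 h2
    constructor <;> nlinarith
  · intro w hw
    have h1 := (h.H2 w hw).1
    have h2 := (h.H2 w hw).2 D (by norm_num)
    have r := NF.reg (D := D) (y := D) (Or.inr rfl) (by norm_num)
    have r0 := NF.reg (D := D) (y := 0) (Or.inl rfl) (by norm_num)
    have h3 := h.der1 r.1 r.2 r0.1 r0.2
    rw [h.z1, sub_zero, sub_zero] at h3
    have h4 : N * C * |D| ≤ N * C * C := mul_le_mul_of_nonneg_left (by linarith) (by linarith)
    have h5 := abs_add_le (w.2 - D) D
    rw [sub_add_cancel] at h5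
    have h6 := abs_add_le ((w.1 + deriv ψ D - t) + t) (-deriv ψ D)
    have h7 := abs_add_le (w.1 + deriv ψ D - t) t
    rw [abs_neg] at h6
    have e : (w.1 + deriv ψ D - t) + t + -deriv ψ D = w.1 := by ring
    rw [e] at h6
    constructor <;> nlinarith

lemma NF.trans {ψ : ℝ → ℝ} {N C D t B : ℝ} (h : NF ψ N C D t) (hB : (Gc N C) ^ 2 * (3 + 4 * Gc N C) + 1 ≤ B) :
    Trans ψ B (thk V1s 10) (thk (V2s ψ D t) 10) ∧ Trans ψ B (thk (V2s ψ D t) 10) (thk V1s 10) := by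
  have hN := h.hN
  have hC := h.hC
  have hNC : 1000000 ≤ N * C := by nlinarith
  have hC2 : N * C * 1 ≤ N * C * C := mul_le_mul_of_nonneg_left (by linarith) (by linarith)
  have hC3 : 1 * C ^ 2 ≤ N * C ^ 2 := mul_le_mul_of_nonneg_right hN (by positivity)
  have hC4 : 1 * C ≤ N * C := mul_le_mul_of_nonneg_right hN (by linarith)
  have hC5 : (1000000 * N) * C ^ 2 ≤ C * C ^ 2 := mul_le_mul_of_nonneg_right hC (by positivity)
  have hG1 : 1 ≤ Gc N C := by unfold Gc; nlinarith
  have hGB : Gc N C ≤ B := by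
    have : 1 * Gc N C ≤ Gc N C * Gc N C := mul_le_mul_of_nonneg_right hG1 (by linarith)
    nlinarith
  obtain ⟨b1, b2⟩ := h.bd hGB
  have D1 := h.D1
  have D2 := h.D2
  have t1 := h.t1
  have t2 := h.t2
  have rD := NF.reg (D := D) (y := D) (Or.inr rfl) (by norm_num)
  have hSD := h.der rD.1 rD.2
  have hΛ : (33 * N * C) * (|D| + 22) ≤ (33 * N * C) * C := mul_le_mul_of_nonneg_left (by linarith) (by linarith)
  have hΛ2 : (|D| + 22) ^ 2 * (11 * N) ≤ C ^ 2 * (11 * N) := by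
    refine mul_le_mul_of_nonneg_right ?_ (by linarith)
    exact pow_le_pow_left₀ (by linarith [abs_nonneg D]) (by linarith) 2
  have hS0 : ∀ e, (e = 0 ∨ e = D) → ∀ ζ, |ζ - e| ≤ 11 → |deriv (deriv ψ) ζ - deriv (deriv ψ) e| ≤ 11 * N := by
    intro e he ζ hζ
    have r := NF.reg he hζ
    have r0 := NF.reg (y := e) he (by norm_num)
    have := h.lip ζ e r.1 r.2 r0.1 r0.2
    have := mul_le_mul_of_nonneg_left hζ (show 0 ≤ N by linarith)
    linarith
  have hGv : Gc N C = 100 * (N * C ^ 2) := by unfold Gc; ring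
  constructor
  · refine trans_core h.d1 h.d2 (e1 := 0) (e2 := D) (T1 := 0) (T2 := t) (S := 0) (Λ := 33 * N * C) (Λ2 := 11 * N) (G := Gc N C)
      (by linarith) (by linarith) h.H1 h.H2 ?_ ?_ ?_ hG1 ?_ ?_ ?_ ?_ hB b1 b2
    · have := hS0 0 (Or.inl rfl)
      rwa [h.z2] at this
    · rw [sub_zero]; linarith
    · rw [sub_zero, sub_zero, abs_zero, zero_mul, mul_zero, sub_zero, abs_mul, abs_mul, abs_two]
      have : C / 8 * (2 * (C ^ 2 / 4)) ≤ |D| * (2 * |t|) := mul_le_mul D1.le (by linarith) (by positivity) (abs_nonneg _)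
      nlinarith
    · nlinarith
    · nlinarith
    · rw [sub_zero]; nlinarith
    · rw [sub_zero, sub_zero, abs_zero, zero_add]
      have : (|D| + 22) * (11 * N) ≤ C * (11 * N) := mul_le_mul_of_nonneg_right (by linarith) (by linarith)
      nlinarith
  · refine trans_core h.d1 h.d2 (e1 := D) (e2 := 0) (T1 := t) (T2 := 0) (S := deriv (deriv ψ) D) (Λ := 33 * N * C) (Λ2 := 11 * N) (G := Gc N C)
      (by linarith) (by linarith) h.H2 h.H1 (hS0 D (Or.inr rfl)) ?_ ?_ hG1 ?_ ?_ ?_ ?_ hB b2 b1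
    · rw [zero_sub, abs_neg]; linarith
    · rw [zero_sub, zero_sub, abs_neg, abs_neg]
      have e : -D * (2 * -t - -D * deriv (deriv ψ) D) = D * (2 * (t - 1 / 2 * D * deriv (deriv ψ) D)) := by ring
      rw [e, abs_mul, abs_mul, abs_two]
      have : C / 8 * (2 * (C ^ 2 / 512)) ≤ |D| * (2 * |t - 1 / 2 * D * deriv (deriv ψ) D|) :=
        mul_le_mul D1.le (by linarith [h.ta]) (by positivity) (abs_nonneg _)
      have h9 : |deriv (deriv ψ) D| * (44 * (|D| + 22)) ≤ (N * C) * (44 * C) :=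
        mul_le_mul hSD (by linarith) (by linarith [abs_nonneg D]) (by linarith)
      nlinarith
    · rw [abs_zero]; nlinarith
    · rw [abs_zero]; nlinarith
    · rw [zero_sub, abs_neg]; nlinarith
    · rw [zero_sub, zero_sub, abs_neg, abs_neg]
      have : (|D| + 22) * (|deriv (deriv ψ) D| + 11 * N) ≤ C * (N * C + 11 * N) :=
        mul_le_mul (by linarith) (by linarith) (by linarith [abs_nonneg (deriv (deriv ψ) D)]) (by linarith)
      nlinarith

end BAP

namespace BAP

lemma prim {a b : ℝ} (ha : a ≤ 0) (hb : 0 ≤ b) {n : ℕ} {g G1 : ℝ → ℝ} (hg : ContDiff ℝ (⊤ : ℕ∞) g) (hG1 : ContDiff ℝ n G1)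
    (he : ∀ j ≤ n, ∀ y ∈ Icc a b, iteratedDeriv j G1 y = iteratedDeriv j (deriv g) y) :
    ∃ G : ℝ → ℝ, ContDiff ℝ ((n + 1 : ℕ)) G ∧ deriv G = G1 ∧
      ∀ j ≤ n + 1, ∀ y ∈ Icc a b, iteratedDeriv j G y = iteratedDeriv j g y := by
  have hd : ∀ y, HasDerivAt (fun y => g 0 + ∫ s in (0:ℝ)..y, G1 s) (G1 y) y := by
    intro y
    have := (hG1.continuous.integral_hasStrictDerivAt 0 y).hasDerivAt
    simpa using this.const_add (g 0)
  have hdd : deriv (fun y => g 0 + ∫ s in (0:ℝ)..y, G1 s) = G1 := funext fun y => (hd y).deriv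
  refine ⟨_, ?_, hdd, ?_⟩
  · push_cast
    rw [contDiff_succ_iff_deriv]
    refine ⟨fun y => (hd y).differentiableAt, by simp, by rwa [hdd]⟩
  · intro j hj y hy
    cases j with
    | zero =>
      simp only [iteratedDeriv_zero]
      have hgc : Continuous (deriv g) := hg.continuous_deriv (by simp)
      have h1 : ∫ s in (0:ℝ)..y, G1 s = ∫ s in (0:ℝ)..y, deriv g s := by
        refine intervalIntegral.integral_congr fun s hs => ?_
        have hs' : s ∈ Icc a b := (uIcc_subset_Icc ⟨ha, hb⟩ hy) hs
        simpa using he 0 (Nat.zero_le _) s hs'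
      rw [h1, intervalIntegral.integral_deriv_eq_sub]
      · ring
      · intro s _; exact (hg.differentiable (by simp)).differentiableAt
      · exact hgc.intervalIntegrable _ _
    | succ j =>
      rw [iteratedDeriv_succ', iteratedDeriv_succ', hdd]
      exact he j (by omega) y hy

lemma ext_n {a b : ℝ} (ha : a ≤ 0) (hb : 0 ≤ b) {M : ℝ} (hM : 0 ≤ M) (n : ℕ) : ∀ g : ℝ → ℝ, ContDiff ℝ (⊤ : ℕ∞) g →
    (∀ j ≤ n, ∀ y ∈ Icc a b, |iteratedDeriv j g y| ≤ M) →
    ∃ G : ℝ → ℝ, ContDiff ℝ n G ∧ (∀ j ≤ n, ∀ y ∈ Icc a b, iteratedDeriv j G y = iteratedDeriv j g y) ∧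
      ∀ j ≤ n, ∀ y d, 0 ≤ d → a - d ≤ y → y ≤ b + d → |iteratedDeriv j G y| ≤ M * (1 + d) ^ n := by
  have hab : a ≤ b := ha.trans hb
  induction n with
  | zero =>
    intro g hg hbd
    refine ⟨fun y => g (max a (min b y)), ?_, ?_, ?_⟩
    · simp only [Nat.cast_zero, contDiff_zero]
      have := hg.continuous
      fun_prop
    · intro j hj y hy
      obtain rfl : j = 0 := by omega
      simp only [iteratedDeriv_zero]
      rw [min_eq_right hy.2, max_eq_right hy.1]
    · intro j hj y d _ _ _
      obtain rfl : j = 0 := by omega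
      simp only [iteratedDeriv_zero, pow_zero, mul_one]
      have := hbd 0 le_rfl (max a (min b y)) ⟨le_max_left _ _, max_le hab (min_le_left _ _)⟩
      simpa using this
  | succ n ih =>
    intro g hg hbd
    have hg' : ContDiff ℝ (⊤ : ℕ∞) (deriv g) := by
      have : ContDiff ℝ ((⊤ : ℕ∞) + 1) g := by simpa using hg
      exact (contDiff_succ_iff_deriv.1 this).2.2
    obtain ⟨G1, c1, e1, b1⟩ := ih (deriv g) hg' (fun j hj y hy => by
      have := hbd (j + 1) (by omega) y hy
      rwa [iteratedDeriv_succ'] at this)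
    obtain ⟨G, c, hd, e⟩ := prim ha hb hg c1 e1
    refine ⟨G, c, e, ?_⟩
    intro j hj y d h0 hy1 hy2
    have hp : M * (1 + d) ^ n ≤ M * (1 + d) ^ (n + 1) :=
      mul_le_mul_of_nonneg_left (pow_le_pow_right₀ (by linarith) (by omega)) hM
    cases j with
    | succ j =>
      rw [iteratedDeriv_succ', hd]
      exact (b1 j (by omega) y d h0 hy1 hy2).trans hp
    | zero =>
      simp only [iteratedDeriv_zero]
      set c0 := max a (min b y) with hc0
      have hcm : c0 ∈ Icc a b := ⟨le_max_left _ _, max_le hab (min_le_left _ _)⟩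
      have hcy : |y - c0| ≤ d := by
        rw [hc0, abs_le]
        rcases max_cases a (min b y) with ⟨q1, q2⟩ | ⟨q1, q2⟩ <;> rcases min_cases b y with ⟨q3, q4⟩ | ⟨q3, q4⟩ <;>
          rw [q1] <;> constructor <;> linarith
      have hG0 : |G c0| ≤ M := by
        have h1 := e 0 (by omega) c0 hcm
        have h2 := hbd 0 (by omega) c0 hcm
        simp only [iteratedDeriv_zero] at h1 h2
        rwa [h1]
      have hmv : ‖G y - G c0‖ ≤ M * (1 + d) ^ n * ‖y - c0‖ := by
        refine Convex.norm_image_sub_le_of_norm_deriv_le (s := Icc (a - d) (b + d)) (𝕜 := ℝ) ?_ ?_ (convex_Icc _ _) ?_ ?_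
        · intro s _
          exact (c.differentiable (by simp)).differentiableAt
        · intro s hs
          rw [hd, Real.norm_eq_abs]
          simpa using b1 0 (by omega) s d h0 hs.1 hs.2
        · exact ⟨by linarith [hcm.1], by linarith [hcm.2]⟩
        · exact ⟨hy1, hy2⟩
      rw [Real.norm_eq_abs, Real.norm_eq_abs] at hmv
      have h1 := abs_add_le (G y - G c0) (G c0)
      rw [sub_add_cancel] at h1
      have h2 : M * (1 + d) ^ n * |y - c0| ≤ M * (1 + d) ^ n * d := mul_le_mul_of_nonneg_left hcy (by positivity)
      have h3 : M * 1 ≤ M * (1 + d) ^ n := mul_le_mul_of_nonneg_left (one_le_pow₀ (by linarith)) hM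
      calc |G y| ≤ M * (1 + d) ^ n * d + M := by linarith
        _ ≤ M * (1 + d) ^ n * d + M * (1 + d) ^ n := by linarith
        _ = _ := by ring

lemma int_bd {F : ℝ → ℝ} (hF : Differentiable ℝ F) (h0 : F 0 = 0) {A R : ℝ} (hA : ∀ y, |y| ≤ R → |deriv F y| ≤ A) :
    ∀ y, |y| ≤ R → |F y| ≤ A * R := by
  intro y hy
  have hR : 0 ≤ R := (abs_nonneg _).trans hy
  obtain ⟨ζ, hζ, he⟩ := mvt hF y 0
  rw [h0, sub_zero, sub_zero] at he
  have := hζ 0 R (by simpa using hy) (by simpa using hR)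
  rw [sub_zero] at this
  rw [he]
  exact abs_mul_le (hA _ this) hy

/-- cut-off lemma -/
lemma cut (C : ℝ) (hC : 1 ≤ C) : ∃ K : ℝ, 1 ≤ K ∧ ∃ χ : ℝ → ℝ, ContDiff ℝ (⊤ : ℕ∞) χ ∧ (∀ y, |y| < C → χ y = 1) ∧
    ∀ F : ℝ → ℝ, ContDiff ℝ 8 F → ∀ A, 0 ≤ A → (∀ k : ℕ, k ≤ 8 → ∀ y, |y| ≤ 2 * C → |iteratedDeriv k F y| ≤ A) →
      ∀ k : ℕ, k ≤ 8 → ∀ y, |iteratedDeriv k (fun y => F y * χ y) y| ≤ A * K := by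
  let bp : ContDiffBump (0 : ℝ) := ⟨C, 2 * C, by linarith, by linarith⟩
  have hs : ContDiff ℝ (⊤ : ℕ∞) bp := bp.contDiff
  have hb : ∀ k : ℕ, ∃ K, ∀ y, ‖iteratedFDeriv ℝ k bp y‖ ≤ K := by
    intro k
    have hc : Continuous (iteratedFDeriv ℝ k bp) := hs.continuous_iteratedFDeriv (by exact_mod_cast le_top)
    exact (bp.hasCompactSupport.iteratedFDeriv k).exists_bound_of_continuous hc
  choose K hK using hb
  have hKp : ∀ k, 0 ≤ K k := fun k => (norm_nonneg _).trans (hK k 0)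
  have hS : ∀ k, k ≤ 8 → K k ≤ ∑ i ∈ Finset.range 9, K i := fun k hk =>
    Finset.single_le_sum (f := K) (fun i _ => hKp i) (Finset.mem_range.2 (by omega))
  refine ⟨256 * (1 + ∑ i ∈ Finset.range 9, K i), ?_, bp, hs, ?_, ?_⟩
  · have : 0 ≤ ∑ i ∈ Finset.range 9, K i := Finset.sum_nonneg fun i _ => hKp i
    linarith
  · intro y hy
    refine bp.one_of_mem_closedBall ?_
    rw [mem_closedBall_zero_iff]; exact hy.le
  · intro F hF A hA hFA k hk y
    have hS0 : 0 ≤ ∑ i ∈ Finset.range 9, K i := Finset.sum_nonneg fun i _ => hKp i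
    rw [← Real.norm_eq_abs, ← norm_iteratedFDeriv_eq_norm_iteratedDeriv]
    have := norm_iteratedFDeriv_mul_le (𝕜 := ℝ) (N := 8) hF (by exact_mod_cast contDiff_infty.1 hs 8) y (n := k) (by exact_mod_cast hk)
    refine this.trans ?_
    have : ∀ i ∈ Finset.range (k + 1), (k.choose i : ℝ) * ‖iteratedFDeriv ℝ i F y‖ * ‖iteratedFDeriv ℝ (k - i) bp y‖ ≤
        (k.choose i : ℝ) * (A * ∑ i ∈ Finset.range 9, K i) := by
      intro i hi
      rw [Finset.mem_range] at hi
      rw [mul_assoc]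
      refine mul_le_mul_of_nonneg_left ?_ (by positivity)
      by_cases hy : |y| ≤ 2 * C
      · refine mul_le_mul ?_ ((hK _ _).trans (hS _ (by omega))) (norm_nonneg _) hA
        rw [norm_iteratedFDeriv_eq_norm_iteratedDeriv]
        exact hFA i (by omega) y hy
      · have : iteratedFDeriv ℝ (k - i) bp y = 0 := by
          by_contra h
          have := support_iteratedFDeriv_subset (𝕜 := ℝ) (k - i) (Function.mem_support.2 h)
          rw [bp.tsupport_eq, mem_closedBall_zero_iff] at this
          exact hy this
        rw [this, norm_zero, mul_zero]
        positivity
    refine (Finset.sum_le_sum this).trans ?_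
    rw [← Finset.sum_mul]
    have h2 : (∑ i ∈ Finset.range (k + 1), (k.choose i : ℝ)) ≤ 256 := by
      have h3 := Nat.sum_range_choose k
      have h4 : (2:ℕ) ^ k ≤ 2 ^ 8 := Nat.pow_le_pow_right (by norm_num) hk
      have : (∑ i ∈ Finset.range (k + 1), k.choose i) ≤ 256 := by rw [h3]; exact h4
      exact_mod_cast this
    calc _ ≤ 256 * (A * ∑ i ∈ Finset.range 9, K i) := mul_le_mul_of_nonneg_right h2 (by positivity)
      _ ≤ _ := by nlinarith

end BAP

namespace BAP

lemma smooth_deriv {g : ℝ → ℝ} (hg : ContDiff ℝ (⊤ : ℕ∞) g) : ContDiff ℝ (⊤ : ℕ∞) (deriv g) := by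
  have : ContDiff ℝ ((⊤ : ℕ∞) + 1) g := by simpa using hg
  exact (contDiff_succ_iff_deriv.1 this).2.2

lemma ext_main (M : ℝ) (hM : 1 ≤ M) (C : ℝ) (hC : 1 ≤ C) : ∃ B0 : ℝ, ∀ B, B0 ≤ B → ∀ ψ : ℝ → ℝ, ContDiff ℝ (⊤ : ℕ∞) ψ →
    ∀ a b : ℝ, a ≤ 0 → 0 ≤ b → ψ 0 = 0 → deriv ψ 0 = 0 → deriv (deriv ψ) 0 = 0 →
    (∀ k : ℕ, 3 ≤ k → k ≤ 8 → ∀ y ∈ Icc a b, |iteratedDeriv k ψ y| ≤ M) →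
    ∃ ψf : ℝ → ℝ, Reg ψf B ∧ (∀ y ∈ Icc a b, |y| < C → ψf y = ψ y ∧ deriv ψf y = deriv ψ y ∧
        deriv (deriv ψf) y = deriv (deriv ψ) y) ∧
      ∀ y z, a - 11 ≤ y → y ≤ b + 11 → |y| < C → a - 11 ≤ z → z ≤ b + 11 → |z| < C →
        |deriv (deriv ψf) y - deriv (deriv ψf) z| ≤ M * 12 ^ 5 * |y - z| := by
  obtain ⟨K, hK, χ, hχ, hχ1, hcut⟩ := cut C hC
  refine ⟨M * (1 + 2 * C) ^ 5 * (2 * C) * (2 * C) * (2 * C) * K, fun B hB ψ hψ a b ha hb h0 h1 h2 hbd => ?_⟩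
  have s1 := smooth_deriv hψ
  have s2 := smooth_deriv s1
  have s3 := smooth_deriv s2
  have it3 : ∀ k (F : ℝ → ℝ), iteratedDeriv (k + 3) F = iteratedDeriv k (deriv (deriv (deriv F))) := by
    intro k F
    rw [iteratedDeriv_succ', iteratedDeriv_succ', iteratedDeriv_succ']
  obtain ⟨G, cG, eG, bG⟩ := ext_n ha hb (by linarith : 0 ≤ M) 5 _ s3 (fun j hj y hy => by
    have := hbd (j + 3) (by omega) (by omega) y hy
    rwa [it3] at this)
  obtain ⟨G2, cG2, dG2, eG2⟩ := prim ha hb s2 cG eG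
  obtain ⟨G1, cG1, dG1, eG1⟩ := prim ha hb s1 cG2 eG2
  obtain ⟨F, cF, dF, eF⟩ := prim ha hb hψ cG1 eG1
  have cF8 : ContDiff ℝ 8 F := by exact_mod_cast cF
  have hz : (0 : ℝ) ∈ Icc a b := ⟨ha, hb⟩
  have zF : F 0 = 0 := by have := eF 0 (by omega) 0 hz; simp only [iteratedDeriv_zero] at this; rw [this, h0]
  have zG1 : G1 0 = 0 := by have := eG1 0 (by omega) 0 hz; simp only [iteratedDeriv_zero] at this; rw [this, h1]
  have zG2 : G2 0 = 0 := by have := eG2 0 (by omega) 0 hz; simp only [iteratedDeriv_zero] at this; rw [this, h2]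
  set A := M * (1 + 2 * C) ^ 5 with hA
  have hAp : 0 ≤ A := by positivity
  have step : ∀ X, 0 ≤ X → X ≤ X * (2 * C) := fun X hX => le_mul_of_one_le_right hX (by linarith)
  have bG' : ∀ j ≤ 5, ∀ y, |y| ≤ 2 * C → |iteratedDeriv j G y| ≤ A := by
    intro j hj y hy
    rw [abs_le] at hy
    exact bG j hj y (2 * C) (by linarith) (by linarith) (by linarith)
  have b2 := int_bd (cG2.differentiable (by simp)) zG2 (A := A) (R := 2 * C) (by
    intro y hy; rw [dG2]; simpa using bG' 0 (by omega) y hy)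
  have b1 := int_bd (cG1.differentiable (by simp)) zG1 (A := A * (2 * C)) (R := 2 * C) (by
    intro y hy; rw [dG1]; exact b2 y hy)
  have b0 := int_bd (cF.differentiable (by simp)) zF (A := A * (2 * C) * (2 * C)) (R := 2 * C) (by
    intro y hy; rw [dF]; exact b1 y hy)
  have ball : ∀ k : ℕ, k ≤ 8 → ∀ y, |y| ≤ 2 * C → |iteratedDeriv k F y| ≤ A * (2 * C) * (2 * C) * (2 * C) := by
    intro k hk y hy
    have q1 := step A hAp
    have q2 := step (A * (2 * C)) (by positivity)
    have q3 := step (A * (2 * C) * (2 * C)) (by positivity)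
    match k, hk with
    | 0, _ => simpa using b0 y hy
    | 1, _ =>
      rw [iteratedDeriv_one, dF]; exact (b1 y hy).trans q3
    | 2, _ =>
      rw [iteratedDeriv_succ', iteratedDeriv_one, dF, dG1]; exact (b2 y hy).trans (q2.trans q3)
    | k + 3, hk =>
      rw [it3, dF, dG1, dG2]
      exact (bG' k (by omega) y hy).trans (q1.trans (q2.trans q3))
  have hfin := hcut F cF8 _ (by positivity) ball
  have hev : ∀ y, |y| < C → (fun y => F y * χ y) =ᶠ[nhds y] F := by
    intro y hy
    have : ∀ᶠ z in nhds y, |z| < C := (continuous_abs.tendsto y).eventually (gt_mem_nhds hy)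
    filter_upwards [this] with z hz
    rw [hχ1 z hz, mul_one]
  have cf8 : ContDiff ℝ 8 (fun y => F y * χ y) := cF8.mul (by exact_mod_cast contDiff_infty.1 hχ 8)
  refine ⟨fun y => F y * χ y, ⟨cf8, fun k _ hk y _ => (hfin k hk y).trans hB⟩, ?_, ?_⟩
  · intro y hy hyC
    have e := hev y hyC
    refine ⟨?_, ?_, ?_⟩
    · have := eF 0 (by omega) y hy
      simp only [iteratedDeriv_zero] at this
      rw [← this]; exact e.eq_of_nhds
    · rw [e.deriv_eq]
      have := eF 1 (by omega) y hy
      rwa [iteratedDeriv_one, iteratedDeriv_one] at this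
    · rw [e.deriv.deriv_eq]
      have := eF 2 (by omega) y hy
      rwa [iteratedDeriv_succ', iteratedDeriv_one, iteratedDeriv_succ', iteratedDeriv_one] at this
  · have hdd : ∀ y, |y| < C → deriv (deriv (fun y => F y * χ y)) y = G2 y := by
      intro y hy
      rw [(hev y hy).deriv.deriv_eq, dF, dG1]
    intro y z ya yb yc za zb zc
    rw [hdd y yc, hdd z zc]
    have := Convex.norm_image_sub_le_of_norm_deriv_le (s := Icc (a - 11) (b + 11)) (𝕜 := ℝ) (f := G2) (C := M * 12 ^ 5) (x := z) (y := y)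
      (fun s _ => (cG2.differentiable (by simp)).differentiableAt) (fun s hs => by
        rw [dG2, Real.norm_eq_abs]
        have := bG 0 (by omega) s 11 (by norm_num) hs.1 hs.2
        norm_num at this ⊢
        exact this) (convex_Icc _ _) ⟨za, zb⟩ ⟨ya, yb⟩
    simpa using this

end BAP

namespace BAP

lemma EE_congr {ψ ψ' : ℝ → ℝ} {f : ℝ × ℝ → ℂ} (h : ∀ z, f z ≠ 0 → ψ z.2 = ψ' z.2) : EE ψ f = EE ψ' f := by
  funext ξ
  unfold EE
  congr 1
  funext z
  by_cases hz : f z = 0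
  · rw [hz, zero_mul, zero_mul]
  · simp only [ph, h z hz]

lemma nf_core (M : ℝ) (hM : 1 ≤ M) (p : ℝ) (hp : 5 / 3 < p) (C : ℝ) (hC : 1000000 * (M * 12 ^ 5) ≤ C) :
    ∃ K : ℝ, 1 ≤ K ∧ ∀ ψ : ℝ → ℝ, ContDiff ℝ (⊤ : ℕ∞) ψ →
    ∀ a b : ℝ, a ≤ 0 → 1 ≤ b → ψ 0 = 0 → deriv ψ 0 = 0 → deriv (deriv ψ) 0 = 0 →
    (∀ k : ℕ, 3 ≤ k → k ≤ 8 → ∀ y ∈ Icc a b, |iteratedDeriv k ψ y| ≤ M) →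
    ∀ D t : ℝ, a ≤ D → D + 1 ≤ b → C / 8 < |D| → |D| < C / 2 → C ^ 2 / 4 ≤ |t| → |t| < 4 * C ^ 2 →
      C ^ 2 / 512 ≤ |t - 1 / 2 * D * deriv (deriv ψ) D| →
    ∀ f g, Ok V1s f → Ok (V2s ψ D t) g →
      eLpNorm (fun ξ => EE ψ f ξ * EE ψ g ξ) (ENNReal.ofReal p) volume ≤ ENNReal.ofReal (K * (N2 f * N2 g)) := by
  have hC1 : 1 ≤ C := by nlinarith
  obtain ⟨B0, hB0⟩ := ext_main M hM C hC1
  set N := M * 12 ^ 5 with hN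
  have hN1 : 1 ≤ N := by rw [hN]; nlinarith
  set B := max 1 (max B0 (Gc N C ^ 2 * (3 + 4 * Gc N C) + 1)) with hB
  have B1 : 1 ≤ B := le_max_left _ _
  have B2 : B0 ≤ B := (le_max_left _ _).trans (le_max_right _ _)
  have B3 : Gc N C ^ 2 * (3 + 4 * Gc N C) + 1 ≤ B := (le_max_right _ _).trans (le_max_right _ _)
  obtain ⟨K, hK, hglob⟩ := glob2 B B1 p hp
  refine ⟨K, hK, fun ψ hψ a b ha hb h0 h1 h2 hbd D t Da Db D1 D2 t1 t2 ta f g hf hg => ?_⟩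
  obtain ⟨ψf, hreg, heq, hlip⟩ := hB0 B B2 ψ hψ a b ha (by linarith) h0 h1 h2 hbd
  have dAbs := abs_le.1 D2.le
  have hC22 : 100 ≤ C := by linarith
  have hz : (0 : ℝ) ∈ Icc a b := ⟨ha, by linarith⟩
  obtain ⟨-, z1, z2⟩ := heq 0 hz (by rw [abs_zero]; linarith)
  obtain ⟨-, -, e2⟩ := heq D ⟨Da, by linarith⟩ (by linarith)
  have cd := hreg.1
  have hJ : ∀ y, min 0 D - 11 ≤ y → y ≤ max 0 D + 11 → a - 11 ≤ y ∧ y ≤ b + 11 ∧ |y| < C := by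
    intro y y1 y2
    have q1 : a ≤ min 0 D := le_min ha Da
    have q2 : max 0 D ≤ b := max_le (by linarith) (by linarith)
    have q3 : -(C / 2) ≤ min 0 D := le_min (by linarith) (by linarith)
    have q4 : max 0 D ≤ C / 2 := max_le (by linarith) (by linarith)
    refine ⟨by linarith, by linarith, ?_⟩
    rw [abs_lt]; constructor <;> linarith
  have nf : NF ψf N C D t := by
    refine ⟨cd.differentiable (by simp), ?_, by rw [z1, h1], by rw [z2, h2], ?_, hN1, hC, D1, D2, t1, t2, by rw [e2]; exact ta⟩
    · exact ((contDiff_succ_iff_deriv (n := 7)).1 (by norm_num; exact cd)).2.2.differentiable (by simp)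
    · intro y z y1 y2 y3 y4
      obtain ⟨a1, a2, a3⟩ := hJ y y1 y2
      obtain ⟨b1, b2, b3⟩ := hJ z y3 y4
      exact hlip y z a1 a2 a3 b1 b2 b3
  obtain ⟨T1, T2⟩ := nf.trans B3
  have hV2 : ∀ z : ℝ × ℝ, 0 ≤ z.2 - D → z.2 - D < 1 → ψf z.2 = ψ z.2 ∧ deriv ψf z.2 = deriv ψ z.2 := by
    intro z c1 c2
    have := heq z.2 ⟨by linarith, by linarith⟩ (by rw [abs_lt]; constructor <;> linarith)
    exact ⟨this.1, this.2.1⟩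
  have hV : V2s ψf D t = V2s ψ D t := by
    ext z
    constructor
    · rintro ⟨c1, c2, c3, c4⟩
      rw [(hV2 z c1 c2).2] at c3 c4
      exact ⟨c1, c2, c3, c4⟩
    · rintro ⟨c1, c2, c3, c4⟩
      rw [← (hV2 z c1 c2).2] at c3 c4
      exact ⟨c1, c2, c3, c4⟩
  have ef : EE ψ f = EE ψf f := EE_congr fun z hz => by
    have hm : z ∈ V1s := by
      by_contra h; exact hz (hf.2.2 z h)
    have := heq z.2 ⟨by linarith [hm.1], by linarith [hm.2.1]⟩ (by rw [abs_lt]; constructor <;> linarith [hm.1, hm.2.1])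
    exact this.1.symm
  have eg : EE ψ g = EE ψf g := EE_congr fun z hz => by
    have hm : z ∈ V2s ψ D t := by
      by_contra h; exact hz (hg.2.2 z h)
    exact (hV2 z hm.1 hm.2.1).1.symm
  rw [ef, eg]
  rw [← hV] at hg
  exact hglob ψf hreg _ _ T1 T2 f g hf hg

lemma V1s_meas : MeasurableSet V1s := by
  have e : V1s = (Ico 0 1) ×ˢ (Ico 0 1) := by
    ext z; simp only [V1s, Set.mem_ofPred_eq, mem_prod, mem_Ico]; tauto
  rw [e]; exact measurableSet_Ico.prod measurableSet_Ico

lemma V1s_vol : volume V1s ≤ 1 := by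
  have e : V1s = (Ico 0 1) ×ˢ (Ico 0 1) := by
    ext z; simp only [V1s, Set.mem_ofPred_eq, mem_prod, mem_Ico]; tauto
  rw [e, Measure.volume_eq_prod, Measure.prod_prod]
  simp

lemma V2s_meas {ψ : ℝ → ℝ} (hψ : Continuous (deriv ψ)) (D t : ℝ) : MeasurableSet (V2s ψ D t) := by
  have hm : Measurable fun z : ℝ × ℝ => z.1 - t + deriv ψ z.2 := by fun_prop
  have e : V2s ψ D t = (fun z : ℝ × ℝ => z.2 - D) ⁻¹' (Ico 0 1) ∩ (fun z : ℝ × ℝ => z.1 - t + deriv ψ z.2) ⁻¹' (Ico 0 1) := by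
    ext z; simp only [V2s, Set.mem_ofPred_eq, mem_inter_iff, mem_preimage, mem_Ico]; tauto
  rw [e]
  exact ((measurable_snd.sub_const D) measurableSet_Ico).inter (hm measurableSet_Ico)

lemma V2s_vol {ψ : ℝ → ℝ} (hψ : Continuous (deriv ψ)) (D t : ℝ) : volume (V2s ψ D t) ≤ 1 := by
  rw [Measure.volume_eq_prod, Measure.prod_apply_symm (V2s_meas hψ D t)]
  have : ∀ y, volume ((fun x : ℝ => (x, y)) ⁻¹' V2s ψ D t) ≤ (Ico D (D + 1)).indicator (fun _ => 1) y := by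
    intro y
    by_cases hy : y ∈ Ico D (D + 1)
    · rw [indicator_of_mem hy]
      calc _ ≤ volume (Ico (t - deriv ψ y) (t - deriv ψ y + 1)) := by
            refine measure_mono ?_
            rintro x ⟨_, _, h3, h4⟩
            simp only at h3 h4
            exact ⟨by linarith, by linarith⟩
        _ = 1 := by simp
    · have : (fun x : ℝ => (x, y)) ⁻¹' V2s ψ D t = ∅ := by
        ext x
        simp only [mem_preimage, mem_empty_iff_false, iff_false]
        rintro ⟨h1, h2, _⟩
        simp only at h1 h2
        exact hy ⟨by linarith, by linarith⟩
      rw [this]; simp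
  refine (lintegral_mono this).trans ?_
  rw [lintegral_indicator measurableSet_Ico]
  simp

end BAP

namespace BAP

lemma lint_aff {c : ℝ} (hc : 0 < c) (d : ℝ) {Φ : ℝ → ℝ≥0∞} (hΦ : Measurable Φ) :
    ∫⁻ x, Φ (c * x + d) = ENNReal.ofReal c⁻¹ * ∫⁻ x, Φ x := by
  have h1 : ∫⁻ x, Φ (c * x + d) = ∫⁻ u, Φ (u + d) ∂(Measure.map (fun x => c * x) volume) := by
    rw [lintegral_map (by fun_prop) (by fun_prop)]
  rw [h1, Real.map_volume_mul_left hc.ne', lintegral_smul_measure, abs_of_pos (inv_pos.2 hc), smul_eq_mul,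
    lintegral_add_right_eq_self]

/-- the affine change of variables -/
def Lm (a ρ σ x0 y0 : ℝ) (z : ℝ × ℝ) : ℝ × ℝ := (x0 + a * z.1 - σ * z.2, y0 + ρ * z.2)

lemma Lm_cont (a ρ σ x0 y0 : ℝ) : Continuous (Lm a ρ σ x0 y0) := by
  unfold Lm; fun_prop

lemma Lm_lint {a ρ : ℝ} (ha : 0 < a) (hρ : 0 < ρ) (σ x0 y0 : ℝ) {Φ : ℝ × ℝ → ℝ≥0∞} (hΦ : Measurable Φ) :
    ∫⁻ z, Φ (Lm a ρ σ x0 y0 z) = ENNReal.ofReal (a * ρ)⁻¹ * ∫⁻ z, Φ z := by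
  have hL := (Lm_cont a ρ σ x0 y0).measurable
  have e0 : ∫⁻ z, Φ (Lm a ρ σ x0 y0 z) = ∫⁻ z, (Φ ∘ Lm a ρ σ x0 y0) z := rfl
  rw [e0, Measure.volume_eq_prod, lintegral_prod_symm' _ (hΦ.comp hL), lintegral_prod_symm' _ hΦ]
  have h1 : ∀ y, ∫⁻ x, Φ (Lm a ρ σ x0 y0 (x, y)) = ENNReal.ofReal a⁻¹ * ∫⁻ x, Φ (x, ρ * y + y0) := by
    intro y
    rw [← lint_aff ha (x0 - σ * y) (Φ := fun x => Φ (x, ρ * y + y0)) (by fun_prop)]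
    refine lintegral_congr fun x => ?_
    simp only [Lm]; congr 2 <;> ring
  simp only [Function.comp_apply] at *
  simp only [h1]
  rw [lintegral_const_mul', lint_aff hρ y0 (Φ := fun y => ∫⁻ x, Φ (x, y)) hΦ.lintegral_prod_left', ← mul_assoc, mul_inv,
    ENNReal.ofReal_mul (inv_pos.2 ha).le]
  exact ENNReal.ofReal_ne_top

lemma Lm_map {a ρ : ℝ} (ha : 0 < a) (hρ : 0 < ρ) (σ x0 y0 : ℝ) :
    Measure.map (Lm a ρ σ x0 y0) volume = ENNReal.ofReal (a * ρ)⁻¹ • volume := by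
  have hL := (Lm_cont a ρ σ x0 y0).measurable
  refine Measure.ext_of_lintegral _ fun Φ hΦ => ?_
  rw [lintegral_map hΦ hL, Lm_lint ha hρ _ _ _ hΦ, lintegral_smul_measure, smul_eq_mul]

lemma Lm_emb {a ρ : ℝ} (ha : 0 < a) (hρ : 0 < ρ) (σ x0 y0 : ℝ) : MeasurableEmbedding (Lm a ρ σ x0 y0) := by
  refine (Lm_cont a ρ σ x0 y0).measurableEmbedding ?_
  rintro ⟨x, y⟩ ⟨x', y'⟩ h
  simp only [Lm, Prod.mk.injEq] at h
  have h2 : y = y' := mul_left_cancel₀ hρ.ne' (by linarith [h.2])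
  subst h2
  have h1 : x = x' := mul_left_cancel₀ ha.ne' (by linarith [h.1])
  rw [h1]

lemma Lm_int {a ρ : ℝ} (ha : 0 < a) (hρ : 0 < ρ) (σ x0 y0 : ℝ) (H : ℝ × ℝ → ℂ) :
    ∫ z, H z = ((a * ρ : ℝ) : ℂ) * ∫ z, H (Lm a ρ σ x0 y0 z) := by
  have := (Lm_emb ha hρ σ x0 y0).integral_map (μ := volume) H
  rw [← this, Lm_map ha hρ, integral_smul_measure, ENNReal.toReal_ofReal (by positivity)]
  rw [Complex.real_smul, ← mul_assoc, ← Complex.ofReal_mul, mul_inv_cancel₀ (by positivity)]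
  simp

/-- the dual linear map -/
def Tm (a ρ σ α β : ℝ) (ξ : ℝ × ℝ × ℝ) : ℝ × ℝ × ℝ :=
  (a * ξ.1 + α * ξ.2.2, ρ * ξ.2.1 + (β * ξ.2.2 - σ * ξ.1), a * ρ * ξ.2.2)

lemma Tm_lint {a ρ : ℝ} (ha : 0 < a) (hρ : 0 < ρ) (σ α β : ℝ) {Φ : ℝ × ℝ × ℝ → ℝ≥0∞} (hΦ : Measurable Φ) :
    ∫⁻ ξ, Φ (Tm a ρ σ α β ξ) = ENNReal.ofReal ((a * ρ) ^ 2)⁻¹ * ∫⁻ ξ, Φ ξ := by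
  have hT : Measurable (Tm a ρ σ α β) := by unfold Tm; fun_prop
  have ex : ∀ Ψ : ℝ × ℝ × ℝ → ℝ≥0∞, Measurable Ψ → ∫⁻ ξ, Ψ ξ = ∫⁻ z, ∫⁻ x, ∫⁻ y, Ψ (x, y, z) := by
    intro Ψ hΨ
    rw [Measure.volume_eq_prod, lintegral_prod _ hΨ.aemeasurable]
    have : ∀ x, ∫⁻ w, Ψ (x, w) = ∫⁻ z, ∫⁻ y, Ψ (x, y, z) := by
      intro x
      rw [Measure.volume_eq_prod, lintegral_prod_symm' _ (by fun_prop)]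
    simp only [this]
    rw [lintegral_lintegral_swap]
    have : Measurable fun w : (ℝ × ℝ) × ℝ => Ψ (w.1.1, w.2, w.1.2) := by fun_prop
    exact this.lintegral_prod_right'.aemeasurable
  have e0 : ∫⁻ ξ, Φ (Tm a ρ σ α β ξ) = ∫⁻ ξ, (Φ ∘ Tm a ρ σ α β) ξ := rfl
  rw [e0, ex _ (hΦ.comp hT), ex _ hΦ]
  have h1 : ∀ z x, ∫⁻ y, Φ (Tm a ρ σ α β (x, y, z)) = ENNReal.ofReal ρ⁻¹ * ∫⁻ y, Φ (a * x + α * z, y, a * ρ * z) := by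
    intro z x
    rw [← lint_aff hρ (β * z - σ * x) (Φ := fun y => Φ (a * x + α * z, y, a * ρ * z)) (by fun_prop)]
    rfl
  have hm : ∀ z, Measurable fun x => ∫⁻ y, Φ (x, y, z) := by
    intro z
    have : Measurable fun w : ℝ × ℝ => Φ (w.1, w.2, z) := by fun_prop
    exact this.lintegral_prod_right'
  have h2 : ∀ z, ∫⁻ x, ∫⁻ y, Φ (Tm a ρ σ α β (x, y, z)) = ENNReal.ofReal ρ⁻¹ * (ENNReal.ofReal a⁻¹ * ∫⁻ x, ∫⁻ y, Φ (x, y, a * ρ * z + 0)) := by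
    intro z
    simp only [h1]
    rw [lintegral_const_mul' _ _ ENNReal.ofReal_ne_top, add_zero, ← lint_aff ha (α * z) (hm (a * ρ * z))]
  have hm2 : Measurable fun z => ∫⁻ x, ∫⁻ y, Φ (x, y, z) := by
    have : Measurable fun w : (ℝ × ℝ) × ℝ => Φ (w.1.2, w.2, w.1.1) := by fun_prop
    have h3 : Measurable fun w : ℝ × ℝ => ∫⁻ y, Φ (w.2, y, w.1) := this.lintegral_prod_right' (ν := volume)
    exact h3.lintegral_prod_right'
  simp only [Function.comp_apply, h2]
  rw [lintegral_const_mul' _ _ ENNReal.ofReal_ne_top, lintegral_const_mul' _ _ ENNReal.ofReal_ne_top,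
    lint_aff (mul_pos ha hρ) 0 hm2, ← mul_assoc, ← mul_assoc, ← ENNReal.ofReal_mul (inv_pos.2 hρ).le,
    ← ENNReal.ofReal_mul (by positivity)]
  congr 2
  field_simp

end BAP

namespace BAP

/-- extension operator for a general phase on the whole plane -/
def EX (φ : ℝ × ℝ → ℝ) (F : ℝ × ℝ → ℂ) (ξ : ℝ × ℝ × ℝ) : ℂ :=
  ∫ z, F z * ee (ξ.1 * z.1 + ξ.2.1 * z.2 + ξ.2.2 * φ z)

lemma EX_eq {a ρ σ x0 y0 α β γ : ℝ} (ha : 0 < a) (hρ : 0 < ρ) {φ : ℝ × ℝ → ℝ} {ψ : ℝ → ℝ}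
    (hφ : ∀ z, φ (Lm a ρ σ x0 y0 z) = a * ρ * ph ψ z + α * z.1 + β * z.2 + γ) (F : ℝ × ℝ → ℂ) (ξ : ℝ × ℝ × ℝ) :
    EX φ F ξ = ((a * ρ : ℝ) : ℂ) * (ee (ξ.1 * x0 + ξ.2.1 * y0 + ξ.2.2 * γ) * EE ψ (fun z => F (Lm a ρ σ x0 y0 z)) (Tm a ρ σ α β ξ)) := by
  unfold EX EE
  rw [Lm_int ha hρ σ x0 y0]
  congr 1
  rw [← integral_const_mul]
  congr 1
  funext z
  rw [hφ]
  have : ξ.1 * (Lm a ρ σ x0 y0 z).1 + ξ.2.1 * (Lm a ρ σ x0 y0 z).2 + ξ.2.2 * (a * ρ * ph ψ z + α * z.1 + β * z.2 + γ) =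
      (ξ.1 * x0 + ξ.2.1 * y0 + ξ.2.2 * γ) + ((Tm a ρ σ α β ξ).1 * z.1 + (Tm a ρ σ α β ξ).2.1 * z.2 + (Tm a ρ σ α β ξ).2.2 * ph ψ z) := by
    simp only [Lm, Tm]; ring
  rw [this, ee_add]; ring

lemma lp_Lm {a ρ : ℝ} (ha : 0 < a) (hρ : 0 < ρ) (σ x0 y0 : ℝ) {q : ℝ} (hq : 0 < q) {F : ℝ × ℝ → ℂ} (hF : Measurable F) :
    eLpNorm (fun z => F (Lm a ρ σ x0 y0 z)) (ENNReal.ofReal q) volume =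
      ENNReal.ofReal ((a * ρ) ^ (-(1 / q))) * eLpNorm F (ENNReal.ofReal q) volume := by
  rw [eLp_eq _ hq, eLp_eq _ hq, Lm_lint ha hρ σ x0 y0 (Φ := fun z => ‖F z‖ₑ ^ q) (by fun_prop),
    ENNReal.mul_rpow_of_nonneg _ _ (by positivity), ENNReal.ofReal_rpow_of_nonneg (by positivity) (by positivity),
    Real.inv_rpow (by positivity), ← Real.rpow_neg (by positivity)]

lemma N2_Lq {V : Set (ℝ × ℝ)} (hV : MeasurableSet V) (hvol : volume V ≤ 1) {q : ℝ} (hq : 2 ≤ q) {f : ℝ × ℝ → ℂ}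
    (hf : Measurable f) (hs : ∀ z, z ∉ V → f z = 0) {X : ℝ} (hX : 0 ≤ X) (hX2 : eLpNorm f (ENNReal.ofReal q) volume ≤ ENNReal.ofReal X) :
    Ok V f ∧ N2 f ≤ X := by
  have hind : V.indicator f = f := by
    funext z
    by_cases h : z ∈ V
    · rw [indicator_of_mem h]
    · rw [indicator_of_notMem h, hs z h]
  have h1 : eLpNorm f (ENNReal.ofReal 2) volume ≤ ENNReal.ofReal X := by
    conv_lhs => rw [← hind]
    rw [eLpNorm_indicator_eq_eLpNorm_restrict hV]
    refine (eLpNorm_le_eLpNorm_mul_rpow_measure_univ (ENNReal.ofReal_le_ofReal hq) hf.aestronglyMeasurable).trans ?_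
    rw [Measure.restrict_apply_univ, ENNReal.toReal_ofReal (by norm_num), ENNReal.toReal_ofReal (by linarith)]
    have : volume V ^ (1 / 2 - 1 / q) ≤ 1 := by
      refine ENNReal.rpow_le_one hvol ?_
      rw [sub_nonneg]
      exact one_div_le_one_div_of_le (by norm_num) hq
    calc _ ≤ eLpNorm f (ENNReal.ofReal q) (volume.restrict V) * 1 := mul_le_mul_right this _
      _ ≤ eLpNorm f (ENNReal.ofReal q) volume := by rw [mul_one]; exact eLpNorm_mono_measure _ Measure.restrict_le_self
      _ ≤ _ := hX2
  have h2 : ∫⁻ z, ‖f z‖ₑ ^ 2 ≤ ENNReal.ofReal (X ^ 2) := by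
    rw [eLp_eq _ (by norm_num), one_div, ENNReal.rpow_inv_le_iff (by norm_num)] at h1
    rw [ENNReal.ofReal_pow hX]
    have e : ∀ x : ℝ≥0∞, x ^ (2:ℝ) = x ^ (2:ℕ) := fun x => by
      rw [← ENNReal.rpow_natCast]; norm_num
    simpa only [e] using h1
  exact ⟨⟨hf, ne_top_of_le_ne_top ENNReal.ofReal_ne_top h2, hs⟩, N2_le hX h2⟩

lemma aff {a ρ σ x0 y0 α β γ : ℝ} (ha : 0 < a) (hρ : 0 < ρ) {φ : ℝ × ℝ → ℝ} {ψ : ℝ → ℝ} (hψ : Continuous ψ)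
    (hφ : ∀ z, φ (Lm a ρ σ x0 y0 z) = a * ρ * ph ψ z + α * z.1 + β * z.2 + γ) {V1 V2 : Set (ℝ × ℝ)}
    (m1 : MeasurableSet V1) (m2 : MeasurableSet V2) (v1 : volume V1 ≤ 1) (v2 : volume V2 ≤ 1) {p q K : ℝ} (hp : 0 < p) (hq : 2 ≤ q) (hK : 0 ≤ K)
    (core : ∀ f g, Ok V1 f → Ok V2 g →
      eLpNorm (fun ξ => EE ψ f ξ * EE ψ g ξ) (ENNReal.ofReal p) volume ≤ ENNReal.ofReal (K * (N2 f * N2 g)))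
    {F G : ℝ × ℝ → ℂ} (hF : Measurable F) (hG : Measurable G) (iF : Integrable F) (iG : Integrable G)
    (sF : ∀ z, z ∉ V1 → F (Lm a ρ σ x0 y0 z) = 0) (sG : ∀ z, z ∉ V2 → G (Lm a ρ σ x0 y0 z) = 0)
    (nF : eLpNorm F (ENNReal.ofReal q) volume ≠ ⊤) (nG : eLpNorm G (ENNReal.ofReal q) volume ≠ ⊤) :
    eLpNorm (fun ξ => EX φ F ξ * EX φ G ξ) (ENNReal.ofReal p) volume ≤
      ENNReal.ofReal (K * (a * ρ) ^ (2 * (1 - 1 / p - 1 / q))) *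
        (eLpNorm F (ENNReal.ofReal q) volume * eLpNorm G (ENNReal.ofReal q) volume) := by
  have hq0 : 0 < q := by linarith
  set c := a * ρ with hc
  have hc0 : 0 < c := mul_pos ha hρ
  set L := Lm a ρ σ x0 y0 with hL
  have hLm : Measurable L := (Lm_cont a ρ σ x0 y0).measurable
  set X := (eLpNorm F (ENNReal.ofReal q) volume).toReal with hX
  set Y := (eLpNorm G (ENNReal.ofReal q) volume).toReal with hY
  have eX : eLpNorm F (ENNReal.ofReal q) volume = ENNReal.ofReal X := (ENNReal.ofReal_toReal nF).symm
  have eY : eLpNorm G (ENNReal.ofReal q) volume = ENNReal.ofReal Y := (ENNReal.ofReal_toReal nG).symm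
  have hX0 : 0 ≤ X := ENNReal.toReal_nonneg
  have hY0 : 0 ≤ Y := ENNReal.toReal_nonneg
  have lf := lp_Lm ha hρ σ x0 y0 hq0 hF
  have lg := lp_Lm ha hρ σ x0 y0 hq0 hG
  rw [eX, ← ENNReal.ofReal_mul (by positivity)] at lf
  rw [eY, ← ENNReal.ofReal_mul (by positivity)] at lg
  obtain ⟨o1, n1⟩ := N2_Lq m1 v1 hq (hF.comp hLm) sF (X := c ^ (-(1 / q)) * X) (by positivity) lf.le
  obtain ⟨o2, n2⟩ := N2_Lq m2 v2 hq (hG.comp hLm) sG (X := c ^ (-(1 / q)) * Y) (by positivity) lg.le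
  have hcore := core _ _ o1 o2
  have hIntg : ∀ F : ℝ × ℝ → ℂ, Integrable F → Integrable (F ∘ L) := by
    intro F hF
    rw [← (Lm_emb ha hρ σ x0 y0).integrable_map_iff, Lm_map ha hρ]
    exact hF.smul_measure ENNReal.ofReal_ne_top
  have mH : Measurable fun ξ => EE ψ (F ∘ L) ξ * EE ψ (G ∘ L) ξ :=
    ((EE_continuous hψ (hIntg F iF)).mul (EE_continuous hψ (hIntg G iG))).measurable
  have key : eLpNorm (fun ξ => EX φ F ξ * EX φ G ξ) (ENNReal.ofReal p) volume =
      ENNReal.ofReal (c ^ 2 * c ^ (-(2 / p))) * eLpNorm (fun ξ => EE ψ (F ∘ L) ξ * EE ψ (G ∘ L) ξ) (ENNReal.ofReal p) volume := by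
    rw [eLp_eq _ hp, eLp_eq _ hp]
    have e1 : ∀ ξ, ‖EX φ F ξ * EX φ G ξ‖ₑ ^ p = ENNReal.ofReal (c ^ 2) ^ p *
        ‖EE ψ (F ∘ L) (Tm a ρ σ α β ξ) * EE ψ (G ∘ L) (Tm a ρ σ α β ξ)‖ₑ ^ p := by
      intro ξ
      rw [← ENNReal.mul_rpow_of_nonneg _ _ hp.le]
      congr 1
      rw [← ofReal_norm, ← ofReal_norm, ← ENNReal.ofReal_mul (by positivity), EX_eq ha hρ hφ F ξ, EX_eq ha hρ hφ G ξ]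
      congr 1
      simp only [norm_mul, ee_norm, Complex.norm_real, Real.norm_eq_abs, one_mul, ← hc, abs_of_pos hc0]
      simp only [Function.comp_def]
      ring
    simp only [e1]
    rw [lintegral_const_mul' _ _ (by finiteness),
      Tm_lint ha hρ σ α β (Φ := fun ξ => ‖EE ψ (F ∘ L) ξ * EE ψ (G ∘ L) ξ‖ₑ ^ p) (mH.enorm.pow_const p),
      ← mul_assoc, ENNReal.mul_rpow_of_nonneg _ _ (by positivity)]
    congr 1
    rw [ENNReal.ofReal_rpow_of_nonneg (by positivity) hp.le, ← ENNReal.ofReal_mul (by positivity),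
      ENNReal.ofReal_rpow_of_nonneg (by positivity) (by positivity)]
    congr 1
    rw [Real.mul_rpow (by positivity) (by positivity), ← Real.rpow_mul (by positivity), mul_one_div_cancel hp.ne', Real.rpow_one]
    congr 1
    rw [Real.inv_rpow (by positivity), Real.rpow_neg hc0.le, ← Real.rpow_natCast, ← Real.rpow_mul hc0.le]
    congr 2
    push_cast; ring
  rw [key, eX, eY]
  refine (mul_le_mul_right hcore _).trans ?_
  rw [← ENNReal.ofReal_mul (by positivity), ← ENNReal.ofReal_mul (by positivity), ← ENNReal.ofReal_mul (by positivity)]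
  refine ENNReal.ofReal_le_ofReal ?_
  have e2 : c ^ (2 * (1 - 1 / p - 1 / q)) = c ^ 2 * c ^ (-(2 / p)) * (c ^ (-(1 / q)) * c ^ (-(1 / q))) := by
    rw [← Real.rpow_natCast, ← Real.rpow_add hc0, ← Real.rpow_add hc0, ← Real.rpow_add hc0]
    congr 1; push_cast; ring
  have h3 : N2 (F ∘ L) * N2 (G ∘ L) ≤ (c ^ (-(1 / q)) * X) * (c ^ (-(1 / q)) * Y) :=
    mul_le_mul n1 n2 (N2_nonneg _) (by positivity)
  calc c ^ 2 * c ^ (-(2 / p)) * (K * (N2 (F ∘ L) * N2 (G ∘ L))) ≤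
      c ^ 2 * c ^ (-(2 / p)) * (K * ((c ^ (-(1 / q)) * X) * (c ^ (-(1 / q)) * Y))) := by gcongr
    _ = _ := by rw [e2]; ring

end BAP

namespace BAP

lemma ext_ee (φ η : ℝ × ℝ → ℝ) (U : Set (ℝ × ℝ)) (f : ℝ × ℝ → ℂ) (ξ : ℝ × ℝ × ℝ) :
    extOp φ η U f ξ = ∫ z in U, f z * (η z : ℂ) * ee (ξ.1 * z.1 + ξ.2.1 * z.2 + ξ.2.2 * φ z) := rfl

lemma rep {φ η : ℝ × ℝ → ℝ} (hφ : Continuous φ) {U : Set (ℝ × ℝ)} (hU : MeasurableSet U) {m : ℝ}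
    (hη : ∀ z ∈ U, |η z| ≤ m) (f : ℝ × ℝ → ℂ) (q : ℝ≥0∞) :
    (∀ ξ, extOp φ η U f ξ = 0) ∨ ∃ F : ℝ × ℝ → ℂ, Measurable F ∧ Integrable F ∧ (∀ z, z ∉ U → F z = 0) ∧
      (∀ ξ, extOp φ η U f ξ = EX φ F ξ) ∧ eLpNorm F q volume ≤ ENNReal.ofReal m * eLpNorm f q (volume.restrict U) := by
  by_cases h : Integrable (fun z => f z * (η z : ℂ)) (volume.restrict U)
  · right
    have h0 := h.aestronglyMeasurable
    have hae := h0.ae_eq_mk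
    have hFm : Measurable (h0.mk _) := h0.stronglyMeasurable_mk.measurable
    refine ⟨U.indicator (h0.mk _), hFm.indicator hU, ?_, fun z hz => indicator_of_notMem hz _, ?_, ?_⟩
    · rw [integrable_indicator_iff hU]
      exact h.congr hae
    · intro ξ
      rw [ext_ee]
      unfold EX
      have : (fun z => U.indicator (h0.mk _) z * ee (ξ.1 * z.1 + ξ.2.1 * z.2 + ξ.2.2 * φ z)) =
          U.indicator (fun z => h0.mk _ z * ee (ξ.1 * z.1 + ξ.2.1 * z.2 + ξ.2.2 * φ z)) := by
        funext z
        by_cases hz : z ∈ U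
        · rw [indicator_of_mem hz, indicator_of_mem hz]
        · rw [indicator_of_notMem hz, indicator_of_notMem hz, zero_mul]
      rw [this, integral_indicator hU]
      refine integral_congr_ae ?_
      filter_upwards [hae] with z hz
      rw [hz]
    · rw [eLpNorm_indicator_eq_eLpNorm_restrict hU]
      refine eLpNorm_le_mul_eLpNorm_of_ae_le_mul ?_ q
      filter_upwards [hae, ae_restrict_mem hU] with z hz hzU
      rw [← hz, norm_mul, Complex.norm_real, mul_comm]
      exact mul_le_mul_of_nonneg_right (hη z hzU) (norm_nonneg _)
  · left
    intro ξ
    rw [ext_ee]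
    refine integral_undef fun hi => h ?_
    have hc : Continuous fun z : ℝ × ℝ => ee (-(ξ.1 * z.1 + ξ.2.1 * z.2 + ξ.2.2 * φ z)) := ee_continuous.comp (by fun_prop)
    have := hi.mul_bdd (c := 1) hc.aestronglyMeasurable (Filter.Eventually.of_forall fun z => (ee_norm _).le)
    refine this.congr (Filter.Eventually.of_forall fun z => ?_)
    simp only
    rw [mul_assoc, ← ee_add, add_neg_cancel, ee_zero, mul_one]

lemma EX_zero {φ : ℝ × ℝ → ℝ} {F : ℝ × ℝ → ℂ} (h : F =ᵐ[volume] 0) (ξ : ℝ × ℝ × ℝ) : EX φ F ξ = 0 := by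
  unfold EX
  refine integral_eq_zero_of_ae ?_
  filter_upwards [h] with z hz
  rw [hz]; simp

lemma wrap {φ η : ℝ × ℝ → ℝ} (hφ : Continuous φ) {U1 U2 : Set (ℝ × ℝ)} (hU1 : MeasurableSet U1) (hU2 : MeasurableSet U2) {m : ℝ}
    (hη1 : ∀ z ∈ U1, |η z| ≤ m) (hη2 : ∀ z ∈ U2, |η z| ≤ m) {p q c : ℝ} (hq : 2 ≤ q) (hc : 0 < c)
    (H : ∀ F G : ℝ × ℝ → ℂ, Measurable F → Measurable G → Integrable F → Integrable G → (∀ z, z ∉ U1 → F z = 0) →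
      (∀ z, z ∉ U2 → G z = 0) → eLpNorm F (ENNReal.ofReal q) volume ≠ ⊤ → eLpNorm G (ENNReal.ofReal q) volume ≠ ⊤ →
      eLpNorm (fun ξ => EX φ F ξ * EX φ G ξ) (ENNReal.ofReal p) volume ≤ ENNReal.ofReal c *
        (eLpNorm F (ENNReal.ofReal q) volume * eLpNorm G (ENNReal.ofReal q) volume)) (f g : ℝ × ℝ → ℂ) :
    eLpNorm (fun ξ => extOp φ η U1 f ξ * extOp φ η U2 g ξ) (ENNReal.ofReal p) volume ≤ ENNReal.ofReal c *
      ((ENNReal.ofReal m * eLpNorm f (ENNReal.ofReal q) (volume.restrict U1)) *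
        (ENNReal.ofReal m * eLpNorm g (ENNReal.ofReal q) (volume.restrict U2))) := by
  have hq0 : ENNReal.ofReal q ≠ 0 := by simp; linarith
  have hc0 : ENNReal.ofReal c ≠ 0 := by simpa using hc
  have zero : ∀ A : ℝ × ℝ × ℝ → ℂ, (∀ ξ, A ξ = 0) → ∀ X, eLpNorm A (ENNReal.ofReal p) volume ≤ X := by
    intro A hA X
    have : A = 0 := funext hA
    rw [this, eLpNorm_zero]; exact zero_le
  rcases rep hφ hU1 hη1 f (ENNReal.ofReal q) with h1 | ⟨F, mF, iF, sF, eF, nF⟩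
  · exact zero _ (fun ξ => by rw [h1 ξ, zero_mul]) _
  rcases rep hφ hU2 hη2 g (ENNReal.ofReal q) with h2 | ⟨G, mG, iG, sG, eG, nG⟩
  · exact zero _ (fun ξ => by rw [h2 ξ, mul_zero]) _
  simp only [eF, eG]
  refine le_trans ?_ (mul_le_mul_right (mul_le_mul' nF nG) _)
  by_cases zF : eLpNorm F (ENNReal.ofReal q) volume = 0
  · rw [eLpNorm_eq_zero_iff iF.aestronglyMeasurable hq0] at zF
    exact zero _ (fun ξ => by rw [EX_zero zF, zero_mul]) _
  by_cases zG : eLpNorm G (ENNReal.ofReal q) volume = 0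
  · rw [eLpNorm_eq_zero_iff iG.aestronglyMeasurable hq0] at zG
    exact zero _ (fun ξ => by rw [EX_zero zG, mul_zero]) _
  by_cases tF : eLpNorm F (ENNReal.ofReal q) volume = ⊤
  · rw [tF, ENNReal.top_mul zG, ENNReal.mul_top hc0]; exact le_top
  by_cases tG : eLpNorm G (ENNReal.ofReal q) volume = ⊤
  · rw [tG, ENNReal.mul_top zF, ENNReal.mul_top hc0]; exact le_top
  exact H F G mF mG iF iG sF sG tF tG

end BAP

namespace BAP

/-- the rescaled perturbation -/
def ps (h : ℝ → ℝ) (y0 ρ δ y : ℝ) : ℝ :=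
  (h (y0 + ρ * y) - h y0 - deriv h y0 * (ρ * y) - 1 / 2 * deriv (deriv h) y0 * (ρ * y) ^ 2) / (ρ ^ 3 * δ)

lemma ps_smooth {h : ℝ → ℝ} (hh : ContDiff ℝ (⊤ : ℕ∞) h) (y0 ρ δ : ℝ) : ContDiff ℝ (⊤ : ℕ∞) (ps h y0 ρ δ) := by
  unfold ps
  fun_prop

lemma hd_comp {g : ℝ → ℝ} (hg : ContDiff ℝ (⊤ : ℕ∞) g) (y0 ρ y : ℝ) :
    HasDerivAt (fun y => g (y0 + ρ * y)) (deriv g (y0 + ρ * y) * ρ) y := by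
  have h1 : HasDerivAt (fun y : ℝ => y0 + ρ * y) ρ y := by
    simpa using ((hasDerivAt_id y).const_mul ρ).const_add y0
  have hd : Differentiable ℝ g := hg.differentiable (by simp)
  exact (hd (y0 + ρ * y)).hasDerivAt.comp y h1

lemma ps_d1 {h : ℝ → ℝ} (hh : ContDiff ℝ (⊤ : ℕ∞) h) {y0 ρ δ : ℝ} (hρ : 0 < ρ) (hδ : 0 < δ) :
    deriv (ps h y0 ρ δ) = fun y => (deriv h (y0 + ρ * y) - deriv h y0 - deriv (deriv h) y0 * (ρ * y)) / (ρ ^ 2 * δ) := by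
  funext y
  have h1 := hd_comp hh y0 ρ y
  have h2 : HasDerivAt (fun y : ℝ => ρ * y) ρ y := by simpa using (hasDerivAt_id y).const_mul ρ
  have h3 := (((h1.sub_const (h y0)).sub (h2.const_mul (deriv h y0))).sub
    ((h2.pow 2).const_mul (1 / 2 * deriv (deriv h) y0))).div_const (ρ ^ 3 * δ)
  have h4 : HasDerivAt (ps h y0 ρ δ) _ y := h3
  rw [h4.deriv]
  field_simp
  ring

lemma ps_d2 {h : ℝ → ℝ} (hh : ContDiff ℝ (⊤ : ℕ∞) h) {y0 ρ δ : ℝ} (hρ : 0 < ρ) (hδ : 0 < δ) :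
    deriv (deriv (ps h y0 ρ δ)) = fun y => (deriv (deriv h) (y0 + ρ * y) - deriv (deriv h) y0) / (ρ * δ) := by
  rw [ps_d1 hh hρ hδ]
  funext y
  have h1 := hd_comp (smooth_deriv hh) y0 ρ y
  have h2 : HasDerivAt (fun y : ℝ => ρ * y) ρ y := by simpa using (hasDerivAt_id y).const_mul ρ
  have h3 := ((h1.sub_const (deriv h y0)).sub (h2.const_mul (deriv (deriv h) y0))).div_const (ρ ^ 2 * δ)
  have h4 : HasDerivAt (fun y => (deriv h (y0 + ρ * y) - deriv h y0 - deriv (deriv h) y0 * (ρ * y)) / (ρ ^ 2 * δ)) _ y := h3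
  rw [h4.deriv]
  field_simp

lemma it_smooth {h : ℝ → ℝ} (hh : ContDiff ℝ (⊤ : ℕ∞) h) (n : ℕ) : ContDiff ℝ (⊤ : ℕ∞) (iteratedDeriv n h) := by
  induction n with
  | zero => simpa using hh
  | succ k ih => rw [iteratedDeriv_succ]; exact smooth_deriv ih

lemma ps_dk {h : ℝ → ℝ} (hh : ContDiff ℝ (⊤ : ℕ∞) h) {y0 ρ δ : ℝ} (hρ : 0 < ρ) (hδ : 0 < δ) (k : ℕ) :
    iteratedDeriv (k + 3) (ps h y0 ρ δ) = fun y => iteratedDeriv (k + 3) h (y0 + ρ * y) * (ρ ^ k / δ) := by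
  have i2 : ∀ F : ℝ → ℝ, iteratedDeriv 2 F = deriv (deriv F) := by
    intro F; rw [iteratedDeriv_succ, iteratedDeriv_one]
  induction k with
  | zero =>
    rw [zero_add, iteratedDeriv_succ, i2, ps_d2 hh hρ hδ]
    funext y
    have h1 := hd_comp (smooth_deriv (smooth_deriv hh)) y0 ρ y
    have h3 : HasDerivAt (fun y => (deriv (deriv h) (y0 + ρ * y) - deriv (deriv h) y0) / (ρ * δ)) _ y :=
      (h1.sub_const (deriv (deriv h) y0)).div_const (ρ * δ)
    rw [h3.deriv, iteratedDeriv_succ, i2]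
    field_simp
  | succ k ih =>
    rw [show k + 1 + 3 = (k + 3) + 1 by ring, iteratedDeriv_succ, ih]
    funext y
    have h1 := hd_comp (it_smooth hh (k + 3)) y0 ρ y
    rw [(h1.mul_const (ρ ^ k / δ)).deriv, iteratedDeriv_succ (n := k + 3)]
    generalize deriv (iteratedDeriv (k + 3) h) (y0 + ρ * y) = w
    ring

/-- bounds of the lower order derivatives -/
lemma lip_of {g : ℝ → ℝ} (hg : ContDiff ℝ (⊤ : ℕ∞) g) {A : ℝ} (hA : ∀ y ∈ Icc (-1 : ℝ) 1, |deriv g y| ≤ A) {x y : ℝ}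
    (hx : x ∈ Icc (-1 : ℝ) 1) (hy : y ∈ Icc (-1 : ℝ) 1) : |g y - g x| ≤ A * |y - x| := by
  have hd : Differentiable ℝ g := hg.differentiable (by simp)
  have := Convex.norm_image_sub_le_of_norm_deriv_le (f := g) (fun z _ => hd z) (fun z hz => by
    rw [Real.norm_eq_abs]; exact hA z hz) (convex_Icc (-1 : ℝ) 1) hx hy
  simpa [Real.norm_eq_abs] using this

lemma cub_bd {C₃ : ℝ} (hC₃ : 0 < C₃) {Cl : ℕ → ℝ} {h : ℝ → ℝ} (H : CubicType C₃ Cl h) {y : ℝ} (hy : y ∈ Icc (-1 : ℝ) 1) :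
    |deriv (deriv h) y| ≤ C₃ ∧ |deriv h y| ≤ C₃ := by
  obtain ⟨hs, h0, h1, h2, h3, -⟩ := H
  have z : (0 : ℝ) ∈ Icc (-1 : ℝ) 1 := by constructor <;> norm_num
  have ab : ∀ y ∈ Icc (-1 : ℝ) 1, |y - 0| ≤ 1 := by
    intro y hy; rw [sub_zero, abs_le]; exact ⟨hy.1, hy.2⟩
  have k2 : ∀ y ∈ Icc (-1 : ℝ) 1, |deriv (deriv h) y| ≤ C₃ := by
    intro y hy
    have := lip_of (smooth_deriv (smooth_deriv hs)) (fun y hy => (h3 y hy).2) z hy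
    rw [h2, sub_zero] at this
    nlinarith [ab y hy]
  refine ⟨k2 y hy, ?_⟩
  have := lip_of (smooth_deriv hs) k2 z hy
  rw [h1, sub_zero] at this
  nlinarith [ab y hy]

lemma eta_bd {η : ℝ × ℝ → ℝ} (hη : Continuous η) (B : ℝ) :
    ∃ m : ℝ, 1 ≤ m ∧ ∀ z : ℝ × ℝ, |z.1| ≤ B → |z.2| ≤ 1 → |η z| ≤ m := by
  have hc : IsCompact (Icc (-B) B ×ˢ Icc (-1 : ℝ) 1) := isCompact_Icc.prod isCompact_Icc
  obtain ⟨m, hm⟩ := hc.exists_bound_of_continuousOn hη.continuousOn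
  refine ⟨max 1 m, le_max_left _ _, fun z h1 h2 => ?_⟩
  have := hm z ⟨⟨(abs_le.1 h1).1, (abs_le.1 h1).2⟩, ⟨(abs_le.1 h2).1, (abs_le.1 h2).2⟩⟩
  exact le_trans (by simpa using this) (le_max_right _ _)

lemma U1_meas {h : ℝ → ℝ} (ε ρ δ x y : ℝ) : MeasurableSet (U1set h ε ρ δ x y) := by
  have hm : Measurable fun z : ℝ × ℝ => z.1 - x + ε * (deriv (deriv h) y / 2) * (z.2 - y) := by fun_prop
  have e : U1set h ε ρ δ x y = (fun z : ℝ × ℝ => z.2 - y) ⁻¹' (Ico 0 (ρ * min 1 δ)) ∩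
      (fun z : ℝ × ℝ => z.1 - x + ε * (deriv (deriv h) y / 2) * (z.2 - y)) ⁻¹' (Ico 0 (ε * ρ ^ 2 * δ)) := by
    ext z; simp only [U1set, Set.mem_ofPred_eq, mem_inter_iff, mem_preimage, mem_Ico]; tauto
  rw [e]
  exact ((measurable_snd.sub_const y) measurableSet_Ico).inter (hm measurableSet_Ico)

lemma U2_meas {h : ℝ → ℝ} (hh : Continuous (deriv h)) (ε ρ δ t y w : ℝ) : MeasurableSet (U2set h ε ρ δ t y w) := by
  have hm : Measurable fun z : ℝ × ℝ =>
    z.1 - t + ε * (deriv h z.2 - deriv h y - deriv (deriv h) y / 2 * (z.2 - y)) := by fun_prop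
  have e : U2set h ε ρ δ t y w = (fun z : ℝ × ℝ => z.2 - w) ⁻¹' (Ico 0 ρ) ∩
      (fun z : ℝ × ℝ => z.1 - t + ε * (deriv h z.2 - deriv h y - deriv (deriv h) y / 2 * (z.2 - y))) ⁻¹'
        (Ico 0 (ε * ρ ^ 2 * δ)) := by
    ext z; simp only [U2set, Set.mem_ofPred_eq, mem_inter_iff, mem_preimage, mem_Ico]; tauto
  rw [e]
  exact ((measurable_snd.sub_const w) measurableSet_Ico).inter (hm measurableSet_Ico)

lemma phase_Lm {h : ℝ → ℝ} {ε ρ δ x0 y0 : ℝ} (hρ : 0 < ρ) (hδ : 0 < δ) (z : ℝ × ℝ) :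
    phase ε h (Lm (ε * ρ ^ 2 * δ) ρ (ε * (deriv (deriv h) y0 / 2) * ρ) x0 y0 z) =
      (ε * ρ ^ 2 * δ) * ρ * ph (ps h y0 ρ δ) z + (ε * ρ ^ 2 * δ * y0) * z.1 +
        (ρ * x0 - ε * (deriv (deriv h) y0 / 2) * ρ * y0 + ε * deriv h y0 * ρ) * z.2 + (x0 * y0 + ε * h y0) := by
  unfold phase Lm ph ps
  simp only
  field_simp
  ring

lemma U1_iff {h : ℝ → ℝ} {ε ρ δ x0 y0 : ℝ} (hε : 0 < ε) (hρ : 0 < ρ) (hδ : 1 < δ) (z : ℝ × ℝ) :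
    Lm (ε * ρ ^ 2 * δ) ρ (ε * (deriv (deriv h) y0 / 2) * ρ) x0 y0 z ∈ U1set h ε ρ δ x0 y0 ↔ z ∈ V1s := by
  have ha : 0 < ε * ρ ^ 2 * δ := by positivity
  unfold U1set V1s Lm
  simp only [Set.mem_ofPred_eq, min_eq_left hδ.le, mul_one]
  set a := ε * ρ ^ 2 * δ
  rw [show y0 + ρ * z.2 - y0 = ρ * z.2 by ring,
    show x0 + a * z.1 - ε * (deriv (deriv h) y0 / 2) * ρ * z.2 - x0 + ε * (deriv (deriv h) y0 / 2) * (ρ * z.2) = a * z.1 by ring]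
  rw [mul_nonneg_iff_of_pos_left hρ, mul_nonneg_iff_of_pos_left ha, mul_lt_iff_lt_one_right hρ, mul_lt_iff_lt_one_right ha]

lemma U2_iff {h : ℝ → ℝ} (hh : ContDiff ℝ (⊤ : ℕ∞) h) {ε ρ δ x0 y0 t0 D : ℝ} (hε : 0 < ε) (hρ : 0 < ρ) (hδ : 1 < δ) (z : ℝ × ℝ) :
    Lm (ε * ρ ^ 2 * δ) ρ (ε * (deriv (deriv h) y0 / 2) * ρ) x0 y0 z ∈ U2set h ε ρ δ t0 y0 (y0 + ρ * D) ↔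
      z ∈ V2s (ps h y0 ρ δ) D ((t0 - x0) / (ε * ρ ^ 2 * δ)) := by
  have hδ0 : 0 < δ := by linarith
  have ha : 0 < ε * ρ ^ 2 * δ := by positivity
  unfold U2set V2s Lm
  rw [ps_d1 hh hρ hδ0]
  simp only [Set.mem_ofPred_eq]
  have e : x0 + ε * ρ ^ 2 * δ * z.1 - ε * (deriv (deriv h) y0 / 2) * ρ * z.2 - t0 +
      ε * (deriv h (y0 + ρ * z.2) - deriv h y0 - deriv (deriv h) y0 / 2 * (y0 + ρ * z.2 - y0)) =
      ε * ρ ^ 2 * δ * (z.1 - (t0 - x0) / (ε * ρ ^ 2 * δ) +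
        (deriv h (y0 + ρ * z.2) - deriv h y0 - deriv (deriv h) y0 * (ρ * z.2)) / (ρ ^ 2 * δ)) := by
    field_simp
    ring
  rw [e, show y0 + ρ * z.2 - (y0 + ρ * D) = ρ * (z.2 - D) by ring]
  rw [mul_nonneg_iff_of_pos_left hρ, mul_nonneg_iff_of_pos_left ha, mul_lt_iff_lt_one_right hρ, mul_lt_iff_lt_one_right ha]

lemma U1_box {C₃ : ℝ} (hC₃ : 0 < C₃) {Cl : ℕ → ℝ} {h : ℝ → ℝ} (H : CubicType C₃ Cl h) {ε ρ δ x0 y0 : ℝ} (hε : 0 < ε) (hε1 : ε ≤ 1)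
    (hρ1 : ρ ≤ 1) (hδ : 1 < δ) (ha : ε * ρ ^ 2 * δ ≤ 1) (hx : x0 ∈ Ico (-1 : ℝ) 1)
    (hy : -1 ≤ y0) (hy1 : y0 + ρ ≤ 1) (hρ : 0 < ρ) (z : ℝ × ℝ) (hz : z ∈ U1set h ε ρ δ x0 y0) : |z.1| ≤ 3 + 10 * C₃ ∧ |z.2| ≤ 1 := by
  unfold U1set at hz
  simp only [Set.mem_ofPred_eq, min_eq_left hδ.le, mul_one] at hz
  obtain ⟨h1, h2, h3, h4⟩ := hz
  have b := (cub_bd hC₃ H (y := y0) ⟨hy, by linarith⟩).1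
  have c : |ε * (deriv (deriv h) y0 / 2) * (z.2 - y0)| ≤ C₃ := by
    rw [abs_mul, abs_mul, abs_of_pos hε, abs_of_nonneg h1, abs_div, abs_two]
    have : ε * (|deriv (deriv h) y0| / 2) ≤ C₃ := by nlinarith [abs_nonneg (deriv (deriv h) y0)]
    have h0 : 0 ≤ ε * (|deriv (deriv h) y0| / 2) := by positivity
    nlinarith
  obtain ⟨c1, c2⟩ := abs_le.1 c
  obtain ⟨x1, x2⟩ := hx
  exact ⟨abs_le.2 ⟨by linarith, by linarith⟩, abs_le.2 ⟨by linarith, by linarith⟩⟩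

lemma U2_box {C₃ : ℝ} (hC₃ : 0 < C₃) {Cl : ℕ → ℝ} {h : ℝ → ℝ} (H : CubicType C₃ Cl h) {ε ρ δ t0 y0 y2 : ℝ} (hε : 0 < ε) (hε1 : ε ≤ 1)
    (ha : ε * ρ ^ 2 * δ ≤ 1) (hx : t0 ∈ Ico (-1 : ℝ) 1)
    (hy : -1 ≤ y0) (hy1 : y0 ≤ 1) (hy2 : -1 ≤ y2) (hy3 : y2 + ρ ≤ 1) (z : ℝ × ℝ) (hz : z ∈ U2set h ε ρ δ t0 y0 y2) :
    |z.1| ≤ 3 + 10 * C₃ ∧ |z.2| ≤ 1 := by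
  unfold U2set at hz
  simp only [Set.mem_ofPred_eq] at hz
  obtain ⟨h1, h2, h3, h4⟩ := hz
  obtain ⟨b, b'⟩ := cub_bd hC₃ H (y := y0) ⟨hy, by linarith⟩
  have d := (cub_bd hC₃ H (y := z.2) ⟨by linarith, by linarith⟩).2
  have f : |deriv (deriv h) y0 / 2 * (z.2 - y0)| ≤ C₃ := by
    rw [abs_mul, abs_div, abs_two]
    have : |z.2 - y0| ≤ 2 := abs_le.2 ⟨by linarith, by linarith⟩
    nlinarith [abs_nonneg (deriv (deriv h) y0), abs_nonneg (z.2 - y0)]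
  have c : |ε * (deriv h z.2 - deriv h y0 - deriv (deriv h) y0 / 2 * (z.2 - y0))| ≤ 3 * C₃ := by
    rw [abs_mul, abs_of_pos hε]
    have : |deriv h z.2 - deriv h y0 - deriv (deriv h) y0 / 2 * (z.2 - y0)| ≤ 3 * C₃ := by
      rw [abs_le] at *
      constructor <;> linarith
    nlinarith [abs_nonneg (deriv h z.2 - deriv h y0 - deriv (deriv h) y0 / 2 * (z.2 - y0))]
  obtain ⟨c1, c2⟩ := abs_le.1 c
  obtain ⟨x1, x2⟩ := hx
  exact ⟨abs_le.2 ⟨by linarith, by linarith⟩, abs_le.2 ⟨by linarith, by linarith⟩⟩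

end BAP

/-- Theorem 4.3, first case: for an admissible pair of type 1 at scale δ > 1 with εδρ² ≤ 1, the bilinear estimate ‖E_{U₁}f · E_{U₂}g‖_p ≤ C_{p,q} (εδρ³)^{2(1−1/p−1/q)} ‖f‖_q ‖g‖_q holds with a constant independent of the pair, ε, ρ, δ. -/
theorem bilinear_admissible_pair (C₃ : ℝ) (hC₃ : 0 < C₃) (Cl : ℕ → ℝ)
    (η : ℝ × ℝ → ℝ) (hη : ContDiff ℝ (⊤ : ℕ∞) η)
    (p q : ℝ) (hp : 5 / 3 < p) (hq : 2 ≤ q) :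
    ∃ C₀₀ : ℝ, 1 ≤ C₀₀ ∧ ∀ C₀ : ℝ, C₀₀ ≤ C₀ → IsDyadic C₀ →
    ∃ Cpq : ℝ, 0 < Cpq ∧
    ∀ h : ℝ → ℝ, CubicType C₃ Cl h →
    ∀ ε ρ δ : ℝ, 0 < ε → ε ≤ 1 → 0 < ρ → ρ ≤ 1 → 0 < δ → IsDyadic ρ → IsDyadic δ →
      1 < δ → ε * δ * ρ ^ 2 ≤ 1 →
    ∀ j₁ j₂ : ℤ, C₀ / 8 < |(j₂ : ℝ) - (j₁ : ℝ)| → |(j₂ : ℝ) - (j₁ : ℝ)| < C₀ / 2 →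
      -1 ≤ (j₁ : ℝ) * ρ → (j₁ : ℝ) * ρ + ρ ≤ 1 → -1 ≤ (j₂ : ℝ) * ρ → (j₂ : ℝ) * ρ + ρ ≤ 1 →
    ∀ x₁0 y₁0 t₂0 : ℝ, Adm1 h ε ρ δ C₀ j₁ j₂ x₁0 y₁0 t₂0 →
    ∀ f g : ℝ × ℝ → ℂ,
      eLpNorm (fun ξ : ℝ × ℝ × ℝ =>
          extOp (phase ε h) η (U1set h ε ρ δ x₁0 y₁0) f ξ *
          extOp (phase ε h) η (U2set h ε ρ δ t₂0 y₁0 ((j₂ : ℝ) * ρ)) g ξ)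
        (ENNReal.ofReal p) volume
      ≤ ENNReal.ofReal (Cpq * (ε * δ * ρ ^ 3) ^ (2 * (1 - 1 / p - 1 / q))) *
          (eLpNorm f (ENNReal.ofReal q) (volume.restrict (U1set h ε ρ δ x₁0 y₁0)) *
           eLpNorm g (ENNReal.ofReal q)
            (volume.restrict (U2set h ε ρ δ t₂0 y₁0 ((j₂ : ℝ) * ρ)))) := by
  set M : ℝ := 1 + C₃ + ∑ l ∈ Finset.Icc 4 8, |Cl l| with hMd
  have hS : 0 ≤ ∑ l ∈ Finset.Icc 4 8, |Cl l| := Finset.sum_nonneg fun _ _ => abs_nonneg _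
  have hM : 1 ≤ M := by linarith
  have hM3 : C₃ ≤ M := by linarith
  have hMl : ∀ l : ℕ, 4 ≤ l → l ≤ 8 → Cl l ≤ M := by
    intro l h1 h2
    have := Finset.single_le_sum (f := fun l => |Cl l|) (s := Finset.Icc 4 8) (fun i _ => abs_nonneg _)
      (Finset.mem_Icc.2 ⟨h1, h2⟩)
    have h3 := le_abs_self (Cl l)
    linarith
  refine ⟨1000000 * (M * 12 ^ 5), by nlinarith, fun C₀ hC _ => ?_⟩
  obtain ⟨K, hK, core⟩ := BAP.nf_core M hM p hp C₀ hC
  obtain ⟨m, hm, hηm⟩ := BAP.eta_bd hη.continuous (3 + 10 * C₃)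
  refine ⟨K * m ^ 2, by positivity, ?_⟩
  intro h H ε ρ δ hε hε1 hρ hρ1 hδ0 _ _ hδ hsm j₁ j₂ hj1 hj2 ha1 ha2 hb1 hb2 x0 y0 t0 hA f g
  obtain ⟨-, hx0, -, ht0, -, hy1, hy2, A1, A2, A3, -⟩ := hA
  rw [min_eq_left hδ.le, mul_one] at hy2
  rw [max_eq_right hδ.le] at A3
  have hy : y0 = (j₁ : ℝ) * ρ := by linarith
  have hs : ContDiff ℝ (⊤ : ℕ∞) h := H.1
  have s1 := BAP.smooth_deriv hs
  set D : ℝ := (j₂ : ℝ) - (j₁ : ℝ) with hD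
  have hj : (j₂ : ℝ) * ρ = y0 + ρ * D := by rw [hy, hD]; ring
  rw [hj] at A3 hb1 hb2 ⊢
  have hapos : 0 < ε * ρ ^ 2 * δ := by positivity
  have hale : ε * ρ ^ 2 * δ ≤ 1 := by linarith [hsm, (by ring : ε * δ * ρ ^ 2 = ε * ρ ^ 2 * δ)]
  have e3 : ε * δ * ρ ^ 3 = ε * ρ ^ 2 * δ * ρ := by ring
  rw [e3]
  have sψ := BAP.ps_smooth hs y0 ρ δ
  have d1 := BAP.ps_d1 hs (y0 := y0) hρ hδ0
  have d2 := BAP.ps_d2 hs (y0 := y0) hρ hδ0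
  have c1 : Continuous (deriv (BAP.ps h y0 ρ δ)) := (BAP.smooth_deriv sψ).continuous
  have it3 : iteratedDeriv 3 h = deriv (deriv (deriv h)) := by
    rw [iteratedDeriv_succ, iteratedDeriv_succ, iteratedDeriv_one]
  have hder : ∀ k : ℕ, 3 ≤ k → k ≤ 8 → ∀ y ∈ Icc (-1 : ℝ) 1, |iteratedDeriv k h y| ≤ M := by
    intro k h3 h8 y hy
    rcases eq_or_lt_of_le h3 with e | e
    · rw [← e, it3]; exact ((H.2.2.2.2.1 y hy).2).trans hM3
    · exact (H.2.2.2.2.2 k e y hy).trans (hMl k e h8)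
  have core' := core (BAP.ps h y0 ρ δ) sψ ((-1 - y0) / ρ) ((1 - y0) / ρ)
    (div_nonpos_of_nonpos_of_nonneg (by linarith) hρ.le) (by rw [le_div_iff₀ hρ]; linarith)
    (by simp [BAP.ps]) (by rw [d1]; simp) (by rw [d2]; simp)
    (by
      intro k h3 h8 y hyI
      obtain ⟨n, rfl⟩ : ∃ n, k = n + 3 := ⟨k - 3, by omega⟩
      rw [BAP.ps_dk hs hρ hδ0]
      have i1 : -1 - y0 ≤ y * ρ := (div_le_iff₀ hρ).1 hyI.1
      have i2 : y * ρ ≤ 1 - y0 := (le_div_iff₀ hρ).1 hyI.2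
      have := hder (n + 3) h3 h8 (y0 + ρ * y) ⟨by linarith, by linarith⟩
      simp only
      have r0 : 0 ≤ ρ ^ n / δ := by positivity
      have r1 : ρ ^ n / δ ≤ 1 := by
        rw [div_le_one hδ0]
        exact (pow_le_one₀ hρ.le hρ1).trans hδ.le
      rw [abs_mul, abs_of_nonneg r0]
      calc _ ≤ M * 1 := mul_le_mul this r1 r0 (by linarith)
        _ = M := mul_one M)
    D ((t0 - x0) / (ε * ρ ^ 2 * δ)) (by rw [div_le_iff₀ hρ]; linarith) (by rw [le_div_iff₀ hρ]; linarith) hj1 hj2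
    (by rw [abs_div, abs_of_pos hapos, le_div_iff₀ hapos]; exact A1)
    (by rw [abs_div, abs_of_pos hapos, div_lt_iff₀ hapos]; exact A2)
    (by
      have e : tau ε h (x20 h ε t0 y0 (y0 + ρ * D), y0 + ρ * D) (x0, y0) (x20 h ε t0 y0 (y0 + ρ * D), y0 + ρ * D) =
          ((t0 - x0) / (ε * ρ ^ 2 * δ) - 1 / 2 * D * deriv (deriv (BAP.ps h y0 ρ δ)) D) * (ε * ρ ^ 2 * δ) := by
        rw [d2]
        unfold tau x20
        simp only
        field_simp
        ring
      rw [e, abs_mul, abs_of_pos hapos] at A3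
      exact le_of_mul_le_mul_right A3 hapos)
  have hcont : Continuous (phase ε h) := by
    have := hs.continuous
    unfold phase
    fun_prop
  have fin := BAP.wrap (p := p) (q := q) (m := m) (η := η) (c := K * (ε * ρ ^ 2 * δ * ρ) ^ (2 * (1 - 1 / p - 1 / q))) hcont
    (BAP.U1_meas (h := h) ε ρ δ x0 y0) (BAP.U2_meas s1.continuous ε ρ δ t0 y0 (y0 + ρ * D))
    (fun z hz => by
      obtain ⟨b1, b2⟩ := BAP.U1_box hC₃ H hε hε1 hρ1 hδ hale hx0 (by linarith) (by linarith) hρ z hz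
      exact hηm z b1 b2)
    (fun z hz => by
      obtain ⟨b1, b2⟩ := BAP.U2_box hC₃ H hε hε1 hale ht0 (by linarith) (by linarith) hb1 hb2 z hz
      exact hηm z b1 b2)
    hq (by positivity)
    (fun F G mF mG iF iG sF sG nF nG =>
      BAP.aff hapos hρ sψ.continuous (BAP.phase_Lm hρ hδ0) BAP.V1s_meas (BAP.V2s_meas c1 D _) BAP.V1s_vol
        (BAP.V2s_vol c1 D _) (by linarith) hq (by linarith) core' mF mG iF iG
        (fun z hz => sF _ fun hU => hz ((BAP.U1_iff hε hρ hδ z).1 hU))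
        (fun z hz => sG _ fun hU => hz ((BAP.U2_iff hs hε hρ hδ z).1 hU)) nF nG) f g
  refine fin.trans (le_of_eq ?_)
  have hpow : 0 ≤ (ε * ρ ^ 2 * δ * ρ) ^ (2 * (1 - 1 / p - 1 / q)) := by positivity
  rw [show K * m ^ 2 * (ε * ρ ^ 2 * δ * ρ) ^ (2 * (1 - 1 / p - 1 / q)) =
    K * (ε * ρ ^ 2 * δ * ρ) ^ (2 * (1 - 1 / p - 1 / q)) * (m * m) by ring,
    ENNReal.ofReal_mul (p := K * (ε * ρ ^ 2 * δ * ρ) ^ (2 * (1 - 1 / p - 1 / q))) (by positivity),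
    ENNReal.ofReal_mul (p := m) (by linarith)]
  ring
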